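/- Let d ≥ 1, let p₀, p₁ be nonzero reals, let χ ∈ C_c^∞(ℝ^d), and suppose P satisfies hypothesis (H_{p₀,p₁}) with constants P₀ = P₁ = 0. Then there exists a constant C > 0 such that for every t ≠ 0, every μ > 0, and every Schwartz function f on ℝ^d, ‖Op(χ((x + t P'(ξ))/(|t| μ)) · 1_{|x| > |t|·|P'(ξ)|}) f‖_{L²(ℝ^d)} ≤ C ‖f‖_{L²(ℝ^d)}. -/

import Mathlib

open MeasureTheory Filter Topology
open scoped RealInnerProductSpace ENNReal

noncomputable section

abbrev Euc (d : ℕ) := EuclideanSpace ℝ (Fin d)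

/-- Fourier transform `f̂(ξ) = ∫ e^{-i x·ξ} f(x) dx`. -/
def FT {d : ℕ} (f : Euc d → ℂ) (ξ : Euc d) : ℂ :=
  ∫ x : Euc d, Complex.exp (-(Complex.I * ((⟪x, ξ⟫ : ℝ) : ℂ))) * f x

/-- The radial vector field `P'(ξ) = P'(|ξ|) · ξ/|ξ|`. -/
def Pgrad {d : ℕ} (P : ℝ → ℝ) (ξ : Euc d) : Euc d :=
  (deriv P ‖ξ‖ / ‖ξ‖) • ξ

/-- Hypothesis (H_{p₀,p₁}) with constants P₀, P₁. -/
def HypH (p₀ p₁ P₀ P₁ : ℝ) (P : ℝ → ℝ) : Prop :=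
  ContDiffOn ℝ (⊤ : ℕ∞) P (Set.Ioi 0) ∧
  (∀ ρ > (0:ℝ), 0 < deriv P ρ) ∧
  (MonotoneOn (deriv P) (Set.Ioi 0) ∨ AntitoneOn (deriv P) (Set.Ioi 0)) ∧
  (∃ c C ρ₀ : ℝ, 0 < c ∧ c < C ∧ 0 < ρ₀ ∧ ∀ ρ : ℝ, 0 < ρ → ρ < ρ₀ →
      (c * ρ ^ p₀ ≤ |deriv P ρ - P₀| ∧ |deriv P ρ - P₀| ≤ C * ρ ^ p₀) ∧
      (c * ρ ^ (p₀ - 1) ≤ |deriv (deriv P) ρ| ∧ |deriv (deriv P) ρ| ≤ C * ρ ^ (p₀ - 1))) ∧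
  (∃ c C R : ℝ, 0 < c ∧ c < C ∧ ∀ ρ : ℝ, R < ρ →
      (c * ρ ^ p₁ ≤ |deriv P ρ - P₁| ∧ |deriv P ρ - P₁| ≤ C * ρ ^ p₁) ∧
      (c * ρ ^ (p₁ - 1) ≤ |deriv (deriv P) ρ| ∧ |deriv (deriv P) ρ| ≤ C * ρ ^ (p₁ - 1))) ∧
  (∀ j : ℕ, 3 ≤ j → ∃ C : ℝ,
      (∀ ρ : ℝ, 0 < ρ → ρ < 1 → |iteratedDeriv j P ρ| ≤ C * ρ ^ (p₀ + 1 - (j : ℝ))) ∧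
      (∀ ρ : ℝ, 1 < ρ → |iteratedDeriv j P ρ| ≤ C * ρ ^ (p₁ + 1 - (j : ℝ))))

/-- The truncation symbol `a_{χ,δ}(t,x,ξ)
    `= χ((x+tP'(ξ))/|t|^{1/2+δ}) · 1_{|x| > |t|·|P'(ξ)|}`. -/
def symbA {d : ℕ} (P : ℝ → ℝ) (χ : Euc d → ℝ) (δ t : ℝ) (x ξ : Euc d) : ℂ :=
  ((χ ((|t| ^ ((1:ℝ)/2 + δ))⁻¹ • (x + t • Pgrad P ξ)) : ℝ) : ℂ) *
    (if |t| * ‖Pgrad P ξ‖ < ‖x‖ then (1:ℂ) else 0)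

/-- `Op(a) (e^{itP(D)} f)` for a Schwartz function `f`:
    `(2π)^{-d} ∫ e^{i(x·ξ + tP(ξ))} a(x,ξ) f̂(ξ) dξ`. -/
def combOp {d : ℕ} (P : ℝ → ℝ) (a : Euc d → Euc d → ℂ) (t : ℝ)
    (f : Euc d → ℂ) (x : Euc d) : ℂ :=
  (((2 * Real.pi) ^ d : ℝ) : ℂ)⁻¹ *
    ∫ ξ : Euc d,
      Complex.exp (Complex.I * ((⟪x, ξ⟫ + t * P ‖ξ‖ : ℝ) : ℂ)) * a x ξ * FT f ξ


/-- The pseudo-differential operator `Op(a)` on a Schwartz function: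
`Op(a)f(x) = (2π)^{-d} ∫ e^{i x·ξ} a(x,ξ) f̂(ξ) dξ`. -/
def OpS {d : ℕ} (a : Euc d → Euc d → ℂ) (f : Euc d → ℂ) (x : Euc d) : ℂ :=
  (((2 * Real.pi) ^ d : ℝ) : ℂ)⁻¹ *
    ∫ ξ : Euc d, Complex.exp (Complex.I * ((⟪x, ξ⟫ : ℝ) : ℂ)) * a x ξ * FT f ξ

/-! ### Schur's test and the one-sided maximal function -/

theorem lintegral_mul_sq_le {α : Type*} [MeasurableSpace α] (μ : Measure α) {f g : α → ℝ≥0∞}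
    (hf : AEMeasurable f μ) (hg : AEMeasurable g μ) :
    (∫⁻ x, f x * g x ∂μ) ^ 2 ≤ (∫⁻ x, f x ^ 2 ∂μ) * ∫⁻ x, g x ^ 2 ∂μ := by
  have h := ENNReal.lintegral_mul_le_Lp_mul_Lq μ
    (Real.HolderConjugate.two_two) hf hg
  simp only [Pi.mul_apply, ENNReal.rpow_two] at h
  calc (∫⁻ x, f x * g x ∂μ) ^ 2
      ≤ ((∫⁻ x, f x ^ 2 ∂μ) ^ (1 / (2:ℝ)) * (∫⁻ x, g x ^ 2 ∂μ) ^ (1 / (2:ℝ))) ^ 2 := by gcongr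
    _ = _ := by
        rw [mul_pow, ← ENNReal.rpow_natCast, ← ENNReal.rpow_natCast, ← ENNReal.rpow_mul,
          ← ENNReal.rpow_mul]
        norm_num

/-- Schur's test. -/
theorem lintegral_schur {α β : Type*} [MeasurableSpace α] [MeasurableSpace β]
    (μ : Measure α) (ν : Measure β) [SFinite μ] [SFinite ν]
    {k : α → β → ℝ≥0∞} (hk : Measurable (Function.uncurry k))
    {w : β → ℝ≥0∞} {w' : α → ℝ≥0∞} (hw : Measurable w) (hw' : Measurable w')
    (hw0 : ∀ᵐ y ∂ν, w y ≠ 0 ∧ w y ≠ ∞) {A B : ℝ≥0∞}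
    (hA : ∀ᵐ x ∂μ, ∫⁻ y, k x y * w y ∂ν ≤ A * w' x)
    (hB : ∀ᵐ y ∂ν, ∫⁻ x, k x y * w' x ∂μ ≤ B * w y)
    {g : β → ℝ≥0∞} (hg : Measurable g) :
    ∫⁻ x, (∫⁻ y, k x y * g y ∂ν) ^ 2 ∂μ ≤ A * B * ∫⁻ y, g y ^ 2 ∂ν := by
  have hkx : ∀ x, Measurable (k x) := fun x => hk.of_uncurry_left
  have hky : ∀ y, Measurable fun x => k x y := fun y => hk.of_uncurry_right
  have h1 : ∀ᵐ x ∂μ, (∫⁻ y, k x y * g y ∂ν) ^ 2 ≤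
      A * w' x * ∫⁻ y, k x y * (g y ^ 2 * (w y)⁻¹) ∂ν := by
    filter_upwards [hA] with x hx
    have e : ∫⁻ y, k x y * g y ∂ν = ∫⁻ y, (k x y * w y) ^ (1 / (2:ℝ)) *
        (k x y * (g y ^ 2 * (w y)⁻¹)) ^ (1 / (2:ℝ)) ∂ν := by
      apply lintegral_congr_ae
      filter_upwards [hw0] with y hy
      rw [← ENNReal.mul_rpow_of_nonneg _ _ (by norm_num)]
      have : k x y * w y * (k x y * (g y ^ 2 * (w y)⁻¹)) = (k x y * g y) ^ 2 := by
        rw [show k x y * w y * (k x y * (g y ^ 2 * (w y)⁻¹)) =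
          (k x y * g y) ^ 2 * (w y * (w y)⁻¹) by ring, ENNReal.mul_inv_cancel hy.1 hy.2, mul_one]
      rw [this, ← ENNReal.rpow_natCast, ← ENNReal.rpow_mul]
      norm_num
    rw [e]
    refine (lintegral_mul_sq_le ν (by fun_prop) (by fun_prop)).trans ?_
    have e2 : ∀ z : ℝ≥0∞, (z ^ (1 / (2:ℝ))) ^ 2 = z := fun z => by
      rw [← ENNReal.rpow_natCast, ← ENNReal.rpow_mul]; norm_num
    simp only [e2]
    gcongr
  calc ∫⁻ x, (∫⁻ y, k x y * g y ∂ν) ^ 2 ∂μ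
      ≤ ∫⁻ x, A * w' x * ∫⁻ y, k x y * (g y ^ 2 * (w y)⁻¹) ∂ν ∂μ := lintegral_mono_ae h1
    _ = ∫⁻ x, ∫⁻ y, A * w' x * (k x y * (g y ^ 2 * (w y)⁻¹)) ∂ν ∂μ := by
        congr 1; ext x
        rw [lintegral_const_mul]
        fun_prop
    _ = ∫⁻ y, ∫⁻ x, A * w' x * (k x y * (g y ^ 2 * (w y)⁻¹)) ∂μ ∂ν := by
        rw [lintegral_lintegral_swap]
        exact Measurable.aemeasurable (by fun_prop)
    _ = ∫⁻ y, A * (g y ^ 2 * (w y)⁻¹) * ∫⁻ x, k x y * w' x ∂μ ∂ν := by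
        congr 1; ext y
        rw [← lintegral_const_mul _ (by fun_prop)]
        congr 1; ext x; ring
    _ ≤ ∫⁻ y, A * B * g y ^ 2 ∂ν := by
        apply lintegral_mono_ae
        filter_upwards [hB, hw0] with y hy hy0
        calc A * (g y ^ 2 * (w y)⁻¹) * ∫⁻ x, k x y * w' x ∂μ
            ≤ A * (g y ^ 2 * (w y)⁻¹) * (B * w y) := by gcongr
          _ = A * B * g y ^ 2 * (w y * (w y)⁻¹) := by ring
          _ = A * B * g y ^ 2 := by rw [ENNReal.mul_inv_cancel hy0.1 hy0.2, mul_one]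
    _ = A * B * ∫⁻ y, g y ^ 2 ∂ν := lintegral_const_mul _ (by fun_prop)

/-- The one-sided Hardy–Littlewood maximal function. -/
def maxRight (g : ℝ → ℝ≥0∞) (σ : ℝ) : ℝ≥0∞ :=
  ⨆ (y : ℝ) (_ : 0 < y), (∫⁻ z in Set.Ioc σ (σ + y), g z) / ENNReal.ofReal y

theorem lintegral_le_maxRight (g : ℝ → ℝ≥0∞) (σ : ℝ) {y : ℝ} (hy : 0 < y) :
    ∫⁻ z in Set.Ioc σ (σ + y), g z ≤ ENNReal.ofReal y * maxRight g σ := by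
  have h : (∫⁻ z in Set.Ioc σ (σ + y), g z) / ENNReal.ofReal y ≤ maxRight g σ :=
    le_iSup₂_of_le y hy le_rfl
  rw [ENNReal.div_le_iff (by simpa using hy) ENNReal.ofReal_ne_top] at h
  rwa [mul_comm]

theorem measure_maxRight_gt_le (g : ℝ → ℝ≥0∞) {l : ℝ} (hl : 0 < l) :
    ENNReal.ofReal l * volume {σ | ENNReal.ofReal l < maxRight g σ} ≤ 5 * ∫⁻ z, g z := by
  rcases eq_or_ne (∫⁻ z, g z) ∞ with htop | htop
  · rw [htop]; simp
  let t : Set (ℝ × ℝ) := {q | 0 < q.2 ∧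
    ENNReal.ofReal (l * q.2) < ∫⁻ z in Set.Ioc q.1 (q.1 + q.2), g z}
  have hR : ∀ q ∈ t, q.2 / 2 ≤ (∫⁻ z, g z).toReal / l / 2 := by
    rintro ⟨σ, y⟩ ⟨hy, h⟩
    simp only at hy h ⊢
    have h2 : ENNReal.ofReal (l * y) ≤ ∫⁻ z, g z := h.le.trans (setLIntegral_le_lintegral _ _)
    rw [ENNReal.ofReal_le_iff_le_toReal htop] at h2
    gcongr
    rw [le_div_iff₀ hl]; linarith
  obtain ⟨u, hut, hdisj, hcov⟩ := Vitali.exists_disjoint_subfamily_covering_enlargement_closedBall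
    t (fun q => q.1 + q.2 / 2) (fun q => q.2 / 2) _ hR 5 (by norm_num)
  have hcount : u.Countable := by
    apply hdisj.countable_of_nonempty_interior
    intro q hq
    have := (hut hq).1
    exact ⟨q.1 + q.2 / 2, by
      rw [interior_closedBall _ (by positivity)]
      exact Metric.mem_ball_self (by positivity)⟩
  have hsub : {σ | ENNReal.ofReal l < maxRight g σ} ⊆
      ⋃ q ∈ u, Metric.closedBall (q.1 + q.2 / 2) (5 * (q.2 / 2)) := by
    intro σ hσ
    simp only [Set.mem_ofPred_eq, maxRight, lt_iSup_iff] at hσ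
    obtain ⟨y, hy, h⟩ := hσ
    have hmem : (σ, y) ∈ t := by
      refine ⟨hy, ?_⟩
      rw [ENNReal.lt_div_iff_mul_lt (by simp [hy]) (by simp)] at h
      rwa [ENNReal.ofReal_mul hl.le]
    obtain ⟨q, hq, hsub⟩ := hcov _ hmem
    simp only [Set.mem_iUnion]
    refine ⟨q, hq, hsub ?_⟩
    simp only [Metric.mem_closedBall, Real.dist_eq]
    rw [abs_le]; constructor <;> linarith
  have : Countable u := hcount
  calc ENNReal.ofReal l * volume {σ | ENNReal.ofReal l < maxRight g σ}
      ≤ ENNReal.ofReal l * ∑' q : u, volume (Metric.closedBall (q.1.1 + q.1.2 / 2) (5 * (q.1.2 / 2))) := by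
        gcongr
        refine (measure_mono hsub).trans ?_
        exact measure_biUnion_le _ hcount _
    _ = ∑' q : u, 5 * ENNReal.ofReal (l * q.1.2) := by
        rw [← ENNReal.tsum_mul_left]
        congr 1; ext q
        rw [Real.volume_closedBall, ← ENNReal.ofReal_mul hl.le,
          show (5:ℝ≥0∞) = ENNReal.ofReal 5 by norm_num, ← ENNReal.ofReal_mul (by norm_num)]
        congr 1; ring
    _ ≤ ∑' q : u, 5 * ∫⁻ z in Metric.closedBall (q.1.1 + q.1.2 / 2) (q.1.2 / 2), g z := by
        apply ENNReal.tsum_le_tsum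
        intro q
        gcongr
        refine (hut q.2).2.le.trans (lintegral_mono_set ?_)
        intro z hz
        rw [Metric.mem_closedBall, Real.dist_eq, abs_le]
        constructor <;> linarith [hz.1, hz.2]
    _ = 5 * ∫⁻ z in ⋃ q : u, Metric.closedBall (q.1.1 + q.1.2 / 2) (q.1.2 / 2), g z := by
        rw [ENNReal.tsum_mul_left, lintegral_iUnion]
        · exact fun _ => Metric.isClosed_closedBall.measurableSet
        · intro q q' hqq
          exact hdisj q.2 q'.2 (fun h => hqq (Subtype.ext h))
    _ ≤ 5 * ∫⁻ z, g z := by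
        gcongr
        exact Measure.restrict_le_self

theorem measurable_maxRight {g : ℝ → ℝ≥0∞} (hg : Measurable g) : Measurable (maxRight g) := by
  have key : maxRight g = fun σ : ℝ => ⨆ (y : ℚ) (_ : 0 < (y:ℝ)),
      (∫⁻ z in Set.Ioc σ (σ + y), g z) / ENNReal.ofReal y := by
    funext σ
    apply le_antisymm
    · refine iSup₂_le fun y hy => ?_
      set S := ⨆ (y : ℚ) (_ : 0 < (y:ℝ)), (∫⁻ z in Set.Ioc σ (σ + y), g z) / ENNReal.ofReal y
      have h1 : ∀ q : ℚ, y < q → ∫⁻ z in Set.Ioc σ (σ + y), g z ≤ ENNReal.ofReal q * S := by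
        intro q hq
        have hq0 : (0:ℝ) < q := hy.trans hq
        have : (∫⁻ z in Set.Ioc σ (σ + q), g z) / ENNReal.ofReal q ≤ S :=
          le_iSup₂_of_le (f := fun (y : ℚ) (_ : 0 < (y:ℝ)) =>
            (∫⁻ z in Set.Ioc σ (σ + y), g z) / ENNReal.ofReal y) q hq0 le_rfl
        rw [ENNReal.div_le_iff (by simpa using hq0) ENNReal.ofReal_ne_top] at this
        rw [mul_comm]
        exact (lintegral_mono_set (Set.Ioc_subset_Ioc_right (by linarith))).trans this
      rw [ENNReal.div_le_iff (by simpa using hy) ENNReal.ofReal_ne_top, mul_comm]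
      obtain ⟨v, -, hv, hlim⟩ := Real.exists_seq_rat_strictAnti_tendsto y
      have : Tendsto (fun n => ENNReal.ofReal (v n) * S) atTop (𝓝 (ENNReal.ofReal y * S)) := by
        apply ENNReal.Tendsto.mul_const
        · exact ENNReal.tendsto_ofReal hlim
        · left; simpa using hy
      exact ge_of_tendsto' this fun n => h1 _ (hv n)
    · exact iSup₂_le fun y hy => le_iSup₂_of_le (y:ℝ) hy le_rfl
  rw [key]
  refine Measurable.iSup fun y => Measurable.iSup fun _ => Measurable.div_const ?_ _
  have : (fun σ : ℝ => ∫⁻ z in Set.Ioc σ (σ + y), g z) =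
      fun σ => ∫⁻ z, ({q : ℝ × ℝ | q.1 < q.2 ∧ q.2 ≤ q.1 + y}.indicator (fun q => g q.2) (σ, z)) := by
    funext σ
    rw [← lintegral_indicator measurableSet_Ioc]
    rfl
  rw [this]
  apply Measurable.lintegral_prod_right'
    (f := fun q : ℝ × ℝ => {q : ℝ × ℝ | q.1 < q.2 ∧ q.2 ≤ q.1 + y}.indicator (fun q => g q.2) q)
  refine Measurable.indicator (by fun_prop) ?_
  exact (measurableSet_lt measurable_fst measurable_snd).inter
    (measurableSet_le measurable_snd (by fun_prop))


theorem lintegral_two_mul_Ioo {x : ℝ} (hx : 0 ≤ x) :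
    ∫⁻ l in Set.Ioo 0 x, ENNReal.ofReal (2 * l) = ENNReal.ofReal x ^ 2 := by
  rw [setLIntegral_congr Ioo_ae_eq_Ioc]
  rw [← ofReal_integral_eq_lintegral_ofReal]
  · rw [← intervalIntegral.integral_of_le hx]
    rw [intervalIntegral.integral_const_mul, integral_id]
    rw [← ENNReal.ofReal_pow hx]
    congr 1; ring
  · exact (by fun_prop : Continuous fun l : ℝ => 2 * l).integrableOn_Ioc
  · filter_upwards [ae_restrict_mem measurableSet_Ioc] with l hl
    have := hl.1
    simp only [Pi.zero_apply]; positivity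

/-- The strong `L²` bound for the one-sided maximal function. -/
theorem lintegral_maxRight_sq_le {g : ℝ → ℝ≥0∞} (hg : Measurable g) {M : ℝ}
    (hM : ∀ z, g z ≤ ENNReal.ofReal M) :
    ∫⁻ σ, maxRight g σ ^ 2 ≤ 40 * ∫⁻ z, g z ^ 2 := by
  have hgt : ∀ z, g z ≠ ∞ := fun z => ((hM z).trans_lt ENNReal.ofReal_lt_top).ne
  have hF : ∀ σ, maxRight g σ ≠ ∞ := by
    intro σ
    refine (lt_of_le_of_lt (iSup₂_le fun y hy => ?_) (ENNReal.ofReal_lt_top (r := M))).ne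
    rw [ENNReal.div_le_iff (by simpa using hy) ENNReal.ofReal_ne_top]
    calc ∫⁻ z in Set.Ioc σ (σ + y), g z ≤ ∫⁻ z in Set.Ioc σ (σ + y), ENNReal.ofReal M :=
          lintegral_mono fun z => hM z
      _ = _ := by simp
  have hFm := measurable_maxRight hg
  have hweak : ∀ l : ℝ, 0 < l → ENNReal.ofReal (2 * l) *
      volume {σ | ENNReal.ofReal l < maxRight g σ} ≤
        20 * ∫⁻ z, {z | ENNReal.ofReal (l / 2) < g z}.indicator g z := by
    intro l hl
    set g1 := {z | ENNReal.ofReal (l / 2) < g z}.indicator g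
    have hg1 : Measurable g1 := hg.indicator (measurableSet_lt measurable_const hg)
    have hle : ∀ z, g z ≤ g1 z + ENNReal.ofReal (l / 2) := by
      intro z
      by_cases hz : ENNReal.ofReal (l / 2) < g z
      · simp [g1, hz]
      · rw [not_lt] at hz
        exact hz.trans le_add_self
    have hsub : {σ | ENNReal.ofReal l < maxRight g σ} ⊆
        {σ | ENNReal.ofReal (l / 2) < maxRight g1 σ} := by
      intro σ hσ
      simp only [Set.mem_ofPred_eq] at hσ ⊢
      have h2 : maxRight g σ ≤ maxRight g1 σ + ENNReal.ofReal (l / 2) := by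
        refine iSup₂_le fun y hy => ?_
        rw [ENNReal.div_le_iff (by simpa using hy) ENNReal.ofReal_ne_top]
        calc ∫⁻ z in Set.Ioc σ (σ + y), g z
            ≤ ∫⁻ z in Set.Ioc σ (σ + y), (g1 z + ENNReal.ofReal (l / 2)) := lintegral_mono hle
          _ = (∫⁻ z in Set.Ioc σ (σ + y), g1 z) + ENNReal.ofReal (l / 2) * ENNReal.ofReal y := by
              rw [lintegral_add_left hg1]; simp
          _ ≤ ENNReal.ofReal y * maxRight g1 σ + ENNReal.ofReal (l / 2) * ENNReal.ofReal y := by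
              gcongr; exact lintegral_le_maxRight g1 σ hy
          _ = _ := by ring
      by_contra hcon
      rw [not_lt] at hcon
      have h3 : maxRight g σ ≤ ENNReal.ofReal l := by
        calc _ ≤ ENNReal.ofReal (l / 2) + ENNReal.ofReal (l / 2) := h2.trans (by gcongr)
          _ = ENNReal.ofReal l := by
            rw [← ENNReal.ofReal_add (by positivity) (by positivity)]; congr 1; ring
      exact absurd hσ (not_lt.mpr h3)
    calc ENNReal.ofReal (2 * l) * volume {σ | ENNReal.ofReal l < maxRight g σ}
        ≤ ENNReal.ofReal (2 * l) * volume {σ | ENNReal.ofReal (l / 2) < maxRight g1 σ} := by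
          gcongr
      _ = 4 * (ENNReal.ofReal (l / 2) * volume {σ | ENNReal.ofReal (l / 2) < maxRight g1 σ}) := by
          rw [← mul_assoc, show (4:ℝ≥0∞) = ENNReal.ofReal 4 by norm_num,
            ← ENNReal.ofReal_mul (by norm_num)]
          congr 2; ring
      _ ≤ 4 * (5 * ∫⁻ z, g1 z) := by
          gcongr 4 * ?_; exact measure_maxRight_gt_le g1 (by positivity)
      _ = _ := by rw [← mul_assoc]; norm_num
  have hmeas : Measurable fun q : ℝ × ℝ => {q : ℝ × ℝ | ENNReal.ofReal q.2 < maxRight g q.1}.indicator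
      (fun q => ENNReal.ofReal (2 * q.2)) q :=
    Measurable.indicator (by fun_prop) (measurableSet_lt (by fun_prop) (by fun_prop))
  calc ∫⁻ σ, maxRight g σ ^ 2
      = ∫⁻ σ, ∫⁻ l in Set.Ioi (0:ℝ), {q : ℝ × ℝ | ENNReal.ofReal q.2 < maxRight g q.1}.indicator
          (fun q => ENNReal.ofReal (2 * q.2)) (σ, l) := by
        congr 1; ext σ
        have : ∀ l ∈ Set.Ioi (0:ℝ), {q : ℝ × ℝ | ENNReal.ofReal q.2 < maxRight g q.1}.indicator
            (fun q => ENNReal.ofReal (2 * q.2)) (σ, l) =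
            (Set.Ioo 0 (maxRight g σ).toReal).indicator (fun l => ENNReal.ofReal (2 * l)) l := by
          intro l hl
          have hl0 : 0 < l := hl
          simp [Set.indicator, hl0, ENNReal.ofReal_lt_iff_lt_toReal hl0.le (hF σ)]
        rw [setLIntegral_congr_fun measurableSet_Ioi this, lintegral_indicator measurableSet_Ioo,
          Measure.restrict_restrict measurableSet_Ioo, Set.inter_eq_left.mpr (fun l hl => hl.1),
          lintegral_two_mul_Ioo ENNReal.toReal_nonneg, ENNReal.ofReal_toReal (hF σ)]
    _ = ∫⁻ l in Set.Ioi (0:ℝ), ∫⁻ σ, {q : ℝ × ℝ | ENNReal.ofReal q.2 < maxRight g q.1}.indicator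
          (fun q => ENNReal.ofReal (2 * q.2)) (σ, l) := by
        rw [lintegral_lintegral_swap]
        exact hmeas.aemeasurable
    _ = ∫⁻ l in Set.Ioi (0:ℝ), ENNReal.ofReal (2 * l) *
          volume {σ | ENNReal.ofReal l < maxRight g σ} := by
        congr 1; ext l
        rw [← setLIntegral_const, ← lintegral_indicator (measurableSet_lt (by fun_prop) (by fun_prop))]
        rfl
    _ ≤ ∫⁻ l in Set.Ioi (0:ℝ), 20 * ∫⁻ z, {z | ENNReal.ofReal (l / 2) < g z}.indicator g z := by
        apply setLIntegral_mono' measurableSet_Ioi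
        intro l hl
        exact hweak l hl
    _ = 20 * ∫⁻ z, ∫⁻ l in Set.Ioi (0:ℝ), {z | ENNReal.ofReal (l / 2) < g z}.indicator g z := by
        have hm : Measurable fun q : ℝ × ℝ =>
            {q : ℝ × ℝ | ENNReal.ofReal (q.1 / 2) < g q.2}.indicator (fun q => g q.2) q :=
          Measurable.indicator (by fun_prop) (measurableSet_lt (by fun_prop) (by fun_prop))
        rw [lintegral_const_mul', lintegral_lintegral_swap]
        · exact hm.aemeasurable
        · norm_num
    _ = 20 * ∫⁻ z, 2 * g z ^ 2 := by
        congr 2; ext z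
        have : ∀ l ∈ Set.Ioi (0:ℝ), {z | ENNReal.ofReal (l / 2) < g z}.indicator g z =
            (Set.Ioo 0 (2 * (g z).toReal)).indicator (fun _ => g z) l := by
          intro l hl
          have hl0 : 0 < l := hl
          have : ENNReal.ofReal (l / 2) < g z ↔ l < 2 * (g z).toReal := by
            rw [ENNReal.ofReal_lt_iff_lt_toReal (by positivity) (hgt z)]
            constructor <;> intro h <;> linarith
          simp [Set.indicator, this, hl0]
        rw [setLIntegral_congr_fun measurableSet_Ioi this, lintegral_indicator measurableSet_Ioo]
        rw [Measure.restrict_restrict measurableSet_Ioo,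
          Set.inter_eq_left.mpr (fun l hl => hl.1)]
        simp only [lintegral_const, Measure.restrict_apply, MeasurableSet.univ, Set.univ_inter,
          Real.volume_Ioo, sub_zero]
        rw [ENNReal.ofReal_mul (by norm_num), ENNReal.ofReal_toReal (hgt z)]
        norm_num; ring
    _ = 40 * ∫⁻ z, g z ^ 2 := by
        rw [lintegral_const_mul _ (by fun_prop), ← mul_assoc]; norm_num


/-- The decreasing kernel `z⁻¹ min(1, (h/z)^{1/4})`. -/
def tailKer (h z : ℝ) : ℝ := z⁻¹ * min 1 ((h / z) ^ (1 / 4 : ℝ))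

theorem tailKer_anti {h z z' : ℝ} (hh : 0 < h) (hz : 0 < z) (hzz : z ≤ z') :
    tailKer h z' ≤ tailKer h z := by
  unfold tailKer
  have : 0 < z' := hz.trans_le hzz
  gcongr

theorem tailKer_nonneg {h z : ℝ} (hh : 0 < h) (hz : 0 < z) : 0 ≤ tailKer h z := by
  unfold tailKer; positivity

theorem measurable_tailKer (h : ℝ) : Measurable (tailKer h) := by
  unfold tailKer; fun_prop

theorem half_le_rpow_quarter : (1 / 2 : ℝ) ≤ (1 / 4 : ℝ) ^ (1 / 4 : ℝ) := by
  have : (1 / 2 : ℝ) = ((1 / 16 : ℝ)) ^ (1 / 4 : ℝ) := by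
    rw [show (1 / 16 : ℝ) = (1 / 2) ^ (4:ℝ) by norm_num, ← Real.rpow_mul (by norm_num)]; norm_num
  rw [this]
  gcongr; norm_num

theorem tailKer_le_lintegral {h x y : ℝ} (hx : 0 < x) (hxh : x ≤ h) (hy : 0 < y) :
    ENNReal.ofReal (tailKer h (x + y)) ≤ 8 * ∫⁻ x' in Set.Ioc 0 h,
      ENNReal.ofReal (max x x')⁻¹ * ENNReal.ofReal ((x' / (x' + y)) ^ (1 / 4 : ℝ) / (x' + y)) := by
  set M := max x y with hMdef
  set N := min M h with hNdef
  have hh : 0 < h := hx.trans_le hxh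
  have hM : 0 < M := lt_max_of_lt_left hx
  have hN : 0 < N := lt_min hM hh
  have hNh : N ≤ h := min_le_right _ _
  have hNM : N ≤ M := min_le_left _ _
  have hxN : x ≤ N := le_min (le_max_left _ _) hxh
  have hyM : y ≤ M := le_max_right _ _
  have key : tailKer h (x + y) ≤ 8 * (N⁻¹ * ((N / 2 / (2 * M)) ^ (1 / 4 : ℝ) / (2 * M)) * (N / 2)) := by
    refine (tailKer_anti hh hM (show M ≤ x + y from max_le (by linarith) (by linarith))).trans ?_
    have e1 : min 1 ((h / M) ^ (1 / 4 : ℝ)) = (N / M) ^ (1 / 4 : ℝ) := by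
      rcases le_total M h with h1 | h1
      · rw [hNdef, min_eq_left h1, div_self hM.ne', Real.one_rpow]
        exact min_eq_left (Real.one_le_rpow (by rw [le_div_iff₀ hM]; linarith) (by norm_num))
      · rw [hNdef, min_eq_right h1]
        exact min_eq_right (Real.rpow_le_one (by positivity) (by rw [div_le_one hM]; exact h1) (by norm_num))
    have e2 : (N / 2 / (2 * M)) ^ (1 / 4 : ℝ) = (N / M) ^ (1 / 4 : ℝ) * (1 / 4 : ℝ) ^ (1 / 4 : ℝ) := by
      rw [← Real.mul_rpow (by positivity) (by norm_num)]; congr 1; field_simp; norm_num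
    rw [tailKer, e1, e2]
    have := half_le_rpow_quarter
    set c := (1 / 4 : ℝ) ^ (1 / 4 : ℝ)
    set a := (N / M) ^ (1 / 4 : ℝ) with ha
    have ha0 : 0 ≤ a := by positivity
    calc M⁻¹ * a = M⁻¹ * a * 1 := by ring
      _ ≤ M⁻¹ * a * (2 * c) := by gcongr; linarith
      _ = _ := by field_simp; norm_num
  calc ENNReal.ofReal (tailKer h (x + y))
      ≤ ENNReal.ofReal (8 * (N⁻¹ * ((N / 2 / (2 * M)) ^ (1 / 4 : ℝ) / (2 * M)) * (N / 2))) := by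
        gcongr
    _ = 8 * ∫⁻ x' in Set.Ioc (N / 2) N, ENNReal.ofReal N⁻¹ *
          ENNReal.ofReal ((N / 2 / (2 * M)) ^ (1 / 4 : ℝ) / (2 * M)) := by
        rw [setLIntegral_const, Real.volume_Ioc, ENNReal.ofReal_mul (by norm_num),
          ENNReal.ofReal_mul (by positivity), ENNReal.ofReal_mul (by positivity)]
        norm_num
        rw [show N - N / 2 = N / 2 by ring]
    _ ≤ 8 * ∫⁻ x' in Set.Ioc (N / 2) N, ENNReal.ofReal (max x x')⁻¹ *
          ENNReal.ofReal ((x' / (x' + y)) ^ (1 / 4 : ℝ) / (x' + y)) := by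
        gcongr 8 * ?_
        apply setLIntegral_mono' measurableSet_Ioc
        intro x' hx'
        have h1 := hx'.1
        have h2 := hx'.2
        have h3 : 0 < x' := by linarith
        have : x' + y ≤ 2 * M := by linarith
        gcongr
        exact max_le hxN h2
    _ ≤ _ := by
        gcongr 8 * ?_
        exact lintegral_mono_set (Set.Ioc_subset_Ioc (by positivity) hNh)

theorem lintegral_rpow_Ioi {a s : ℝ} (ha : a < -1) (hs : 0 < s) :
    ∫⁻ t in Set.Ioi s, ENNReal.ofReal (t ^ a) = ENNReal.ofReal (s ^ (a + 1) / (-(a + 1))) := by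
  rw [← ofReal_integral_eq_lintegral_ofReal (integrableOn_Ioi_rpow_of_lt ha hs),
    integral_Ioi_rpow_of_lt ha hs]
  · congr 1; rw [neg_div, ← div_neg]
  · filter_upwards [ae_restrict_mem measurableSet_Ioi] with t ht
    have : 0 < t := hs.trans ht
    simp only [Pi.zero_apply]; positivity

theorem lintegral_tail_le_maxRight {g : ℝ → ℝ≥0∞} (hg : Measurable g) {b x : ℝ} (hx : 0 < x) :
    ∫⁻ r in Set.Ioi b, g r * ENNReal.ofReal ((x / (r - (b - x))) ^ (1 / 4 : ℝ) / (r - (b - x))) ≤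
      5 * maxRight g (b - x) := by
  set σ := b - x with hσ
  have h1 : ∀ r ∈ Set.Ioi b, ENNReal.ofReal ((x / (r - σ)) ^ (1 / 4 : ℝ) / (r - σ)) =
      ENNReal.ofReal (5 / 4 * x ^ (1 / 4 : ℝ)) * ∫⁻ t in Set.Ioi x,
        (Set.Ioi (r - σ)).indicator (fun t => ENNReal.ofReal (t ^ (-(9 / 4) : ℝ))) t := by
    intro r hr
    have hr' : b < r := hr
    have hz : 0 < r - σ := by linarith
    rw [lintegral_indicator measurableSet_Ioi, Measure.restrict_restrict measurableSet_Ioi,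
      Set.inter_eq_left.mpr (Set.Ioi_subset_Ioi (by linarith)), lintegral_rpow_Ioi (by norm_num) hz,
      ← ENNReal.ofReal_mul (by positivity), Real.div_rpow hx.le hz.le]
    congr 1
    rw [show (-(9 / 4) + 1 : ℝ) = -(1 / 4) - 1 by norm_num, Real.rpow_sub_one hz.ne',
      Real.rpow_neg hz.le]
    field_simp; norm_num
  calc ∫⁻ r in Set.Ioi b, g r * ENNReal.ofReal ((x / (r - σ)) ^ (1 / 4 : ℝ) / (r - σ))
      = ∫⁻ r in Set.Ioi b, ENNReal.ofReal (5 / 4 * x ^ (1 / 4 : ℝ)) * ∫⁻ t in Set.Ioi x,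
        g r * (Set.Ioi (r - σ)).indicator (fun t => ENNReal.ofReal (t ^ (-(9 / 4) : ℝ))) t := by
        apply setLIntegral_congr_fun measurableSet_Ioi
        intro r hr
        simp only []
        rw [h1 r hr, lintegral_const_mul _ (Measurable.indicator (by fun_prop) measurableSet_Ioi)]
        ring
    _ = ENNReal.ofReal (5 / 4 * x ^ (1 / 4 : ℝ)) * ∫⁻ t in Set.Ioi x, ∫⁻ r in Set.Ioi b,
        g r * (Set.Ioi (r - σ)).indicator (fun t => ENNReal.ofReal (t ^ (-(9 / 4) : ℝ))) t := by
        rw [lintegral_const_mul' _ _ ENNReal.ofReal_ne_top, lintegral_lintegral_swap]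
        have : Measurable fun q : ℝ × ℝ => g q.1 * {q : ℝ × ℝ | q.1 - σ < q.2}.indicator
            (fun q => ENNReal.ofReal (q.2 ^ (-(9 / 4) : ℝ))) q :=
          (by fun_prop : Measurable fun q : ℝ × ℝ => g q.1).mul
            (Measurable.indicator (by fun_prop) (measurableSet_lt (by fun_prop) (by fun_prop)))
        exact this.aemeasurable
    _ ≤ ENNReal.ofReal (5 / 4 * x ^ (1 / 4 : ℝ)) * ∫⁻ t in Set.Ioi x,
          maxRight g σ * ENNReal.ofReal (t ^ (-(5 / 4) : ℝ)) := by
        gcongr ENNReal.ofReal _ * ?_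
        apply setLIntegral_mono' measurableSet_Ioi
        intro t ht
        have ht0 : 0 < t := hx.trans ht
        calc ∫⁻ r in Set.Ioi b, g r *
              (Set.Ioi (r - σ)).indicator (fun t => ENNReal.ofReal (t ^ (-(9 / 4) : ℝ))) t
            ≤ ∫⁻ r, (Set.Ioc σ (σ + t)).indicator (fun r => g r * ENNReal.ofReal (t ^ (-(9 / 4) : ℝ))) r := by
              rw [← lintegral_indicator measurableSet_Ioi]
              apply lintegral_mono
              intro r
              simp only [Set.indicator, Set.mem_Ioi, Set.mem_Ioc]
              split_ifs with h1 h2 h3 h3 <;> first | positivity | skip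
              · exact le_rfl
              · exact absurd ⟨by linarith, by linarith⟩ h3
              · simp
              · simp
          _ = (∫⁻ r in Set.Ioc σ (σ + t), g r) * ENNReal.ofReal (t ^ (-(9 / 4) : ℝ)) := by
              rw [lintegral_indicator measurableSet_Ioc, lintegral_mul_const _ hg]
          _ ≤ ENNReal.ofReal t * maxRight g σ * ENNReal.ofReal (t ^ (-(9 / 4) : ℝ)) := by
              gcongr; exact lintegral_le_maxRight g σ ht0
          _ = maxRight g σ * (ENNReal.ofReal t * ENNReal.ofReal (t ^ (-(9 / 4) : ℝ))) := by ring
          _ = _ := by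
              rw [← ENNReal.ofReal_mul ht0.le, show (-(5 / 4) : ℝ) = 1 + -(9 / 4) by norm_num,
                Real.rpow_add ht0, Real.rpow_one]
    _ = 5 * maxRight g σ := by
        rw [lintegral_const_mul _ (by fun_prop), lintegral_rpow_Ioi (by norm_num) hx,
          mul_left_comm, ← ENNReal.ofReal_mul (by positivity), mul_comm,
          show (5:ℝ≥0∞) = ENNReal.ofReal 5 by norm_num]
        congr 2
        rw [show (-(5 / 4) + 1 : ℝ) = -(1 / 4) by norm_num, Real.rpow_neg hx.le]
        field_simp


theorem lintegral_rpow_Ioc {a s : ℝ} (ha : -1 < a) (hs : 0 < s) :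
    ∫⁻ t in Set.Ioc 0 s, ENNReal.ofReal (t ^ a) = ENNReal.ofReal (s ^ (a + 1) / (a + 1)) := by
  rw [← ofReal_integral_eq_lintegral_ofReal, ← intervalIntegral.integral_of_le hs.le,
    integral_rpow (Or.inl ha), Real.zero_rpow (by linarith), sub_zero]
  · exact (intervalIntegral.intervalIntegrable_rpow' ha).1
  · filter_upwards [ae_restrict_mem measurableSet_Ioc] with t ht
    have : 0 < t := ht.1
    simp only [Pi.zero_apply]; positivity

theorem lintegral_max_inv_mul_rpow {x : ℝ} (hx : 0 < x) (h : ℝ) :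
    ∫⁻ x' in Set.Ioc 0 h, ENNReal.ofReal (max x x')⁻¹ * ENNReal.ofReal (x' ^ (-(1 / 2) : ℝ)) ≤
      4 * ENNReal.ofReal (x ^ (-(1 / 2) : ℝ)) := by
  calc ∫⁻ x' in Set.Ioc 0 h, ENNReal.ofReal (max x x')⁻¹ * ENNReal.ofReal (x' ^ (-(1 / 2) : ℝ))
      ≤ ∫⁻ x' in Set.Ioc 0 x ∪ Set.Ioi x,
          ENNReal.ofReal (max x x')⁻¹ * ENNReal.ofReal (x' ^ (-(1 / 2) : ℝ)) := by
        apply lintegral_mono_set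
        intro x' hx'
        rcases le_or_gt x' x with h1 | h1
        · exact Or.inl ⟨hx'.1, h1⟩
        · exact Or.inr h1
    _ ≤ (∫⁻ x' in Set.Ioc 0 x, ENNReal.ofReal (max x x')⁻¹ * ENNReal.ofReal (x' ^ (-(1 / 2) : ℝ))) +
          ∫⁻ x' in Set.Ioi x, ENNReal.ofReal (max x x')⁻¹ * ENNReal.ofReal (x' ^ (-(1 / 2) : ℝ)) :=
        lintegral_union_le _ _ _
    _ = (∫⁻ x' in Set.Ioc 0 x, ENNReal.ofReal x⁻¹ * ENNReal.ofReal (x' ^ (-(1 / 2) : ℝ))) +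
          ∫⁻ x' in Set.Ioi x, ENNReal.ofReal (x' ^ (-(3 / 2) : ℝ)) := by
        congr 1
        · apply setLIntegral_congr_fun measurableSet_Ioc
          intro x' hx'
          simp only []
          rw [max_eq_left hx'.2]
        · apply setLIntegral_congr_fun measurableSet_Ioi
          intro x' hx'
          have h1 : x < x' := hx'
          have h0 : 0 < x' := hx.trans h1
          simp only []
          rw [max_eq_right h1.le, ← ENNReal.ofReal_mul (by positivity),
            show (-(3 / 2) : ℝ) = -1 + -(1 / 2) by norm_num, Real.rpow_add h0, Real.rpow_neg_one]
    _ = 4 * ENNReal.ofReal (x ^ (-(1 / 2) : ℝ)) := by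
        rw [lintegral_const_mul' _ _ ENNReal.ofReal_ne_top, lintegral_rpow_Ioc (by norm_num) hx,
          lintegral_rpow_Ioi (by norm_num) hx, ← ENNReal.ofReal_mul (by positivity),
          ← ENNReal.ofReal_add (by positivity) (by norm_num; positivity),
          show (4:ℝ≥0∞) = ENNReal.ofReal 4 by norm_num, ← ENNReal.ofReal_mul (by norm_num)]
        congr 1
        rw [show (-(1 / 2) + 1 : ℝ) = -(1/2) + 1 by norm_num, Real.rpow_add hx, Real.rpow_one,
          show (-(3 / 2) + 1 : ℝ) = -(1/2) by norm_num]
        field_simp; norm_num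

theorem lintegral_tailKer_sq_le {g : ℝ → ℝ≥0∞} (hg : Measurable g) {a b : ℝ} (hab : a < b) :
    ∫⁻ r in Set.Ico a b, (∫⁻ r' in Set.Ioi b, g r' * ENNReal.ofReal (tailKer (b - a) (r' - r))) ^ 2 ≤
      25600 * ∫⁻ r in Set.Ico a b, maxRight g r ^ 2 := by
  set h := b - a with hh
  have hh0 : 0 < h := by linarith
  have hG := measurable_maxRight hg
  have hsub : ∀ F : ℝ → ℝ≥0∞, ∫⁻ r in Set.Ico a b, F r = ∫⁻ x in Set.Ioc 0 h, F (b - x) := by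
    intro F
    have hmp := (Measure.measurePreserving_sub_left (volume : Measure ℝ) b)
    have he : MeasurableEmbedding fun x : ℝ => b - x :=
      (Homeomorph.subLeft b).measurableEmbedding
    have := hmp.setLIntegral_comp_emb he F (Set.Ioc 0 h)
    rw [this]
    congr 2
    ext r
    simp only [Set.mem_Ico, Set.mem_image, Set.mem_Ioc]
    constructor
    · intro hr; exact ⟨b - r, ⟨by linarith, by linarith⟩, by ring⟩
    · rintro ⟨x, hx, rfl⟩; constructor <;> linarith
  rw [hsub, hsub]
  have hpt : ∀ x ∈ Set.Ioc 0 h, ∫⁻ r' in Set.Ioi b, g r' * ENNReal.ofReal (tailKer h (r' - (b - x)))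
      ≤ 40 * ∫⁻ x' in Set.Ioc 0 h, ENNReal.ofReal (max x x')⁻¹ * maxRight g (b - x') := by
    intro x hx
    calc ∫⁻ r' in Set.Ioi b, g r' * ENNReal.ofReal (tailKer h (r' - (b - x)))
        ≤ ∫⁻ r' in Set.Ioi b, 8 * ∫⁻ x' in Set.Ioc 0 h, g r' * (ENNReal.ofReal (max x x')⁻¹ *
          ENNReal.ofReal ((x' / (r' - (b - x'))) ^ (1 / 4 : ℝ) / (r' - (b - x')))) := by
          apply setLIntegral_mono' measurableSet_Ioi
          intro r' hr'
          have h1 : b < r' := hr'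
          have := tailKer_le_lintegral (y := r' - b) hx.1 hx.2 (by linarith)
          rw [lintegral_const_mul _ (by fun_prop), mul_left_comm]
          gcongr
          have e : ∀ x' : ℝ, r' - (b - x') = x' + (r' - b) := fun x' => by ring
          simp_rw [e]
          exact this
      _ = 8 * ∫⁻ x' in Set.Ioc 0 h, ∫⁻ r' in Set.Ioi b, g r' * (ENNReal.ofReal (max x x')⁻¹ *
          ENNReal.ofReal ((x' / (r' - (b - x'))) ^ (1 / 4 : ℝ) / (r' - (b - x')))) := by
          rw [lintegral_const_mul' _ _ (by norm_num), lintegral_lintegral_swap]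
          exact Measurable.aemeasurable (by fun_prop)
      _ = 8 * ∫⁻ x' in Set.Ioc 0 h, ENNReal.ofReal (max x x')⁻¹ * ∫⁻ r' in Set.Ioi b, g r' *
          ENNReal.ofReal ((x' / (r' - (b - x'))) ^ (1 / 4 : ℝ) / (r' - (b - x'))) := by
          congr 2; ext x'
          rw [← lintegral_const_mul _ (by fun_prop)]
          congr 1; ext r'; ring
      _ ≤ 8 * ∫⁻ x' in Set.Ioc 0 h, ENNReal.ofReal (max x x')⁻¹ * (5 * maxRight g (b - x')) := by
          gcongr 8 * ?_
          apply setLIntegral_mono' measurableSet_Ioc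
          intro x' hx'
          gcongr
          exact lintegral_tail_le_maxRight hg hx'.1
      _ = _ := by
          simp_rw [mul_left_comm _ (5:ℝ≥0∞)]
          rw [lintegral_const_mul' _ _ (by norm_num), ← mul_assoc]
          norm_num
  have hsc : ∀ x ∈ Set.Ioc 0 h, ∫⁻ x' in Set.Ioc 0 h, ENNReal.ofReal (max x x')⁻¹ *
      ENNReal.ofReal (x' ^ (-(1 / 2) : ℝ)) ≤ 4 * ENNReal.ofReal (x ^ (-(1 / 2) : ℝ)) :=
    fun x hx => lintegral_max_inv_mul_rpow hx.1 h
  have hschur := lintegral_schur (volume.restrict (Set.Ioc 0 h)) (volume.restrict (Set.Ioc 0 h))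
    (k := fun x x' => ENNReal.ofReal (max x x')⁻¹) (by unfold Function.uncurry; fun_prop)
    (w := fun x => ENNReal.ofReal (x ^ (-(1 / 2) : ℝ)))
    (w' := fun x => ENNReal.ofReal (x ^ (-(1 / 2) : ℝ))) (by fun_prop) (by fun_prop)
    (by
      filter_upwards [ae_restrict_mem measurableSet_Ioc] with x hx
      have := hx.1
      refine ⟨?_, ENNReal.ofReal_ne_top⟩
      simp only [ne_eq, ENNReal.ofReal_eq_zero, not_le]; positivity)
    (A := 4) (B := 4)
    (by filter_upwards [ae_restrict_mem measurableSet_Ioc] with x hx using hsc x hx)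
    (by
      filter_upwards [ae_restrict_mem measurableSet_Ioc] with x hx
      simp_rw [max_comm _ x]
      exact hsc x hx)
    (g := fun x' => maxRight g (b - x')) (by fun_prop)
  calc ∫⁻ x in Set.Ioc 0 h, (∫⁻ r' in Set.Ioi b, g r' * ENNReal.ofReal (tailKer h (r' - (b - x)))) ^ 2
      ≤ ∫⁻ x in Set.Ioc 0 h,
        (40 * ∫⁻ x' in Set.Ioc 0 h, ENNReal.ofReal (max x x')⁻¹ * maxRight g (b - x')) ^ 2 := by
        apply setLIntegral_mono' measurableSet_Ioc
        intro x hx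
        have := hpt x hx
        gcongr
    _ = 1600 * ∫⁻ x in Set.Ioc 0 h,
        (∫⁻ x' in Set.Ioc 0 h, ENNReal.ofReal (max x x')⁻¹ * maxRight g (b - x')) ^ 2 := by
        simp_rw [mul_pow]
        rw [lintegral_const_mul' _ _ (by norm_num)]
        norm_num
    _ ≤ 1600 * (4 * 4 * ∫⁻ x in Set.Ioc 0 h, maxRight g (b - x) ^ 2) := by gcongr
    _ = _ := by rw [← mul_assoc]; norm_num

/-- The positive bilinear bound for a finite family of disjoint intervals. -/
theorem sum_lintegral_tailKer_sq_le {ι : Type*} (s : Finset ι) (a b : ι → ℝ)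
    (hab : ∀ i ∈ s, a i < b i)
    (hdisj : (s : Set ι).PairwiseDisjoint fun i => Set.Ico (a i) (b i))
    {g : ℝ → ℝ≥0∞} (hg : Measurable g) {M : ℝ} (hM : ∀ z, g z ≤ ENNReal.ofReal M) :
    ∑ i ∈ s, ∫⁻ r in Set.Ico (a i) (b i),
      (∫⁻ r' in Set.Ioi (b i), g r' * ENNReal.ofReal (tailKer (b i - a i) (r' - r))) ^ 2 ≤
      1024000 * ∫⁻ r, g r ^ 2 := by
  calc _ ≤ ∑ i ∈ s, 25600 * ∫⁻ r in Set.Ico (a i) (b i), maxRight g r ^ 2 :=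
        Finset.sum_le_sum fun i hi => lintegral_tailKer_sq_le hg (hab i hi)
    _ = 25600 * ∫⁻ r in ⋃ i ∈ s, Set.Ico (a i) (b i), maxRight g r ^ 2 := by
        rw [← Finset.mul_sum, lintegral_biUnion_finset hdisj fun _ _ => measurableSet_Ico]
    _ ≤ 25600 * (40 * ∫⁻ z, g z ^ 2) := by
        gcongr 25600 * ?_
        exact (setLIntegral_le_lintegral _ _).trans (lintegral_maxRight_sq_le hg hM)
    _ = _ := by rw [← mul_assoc]; norm_num

/-! ### Bounds for solutions of `f'' = -(1 - c/u²) f` -/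

/-- A solution `f` (with derivative `f1`) of `f'' = -(1 - c/u²) f` on `(0,∞)`, regular at the origin,
whose multiplicative convolution transform `g ↦ ∫ f(rρ) g(ρ) dρ` is isometric on `L²(0,∞)`. -/
structure BesselLike (c K α : ℝ) (f f1 : ℝ → ℝ) : Prop where
  hc : -(1 / 4) ≤ c
  hα : 0 ≤ α
  meas : Measurable f
  d1 : ∀ u > 0, HasDerivAt f (f1 u) u
  d2 : ∀ u > 0, HasDerivAt f1 (-((u ^ 2 - c) / u ^ 2 * f u)) u
  bd : ∀ u > 0, |f u| ≤ K * u ^ α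
  zero : 0 < c → Tendsto f (𝓝[>] 0) (𝓝 0)
  wr : ∀ ρ > 0, ∀ ρ' > 0, Tendsto (fun r => ρ * f1 (r * ρ) * f (r * ρ') - ρ' * f (r * ρ) * f1 (r * ρ'))
    (𝓝[>] 0) (𝓝 0)
  iso : ∀ (g : ℝ → ℝ), Measurable g → ∀ a b M : ℝ, 0 < a → (∀ ρ, |g ρ| ≤ M) →
    (∀ ρ, ρ ∉ Set.Icc a b → g ρ = 0) →
    ∫⁻ r in Set.Ioi 0, ENNReal.ofReal ((∫ ρ, f (r * ρ) * g ρ) ^ 2) = ∫⁻ ρ, ENNReal.ofReal (g ρ ^ 2)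

/-- `√(u² - c)` -/
def turn (c u : ℝ) : ℝ := √(u ^ 2 - c)

theorem turn_sq {c u : ℝ} (h : c ≤ u ^ 2) : turn c u ^ 2 = u ^ 2 - c :=
  Real.sq_sqrt (by linarith)

theorem turn_nonneg (c u : ℝ) : 0 ≤ turn c u := Real.sqrt_nonneg _

theorem turn_mono {c u v : ℝ} (hu : 0 ≤ u) (h : u ≤ v) : turn c u ≤ turn c v := by
  unfold turn; gcongr

theorem continuous_turn (c : ℝ) : Continuous (turn c) := by unfold turn; fun_prop

theorem hasDerivAt_turn {c u : ℝ} (h : c < u ^ 2) : HasDerivAt (turn c) (u / turn c u) u := by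
  have h1 : HasDerivAt (fun u : ℝ => u ^ 2 - c) (2 * u) u := by
    simpa using (hasDerivAt_pow 2 u).sub_const c
  have h2 := h1.sqrt (by linarith : u ^ 2 - c ≠ 0)
  have e : 2 * u / (2 * √(u ^ 2 - c)) = u / turn c u := by
    unfold turn; exact mul_div_mul_left _ _ two_ne_zero
  rw [e] at h2
  exact h2

/-- the modified energy -/
def energy (c : ℝ) (f f1 : ℝ → ℝ) (u : ℝ) : ℝ :=
  turn c u / u * f u ^ 2 + u / turn c u * f1 u ^ 2 + c / turn c u ^ 3 * (f u * f1 u)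

namespace BesselLike

variable {c K α : ℝ} {f f1 : ℝ → ℝ}

theorem hasDerivAt_energy (hf : BesselLike c K α f f1) {u : ℝ} (hu : 0 < u) (h : c < u ^ 2) :
    HasDerivAt (energy c f f1) (-(3 * c * u / turn c u ^ 5) * (f u * f1 u)) u := by
  have hs := hasDerivAt_turn h
  have hs0 : 0 < turn c u := Real.sqrt_pos.mpr (by linarith)
  have hsq := turn_sq h.le
  have hid := hasDerivAt_id u
  have H := (((hs.div hid hu.ne').mul ((hf.d1 u hu).pow 2)).add
    ((hid.div hs hs0.ne').mul ((hf.d2 u hu).pow 2))).add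
    (((hasDerivAt_const u c).div (hs.pow 3) (by simp only [Pi.pow_apply]; positivity)).mul ((hf.d1 u hu).mul (hf.d2 u hu)))
  refine H.congr_deriv ?_
  simp only [id, Pi.div_apply, Pi.pow_apply, Pi.mul_apply]
  have hc : c = u ^ 2 - turn c u ^ 2 := by linarith
  generalize turn c u = s at *
  rw [hc]
  field_simp
  ring

theorem cross_le (hc : -(1 / 4) ≤ c) {κ : ℝ} (hκ : 1 ≤ κ) (hκc : c ≤ κ ^ 3) {s : ℝ} (hs : κ ≤ s) :
    |c| / s ^ 3 ≤ 1 := by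
  have h1 : (1:ℝ) ≤ κ ^ 3 := one_le_pow₀ hκ
  have h2 : κ ^ 3 ≤ s ^ 3 := by gcongr
  have h3 : |c| ≤ s ^ 3 := abs_le.mpr ⟨by linarith, by linarith⟩
  rw [div_le_one (by linarith)]
  exact h3

theorem energy_bounds (hc : -(1 / 4) ≤ c) {κ : ℝ} (hκ : 1 ≤ κ) (hκc : c ≤ κ ^ 3) {u : ℝ} (hu : 0 < u)
    (hs : κ ≤ turn c u) (f f1 : ℝ → ℝ) :
    2 * |f u * f1 u| ≤ turn c u / u * f u ^ 2 + u / turn c u * f1 u ^ 2 ∧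
    (turn c u / u * f u ^ 2 + u / turn c u * f1 u ^ 2) / 2 ≤ energy c f f1 u ∧
    energy c f f1 u ≤ 2 * (turn c u / u * f u ^ 2 + u / turn c u * f1 u ^ 2) := by
  have hs0 : 0 < turn c u := by linarith
  have h1 : 2 * |f u * f1 u| ≤ turn c u / u * f u ^ 2 + u / turn c u * f1 u ^ 2 := by
    have hq : 0 < turn c u / u := by positivity
    have e : u / turn c u = (turn c u / u)⁻¹ := by rw [inv_div]
    rw [e, abs_mul, ← sq_abs (f u), ← sq_abs (f1 u)]
    generalize turn c u / u = q at *
    have := sq_nonneg (q * |f u| - |f1 u|)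
    have h2 : 0 ≤ q⁻¹ * (q * |f u| - |f1 u|) ^ 2 := by positivity
    have h3 : q⁻¹ * (q * |f u| - |f1 u|) ^ 2 =
      q * |f u| ^ 2 + q⁻¹ * |f1 u| ^ 2 - 2 * (|f u| * |f1 u|) := by field_simp; ring
    linarith
  have h2 : |c / turn c u ^ 3 * (f u * f1 u)| ≤ |f u * f1 u| := by
    rw [abs_mul, abs_div, abs_of_pos (by positivity : 0 < turn c u ^ 3)]
    exact mul_le_of_le_one_left (abs_nonneg _) (cross_le hc hκ hκc hs)
  have h3 := abs_le.mp h2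
  have h4 := abs_nonneg (f u * f1 u)
  refine ⟨h1, ?_, ?_⟩ <;> unfold energy <;> linarith [h3.1, h3.2]

theorem good_mono {c κ : ℝ} (hκ : 1 ≤ κ) {u v : ℝ} (hu : 0 < u) (hs : κ ≤ turn c u) (h : u ≤ v) :
    0 < v ∧ κ ≤ turn c v ∧ c < v ^ 2 := by
  have h2 : κ ≤ turn c v := hs.trans (turn_mono hu.le h)
  refine ⟨hu.trans_le h, h2, ?_⟩
  have : 0 < turn c v := by linarith
  have := Real.sqrt_pos.mp this
  linarith

theorem energy_comparable (hf : BesselLike c K α f f1) {κ : ℝ} (hκ : 1 ≤ κ) (hκc : c ≤ κ ^ 3) {u v : ℝ}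
    (hu : 0 < u) (hs : κ ≤ turn c u) (huv : u ≤ v) :
    energy c f f1 u ≤ 3 * energy c f f1 v ∧ energy c f f1 v ≤ 3 * energy c f f1 u := by
  have hgood : ∀ w ∈ Set.Ici u, 0 < w ∧ κ ≤ turn c w ∧ c < w ^ 2 := fun w hw => good_mono hκ hu hs hw
  have hE0 : ∀ w ∈ Set.Ici u, 0 ≤ energy c f f1 w := by
    intro w hw
    obtain ⟨h1, h2, h3⟩ := hgood w hw
    obtain ⟨e1, e2, e3⟩ := energy_bounds hf.hc hκ hκc h1 h2 f f1
    linarith [abs_nonneg (f w * f1 w)]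
  set b : ℝ → ℝ := fun w => |c| / turn c w ^ 3 with hb
  have hbd : ∀ w ∈ Set.Ici u, HasDerivAt b (-(3 * |c| * w / turn c w ^ 5)) w := by
    intro w hw
    obtain ⟨h1, h2, h3⟩ := hgood w hw
    have hs0 : 0 < turn c w := by linarith
    refine ((hasDerivAt_const w |c|).div ((hasDerivAt_turn h3).pow 3) (by simp only [Pi.pow_apply]; positivity)).congr_deriv ?_
    simp only [Pi.pow_apply]
    field_simp
    ring
  have hEd : ∀ w ∈ Set.Ici u, HasDerivAt (energy c f f1) (-(3 * c * w / turn c w ^ 5) * (f w * f1 w)) w :=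
    fun w hw => hf.hasDerivAt_energy (hgood w hw).1 (hgood w hw).2.2
  have hEb : ∀ w ∈ Set.Ici u, |-(3 * c * w / turn c w ^ 5) * (f w * f1 w)| ≤
      3 * |c| * w / turn c w ^ 5 * energy c f f1 w := by
    intro w hw
    obtain ⟨h1, h2, h3⟩ := hgood w hw
    have hs0 : 0 < turn c w := by linarith
    obtain ⟨e1, e2, e3⟩ := energy_bounds hf.hc hκ hκc h1 h2 f f1
    rw [abs_mul, abs_neg, abs_div, abs_mul, abs_mul, abs_of_pos h1,
      abs_of_pos (by positivity : 0 < turn c w ^ 5), abs_of_pos (by norm_num : (0:ℝ) < 3)]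
    gcongr
    linarith
  have hb01 : ∀ w ∈ Set.Ici u, 0 ≤ b w ∧ b w ≤ 1 := by
    intro w hw
    obtain ⟨h1, h2, h3⟩ := hgood w hw
    have hs0 : 0 < turn c w := by linarith
    exact ⟨by positivity, cross_le hf.hc hκ hκc h2⟩
  have mono : MonotoneOn (fun w => energy c f f1 w * Real.exp (-b w)) (Set.Ici u) := by
    apply monotoneOn_of_hasDerivWithinAt_nonneg (convex_Ici u)
      (f' := fun w => (-(3 * c * w / turn c w ^ 5) * (f w * f1 w)) * Real.exp (-b w) +
        energy c f f1 w * (Real.exp (-b w) * -(-(3 * |c| * w / turn c w ^ 5))))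
    · intro w hw
      exact ((hEd w hw).mul (hbd w hw).neg.exp).continuousAt.continuousWithinAt
    · intro w hw
      exact ((hEd w (interior_subset hw)).mul (hbd w (interior_subset hw)).neg.exp).hasDerivWithinAt
    · intro w hw
      have h1 := (abs_le.mp (hEb w (interior_subset hw))).1
      have h2 := Real.exp_pos (-b w)
      have : 0 ≤ Real.exp (-b w) * (-(3 * c * w / turn c w ^ 5) * (f w * f1 w) +
        3 * |c| * w / turn c w ^ 5 * energy c f f1 w) := mul_nonneg h2.le (by linarith)
      linarith
  have anti : AntitoneOn (fun w => energy c f f1 w * Real.exp (b w)) (Set.Ici u) := by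
    apply antitoneOn_of_hasDerivWithinAt_nonpos (convex_Ici u)
      (f' := fun w => (-(3 * c * w / turn c w ^ 5) * (f w * f1 w)) * Real.exp (b w) +
        energy c f f1 w * (Real.exp (b w) * (-(3 * |c| * w / turn c w ^ 5))))
    · intro w hw
      exact ((hEd w hw).mul (hbd w hw).exp).continuousAt.continuousWithinAt
    · intro w hw
      exact ((hEd w (interior_subset hw)).mul (hbd w (interior_subset hw)).exp).hasDerivWithinAt
    · intro w hw
      have h1 := (abs_le.mp (hEb w (interior_subset hw))).2
      have h2 := Real.exp_pos (b w)
      have : 0 ≤ Real.exp (b w) * (3 * |c| * w / turn c w ^ 5 * energy c f f1 w -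
        (-(3 * c * w / turn c w ^ 5) * (f w * f1 w))) := mul_nonneg h2.le (by linarith)
      linarith
  have hu' : u ∈ Set.Ici u := Set.self_mem_Ici
  have hv' : v ∈ Set.Ici u := huv
  have m := mono hu' hv' huv
  have a := anti hu' hv' huv
  simp only at m a
  have e3 : Real.exp 1 ≤ 3 := by linarith [Real.exp_one_lt_d9]
  constructor
  · have : energy c f f1 u * Real.exp (-1) ≤ energy c f f1 v := by
      calc energy c f f1 u * Real.exp (-1) ≤ energy c f f1 u * Real.exp (-b u) := by
            have := hE0 u hu'
            gcongr; exact (hb01 u hu').2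
        _ ≤ _ := m
        _ ≤ energy c f f1 v * 1 := by
            have := hE0 v hv'
            gcongr; exact Real.exp_le_one_iff.mpr (by linarith [(hb01 v hv').1])
        _ = _ := mul_one _
    rw [Real.exp_neg, ← div_eq_mul_inv, div_le_iff₀ (Real.exp_pos 1)] at this
    nlinarith [hE0 v hv']
  · calc energy c f f1 v = energy c f f1 v * 1 := (mul_one _).symm
      _ ≤ energy c f f1 v * Real.exp (b v) := by
          have := hE0 v hv'
          gcongr; exact Real.one_le_exp (hb01 v hv').1
      _ ≤ energy c f f1 u * Real.exp (b u) := a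
      _ ≤ energy c f f1 u * 3 := by
          have := hE0 u hu'
          gcongr; exact (Real.exp_le_exp.mpr (hb01 u hu').2).trans e3
      _ = _ := mul_comm _ _

theorem continuousOn (hf : BesselLike c K α f f1) : ContinuousOn f (Set.Ioi 0) :=
  fun u hu => (hf.d1 u hu).continuousAt.continuousWithinAt

theorem continuousOn' (hf : BesselLike c K α f f1) : ContinuousOn f1 (Set.Ioi 0) :=
  fun u hu => (hf.d2 u hu).continuousAt.continuousWithinAt

theorem continuousOn_comp_mul {f : ℝ → ℝ} (hf : ContinuousOn f (Set.Ioi 0)) {r a b : ℝ} (hr : 0 < r)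
    (ha : 0 < a) : ContinuousOn (fun ρ => f (r * ρ)) (Set.Icc a b) :=
  hf.comp (by fun_prop) fun ρ hρ => mul_pos hr (ha.trans_le hρ.1)

theorem measurable_indicator_of_continuousOn {h : ℝ → ℝ} {s : Set ℝ} (hs : MeasurableSet s)
    (hh : ContinuousOn h s) : Measurable (s.indicator h) := by
  classical
  rw [← Set.piecewise_eq_indicator]
  exact hh.measurable_piecewise continuousOn_const hs

theorem exists_far (hf : BesselLike c K α f f1) {κ : ℝ} (hκ : 1 ≤ κ) (hκc : c ≤ κ ^ 3) {u : ℝ}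
    (hu : 0 < u) (hs : κ ≤ turn c u) :
    ∃ R ≥ u + 1, 576 ≤ R ∧ ∀ v ≥ R - 1, f v ^ 2 ≤ 12 * energy c f f1 (R - 1) ∧
      f1 v ^ 2 ≤ 12 * energy c f f1 (R - 1) ∧ energy c f f1 (R - 1) / 12 ≤ f v ^ 2 + f1 v ^ 2 ∧
      (v ^ 2 - c) / v ^ 2 ≤ 4 := by
  have hc0 := abs_nonneg c
  refine ⟨u + 1 + 576 + |c|, by linarith, by linarith, ?_⟩
  intro v hv
  set w := u + 1 + 576 + |c| - 1 with hw
  have huw : u ≤ w := by linarith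
  obtain ⟨hw0, hws, hwc⟩ := good_mono hκ hu hs huw
  obtain ⟨hv0, hvs, hvc⟩ := good_mono hκ hu hs (huw.trans hv)
  obtain ⟨c1, c2⟩ := hf.energy_comparable hκ hκc hw0 hws hv
  obtain ⟨e1, e2, e3⟩ := energy_bounds hf.hc hκ hκc hv0 hvs f f1
  have hv1 : 1 + |c| ≤ v := by linarith
  have hvsq : 1 + 2 * |c| ≤ v ^ 2 := by nlinarith
  have hcle := le_abs_self c
  have hcge := neg_abs_le c
  have hsq := turn_sq hvc.le
  have hs0 : 0 < turn c v := by linarith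
  have q1 : 1 / 2 ≤ turn c v / v := by
    rw [le_div_iff₀ hv0]
    apply le_of_sq_le_sq _ hs0.le
    nlinarith
  have q2 : turn c v / v ≤ 2 := by
    rw [div_le_iff₀ hv0]
    apply le_of_sq_le_sq _ (by positivity)
    nlinarith
  have p1 : 1 / 2 ≤ v / turn c v := by
    rw [le_div_iff₀ hs0]; rw [div_le_iff₀ hv0] at q2; linarith
  have p2 : v / turn c v ≤ 2 := by
    rw [div_le_iff₀ hs0]; rw [le_div_iff₀ hv0] at q1; linarith
  have a1 : 1 / 2 * f v ^ 2 ≤ turn c v / v * f v ^ 2 := by gcongr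
  have a2 : 1 / 2 * f1 v ^ 2 ≤ v / turn c v * f1 v ^ 2 := by gcongr
  have a3 : turn c v / v * f v ^ 2 ≤ 2 * f v ^ 2 := by gcongr
  have a4 : v / turn c v * f1 v ^ 2 ≤ 2 * f1 v ^ 2 := by gcongr
  have n1 := sq_nonneg (f v)
  have n2 := sq_nonneg (f1 v)
  refine ⟨by linarith, by linarith, by linarith, ?_⟩
  rw [div_le_iff₀ (by positivity)]
  nlinarith

theorem abs_mul_le_of_sq_le {x y m : ℝ} (hx : x ^ 2 ≤ m) (hy : y ^ 2 ≤ m) : |x * y| ≤ m := by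
  rw [abs_mul]
  nlinarith [sq_nonneg (|x| - |y|), sq_abs x, sq_abs y]

theorem exists_deriv_eq_sub {f f1 : ℝ → ℝ} {m : ℝ} (hd : ∀ v ≥ m, HasDerivAt f (f1 v) v) {v w : ℝ}
    (hv : m ≤ v) (hw : m ≤ w) : ∃ ξ ≥ m, f v - f w = f1 ξ * (v - w) := by
  wlog hvw : w ≤ v generalizing v w
  · obtain ⟨ξ, h1, h2⟩ := this hw hv (le_of_not_ge hvw)
    exact ⟨ξ, h1, by linarith⟩
  rcases hvw.eq_or_lt with h | h
  · exact ⟨v, hv, by rw [h]; ring⟩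
  · obtain ⟨ξ, hξ, h2⟩ := exists_hasDerivAt_eq_slope f f1 h
      (fun x hx => (hd x (hw.trans hx.1)).continuousAt.continuousWithinAt)
      (fun x hx => hd x (hw.trans hx.1.le))
    refine ⟨ξ, hw.trans hξ.1.le, ?_⟩
    rw [h2, div_mul_cancel₀ _ (sub_ne_zero.mpr h.ne')]

set_option maxHeartbeats 800000 in
theorem energy_le (hf : BesselLike c K α f f1) {κ : ℝ} (hκ : 1 ≤ κ) (hκc : c ≤ κ ^ 3) {u : ℝ}
    (hu : 0 < u) (hs : κ ≤ turn c u) : energy c f f1 u ≤ 4147200 := by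
  obtain ⟨R, hRu, hR, hfar⟩ := hf.exists_far hκ hκc hu hs
  set E := energy c f f1 (R - 1) with hE
  have hcomp := (hf.energy_comparable hκ hκc hu hs (show u ≤ R - 1 by linarith)).1
  have hR0 : 0 < R := by linarith
  have hE0 : 0 ≤ E := by
    have := (hfar R (by linarith)).1
    nlinarith [sq_nonneg (f R)]
  have hRρ : ∀ ρ ∈ Set.Icc (1:ℝ) 2, R - 1 ≤ R * ρ := fun ρ hρ => by nlinarith [hρ.1]
  have hcf := continuousOn_comp_mul hf.continuousOn hR0 (a := 1) (b := 2) one_pos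
  have hcf1 := continuousOn_comp_mul hf.continuousOn' hR0 (a := 1) (b := 2) one_pos
  have u12 : Set.uIcc (1:ℝ) 2 = Set.Icc 1 2 := Set.uIcc_of_le (by norm_num)
  set N := ∫ ρ in (1:ℝ)..2, f (R * ρ) ^ 2 with hN
  set J := ∫ ρ in (1:ℝ)..2, f1 (R * ρ) ^ 2 with hJ
  have iN : IntervalIntegrable (fun ρ => f (R * ρ) ^ 2) volume 1 2 :=
    ContinuousOn.intervalIntegrable_of_Icc (by norm_num) (hcf.pow 2)
  have iJ : IntervalIntegrable (fun ρ => f1 (R * ρ) ^ 2) volume 1 2 :=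
    ContinuousOn.intervalIntegrable_of_Icc (by norm_num) (hcf1.pow 2)
  have hQc : ContinuousOn (fun ρ => ((R * ρ) ^ 2 - c) / (R * ρ) ^ 2 * f (R * ρ) ^ 2) (Set.Icc 1 2) := by
    refine ContinuousOn.mul (ContinuousOn.div (by fun_prop) (by fun_prop) ?_) (hcf.pow 2)
    intro ρ hρ
    have : 0 < ρ := by linarith [hρ.1]
    positivity
  have iQ : IntervalIntegrable (fun ρ => ((R * ρ) ^ 2 - c) / (R * ρ) ^ 2 * f (R * ρ) ^ 2) volume 1 2 :=
    ContinuousOn.intervalIntegrable_of_Icc (by norm_num) (hQc)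
  have hFTC : ∫ ρ in (1:ℝ)..2, R * (f1 (R * ρ) ^ 2 - ((R * ρ) ^ 2 - c) / (R * ρ) ^ 2 * f (R * ρ) ^ 2) =
      f (R * 2) * f1 (R * 2) - f (R * 1) * f1 (R * 1) := by
    apply intervalIntegral.integral_eq_sub_of_hasDerivAt (f := fun ρ => f (R * ρ) * f1 (R * ρ))
    · intro ρ hρ
      rw [u12] at hρ
      have hp : 0 < R * ρ := mul_pos hR0 (by linarith [hρ.1])
      have hlin : HasDerivAt (fun ρ : ℝ => R * ρ) R ρ := by
        simpa using (hasDerivAt_id ρ).const_mul R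
      have h1 := (hf.d1 _ hp).comp ρ hlin
      have h2 := (hf.d2 _ hp).comp ρ hlin
      refine (h1.mul h2).congr_deriv ?_
      simp only [Function.comp]
      ring
    · exact (iJ.sub iQ).const_mul R
  rw [intervalIntegral.integral_const_mul, intervalIntegral.integral_sub iJ iQ] at hFTC
  have hQN : ∫ ρ in (1:ℝ)..2, ((R * ρ) ^ 2 - c) / (R * ρ) ^ 2 * f (R * ρ) ^ 2 ≤ 4 * N := by
    rw [hN, ← intervalIntegral.integral_const_mul]
    apply intervalIntegral.integral_mono_on (by norm_num) iQ (iN.const_mul 4)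
    intro ρ hρ
    have := (hfar _ (hRρ ρ hρ)).2.2.2
    gcongr
  have hNJ : E / 12 ≤ N + J := by
    rw [hN, hJ, ← intervalIntegral.integral_add iN iJ]
    calc E / 12 = ∫ ρ in (1:ℝ)..2, E / 12 := by norm_num
      _ ≤ _ := by
        apply intervalIntegral.integral_mono_on (by norm_num) (by simp) (iN.add iJ)
        intro ρ hρ
        exact (hfar _ (hRρ ρ hρ)).2.2.1
  have hprod : ∀ v w, R - 1 ≤ v → R - 1 ≤ w → |f v * f w| ≤ 12 * E ∧ |f v * f1 v| ≤ 12 * E ∧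
      |f1 v * f w| ≤ 12 * E := by
    intro v w hv hw
    have h1 := (hfar v hv).1
    have h2 := (hfar v hv).2.1
    have h3 := (hfar w hw).1
    exact ⟨abs_mul_le_of_sq_le h1 h3, abs_mul_le_of_sq_le h1 h2, abs_mul_le_of_sq_le h2 h3⟩
  have hb1 := (abs_le.mp (hprod (R * 2) R (by linarith) (by linarith)).2.1)
  have hb2 := (abs_le.mp (hprod (R * 1) R (by linarith) (by linarith)).2.1)
  have hNlow : E / 120 ≤ N := by
    have : R * (J - 4 * N) ≤ 24 * E := by
      have : R * (J - 4 * N) ≤ R * (J - ∫ ρ in (1:ℝ)..2, ((R * ρ) ^ 2 - c) / (R * ρ) ^ 2 * f (R * ρ) ^ 2) := by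
        gcongr
      linarith [hb1.1, hb1.2, hb2.1, hb2.2]
    have h2 : J - 4 * N ≤ E / 24 := by
      by_contra hcon
      rw [not_le] at hcon
      nlinarith
    linarith
  obtain ⟨δ, hδ⟩ : ∃ δ : ℝ, δ = 1 / 5760 := ⟨_, rfl⟩
  have hδ0 : 0 < δ := by rw [hδ]; norm_num
  have hδ1 : δ ≤ 1 / 2 := by rw [hδ]; norm_num
  have hU : ∀ r ∈ Set.Icc (R - δ) (R + δ), N / 2 ≤ ∫ ρ, f (r * ρ) *
      (Set.Icc (1:ℝ) 2).indicator (fun ρ => f (R * ρ)) ρ := by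
    intro r hr
    have hr0 : 0 < r := by linarith [hr.1]
    have hrρ : ∀ ρ ∈ Set.Icc (1:ℝ) 2, R - 1 ≤ r * ρ := fun ρ hρ => by
      have h1 := hr.1
      have h2 := mul_le_mul_of_nonneg_left hρ.1 hr0.le
      linarith
    have hcr := continuousOn_comp_mul hf.continuousOn hr0 (a := 1) (b := 2) one_pos
    have e1 : ∫ ρ, f (r * ρ) * (Set.Icc (1:ℝ) 2).indicator (fun ρ => f (R * ρ)) ρ =
        ∫ ρ in (1:ℝ)..2, f (r * ρ) * f (R * ρ) := by
      rw [intervalIntegral.integral_of_le (by norm_num), ← integral_Icc_eq_integral_Ioc,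
        ← integral_indicator measurableSet_Icc]
      congr 1; ext ρ
      by_cases h : ρ ∈ Set.Icc (1:ℝ) 2 <;> simp [h]
    rw [e1]
    have ii : IntervalIntegrable (fun ρ => f (r * ρ) * f (R * ρ)) volume 1 2 :=
      ContinuousOn.intervalIntegrable_of_Icc (by norm_num) (hcr.mul hcf)
    have hle : ∫ ρ in (1:ℝ)..2, (f (R * ρ) ^ 2 - E / 240) ≤ ∫ ρ in (1:ℝ)..2, f (r * ρ) * f (R * ρ) := by
      apply intervalIntegral.integral_mono_on (by norm_num) (iN.sub (by simp)) ii
      intro ρ hρ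
      obtain ⟨ξ, hξ, hmv⟩ := exists_deriv_eq_sub (m := R - 1) (fun v hv => hf.d1 v (by linarith))
        (hRρ ρ hρ) (hrρ ρ hρ)
      have h3 := (hprod ξ (R * ρ) hξ (hRρ ρ hρ)).2.2
      have h4 : |R * ρ - r * ρ| ≤ 2 * δ := by
        rw [← sub_mul, abs_mul, abs_of_pos (by linarith [hρ.1] : 0 < ρ)]
        have : |R - r| ≤ δ := abs_le.mpr ⟨by linarith [hr.2], by linarith [hr.1]⟩
        calc |R - r| * ρ ≤ δ * 2 := mul_le_mul this hρ.2 (by linarith [hρ.1]) hδ0.le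
          _ = 2 * δ := mul_comm _ _
      have h5 : |(f1 ξ * f (R * ρ)) * (R * ρ - r * ρ)| ≤ 12 * E * (2 * δ) := by
        rw [abs_mul]; gcongr
      have h6 := (abs_le.mp h5).2
      have h7 : f (r * ρ) * f (R * ρ) = f (R * ρ) ^ 2 - (f1 ξ * f (R * ρ)) * (R * ρ - r * ρ) := by
        have : f (r * ρ) = f (R * ρ) - f1 ξ * (R * ρ - r * ρ) := by linarith
        rw [this]; ring
      rw [h7]
      have : 12 * E * (2 * δ) = E / 240 := by rw [hδ]; ring
      linarith
    rw [intervalIntegral.integral_sub iN (by simp)] at hle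
    simp only [intervalIntegral.integral_const] at hle
    norm_num at hle
    linarith
  have hiso := hf.iso ((Set.Icc (1:ℝ) 2).indicator fun ρ => f (R * ρ))
    (measurable_indicator_of_continuousOn measurableSet_Icc hcf) 1 2 (12 * E + 1) one_pos
    (by
      intro ρ
      by_cases h : ρ ∈ Set.Icc (1:ℝ) 2
      · rw [Set.indicator_of_mem h]
        have := (hfar _ (hRρ ρ h)).1
        rw [abs_le]; constructor <;> nlinarith
      · rw [Set.indicator_of_notMem h]; simp; positivity)
    (fun ρ h => Set.indicator_of_notMem h _)
  have hrhs : ∫⁻ ρ, ENNReal.ofReal ((Set.Icc (1:ℝ) 2).indicator (fun ρ => f (R * ρ)) ρ ^ 2) =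
      ENNReal.ofReal N := by
    rw [hN, intervalIntegral.integral_of_le (by norm_num), ← integral_Icc_eq_integral_Ioc,
      ofReal_integral_eq_lintegral_ofReal (f := fun ρ => f (R * ρ) ^ 2) (μ := volume.restrict (Set.Icc 1 2))
        (show ContinuousOn (fun ρ => f (R * ρ) ^ 2) (Set.Icc 1 2) from hcf.pow 2).integrableOn_Icc
        (Eventually.of_forall fun ρ => sq_nonneg _), ← lintegral_indicator measurableSet_Icc]
    congr 1; ext ρ
    by_cases h : ρ ∈ Set.Icc (1:ℝ) 2 <;> simp [h]
  have hN0 : 0 ≤ N := by linarith [div_nonneg hE0 (by norm_num : (0:ℝ) ≤ 120)]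
  have hlow : ENNReal.ofReal ((N / 2) ^ 2 * (2 * δ)) ≤ ENNReal.ofReal N := by
    rw [← hrhs, ← hiso]
    calc ENNReal.ofReal ((N / 2) ^ 2 * (2 * δ))
        = ∫⁻ r in Set.Icc (R - δ) (R + δ), ENNReal.ofReal ((N / 2) ^ 2) := by
          rw [setLIntegral_const, Real.volume_Icc, ENNReal.ofReal_mul (by positivity)]
          congr 2; ring
      _ ≤ ∫⁻ r in Set.Icc (R - δ) (R + δ), ENNReal.ofReal ((∫ ρ, f (r * ρ) *
          (Set.Icc (1:ℝ) 2).indicator (fun ρ => f (R * ρ)) ρ) ^ 2) := by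
          apply setLIntegral_mono' measurableSet_Icc
          intro r hr
          have := hU r hr
          gcongr
      _ ≤ _ := lintegral_mono_set fun r hr => by
          have := hr.1
          rw [Set.mem_Ioi]; linarith
  rw [ENNReal.ofReal_le_ofReal_iff hN0] at hlow
  have hNup : N ≤ 11520 := by
    by_contra hcon
    rw [not_le] at hcon
    rw [hδ] at hlow
    nlinarith
  linarith

/-- Oscillatory-region bounds with an absolute constant. -/
theorem bounds (hf : BesselLike c K α f f1) {κ : ℝ} (hκ : 1 ≤ κ) (hκc : c ≤ κ ^ 3) {u : ℝ}
    (hu : 0 < u) (hs : κ ≤ turn c u) :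
    f u ^ 2 ≤ 10 ^ 7 * (u / turn c u) ∧ f1 u ^ 2 ≤ 10 ^ 7 * (turn c u / u) := by
  have h1 := hf.energy_le hκ hκc hu hs
  obtain ⟨e1, e2, e3⟩ := energy_bounds hf.hc hκ hκc hu hs f f1
  have hs0 : 0 < turn c u := by linarith
  have p1 : 0 ≤ turn c u / u * f u ^ 2 := by positivity
  have p2 : 0 ≤ u / turn c u * f1 u ^ 2 := by positivity
  have q1 : turn c u / u * f u ^ 2 ≤ 10 ^ 7 := by linarith
  have q2 : u / turn c u * f1 u ^ 2 ≤ 10 ^ 7 := by linarith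
  constructor
  · calc f u ^ 2 = turn c u / u * f u ^ 2 * (u / turn c u) := by field_simp
      _ ≤ _ := by gcongr
  · calc f1 u ^ 2 = u / turn c u * f1 u ^ 2 * (turn c u / u) := by field_simp
      _ ≤ _ := by gcongr

end BesselLike

/-! ### The region below the turning point -/

section BelowTurn

variable {c : ℝ} {h h1 : ℝ → ℝ} (d1 : ∀ u > 0, HasDerivAt h (h1 u) u)
  (d2 : ∀ u > 0, HasDerivAt h1 (-((u ^ 2 - c) / u ^ 2 * h u)) u)
  (hz : Tendsto h (𝓝[>] 0) (𝓝 0))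

theorem monotoneOn_Ioc_of_hasDerivAt {F F' : ℝ → ℝ} {x : ℝ} (hd : ∀ u > 0, HasDerivAt F (F' u) u)
    (hF : ∀ u ∈ Set.Ioc 0 x, 0 ≤ F' u) : MonotoneOn F (Set.Ioc 0 x) := by
  apply monotoneOn_of_hasDerivWithinAt_nonneg (convex_Ioc 0 x) (f' := F')
  · exact fun u hu => (hd u hu.1).continuousAt.continuousWithinAt
  · exact fun u hu => (hd u (interior_subset hu).1).hasDerivWithinAt
  · exact fun u hu => hF u (interior_subset hu)

include d1 d2 hz in
theorem mul_deriv_nonneg_below {x : ℝ} (hxc : x ^ 2 ≤ c) : ∀ u ∈ Set.Ioc 0 x, 0 ≤ h u * h1 u := by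
  have hle : ∀ u ∈ Set.Ioc 0 x, 0 ≤ -((u ^ 2 - c) / u ^ 2) := by
    intro u hu
    have h0 := hu.1
    have : u ^ 2 ≤ x ^ 2 := by gcongr; exact hu.2
    rw [← neg_div]
    exact div_nonneg (by linarith) (by positivity)
  have hmono : MonotoneOn (fun u => h u * h1 u) (Set.Ioc 0 x) := by
    apply monotoneOn_Ioc_of_hasDerivAt (fun u hu => (d1 u hu).mul (d2 u hu))
    intro u hu
    have : 0 ≤ -((u ^ 2 - c) / u ^ 2) * h u ^ 2 := mul_nonneg (hle u hu) (sq_nonneg _)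
    nlinarith [sq_nonneg (h1 u)]
  intro v hv
  by_contra hcon
  rw [not_le] at hcon
  have hv0 := hv.1
  have hneg : ∀ u ∈ Set.Ioc 0 v, h u * h1 u < 0 := fun u hu =>
    (hmono ⟨hu.1, hu.2.trans hv.2⟩ hv hu.2).trans_lt hcon
  have hanti : MonotoneOn (fun u => -(h u ^ 2)) (Set.Ioc 0 v) := by
    apply monotoneOn_Ioc_of_hasDerivAt (fun u hu => ((d1 u hu).pow 2).neg)
    intro u hu
    have := hneg u hu
    norm_num
    linarith
  have hw : v / 2 ∈ Set.Ioc 0 v := ⟨by linarith, by linarith⟩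
  have hne : h (v / 2) ≠ 0 := fun h0 => by have := hneg _ hw; rw [h0] at this; simp at this
  have hpos : 0 < h (v / 2) ^ 2 := by positivity
  have hlim : Tendsto (fun u => h u ^ 2) (𝓝[>] 0) (𝓝 0) := by simpa using hz.pow 2
  have hev : ∀ᶠ u in 𝓝[>] (0:ℝ), h (v / 2) ^ 2 ≤ h u ^ 2 := by
    have : Set.Ioc 0 (v / 2) ∈ 𝓝[>] (0:ℝ) := Ioc_mem_nhdsGT (by linarith)
    filter_upwards [this] with u hu
    have := hanti ⟨hu.1, hu.2.trans hw.2⟩ hw hu.2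
    simp only at this
    linarith
  have := ge_of_tendsto hlim hev
  linarith

include d1 d2 hz in
theorem sq_monotoneOn_below {x : ℝ} (hxc : x ^ 2 ≤ c) :
    MonotoneOn (fun u => h u ^ 2) (Set.Ioc 0 x) ∧ MonotoneOn (fun u => h1 u ^ 2) (Set.Ioc 0 x) := by
  have hn := mul_deriv_nonneg_below d1 d2 hz hxc
  constructor
  · apply monotoneOn_Ioc_of_hasDerivAt (fun u hu => (d1 u hu).pow 2)
    intro u hu
    have := hn u hu
    norm_num
    linarith
  · apply monotoneOn_Ioc_of_hasDerivAt (fun u hu => (d2 u hu).pow 2)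
    intro u hu
    have h2 := hn u hu
    have h0 := hu.1
    have h3 : u ^ 2 ≤ x ^ 2 := by gcongr; exact hu.2
    have : 0 ≤ -((u ^ 2 - c) / u ^ 2) := by
      rw [← neg_div]; exact div_nonneg (by linarith) (by positivity)
    have := mul_nonneg this h2
    norm_num
    linarith

theorem lintegral_Ioc_zero_le {F : ℝ → ℝ≥0∞} {x : ℝ} {C : ℝ≥0∞}
    (hF : ∀ ε ∈ Set.Ioo 0 x, ∫⁻ u in Set.Ioc ε x, F u ≤ C) : ∫⁻ u in Set.Ioc 0 x, F u ≤ C := by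
  rcases le_or_gt x 0 with hx | hx
  · simp [Set.Ioc_eq_empty (not_lt.mpr hx)]
  have e : Set.Ioc 0 x = ⋃ n : ℕ, Set.Ioc (x / (n + 2)) x := by
    ext u
    simp only [Set.mem_Ioc, Set.mem_iUnion]
    constructor
    · rintro ⟨h1, h2⟩
      obtain ⟨n, hn⟩ := exists_nat_gt (x / u)
      refine ⟨n, ?_, h2⟩
      rw [div_lt_iff₀ h1] at hn
      rw [div_lt_iff₀ (by positivity)]
      nlinarith
    · rintro ⟨n, h1, h2⟩
      exact ⟨lt_of_le_of_lt (by positivity) h1, h2⟩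
  rw [e, setLIntegral_iUnion_of_directed]
  · apply iSup_le
    intro n
    apply hF
    refine ⟨by positivity, ?_⟩
    rw [div_lt_iff₀ (by positivity)]
    nlinarith [(Nat.cast_nonneg n : (0:ℝ) ≤ n)]
  · apply Monotone.directed_le
    intro n m hnm
    have hnm' : (n:ℝ) ≤ m := by exact_mod_cast hnm
    apply Set.Ioc_subset_Ioc_left
    gcongr

include d1 d2 hz in
theorem lintegral_below_turn_of_nonneg {x y : ℝ} (hx : 0 < x) (hxy : x < y) (hyc : y ^ 2 = c)
    (hy : 0 ≤ h y) :
    ∫⁻ u in Set.Ioc 0 x, ENNReal.ofReal (|h u| / √u) ≤ ENNReal.ofReal (x * √x / (c - x ^ 2) * h1 x) := by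
  have hy0 : 0 < y := hx.trans hxy
  have hm := (sq_monotoneOn_below d1 d2 hz hyc.le).1
  have hprod := mul_deriv_nonneg_below d1 d2 hz hyc.le
  have hnn : ∀ v ∈ Set.Ioc 0 y, 0 ≤ h v := by
    intro v hv
    by_contra hcon
    rw [not_le] at hcon
    have hc : ContinuousOn h (Set.Icc v y) :=
      fun u hu => (d1 u (hv.1.trans_le hu.1)).continuousAt.continuousWithinAt
    obtain ⟨w, hw, hw0⟩ := intermediate_value_Icc hv.2 hc ⟨hcon.le, hy⟩
    have := hm hv ⟨hv.1.trans_le hw.1, hw.2⟩ hw.1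
    simp only [hw0] at this
    nlinarith
  have hd : ∀ v ∈ Set.Ioo 0 y, 0 ≤ h1 v := by
    intro v hv
    rcases (hnn v ⟨hv.1, hv.2.le⟩).eq_or_lt with h0 | h0
    · have : IsLocalMin h v := by
        filter_upwards [Ioo_mem_nhds hv.1 hv.2] with w hw
        rw [← h0]; exact hnn w ⟨hw.1, hw.2.le⟩
      rw [this.hasDerivAt_eq_zero (d1 v hv.1)]
    · by_contra hcon
      rw [not_le] at hcon
      have := hprod v ⟨hv.1, hv.2.le⟩
      nlinarith
  apply lintegral_Ioc_zero_le
  intro ε hε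
  have hpos : ∀ u ∈ Set.Icc ε x, 0 < u ∧ u < y ∧ 0 < c - u ^ 2 := by
    intro u hu
    have h1 : 0 < u := hε.1.trans_le hu.1
    have h2 : u < y := hu.2.trans_lt hxy
    refine ⟨h1, h2, ?_⟩
    rw [← hyc]; nlinarith
  have hder : ∀ u ∈ Set.Icc ε x, HasDerivAt (fun u => u * √u / (c - u ^ 2) * h1 u)
      ((3 / 2 * √u * (c - u ^ 2) + 2 * u ^ 2 * √u) / (c - u ^ 2) ^ 2 * h1 u + h u / √u) u := by
    intro u hu
    obtain ⟨h0, h2, h3⟩ := hpos u hu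
    have hs := Real.hasDerivAt_sqrt h0.ne'
    have hid := hasDerivAt_id u
    have hq : HasDerivAt (fun u : ℝ => c - u ^ 2) (-(2 * u)) u := by
      simpa using ((hasDerivAt_pow 2 u).const_sub c)
    refine (((hid.mul hs).div hq h3.ne').mul (d2 u h0)).congr_deriv ?_
    simp only [id, Pi.mul_apply, Pi.div_apply]
    have hsp : 0 < √u := Real.sqrt_pos.mpr h0
    have e : u = √u ^ 2 := (Real.sq_sqrt h0.le).symm
    have e2 : (u ^ 2 - c) / u ^ 2 = -((c - u ^ 2) / u ^ 2) := by ring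
    rw [e2]
    generalize hD : c - u ^ 2 = D at *
    generalize hv : √u = v at *
    rw [e]
    field_simp
    ring
  have hφ : ContinuousOn (fun u => h u / √u) (Set.Icc ε x) := by
    apply ContinuousOn.div
    · exact fun u hu => (d1 u (hpos u hu).1).continuousAt.continuousWithinAt
    · fun_prop
    · exact fun u hu => (Real.sqrt_pos.mpr (hpos u hu).1).ne'
  have hle := intervalIntegral.integral_le_sub_of_hasDeriv_right_of_le (a := ε) (b := x) hε.2.le
    (g := fun u => u * √u / (c - u ^ 2) * h1 u)
    (fun u hu => (hder u hu).continuousAt.continuousWithinAt)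
    (fun u hu => (hder u (Set.Ioo_subset_Icc_self hu)).hasDerivWithinAt)
    (φ := fun u => h u / √u) hφ.integrableOn_Icc
    (by
      intro u hu
      obtain ⟨h0, h2, h3⟩ := hpos u (Set.Ioo_subset_Icc_self hu)
      have := hd u ⟨h0, h2⟩
      have : 0 ≤ (3 / 2 * √u * (c - u ^ 2) + 2 * u ^ 2 * √u) / (c - u ^ 2) ^ 2 * h1 u := by positivity
      linarith)
  have hεp := hpos ε ⟨le_rfl, hε.2.le⟩
  have h0ε : 0 ≤ ε * √ε / (c - ε ^ 2) * h1 ε := by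
    have := hd ε ⟨hεp.1, hεp.2.1⟩
    have := hεp.1
    have := hεp.2.2
    positivity
  calc ∫⁻ u in Set.Ioc ε x, ENNReal.ofReal (|h u| / √u)
      = ∫⁻ u in Set.Ioc ε x, ENNReal.ofReal (h u / √u) := by
        apply setLIntegral_congr_fun measurableSet_Ioc
        intro u hu
        have := hpos u ⟨hu.1.le, hu.2⟩
        simp only []
        rw [abs_of_nonneg (hnn u ⟨this.1, this.2.1.le⟩)]
    _ = ENNReal.ofReal (∫ u in ε..x, h u / √u) := by
        rw [intervalIntegral.integral_of_le hε.2.le, ofReal_integral_eq_lintegral_ofReal]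
        · exact hφ.integrableOn_Icc.mono_set Set.Ioc_subset_Icc_self
        · filter_upwards [ae_restrict_mem measurableSet_Ioc] with u hu
          have := hpos u ⟨hu.1.le, hu.2⟩
          have := hnn u ⟨this.1, this.2.1.le⟩
          simp only [Pi.zero_apply]; positivity
    _ ≤ _ := by
        apply ENNReal.ofReal_le_ofReal
        linarith

include d1 d2 hz in
theorem lintegral_below_turn {x y : ℝ} (hx : 0 < x) (hxy : x < y) (hyc : y ^ 2 = c) :
    ∫⁻ u in Set.Ioc 0 x, ENNReal.ofReal (|h u| / √u) ≤
      ENNReal.ofReal (x * √x / (c - x ^ 2) * |h1 x|) := by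
  have hpos : 0 < c - x ^ 2 := by rw [← hyc]; nlinarith
  rcases le_total 0 (h y) with hy | hy
  · refine (lintegral_below_turn_of_nonneg d1 d2 hz hx hxy hyc hy).trans ?_
    apply ENNReal.ofReal_le_ofReal
    gcongr
    exact le_abs_self _
  · have := lintegral_below_turn_of_nonneg (h := fun u => -h u) (h1 := fun u => -h1 u) (c := c)
      (fun u hu => (d1 u hu).neg) (fun u hu => ((d2 u hu).neg).congr_deriv (by ring)) (by simpa using hz.neg)
      hx hxy hyc (by linarith)
    simp only [abs_neg] at this
    refine this.trans ?_
    apply ENNReal.ofReal_le_ofReal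
    gcongr
    exact neg_le_abs _

end BelowTurn

namespace BesselLike

variable {c K α : ℝ} {f f1 : ℝ → ℝ}

theorem sq_le_near_turn (hf : BesselLike c K α f f1) {l : ℝ} (hl : 2 ≤ l ^ 2) (hl0 : 0 < l)
    (hc : c = l ^ 6) :
    (∀ u, 0 < u → u ^ 2 ≤ l ^ 6 + l ^ 4 → f u ^ 2 ≤ 8 * 10 ^ 7 * l) ∧
    (∀ u ∈ Set.Ioc 0 (l ^ 3), f1 u ^ 2 ≤ 2 * 10 ^ 7 / l) := by
  have hκ : (1:ℝ) ≤ l ^ 2 := by linarith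
  have hκc : c ≤ (l ^ 2) ^ 3 := by rw [hc]; exact le_of_eq (by ring)
  set u0 := √(l ^ 6 + l ^ 4) with hu0
  have hu0sq : u0 ^ 2 = l ^ 6 + l ^ 4 := Real.sq_sqrt (by positivity)
  have hu0p : 0 < u0 := Real.sqrt_pos.mpr (by positivity)
  have hs : turn c u0 = l ^ 2 := by
    rw [turn, hu0sq, hc, show l ^ 6 + l ^ 4 - l ^ 6 = (l ^ 2) ^ 2 by ring, Real.sqrt_sq (by positivity)]
  obtain ⟨b1, b2⟩ := hf.bounds hκ hκc hu0p hs.ge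
  rw [hs] at b1 b2
  have h3 : l ^ 3 ≤ u0 := by
    apply Real.le_sqrt_of_sq_le
    have : 0 < l ^ 4 := by positivity
    nlinarith
  have hu2 : u0 ≤ 2 * l ^ 3 := by
    apply Real.sqrt_le_iff.mpr
    refine ⟨by positivity, ?_⟩
    have : 0 < l ^ 4 := by positivity
    nlinarith
  have hu3 : u0 - l ^ 3 ≤ l / 2 := by
    have : u0 ≤ l ^ 3 + l / 2 := by
      apply Real.sqrt_le_iff.mpr
      refine ⟨by positivity, ?_⟩
      nlinarith [sq_nonneg l]
    linarith
  have q1 : f u0 ^ 2 ≤ 2 * 10 ^ 7 * l := by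
    refine b1.trans ?_
    have : u0 / l ^ 2 ≤ 2 * l := by rw [div_le_iff₀ (by positivity)]; linarith
    linarith
  have q2 : l ^ 2 / u0 ≤ 1 / l := by
    rw [div_le_div_iff₀ hu0p hl0]; linarith
  have q3 : f1 u0 ^ 2 ≤ 10 ^ 7 / l := by
    refine b2.trans ?_
    rw [div_eq_mul_one_div (10 ^ 7 : ℝ)]; gcongr
  have q4 : (u0 ^ 2 - c) / u0 ^ 2 * f u0 ^ 2 ≤ 10 ^ 7 / l := by
    have e : (u0 ^ 2 - c) / u0 ^ 2 = (l ^ 2 / u0) ^ 2 := by rw [hu0sq, hc, div_pow, hu0sq]; ring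
    rw [e]
    calc (l ^ 2 / u0) ^ 2 * f u0 ^ 2 ≤ (l ^ 2 / u0) ^ 2 * (10 ^ 7 * (u0 / l ^ 2)) := by gcongr
      _ = 10 ^ 7 * (l ^ 2 / u0) := by field_simp
      _ ≤ 10 ^ 7 * (1 / l) := by gcongr
      _ = _ := by ring
  have hmid : MonotoneOn (fun u => (u ^ 2 - c) / u ^ 2 * f u ^ 2 + f1 u ^ 2) (Set.Ioc 0 u0) := by
    apply monotoneOn_Ioc_of_hasDerivAt (F' := fun u => 2 * c / u ^ 3 * f u ^ 2)
    · intro u hu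
      have hq : HasDerivAt (fun u : ℝ => u ^ 2 - c) (2 * u) u := by
        simpa using ((hasDerivAt_pow 2 u).sub_const c)
      have hp : HasDerivAt (fun u : ℝ => u ^ 2) (2 * u) u := by simpa using hasDerivAt_pow 2 u
      refine (((hq.div hp (by positivity)).mul ((hf.d1 u hu).pow 2)).add
        ((hf.d2 u hu).pow 2)).congr_deriv ?_
      simp only [Pi.div_apply, Pi.pow_apply]
      field_simp
      ring
    · intro u hu
      have := hu.1
      rw [hc]; positivity
  have hf1mid : ∀ u ∈ Set.Icc (l ^ 3) u0, f1 u ^ 2 ≤ 2 * 10 ^ 7 / l := by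
    intro u hu
    have hup : 0 < u := (by positivity : 0 < l ^ 3).trans_le hu.1
    have := hmid ⟨hup, hu.2⟩ ⟨hu0p, le_rfl⟩ hu.2
    simp only at this
    have hn : 0 ≤ (u ^ 2 - c) / u ^ 2 * f u ^ 2 := by
      have : l ^ 6 ≤ u ^ 2 := by
        calc l ^ 6 = (l ^ 3) ^ 2 := by ring
          _ ≤ u ^ 2 := by gcongr; exact hu.1
      have : 0 ≤ u ^ 2 - c := by rw [hc]; linarith
      positivity
    have : (2 * 10 ^ 7 / l : ℝ) = 10 ^ 7 / l + 10 ^ 7 / l := by ring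
    linarith
  have hfmid : ∀ u ∈ Set.Icc (l ^ 3) u0, f u ^ 2 ≤ 8 * 10 ^ 7 * l := by
    intro u hu
    have hup : 0 < l ^ 3 := (by positivity : 0 < l ^ 3)
    have hmv : f u0 ^ 2 ≤ 2 * 10 ^ 7 * l ∧ |f u - f u0| ^ 2 ≤ 10 ^ 7 * l := by
      refine ⟨q1, ?_⟩
      have hb : |f u - f u0| ≤ √(2 * 10 ^ 7 / l) * |u - u0| := by
        have := (convex_Icc (l ^ 3) u0).norm_image_sub_le_of_norm_hasDerivWithin_le (f := f)
          (f' := f1) (C := √(2 * 10 ^ 7 / l))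
          (fun x hx => (hf.d1 x (hup.trans_le hx.1)).hasDerivWithinAt)
          (fun x hx => by
            rw [Real.norm_eq_abs]
            exact Real.abs_le_sqrt (hf1mid x hx)) (x := u0) (y := u) ⟨h3, le_rfl⟩ hu
        simpa [Real.norm_eq_abs] using this
      have hu' : |u - u0| ≤ l / 2 := by
        rw [abs_le]; constructor <;> linarith [hu.1, hu.2]
      calc |f u - f u0| ^ 2 ≤ (√(2 * 10 ^ 7 / l) * (l / 2)) ^ 2 := by
            have := abs_nonneg (f u - f u0)
            gcongr
            exact hb.trans (by gcongr)
        _ = 2 * 10 ^ 7 / l * (l / 2) ^ 2 := by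
            rw [mul_pow, Real.sq_sqrt (by positivity)]
        _ = 10 ^ 7 * l / 2 := by field_simp
        _ ≤ 10 ^ 7 * l := by linarith [(by positivity : 0 < 10 ^ 7 * l)]
    rw [sq_abs] at hmv
    nlinarith [sq_nonneg (f u - 2 * f u0), hmv.1, hmv.2, sq_nonneg (f u - f u0 - f u0)]
  have hyc : (l ^ 3) ^ 2 ≤ c := by rw [hc]; exact le_of_eq (by ring)
  have hc0 : 0 < c := by rw [hc]; positivity
  obtain ⟨m1, m2⟩ := sq_monotoneOn_below hf.d1 hf.d2 (hf.zero hc0) hyc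
  have hmem : l ^ 3 ∈ Set.Ioc 0 (l ^ 3) := ⟨by positivity, le_rfl⟩
  constructor
  · intro u hu huu
    rcases le_total u (l ^ 3) with h | h
    · exact (m1 ⟨hu, h⟩ hmem h).trans (hfmid _ ⟨le_rfl, h3⟩)
    · exact hfmid u ⟨h, Real.le_sqrt_of_sq_le huu⟩
  · intro u hu
    exact (m2 hu hmem hu.2).trans (hf1mid _ ⟨le_rfl, h3⟩)

theorem lintegral_small_of_large (hf : BesselLike c K α f f1) {l : ℝ} (hl : 2 ≤ l ^ 2) (hl0 : 0 < l)
    (hc : c = l ^ 6) {x : ℝ} (hx : x ^ 2 ≤ l ^ 6 + 10 ^ 4 * l ^ 4) :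
    ∫⁻ u in Set.Ioc 0 x, ENNReal.ofReal (|f u| / √u) ≤ ENNReal.ofReal (3 * 10 ^ 8) := by
  obtain ⟨B1, B2⟩ := hf.sq_le_near_turn hl hl0 hc
  have hκ : (1:ℝ) ≤ l ^ 2 := by linarith
  have hκc : c ≤ (l ^ 2) ^ 3 := by rw [hc]; exact le_of_eq (by ring)
  have hc0 : 0 < c := by rw [hc]; positivity
  set y := l ^ 3 - l with hy
  have hl1 : 1 < l := by nlinarith
  have hyhalf : l ^ 3 / 2 ≤ y := by nlinarith
  have hl3 : 0 < l ^ 3 := by positivity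
  have hy0 : 0 < y := by linarith
  have hx2 : x ≤ l ^ 3 + 5000 * l := by
    apply le_of_sq_le_sq _ (by positivity)
    nlinarith [sq_nonneg l]
  have low : ∫⁻ u in Set.Ioc 0 y, ENNReal.ofReal (|f u| / √u) ≤ ENNReal.ofReal (5 * 10 ^ 3) := by
    refine (lintegral_below_turn hf.d1 hf.d2 (hf.zero hc0) hy0 (y := l ^ 3) (by linarith)
      (by rw [hc]; ring)).trans (ENNReal.ofReal_le_ofReal ?_)
    have hD : l ^ 4 ≤ c - y ^ 2 := by rw [hc, hy]; nlinarith [sq_nonneg l, sq_nonneg (l ^ 2)]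
    have hf1 := B2 y ⟨hy0, by linarith⟩
    apply le_of_sq_le_sq _ (by norm_num)
    have e : (y * √y / (c - y ^ 2) * |f1 y|) ^ 2 = y ^ 3 / (c - y ^ 2) ^ 2 * f1 y ^ 2 := by
      rw [mul_pow, sq_abs, div_pow, mul_pow, Real.sq_sqrt hy0.le]; ring
    rw [e]
    calc y ^ 3 / (c - y ^ 2) ^ 2 * f1 y ^ 2 ≤ (l ^ 3) ^ 3 / (l ^ 4) ^ 2 * (2 * 10 ^ 7 / l) := by
          gcongr; linarith
      _ = 2 * 10 ^ 7 := by field_simp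
      _ ≤ _ := by norm_num
  have high : ∫⁻ u in Set.Ioc y x, ENNReal.ofReal (|f u| / √u) ≤ ENNReal.ofReal (45000 * 5001) := by
    calc ∫⁻ u in Set.Ioc y x, ENNReal.ofReal (|f u| / √u)
        ≤ ∫⁻ u in Set.Ioc y x, ENNReal.ofReal (45000 / l) := by
          apply setLIntegral_mono' measurableSet_Ioc
          intro u hu
          have hu0 : 0 < u := hy0.trans hu.1
          apply ENNReal.ofReal_le_ofReal
          apply le_of_sq_le_sq _ (by positivity)
          rw [div_pow, sq_abs, Real.sq_sqrt hu0.le, div_pow]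
          have hfu : f u ^ 2 ≤ 101 * 10 ^ 7 * l := by
            rcases le_total (u ^ 2) (l ^ 6 + l ^ 4) with h | h
            · refine (B1 u hu0 h).trans ?_
              gcongr; norm_num
            · have hs : l ^ 2 ≤ turn c u := by
                apply Real.le_sqrt_of_sq_le
                rw [hc]; nlinarith
              refine (hf.bounds hκ hκc hu0 hs).1.trans ?_
              have h2 : u ≤ 101 * l ^ 3 := by
                apply le_of_sq_le_sq _ (by positivity)
                have h1 : u ^ 2 ≤ x ^ 2 := by gcongr; exact hu.2
                have : l ^ 4 ≤ l ^ 6 := pow_le_pow_right₀ hl1.le (by norm_num)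
                nlinarith
              have : u / turn c u ≤ 101 * l := by
                rw [div_le_iff₀ (lt_of_lt_of_le (by positivity) hs)]
                nlinarith
              linarith
          rw [div_le_div_iff₀ hu0 (by positivity)]
          have hu3 : l ^ 3 / 2 ≤ u := by linarith [hu.1]
          calc f u ^ 2 * l ^ 2 ≤ 101 * 10 ^ 7 * l * l ^ 2 := by gcongr
            _ ≤ 45000 ^ 2 * (l ^ 3 / 2) := by nlinarith
            _ ≤ 45000 ^ 2 * u := by gcongr
      _ = ENNReal.ofReal (45000 / l) * ENNReal.ofReal (x - y) := by
          rw [setLIntegral_const, Real.volume_Ioc]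
      _ ≤ ENNReal.ofReal (45000 / l) * ENNReal.ofReal (5001 * l) := by
          gcongr; linarith
      _ = ENNReal.ofReal (45000 * 5001) := by
          rw [← ENNReal.ofReal_mul (by positivity)]
          congr 1; field_simp
  calc ∫⁻ u in Set.Ioc 0 x, ENNReal.ofReal (|f u| / √u)
      ≤ ∫⁻ u in Set.Ioc 0 y ∪ Set.Ioc y x, ENNReal.ofReal (|f u| / √u) := by
        apply lintegral_mono_set
        intro u hu
        rcases le_or_gt u y with h | h
        · exact Or.inl ⟨hu.1, h⟩
        · exact Or.inr ⟨h, hu.2⟩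
    _ ≤ _ := lintegral_union_le _ _ _
    _ ≤ ENNReal.ofReal (5 * 10 ^ 3) + ENNReal.ofReal (45000 * 5001) := add_le_add low high
    _ ≤ _ := by
        rw [← ENNReal.ofReal_add (by norm_num) (by norm_num)]
        apply ENNReal.ofReal_le_ofReal; norm_num

/-- The weighted `L¹` bound up to and slightly beyond the turning point. -/
theorem lintegral_small (hf : BesselLike c K α f f1) (hK : 0 ≤ K) {κ : ℝ} (hκ : 1 ≤ κ)
    (hκc : κ ^ 3 = max c 1) {x : ℝ} (hx : x ^ 2 ≤ c + 10 ^ 4 * κ ^ 2) :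
    ∫⁻ u in Set.Ioc 0 x, ENNReal.ofReal (|f u| / √u) ≤ ENNReal.ofReal (K * 400 ^ α * 40 + 3 * 10 ^ 8) := by
  have hα := hf.hα
  rcases le_total 2 κ with h | h
  · have hc : c = κ ^ 3 := by
      rcases le_total c 1 with h1 | h1
      · rw [max_eq_right h1] at hκc; nlinarith [sq_nonneg κ]
      · rw [hκc, max_eq_left h1]
    have e : √κ ^ 2 = κ := Real.sq_sqrt (by linarith)
    refine (hf.lintegral_small_of_large (l := √κ) (by rw [e]; exact h) (Real.sqrt_pos.mpr (by linarith))
      ?_ ?_).trans (ENNReal.ofReal_le_ofReal ?_)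
    · rw [show √κ ^ 6 = (√κ ^ 2) ^ 3 by ring, e, hc]
    · rw [show √κ ^ 6 = (√κ ^ 2) ^ 3 by ring, show √κ ^ 4 = (√κ ^ 2) ^ 2 by ring, e]
      rw [hc] at hx; exact hx
    · have : 0 ≤ K * 400 ^ α * 40 := by positivity
      linarith
  · have hc8 : c ≤ 8 := by
      have h1 : c ≤ κ ^ 3 := hκc ▸ le_max_left _ _
      have h2 : κ ^ 3 ≤ 2 ^ 3 := by gcongr
      linarith
    have hx400 : x ≤ 400 := by
      apply le_of_sq_le_sq _ (by norm_num)
      nlinarith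
    calc ∫⁻ u in Set.Ioc 0 x, ENNReal.ofReal (|f u| / √u)
        ≤ ∫⁻ u in Set.Ioc 0 400, ENNReal.ofReal (|f u| / √u) :=
          lintegral_mono_set (Set.Ioc_subset_Ioc_right hx400)
      _ ≤ ∫⁻ u in Set.Ioc 0 400, ENNReal.ofReal (K * 400 ^ α) * ENNReal.ofReal (u ^ (-(1 / 2) : ℝ)) := by
          apply setLIntegral_mono' measurableSet_Ioc
          intro u hu
          have hu0 := hu.1
          have hu4 := hu.2
          rw [← ENNReal.ofReal_mul (by positivity)]
          apply ENNReal.ofReal_le_ofReal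
          rw [Real.rpow_neg hu0.le, ← Real.sqrt_eq_rpow, ← div_eq_mul_inv]
          gcongr
          exact (hf.bd u hu0).trans (by gcongr)
      _ = ENNReal.ofReal (K * 400 ^ α * 40) := by
          rw [lintegral_const_mul' _ _ ENNReal.ofReal_ne_top, lintegral_rpow_Ioc (by norm_num) (by norm_num),
            ← ENNReal.ofReal_mul (by positivity)]
          congr 1
          rw [show (-(1 / 2) + 1 : ℝ) = 1 / 2 by norm_num, ← Real.sqrt_eq_rpow,
            show (400:ℝ) = 20 ^ 2 by norm_num, Real.sqrt_sq (by norm_num)]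
          ring
      _ ≤ _ := by
          apply ENNReal.ofReal_le_ofReal
          linarith

end BesselLike

/-! ### Smoothly truncated inner products -/

/-- The Wronskian of `r ↦ f (r ρ)` and `r ↦ f (r ρ')`. -/
def wronsk (f f1 : ℝ → ℝ) (ρ ρ' r : ℝ) : ℝ :=
  ρ * f1 (r * ρ) * f (r * ρ') - ρ' * f (r * ρ) * f1 (r * ρ')

/-- The piecewise linear cutoff, `1` for `r ≤ q` and `0` for `r ≥ q'`. -/
def ramp (q q' r : ℝ) : ℝ := max 0 (min 1 ((q' - r) / (q' - q)))

theorem ramp_nonneg (q q' r : ℝ) : 0 ≤ ramp q q' r := le_max_left _ _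

theorem ramp_le_one (q q' r : ℝ) : ramp q q' r ≤ 1 := max_le zero_le_one (min_le_left _ _)

theorem ramp_eq_one {q q' r : ℝ} (hq : q < q') (h : r ≤ q) : ramp q q' r = 1 := by
  have : 1 ≤ (q' - r) / (q' - q) := by rw [le_div_iff₀ (by linarith)]; linarith
  rw [ramp, min_eq_left this, max_eq_right zero_le_one]

theorem ramp_eq_zero {q q' r : ℝ} (hq : q < q') (h : q' ≤ r) : ramp q q' r = 0 := by
  have : (q' - r) / (q' - q) ≤ 0 := div_nonpos_of_nonpos_of_nonneg (by linarith) (by linarith)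
  rw [ramp]; exact max_eq_left ((min_le_right _ _).trans this)

theorem ramp_eq_div {q q' r : ℝ} (hq : q < q') (h : r ∈ Set.Icc q q') :
    ramp q q' r = (q' - r) / (q' - q) := by
  have h1 : (q' - r) / (q' - q) ≤ 1 := by rw [div_le_one (by linarith)]; linarith [h.1]
  have h2 : 0 ≤ (q' - r) / (q' - q) := div_nonneg (by linarith [h.2]) (by linarith)
  rw [ramp, min_eq_right h1, max_eq_right h2]

theorem continuous_ramp (q q' : ℝ) : Continuous (ramp q q') := by unfold ramp; fun_prop

namespace BesselLike

variable {c K α : ℝ} {f f1 : ℝ → ℝ}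

theorem hasDerivAt_dil (hf : BesselLike c K α f f1) {r ρ : ℝ} (hr : 0 < r) (hρ : 0 < ρ) :
    HasDerivAt (fun r => f (r * ρ)) (ρ * f1 (r * ρ)) r ∧
    HasDerivAt (fun r => ρ * f1 (r * ρ)) (-((ρ ^ 2 - c / r ^ 2) * f (r * ρ))) r := by
  have hlin : HasDerivAt (fun r : ℝ => r * ρ) ρ r := by simpa using (hasDerivAt_id r).mul_const ρ
  have hp : 0 < r * ρ := mul_pos hr hρ
  constructor
  · exact ((hf.d1 _ hp).comp r hlin).congr_deriv (by ring)
  · refine (((hf.d2 _ hp).comp r hlin).const_mul ρ).congr_deriv ?_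
    field_simp

theorem hasDerivAt_wronsk (hf : BesselLike c K α f f1) {r ρ ρ' : ℝ} (hr : 0 < r) (hρ : 0 < ρ)
    (hρ' : 0 < ρ') :
    HasDerivAt (wronsk f f1 ρ ρ') ((ρ' ^ 2 - ρ ^ 2) * (f (r * ρ) * f (r * ρ'))) r := by
  obtain ⟨g1, g2⟩ := hf.hasDerivAt_dil hr hρ
  obtain ⟨h1, h2⟩ := hf.hasDerivAt_dil hr hρ'
  have e : wronsk f f1 ρ ρ' = fun r => (ρ * f1 (r * ρ)) * f (r * ρ') - f (r * ρ) * (ρ' * f1 (r * ρ')) := by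
    funext r; unfold wronsk; ring
  rw [e]
  refine ((g2.mul h1).sub (g1.mul h2)).congr_deriv ?_
  ring

theorem abs_le_on (hf : BesselLike c K α f f1) (hK : 0 ≤ K) {x : ℝ} {u : ℝ} (hu : 0 < u) (hx : u ≤ x) :
    |f u| ≤ K * x ^ α := by
  have := hf.hα
  exact (hf.bd u hu).trans (by gcongr)

theorem continuousOn_dil (hf : BesselLike c K α f f1) {ρ : ℝ} (hρ : 0 < ρ) :
    ContinuousOn (fun r => f (r * ρ)) (Set.Ioi 0) :=
  fun _ hr => (hf.hasDerivAt_dil hr hρ).1.continuousAt.continuousWithinAt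

theorem intervalIntegrable_mul (hf : BesselLike c K α f f1) (hK : 0 ≤ K) {ρ ρ' q : ℝ} (hρ : 0 < ρ)
    (hρ' : 0 < ρ') (hq : 0 < q) :
    IntervalIntegrable (fun r => f (r * ρ) * f (r * ρ')) volume 0 q := by
  rw [intervalIntegrable_iff_integrableOn_Ioc_of_le hq.le]
  refine Integrable.of_bound (C := K * (q * ρ) ^ α * (K * (q * ρ') ^ α)) ?_ ?_
  · apply ContinuousOn.aestronglyMeasurable _ measurableSet_Ioc
    exact ((hf.continuousOn_dil hρ).mul (hf.continuousOn_dil hρ')).mono fun r hr => hr.1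
  · filter_upwards [ae_restrict_mem measurableSet_Ioc] with r hr
    have hr0 := hr.1
    have hr2 := hr.2
    rw [Real.norm_eq_abs, abs_mul]
    gcongr
    · exact hf.abs_le_on hK (by positivity) (by gcongr)
    · exact hf.abs_le_on hK (by positivity) (by gcongr)

theorem integral_ramp_mul (hf : BesselLike c K α f f1) (hK : 0 ≤ K) {ρ ρ' q q' : ℝ} (hρ : 0 < ρ)
    (hρ' : 0 < ρ') (hq : 0 < q) (hqq : q < q') :
    (ρ' ^ 2 - ρ ^ 2) * (q' - q) * ∫ r in (0:ℝ)..q', ramp q q' r * (f (r * ρ) * f (r * ρ')) =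
      ∫ r in q..q', wronsk f f1 ρ ρ' r := by
  set Δ := ρ' ^ 2 - ρ ^ 2 with hΔ
  have hq' : 0 < q' := hq.trans hqq
  have hi := hf.intervalIntegrable_mul hK hρ hρ' hq
  have hi' := hf.intervalIntegrable_mul hK hρ hρ' hq'
  have hsub : Set.uIcc q q' ⊆ Set.uIcc 0 q' := by
    rw [Set.uIcc_of_le hqq.le, Set.uIcc_of_le hq'.le]; exact Set.Icc_subset_Icc_left hq.le
  have hi2 : IntervalIntegrable (fun r => f (r * ρ) * f (r * ρ')) volume q q' := hi'.mono_set hsub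
  have e1 : ∫ r in (0:ℝ)..q, Δ * (f (r * ρ) * f (r * ρ')) = wronsk f f1 ρ ρ' q - 0 := by
    apply intervalIntegral.integral_eq_sub_of_hasDerivAt_of_tendsto hq
      (fun r hr => hf.hasDerivAt_wronsk hr.1 hρ hρ') (hi.const_mul Δ)
    · exact hf.wr ρ hρ ρ' hρ'
    · exact (hf.hasDerivAt_wronsk hq hρ hρ').continuousAt.tendsto.mono_left nhdsWithin_le_nhds
  have hrd : ∀ r, HasDerivAt (fun r => (q' - r) / (q' - q)) (-1 / (q' - q)) r := by
    intro r
    exact ((hasDerivAt_id r).const_sub q').div_const (q' - q)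
  have e2 : ∫ r in q..q', ((q' - r) / (q' - q)) * (Δ * (f (r * ρ) * f (r * ρ'))) =
      (q' - q') / (q' - q) * wronsk f f1 ρ ρ' q' - (q' - q) / (q' - q) * wronsk f f1 ρ ρ' q -
        ∫ r in q..q', (-1 / (q' - q)) * wronsk f f1 ρ ρ' r := by
    apply intervalIntegral.integral_mul_deriv_eq_deriv_mul
      (u := fun r => (q' - r) / (q' - q)) (v := wronsk f f1 ρ ρ')
    · exact fun r _ => hrd r
    · intro r hr
      rw [Set.uIcc_of_le hqq.le] at hr
      exact hf.hasDerivAt_wronsk (hq.trans_le hr.1) hρ hρ'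
    · simp
    · exact hi2.const_mul Δ
  have hne : q' - q ≠ 0 := by linarith
  rw [sub_self, zero_div, zero_mul, div_self hne, one_mul, intervalIntegral.integral_const_mul] at e2
  have hrc := (continuous_ramp q q').continuousOn (s := Set.uIcc 0 q)
  have hrc' := (continuous_ramp q q').continuousOn (s := Set.uIcc q q')
  have split : ∫ r in (0:ℝ)..q', ramp q q' r * (f (r * ρ) * f (r * ρ')) =
      (∫ r in (0:ℝ)..q, f (r * ρ) * f (r * ρ')) +
        ∫ r in q..q', ((q' - r) / (q' - q)) * (f (r * ρ) * f (r * ρ')) := by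
    rw [← intervalIntegral.integral_add_adjacent_intervals (hi.continuousOn_mul hrc)
      (hi2.continuousOn_mul hrc')]
    congr 1
    · apply intervalIntegral.integral_congr
      intro r hr
      rw [Set.uIcc_of_le hq.le] at hr
      simp only []
      rw [ramp_eq_one hqq hr.2, one_mul]
    · apply intervalIntegral.integral_congr
      intro r hr
      rw [Set.uIcc_of_le hqq.le] at hr
      simp only []
      rw [ramp_eq_div hqq hr]
  rw [intervalIntegral.integral_const_mul] at e1
  have e3 : ∫ r in q..q', ((q' - r) / (q' - q)) * (Δ * (f (r * ρ) * f (r * ρ'))) =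
      Δ * ∫ r in q..q', ((q' - r) / (q' - q)) * (f (r * ρ) * f (r * ρ')) := by
    rw [← intervalIntegral.integral_const_mul]
    congr 1; ext r; ring
  rw [e3] at e2
  rw [split, mul_right_comm, mul_add, e1, e2]
  field_simp
  ring

/-- the second antiderivative formula -/
theorem integral_wronsk (hf : BesselLike c K α f f1) {ρ ρ' q q' : ℝ} (hρ : 0 < ρ)
    (hρ' : 0 < ρ') (hq : 0 < q) (hqq : q ≤ q') :
    (ρ' ^ 2 - ρ ^ 2) / 2 * ∫ r in q..q', wronsk f f1 ρ ρ' r =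
      (ρ * f1 (q * ρ) * (ρ' * f1 (q * ρ')) + ((ρ ^ 2 + ρ' ^ 2) / 2 - c / q ^ 2) * (f (q * ρ) * f (q * ρ')))
      - (ρ * f1 (q' * ρ) * (ρ' * f1 (q' * ρ')) +
        ((ρ ^ 2 + ρ' ^ 2) / 2 - c / q' ^ 2) * (f (q' * ρ) * f (q' * ρ')))
      + ∫ r in q..q', 2 * c / r ^ 3 * (f (r * ρ) * f (r * ρ')) := by
  have hpos : ∀ r ∈ Set.uIcc q q', 0 < r := fun r hr => by
    rw [Set.uIcc_of_le hqq] at hr; exact hq.trans_le hr.1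
  have hWc : IntervalIntegrable (wronsk f f1 ρ ρ') volume q q' :=
    ContinuousOn.intervalIntegrable fun r hr =>
      (hf.hasDerivAt_wronsk (hpos r hr) hρ hρ').continuousAt.continuousWithinAt
  have hGc : IntervalIntegrable (fun r => 2 * c / r ^ 3 * (f (r * ρ) * f (r * ρ'))) volume q q' := by
    apply ContinuousOn.intervalIntegrable
    apply ContinuousOn.mul
    · exact ContinuousOn.div (by fun_prop) (by fun_prop) fun r hr => by
        have := hpos r hr; positivity
    · exact ((hf.continuousOn_dil hρ).mul (hf.continuousOn_dil hρ')).mono fun r hr => hpos r hr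
  have key : ∫ r in q..q', (-((ρ' ^ 2 - ρ ^ 2) / 2) * wronsk f f1 ρ ρ' r +
      2 * c / r ^ 3 * (f (r * ρ) * f (r * ρ'))) =
      (ρ * f1 (q' * ρ) * (ρ' * f1 (q' * ρ')) +
        ((ρ ^ 2 + ρ' ^ 2) / 2 - c / q' ^ 2) * (f (q' * ρ) * f (q' * ρ'))) -
      (ρ * f1 (q * ρ) * (ρ' * f1 (q * ρ')) +
        ((ρ ^ 2 + ρ' ^ 2) / 2 - c / q ^ 2) * (f (q * ρ) * f (q * ρ'))) := by
    apply intervalIntegral.integral_eq_sub_of_hasDerivAt (f := fun r =>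
      ρ * f1 (r * ρ) * (ρ' * f1 (r * ρ')) + ((ρ ^ 2 + ρ' ^ 2) / 2 - c / r ^ 2) * (f (r * ρ) * f (r * ρ')))
    · intro r hr
      have hr0 := hpos r hr
      obtain ⟨g1, g2⟩ := hf.hasDerivAt_dil hr0 hρ
      obtain ⟨h1, h2⟩ := hf.hasDerivAt_dil hr0 hρ'
      have hc : HasDerivAt (fun r : ℝ => (ρ ^ 2 + ρ' ^ 2) / 2 - c / r ^ 2) (2 * c / r ^ 3) r := by
        have hp : HasDerivAt (fun r : ℝ => r ^ 2) (2 * r) r := by simpa using hasDerivAt_pow 2 r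
        refine (((hasDerivAt_const r c).div hp (by positivity)).const_sub _).congr_deriv ?_
        field_simp
        ring
      refine ((g2.mul h2).add (hc.mul (g1.mul h1))).congr_deriv ?_
      simp only [wronsk, Pi.mul_apply]
      ring
    · exact (hWc.const_mul _).add hGc
  rw [intervalIntegral.integral_add (hWc.const_mul _) hGc, intervalIntegral.integral_const_mul] at key
  linarith

theorem pointwise_bounds (hf : BesselLike c K α f f1) {κ : ℝ} (hκ : 1 ≤ κ) (hκc : c ≤ κ ^ 3)
    {r ρ ρ' : ℝ} (hr : 0 < r) (hρ : 0 < ρ) (hρρ : ρ ≤ ρ') (hs : κ ≤ turn c (r * ρ)) :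
    |wronsk f f1 ρ ρ' r| ≤ 2 * 10 ^ 7 * √(ρ * ρ' * turn c (r * ρ') / turn c (r * ρ)) ∧
    |ρ * f1 (r * ρ) * (ρ' * f1 (r * ρ'))| ≤
      10 ^ 7 * (turn c (r * ρ') / r) * √(ρ * ρ' * turn c (r * ρ') / turn c (r * ρ)) ∧
    |f (r * ρ) * f (r * ρ')| ≤
      10 ^ 7 * (r / turn c (r * ρ')) * √(ρ * ρ' * turn c (r * ρ') / turn c (r * ρ)) := by
  unfold wronsk
  have hp : 0 < r * ρ := mul_pos hr hρ
  have hρ' : 0 < ρ' := hρ.trans_le hρρ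
  have hle : r * ρ ≤ r * ρ' := by gcongr
  obtain ⟨hp', hs', -⟩ := good_mono hκ hp hs hle
  have hss : turn c (r * ρ) ≤ turn c (r * ρ') := turn_mono hp.le hle
  obtain ⟨g0, g1⟩ := hf.bounds hκ hκc hp hs
  obtain ⟨h0, h1⟩ := hf.bounds hκ hκc hp' hs'
  have hspos : 0 < turn c (r * ρ) := by linarith
  have hspos' : 0 < turn c (r * ρ') := by linarith
  generalize turn c (r * ρ) = s at *
  generalize turn c (r * ρ') = s' at *
  generalize f (r * ρ) = G at *
  generalize f (r * ρ') = H at *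
  have hX : 0 ≤ ρ * ρ' * s' / s := by positivity
  have main : ∀ x y k : ℝ, 0 ≤ k → x ^ 2 * y ^ 2 ≤ k ^ 2 * (ρ * ρ' * s' / s) →
      |x * y| ≤ k * √(ρ * ρ' * s' / s) := by
    intro x y k hk hxy
    rw [← Real.sqrt_sq hk, ← Real.sqrt_mul (by positivity)]
    apply Real.abs_le_sqrt
    rw [mul_pow]; exact hxy
  have w1 : |ρ * f1 (r * ρ) * H| ≤ 10 ^ 7 * √(ρ * ρ' * s' / s) := by
    apply main _ _ _ (by norm_num)
    calc (ρ * f1 (r * ρ)) ^ 2 * H ^ 2 = ρ ^ 2 * (f1 (r * ρ) ^ 2 * H ^ 2) := by ring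
      _ ≤ ρ ^ 2 * ((10 ^ 7 * (s / (r * ρ))) * (10 ^ 7 * (r * ρ' / s'))) := by gcongr
      _ = (10 ^ 7) ^ 2 * (ρ * ρ' * s / s') := by field_simp
      _ ≤ (10 ^ 7) ^ 2 * (ρ * ρ' * s' / s) := by gcongr
  have w2 : |ρ' * G * f1 (r * ρ')| ≤ 10 ^ 7 * √(ρ * ρ' * s' / s) := by
    apply main _ _ _ (by norm_num)
    calc (ρ' * G) ^ 2 * f1 (r * ρ') ^ 2 = ρ' ^ 2 * (G ^ 2 * f1 (r * ρ') ^ 2) := by ring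
      _ ≤ ρ' ^ 2 * ((10 ^ 7 * (r * ρ / s)) * (10 ^ 7 * (s' / (r * ρ')))) := by gcongr
      _ = (10 ^ 7) ^ 2 * (ρ * ρ' * s' / s) := by field_simp
  refine ⟨?_, ?_, ?_⟩
  · have := abs_sub (ρ * f1 (r * ρ) * H) (ρ' * G * f1 (r * ρ'))
    linarith
  · apply main _ _ _ (by positivity)
    calc (ρ * f1 (r * ρ)) ^ 2 * (ρ' * f1 (r * ρ')) ^ 2
        = ρ ^ 2 * ρ' ^ 2 * (f1 (r * ρ) ^ 2 * f1 (r * ρ') ^ 2) := by ring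
      _ ≤ ρ ^ 2 * ρ' ^ 2 * ((10 ^ 7 * (s / (r * ρ))) * (10 ^ 7 * (s' / (r * ρ')))) := by gcongr
      _ = (10 ^ 7) ^ 2 / r ^ 2 * (ρ * ρ') * s' * s := by field_simp
      _ ≤ (10 ^ 7) ^ 2 / r ^ 2 * (ρ * ρ') * s' * (s' ^ 2 / s) := by
          gcongr
          rw [le_div_iff₀ hspos]; nlinarith
      _ = _ := by field_simp
  · apply main _ _ _ (by positivity)
    calc G ^ 2 * H ^ 2 ≤ (10 ^ 7 * (r * ρ / s)) * (10 ^ 7 * (r * ρ' / s')) := by gcongr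
      _ = _ := by field_simp

/-- Bounds for the averaged Wronskian over the upper half of a box. -/
theorem integral_wronsk_bounds (hf : BesselLike c K α f f1) {κ : ℝ} (hκ : 1 ≤ κ) (hκc : c ≤ κ ^ 3)
    {r₁ q r₂ ρ ρ' : ℝ} (hr₁ : 0 < r₁) (hq : q = (r₁ + r₂) / 2) (hrr : r₁ < r₂) (hρ : 0 < ρ) (hρρ : ρ < ρ')
    (hs : κ ≤ turn c (r₁ * ρ)) :
    |∫ r in q..r₂, wronsk f f1 ρ ρ' r| ≤
      2 * 10 ^ 7 * √(ρ * ρ' * turn c (r₂ * ρ') / turn c (q * ρ)) * (r₂ - q) ∧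
    |∫ r in q..r₂, wronsk f f1 ρ ρ' r| ≤
      24 * 10 ^ 7 * √(ρ * ρ' * turn c (r₂ * ρ') / turn c (q * ρ)) * turn c (r₂ * ρ') /
        ((ρ' ^ 2 - ρ ^ 2) * r₂) := by
  have hq₁ : r₁ < q := by linarith
  have hq₂ : q < r₂ := by linarith
  have hq0 : 0 < q := by linarith
  have hρ' : 0 < ρ' := by linarith
  set σ := turn c (r₂ * ρ') with hσ
  set s₁ := turn c (q * ρ) with hs₁
  set M := √(ρ * ρ' * σ / s₁) with hM
  obtain ⟨h1, h2, h3⟩ := good_mono hκ (mul_pos hr₁ hρ) hs (show r₁ * ρ ≤ q * ρ by gcongr)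
  have hs₁0 : 0 < s₁ := by linarith
  have hloc : ∀ r ∈ Set.Icc q r₂, 0 < r ∧ κ ≤ turn c (r * ρ) ∧ κ ≤ turn c (r * ρ') ∧
      turn c (r * ρ') ≤ σ ∧ √(ρ * ρ' * turn c (r * ρ') / turn c (r * ρ)) ≤ M := by
    intro r hr
    have hr0 : 0 < r := hq0.trans_le hr.1
    have hrq := hr.1
    have hrr := hr.2
    have a1 : s₁ ≤ turn c (r * ρ) := turn_mono (by positivity) (by gcongr)
    have a2 : turn c (r * ρ') ≤ σ := turn_mono (by positivity) (by gcongr)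
    have a3 : turn c (r * ρ) ≤ turn c (r * ρ') := turn_mono (by positivity) (by gcongr)
    refine ⟨hr0, by linarith, by linarith, a2, ?_⟩
    have hσ0 : 0 ≤ σ := turn_nonneg _ _
    apply Real.sqrt_le_sqrt
    gcongr
  have hM0 : 0 ≤ M := Real.sqrt_nonneg _
  constructor
  · have := intervalIntegral.norm_integral_le_of_norm_le_const (a := q) (b := r₂)
      (f := wronsk f f1 ρ ρ') (C := 2 * 10 ^ 7 * M) (by
        intro r hr
        rw [Set.uIoc_of_le hq₂.le] at hr
        obtain ⟨b1, b2, b3, b4, b5⟩ := hloc r ⟨hr.1.le, hr.2⟩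
        rw [Real.norm_eq_abs]
        refine (hf.pointwise_bounds hκ hκc b1 hρ hρρ.le b2).1.trans ?_
        gcongr)
    rwa [Real.norm_eq_abs, abs_of_pos (by linarith : 0 < r₂ - q)] at this
  · have hΔ : 0 < ρ' ^ 2 - ρ ^ 2 := by nlinarith
    have hσ0 : 0 < σ := by
      obtain ⟨b1, b2, b3, b4, b5⟩ := hloc q ⟨le_rfl, hq₂.le⟩
      linarith
    have hprod : ∀ r ∈ Set.Icc q r₂, |f (r * ρ) * f (r * ρ')| ≤
        10 ^ 7 * (r / turn c (r * ρ')) * M := by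
      intro r hr
      obtain ⟨b1, b2, b3, b4, b5⟩ := hloc r hr
      have : 0 < turn c (r * ρ') := by linarith
      exact (hf.pointwise_bounds hκ hκc b1 hρ hρρ.le b2).2.2.trans (by gcongr)
    have hbd : ∀ r ∈ Set.Icc q r₂, |ρ * f1 (r * ρ) * (ρ' * f1 (r * ρ')) +
        ((ρ ^ 2 + ρ' ^ 2) / 2 - c / r ^ 2) * (f (r * ρ) * f (r * ρ'))| ≤
          2 * (10 ^ 7 * σ / q * M) := by
      intro r hr
      obtain ⟨b1, b2, b3, b4, b5⟩ := hloc r hr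
      have hs0 : 0 < turn c (r * ρ') := by linarith
      have hs0' : 0 < turn c (r * ρ) := by linarith
      have hrq := hr.1
      have t1 : |ρ * f1 (r * ρ) * (ρ' * f1 (r * ρ'))| ≤ 10 ^ 7 * σ / q * M := by
        refine (hf.pointwise_bounds hκ hκc b1 hρ hρρ.le b2).2.1.trans ?_
        rw [show 10 ^ 7 * σ / q * M = 10 ^ 7 * (σ / q) * M by ring]
        gcongr
      have hs2 : turn c (r * ρ') ^ 2 = (r * ρ') ^ 2 - c :=
        turn_sq (Real.sqrt_pos.mp hs0 |>.le |> fun h => by linarith)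
      have hs2' : turn c (r * ρ) ^ 2 = (r * ρ) ^ 2 - c :=
        turn_sq (Real.sqrt_pos.mp hs0' |>.le |> fun h => by linarith)
      have hco : |(ρ ^ 2 + ρ' ^ 2) / 2 - c / r ^ 2| ≤ turn c (r * ρ') ^ 2 / r ^ 2 := by
        have e : (ρ ^ 2 + ρ' ^ 2) / 2 - c / r ^ 2 =
            (turn c (r * ρ) ^ 2 + turn c (r * ρ') ^ 2) / 2 / r ^ 2 := by
          rw [hs2, hs2']; field_simp; ring
        rw [e, abs_of_nonneg (by positivity)]
        gcongr
        have : turn c (r * ρ) ^ 2 ≤ turn c (r * ρ') ^ 2 := by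
          rw [hs2, hs2']
          have : (r * ρ) ^ 2 ≤ (r * ρ') ^ 2 := by gcongr
          linarith
        linarith
      have t2 : |((ρ ^ 2 + ρ' ^ 2) / 2 - c / r ^ 2) * (f (r * ρ) * f (r * ρ'))| ≤ 10 ^ 7 * σ / q * M := by
        rw [abs_mul]
        calc _ ≤ turn c (r * ρ') ^ 2 / r ^ 2 * (10 ^ 7 * (r / turn c (r * ρ')) * M) := by
              gcongr; exact hprod r hr
          _ = 10 ^ 7 * turn c (r * ρ') / r * M := by field_simp
          _ ≤ _ := by gcongr
      exact (abs_add_le _ _).trans (by linarith)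
    have hthird : |∫ r in q..r₂, 2 * c / r ^ 3 * (f (r * ρ) * f (r * ρ'))| ≤ 2 * (10 ^ 7 * σ / q * M) := by
      have := intervalIntegral.norm_integral_le_of_norm_le_const (a := q) (b := r₂)
        (f := fun r => 2 * c / r ^ 3 * (f (r * ρ) * f (r * ρ')))
        (C := 2 * (10 ^ 7 * σ / q * M) / (r₂ - q)) (by
          intro r hr
          rw [Set.uIoc_of_le hq₂.le] at hr
          have hr' : r ∈ Set.Icc q r₂ := ⟨hr.1.le, hr.2⟩
          obtain ⟨b1, b2, b3, b4, b5⟩ := hloc r hr'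
          have hs0 : 0 < turn c (r * ρ') := by linarith
          have hs2 : turn c (r * ρ') ^ 2 = (r * ρ') ^ 2 - c :=
            turn_sq (Real.sqrt_pos.mp hs0 |>.le |> fun h => by linarith)
          have hbl : c + 1 ≤ (r₁ * ρ') ^ 2 := by
            have h5 : 1 ≤ turn c (r₁ * ρ) := hκ.trans hs
            have h6 : 1 ≤ (r₁ * ρ) ^ 2 - c := by
              have := Real.le_sqrt' one_pos |>.mp h5; linarith
            have : (r₁ * ρ) ^ 2 ≤ (r₁ * ρ') ^ 2 := by gcongr
            linarith
          have hr1 : r₁ ≤ r := by linarith [hr.1]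
          have hmono : (r₁ * ρ') ^ 2 ≤ (r * ρ') ^ 2 := by gcongr
          have hcabs : |c| ≤ (r * ρ') ^ 2 := by
            rw [abs_le]; constructor <;> linarith [hf.hc]
          have hlow : (r₂ - q) * r * ρ' ^ 2 ≤ turn c (r * ρ') ^ 2 := by
            rw [hs2]
            have e1 : (r₂ - q) ≤ r - r₁ := by linarith [hr.1]
            have e2 : (r₂ - q) * r * ρ' ^ 2 ≤ (r - r₁) * (r + r₁) * ρ' ^ 2 := by
              have : (r₂ - q) * r ≤ (r - r₁) * (r + r₁) :=
                mul_le_mul e1 (by linarith) b1.le (by linarith)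
              gcongr
            nlinarith
          rw [Real.norm_eq_abs, abs_mul, abs_div, abs_mul, abs_two, abs_of_pos (by positivity : 0 < r ^ 3)]
          rw [le_div_iff₀ (by linarith)]
          calc 2 * |c| / r ^ 3 * |f (r * ρ) * f (r * ρ')| * (r₂ - q)
              ≤ 2 * (r * ρ') ^ 2 / r ^ 3 * (10 ^ 7 * (r / turn c (r * ρ')) * M) * (r₂ - q) := by
                have : 0 ≤ r₂ - q := by linarith
                gcongr
                exact hprod r hr'
            _ = 2 * (10 ^ 7 * ((r₂ - q) * r * ρ' ^ 2 / turn c (r * ρ')) / r * M) := by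
                field_simp
            _ ≤ 2 * (10 ^ 7 * (turn c (r * ρ') ^ 2 / turn c (r * ρ')) / r * M) := by gcongr
            _ = 2 * (10 ^ 7 * turn c (r * ρ') / r * M) := by field_simp
            _ ≤ _ := by gcongr; exact hr.1.le)
      rw [Real.norm_eq_abs, abs_of_pos (by linarith : 0 < r₂ - q), div_mul_cancel₀ _ (by linarith)] at this
      exact this
    have hid := hf.integral_wronsk hρ hρ' hq0 hq₂.le
    have t1 := hbd q ⟨le_rfl, hq₂.le⟩
    have t2 := hbd r₂ ⟨hq₂.le, le_rfl⟩
    have habs : (ρ' ^ 2 - ρ ^ 2) / 2 * |∫ r in q..r₂, wronsk f f1 ρ ρ' r| ≤ 6 * (10 ^ 7 * σ / q * M) := by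
      rw [← abs_of_pos (by linarith : 0 < (ρ' ^ 2 - ρ ^ 2) / 2), ← abs_mul, hid]
      refine (abs_add_le _ _).trans ?_
      have := abs_sub (ρ * f1 (q * ρ) * (ρ' * f1 (q * ρ')) + ((ρ ^ 2 + ρ' ^ 2) / 2 - c / q ^ 2) * (f (q * ρ) * f (q * ρ')))
        (ρ * f1 (r₂ * ρ) * (ρ' * f1 (r₂ * ρ')) +
        ((ρ ^ 2 + ρ' ^ 2) / 2 - c / r₂ ^ 2) * (f (r₂ * ρ) * f (r₂ * ρ')))
      linarith
    have hr₂ : 0 < r₂ := by linarith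
    have hq2 : 10 ^ 7 * σ / q * M ≤ 10 ^ 7 * σ / (r₂ / 2) * M := by gcongr; linarith
    rw [le_div_iff₀ (by positivity)]
    have : 10 ^ 7 * σ / (r₂ / 2) * M * r₂ = 2 * (10 ^ 7 * M * σ) := by field_simp
    nlinarith

theorem rpow_quarter_eq {x : ℝ} (hx : 0 ≤ x) : x ^ (1 / 4 : ℝ) = √(√x) := by
  rw [Real.sqrt_eq_rpow, Real.sqrt_eq_rpow, ← Real.rpow_mul hx]; norm_num

theorem near_box_aux {h b ρ ρ' t s₁ σ r₂ : ℝ} (hh0 : 0 < h) (hb : 0 < b) (hρ0 : 0 < ρ) (ht : 0 < t)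
    (hs₁ : 0 < s₁) (hσ0 : 0 < σ) (hhb : h ≤ b) (hρb : ρ ≤ b) (hbρ : b - ρ ≤ h) (hρ' : b < ρ')
    (hy : ρ' - b ≤ h) (htlow : r₂ ^ 2 * (h * b) ≤ t ^ 2)
    (hσt : σ ^ 2 = t ^ 2 + r₂ ^ 2 * ((ρ' - b) * (ρ' + b))) :
    2 * √(ρ * ρ' * σ / s₁) / ((ρ' - ρ) * ρ') ≤
      8 * √(ρ / b * (t / s₁)) * tailKer h (ρ' - ρ) := by
  have hρ'0 : 0 < ρ' := hb.trans hρ'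
  have hz0 : 0 < ρ' - ρ := by linarith
  have hσ4 : σ ≤ 2 * t := by
    apply le_of_sq_le_sq _ (by positivity)
    have e1 : (ρ' - b) * (ρ' + b) ≤ h * (3 * b) :=
      mul_le_mul hy (by linarith) (by linarith) hh0.le
    have e2 : r₂ ^ 2 * ((ρ' - b) * (ρ' + b)) ≤ r₂ ^ 2 * (h * (3 * b)) := by gcongr
    rw [hσt]
    linarith
  have hMV : √(ρ * ρ' * σ / s₁) ≤ 2 * √(ρ / b * (t / s₁)) * ρ' := by
    apply le_of_sq_le_sq _ (by positivity)
    rw [Real.sq_sqrt (by positivity), mul_pow, mul_pow, Real.sq_sqrt (by positivity)]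
    calc ρ * ρ' * σ / s₁ ≤ ρ * ρ' * (2 * t) / s₁ := by gcongr
      _ = 2 * (ρ * (t / s₁)) * ρ' * 1 := by ring
      _ ≤ 2 * (ρ * (t / s₁)) * ρ' * (2 * (ρ' / b)) := by
          gcongr
          have : 1 ≤ ρ' / b := by rw [le_div_iff₀ hb]; linarith
          linarith
      _ = _ := by ring
  have hker : (ρ' - ρ)⁻¹ / 2 ≤ tailKer h (ρ' - ρ) := by
    unfold tailKer
    rw [div_eq_mul_inv]
    gcongr
    rw [le_min_iff]
    refine ⟨by norm_num, ?_⟩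
    have h1 : (1 / 4 : ℝ) ≤ h / (ρ' - ρ) := by rw [le_div_iff₀ hz0]; linarith
    calc (2:ℝ)⁻¹ ≤ (1 / 4 : ℝ) ^ (1 / 4 : ℝ) := by simpa using half_le_rpow_quarter
      _ ≤ _ := by gcongr
  generalize √(ρ / b * (t / s₁)) = V at *
  have hV0 : 0 ≤ V := by
    have := (Real.sqrt_nonneg _).trans hMV
    by_contra hcon
    rw [not_le] at hcon
    nlinarith
  calc 2 * √(ρ * ρ' * σ / s₁) / ((ρ' - ρ) * ρ') ≤ 2 * (2 * V * ρ') / ((ρ' - ρ) * ρ') := by gcongr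
    _ = 8 * V * ((ρ' - ρ)⁻¹ / 2) := by field_simp; ring
    _ ≤ _ := by gcongr

theorem far_box_aux {h b ρ ρ' t s₁ σ r₂ : ℝ} (hh0 : 0 < h) (hb : 0 < b) (hρ0 : 0 < ρ) (ht : 0 < t)
    (hs₁ : 0 < s₁) (hσ0 : 0 < σ) (hρb : ρ ≤ b) (hρ' : b < ρ')
    (hy : h < ρ' - b) (htlow : r₂ ^ 2 * (h * b) ≤ t ^ 2)
    (hσt : σ ^ 2 = t ^ 2 + r₂ ^ 2 * ((ρ' - b) * (ρ' + b))) :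
    48 * √(ρ * ρ' * σ / s₁) * σ * (h * b) / (t * ((ρ' - ρ) * ρ') ^ 2) ≤
      192 * √(ρ / b * (t / s₁)) * tailKer h (ρ' - ρ) := by
  have hρ'0 : 0 < ρ' := hb.trans hρ'
  have hz0 : 0 < ρ' - ρ := by linarith
  have hhb : 0 < h * b := by positivity
  obtain ⟨X, hX⟩ : ∃ X, X = (ρ' - ρ) * ρ' / (h * b) := ⟨_, rfl⟩
  have hX0 : 0 < X := by rw [hX]; positivity
  have e1 : h * b ≤ (ρ' - b) * (ρ' + b) := mul_le_mul hy.le (by linarith) hb.le (by linarith)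
  have e2 : (ρ' - b) * (ρ' + b) ≤ (ρ' - ρ) * (2 * ρ') :=
    mul_le_mul (by linarith) (by linarith) (by linarith) hz0.le
  have hσX : σ ≤ 2 * t * √X := by
    apply le_of_sq_le_sq _ (by positivity)
    rw [mul_pow, Real.sq_sqrt hX0.le, hσt, hX]
    have e3 : t ^ 2 ≤ t ^ 2 * ((ρ' - ρ) * (2 * ρ')) / (h * b) := by
      rw [le_div_iff₀ hhb]
      have : h * b ≤ (ρ' - ρ) * (2 * ρ') := e1.trans e2
      gcongr
    have e4 : r₂ ^ 2 * ((ρ' - b) * (ρ' + b)) ≤ t ^ 2 * ((ρ' - ρ) * (2 * ρ')) / (h * b) := by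
      rw [le_div_iff₀ hhb]
      calc r₂ ^ 2 * ((ρ' - b) * (ρ' + b)) * (h * b) = r₂ ^ 2 * (h * b) * ((ρ' - b) * (ρ' + b)) := by ring
        _ ≤ t ^ 2 * ((ρ' - ρ) * (2 * ρ')) := by gcongr
    calc _ ≤ t ^ 2 * ((ρ' - ρ) * (2 * ρ')) / (h * b) + t ^ 2 * ((ρ' - ρ) * (2 * ρ')) / (h * b) :=
          add_le_add e3 e4
      _ = _ := by ring
  obtain ⟨x, hx⟩ : ∃ x, x = √(√X) := ⟨_, rfl⟩
  have hx0 : 0 < x := by rw [hx]; exact Real.sqrt_pos.mpr (Real.sqrt_pos.mpr hX0)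
  have hx2 : √X = x ^ 2 := by rw [hx, Real.sq_sqrt (Real.sqrt_nonneg _)]
  have hx4 : X = x ^ 4 := by
    rw [show x ^ 4 = (x ^ 2) ^ 2 by ring, ← hx2, Real.sq_sqrt hX0.le]
  have hMV : √(ρ * ρ' * σ / s₁) ≤ 2 * x * √(ρ / b * (t / s₁)) * ρ' := by
    apply le_of_sq_le_sq _ (by positivity)
    rw [Real.sq_sqrt (by positivity), mul_pow, mul_pow, mul_pow, Real.sq_sqrt (by positivity), ← hx2]
    calc ρ * ρ' * σ / s₁ ≤ ρ * ρ' * (2 * t * √X) / s₁ := by gcongr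
      _ = 2 * √X * (ρ * (t / s₁)) * ρ' * 1 := by ring
      _ ≤ 2 * √X * (ρ * (t / s₁)) * ρ' * (2 * (ρ' / b)) := by
          gcongr
          have : 1 ≤ ρ' / b := by rw [le_div_iff₀ hb]; linarith
          linarith
      _ = _ := by ring
  have hker : (ρ' - ρ)⁻¹ * x⁻¹ ≤ tailKer h (ρ' - ρ) := by
    unfold tailKer
    have hhz : h / (ρ' - ρ) ≤ 1 := by rw [div_le_one hz0]; linarith
    have hmin : min 1 ((h / (ρ' - ρ)) ^ (1 / 4 : ℝ)) = √(√(h / (ρ' - ρ))) := by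
      rw [← rpow_quarter_eq (by positivity)]
      exact min_eq_right (Real.rpow_le_one (by positivity) hhz (by norm_num))
    rw [hmin]
    gcongr
    rw [inv_le_iff_one_le_mul₀ hx0, hx, ← Real.sqrt_mul (Real.sqrt_nonneg _), ← Real.sqrt_mul (by positivity)]
    have : 1 ≤ h / (ρ' - ρ) * X := by
      rw [hX, show h / (ρ' - ρ) * ((ρ' - ρ) * ρ' / (h * b)) = ρ' / b by field_simp, le_div_iff₀ hb]
      linarith
    rw [Real.one_le_sqrt, Real.one_le_sqrt]
    exact this
  have hV0 := Real.sqrt_nonneg (ρ / b * (t / s₁))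
  rw [hx2] at hσX
  generalize √(ρ / b * (t / s₁)) = V at *
  calc 48 * √(ρ * ρ' * σ / s₁) * σ * (h * b) / (t * ((ρ' - ρ) * ρ') ^ 2)
      ≤ 48 * (2 * x * V * ρ') * (2 * t * x ^ 2) * (h * b) / (t * ((ρ' - ρ) * ρ') ^ 2) := by gcongr
    _ = 192 * V * ((ρ' - ρ)⁻¹ * (x ^ 3 / ((ρ' - ρ) * ρ' / (h * b)))) := by field_simp; ring
    _ = 192 * V * ((ρ' - ρ)⁻¹ * x⁻¹) := by
        rw [← hX, hx4]; field_simp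
    _ ≤ 192 * V * tailKer h (ρ' - ρ) := by gcongr

set_option maxHeartbeats 400000 in
/-- Off-diagonal decay of the smoothly truncated inner products. -/
theorem theta_le (hf : BesselLike c K α f f1) (hK : 0 ≤ K) {κ : ℝ} (hκ : 1 ≤ κ) (hκc : c ≤ κ ^ 3)
    {a b r₁ q r₂ ρ ρ' : ℝ} (ha : 0 < a) (hab : a < b) (hr₁ : 0 < r₁) (hq : q = (r₁ + r₂) / 2)
    (hrr : r₁ < r₂) (hs : κ ≤ turn c (r₁ * a))
    (hfull : (r₂ - r₁) * (b - a) * (r₂ * b) = turn c (r₂ * b))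
    (hρ : ρ ∈ Set.Icc a b) (hρ' : b < ρ') :
    |∫ r in (0:ℝ)..r₂, ramp q r₂ r * (f (r * ρ) * f (r * ρ'))| ≤
      10 ^ 10 * √(ρ / b * (turn c (r₂ * b) / turn c (q * ρ))) * tailKer (b - a) (ρ' - ρ) := by
  have hρ0 : 0 < ρ := ha.trans_le hρ.1
  have hb : 0 < b := ha.trans hab
  have hρb := hρ.2
  have hρρ : ρ < ρ' := hρb.trans_lt hρ'
  have hρ'0 : 0 < ρ' := hb.trans hρ'
  have hr₂ : 0 < r₂ := hr₁.trans hrr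
  have hq0 : 0 < q := by linarith
  have hq₂ : q < r₂ := by linarith
  have hsρ : κ ≤ turn c (r₁ * ρ) :=
    (good_mono hκ (mul_pos hr₁ ha) hs (by gcongr; exact hρ.1)).2.1
  have hid := hf.integral_ramp_mul hK hρ0 hρ'0 hq0 hq₂
  obtain ⟨bA, bB⟩ := hf.integral_wronsk_bounds hκ hκc hr₁ hq hrr hρ0 hρρ hsρ
  have hg1 := good_mono hκ (mul_pos hr₁ hρ0) hsρ (show r₁ * ρ ≤ q * ρ by gcongr; linarith)
  have hs₁0 : 0 < turn c (q * ρ) := by linarith [hg1.2.1]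
  have hg2 := good_mono hκ (mul_pos hr₁ hρ0) hsρ (show r₁ * ρ ≤ r₂ * b by gcongr)
  have ht0 : 0 < turn c (r₂ * b) := by linarith [hg2.2.1]
  have ht2 := turn_sq hg2.2.2.le
  have hg3 := good_mono hκ (mul_pos hr₁ hρ0) hsρ (show r₁ * ρ ≤ r₂ * ρ' by gcongr)
  have hσ0 : 0 < turn c (r₂ * ρ') := by linarith [hg3.2.1]
  have hσ2 := turn_sq hg3.2.2.le
  have hg4 := good_mono hκ (mul_pos hr₁ ha) hs (show r₁ * a ≤ r₂ * a by gcongr)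
  have hJ2 : r₂ - q = (r₂ - r₁) / 2 := by rw [hq]; ring
  have hJ0 : 0 < r₂ - r₁ := by linarith
  have hh0 : 0 < b - a := by linarith
  have htlow : r₂ ^ 2 * ((b - a) * b) ≤ turn c (r₂ * b) ^ 2 := by
    rw [ht2]
    have e : (b - a) * b ≤ b ^ 2 - a ^ 2 := by nlinarith [mul_pos ha (sub_pos.mpr hab)]
    calc r₂ ^ 2 * ((b - a) * b) ≤ r₂ ^ 2 * (b ^ 2 - a ^ 2) := by gcongr
      _ = (r₂ * b) ^ 2 - (r₂ * a) ^ 2 := by ring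
      _ ≤ _ := by linarith [hg4.2.2]
  have hσt : turn c (r₂ * ρ') ^ 2 = turn c (r₂ * b) ^ 2 + r₂ ^ 2 * ((ρ' - b) * (ρ' + b)) := by
    rw [hσ2, ht2]; ring
  have hJt : (r₂ - r₁) * r₂ = turn c (r₂ * b) / ((b - a) * b) := by
    rw [eq_div_iff (by positivity), ← hfull]; ring
  generalize turn c (q * ρ) = s₁ at *
  generalize turn c (r₂ * b) = t at *
  generalize turn c (r₂ * ρ') = σ at *
  generalize (∫ r in (0:ℝ)..r₂, ramp q r₂ r * (f (r * ρ) * f (r * ρ'))) = Θ at *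
  generalize (∫ r in q..r₂, wronsk f f1 ρ ρ' r) = I at *
  have hz0 : 0 < ρ' - ρ := by linarith
  have hΔ : (ρ' - ρ) * ρ' ≤ ρ' ^ 2 - ρ ^ 2 := by nlinarith
  generalize ρ' ^ 2 - ρ ^ 2 = Δ at *
  have hzρ : 0 < (ρ' - ρ) * ρ' := by positivity
  have hΔ0 : 0 < Δ := by linarith
  have hΘI : |Θ| = |I| / (Δ * ((r₂ - r₁) / 2)) := by
    rw [← hid, hJ2, abs_mul, abs_of_pos (by positivity : 0 < Δ * ((r₂ - r₁) / 2))]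
    field_simp
  have hV0 : 0 ≤ √(ρ / b * (t / s₁)) * tailKer (b - a) (ρ' - ρ) :=
    mul_nonneg (Real.sqrt_nonneg _) (tailKer_nonneg hh0 hz0)
  rcases le_or_gt (ρ' - b) (b - a) with hy | hy
  · have := near_box_aux hh0 hb hρ0 ht0 hs₁0 hσ0 (by linarith) hρb (by linarith [hρ.1]) hρ' hy htlow hσt
    have hA : |Θ| ≤ 10 ^ 7 * (2 * √(ρ * ρ' * σ / s₁) / ((ρ' - ρ) * ρ')) := by
      rw [hΘI]
      rw [hJ2] at bA
      calc |I| / (Δ * ((r₂ - r₁) / 2)) ≤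
            2 * 10 ^ 7 * √(ρ * ρ' * σ / s₁) * ((r₂ - r₁) / 2) / (Δ * ((r₂ - r₁) / 2)) := by gcongr
        _ = 10 ^ 7 * (2 * √(ρ * ρ' * σ / s₁) / Δ) := by field_simp
        _ ≤ _ := by gcongr
    linarith
  · have := far_box_aux hh0 hb hρ0 ht0 hs₁0 hσ0 hρb hρ' hy htlow hσt
    have hM0 := Real.sqrt_nonneg (ρ * ρ' * σ / s₁)
    have hhb0 : 0 < (b - a) * b := by positivity
    generalize √(ρ * ρ' * σ / s₁) = M at *
    generalize (b - a) * b = hb' at *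
    have hB : |Θ| ≤ 10 ^ 7 * (48 * M * σ * hb' / (t * ((ρ' - ρ) * ρ') ^ 2)) := by
      rw [hΘI]
      calc |I| / (Δ * ((r₂ - r₁) / 2)) ≤
            24 * 10 ^ 7 * M * σ / (Δ * r₂) / (Δ * ((r₂ - r₁) / 2)) := by gcongr
        _ = 48 * 10 ^ 7 * M * σ / (Δ ^ 2 * ((r₂ - r₁) * r₂)) := by
            generalize r₂ - r₁ = j at *
            field_simp; ring
        _ = 10 ^ 7 * (48 * M * σ * hb' / (t * Δ ^ 2)) := by
            rw [hJt]
            clear hJt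
            field_simp
        _ ≤ _ := by gcongr
    linarith

end BesselLike

/-! ### The transform `g ↦ ∫ f(rρ) g(ρ) dρ` -/

/-- Bounded measurable functions supported in a compact subset of `(0,∞)`. -/
def Adm (g : ℝ → ℝ) : Prop :=
  Measurable g ∧ ∃ a b M : ℝ, 0 < a ∧ (∀ ρ, |g ρ| ≤ M) ∧ ∀ ρ, ρ ∉ Set.Icc a b → g ρ = 0

theorem Adm.indicator {g : ℝ → ℝ} (hg : Adm g) {s : Set ℝ} (hs : MeasurableSet s) :
    Adm (s.indicator g) := by
  obtain ⟨hm, a, b, M, ha, hM, h0⟩ := hg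
  refine ⟨hm.indicator hs, a, b, M, ha, fun ρ => ?_, fun ρ hρ => ?_⟩
  · by_cases h : ρ ∈ s
    · rw [Set.indicator_of_mem h]; exact hM ρ
    · rw [Set.indicator_of_notMem h, abs_zero]; exact (abs_nonneg _).trans (hM ρ)
  · by_cases h : ρ ∈ s
    · rw [Set.indicator_of_mem h]; exact h0 ρ hρ
    · rw [Set.indicator_of_notMem h]

theorem Adm.add {g g' : ℝ → ℝ} (hg : Adm g) (hg' : Adm g') : Adm (fun ρ => g ρ + g' ρ) := by
  obtain ⟨hm, a, b, M, ha, hM, h0⟩ := hg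
  obtain ⟨hm', a', b', M', ha', hM', h0'⟩ := hg'
  refine ⟨hm.add hm', min a a', max b b', M + M', lt_min ha ha',
    fun ρ => (abs_add_le _ _).trans (add_le_add (hM ρ) (hM' ρ)), fun ρ hρ => ?_⟩
  have e1 : ρ ∉ Set.Icc a b := fun h => hρ ⟨(min_le_left _ _).trans h.1, h.2.trans (le_max_left _ _)⟩
  have e2 : ρ ∉ Set.Icc a' b' := fun h => hρ ⟨(min_le_right _ _).trans h.1, h.2.trans (le_max_right _ _)⟩
  simp only [h0 ρ e1, h0' ρ e2, add_zero]

theorem Adm.integrable_sq {g : ℝ → ℝ} (hg : Adm g) : Integrable fun ρ => g ρ ^ 2 := by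
  obtain ⟨hm, a, b, M, ha, hM, h0⟩ := hg
  have : IntegrableOn (fun ρ => g ρ ^ 2) (Set.Icc a b) := by
    refine Integrable.of_bound (hm.pow_const 2).aestronglyMeasurable (M ^ 2) ?_
    refine Eventually.of_forall fun ρ => ?_
    rw [Real.norm_eq_abs, abs_pow]
    have := hM ρ
    gcongr
  rw [← integrableOn_univ]
  refine this.of_forall_sdiff_eq_zero MeasurableSet.univ fun ρ hρ => ?_
  simp [h0 ρ hρ.2]

/-- the transform -/
def hank (f g : ℝ → ℝ) (r : ℝ) : ℝ := ∫ ρ, f (r * ρ) * g ρ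

namespace BesselLike

variable {c K α : ℝ} {f f1 : ℝ → ℝ}

theorem exists_bound (hf : BesselLike c K α f f1) {g : ℝ → ℝ} (hg : Adm g) {R : ℝ} :
    ∃ B a b : ℝ, 0 ≤ B ∧ 0 < a ∧ (∀ ρ, ρ ∉ Set.Icc a b → g ρ = 0) ∧
      ∀ r, 0 < r → r ≤ R → ∀ ρ, |f (r * ρ) * g ρ| ≤ B := by
  obtain ⟨hm, a, b, M, ha, hM, h0⟩ := hg
  have hα := hf.hα
  refine ⟨|K| * |R * b| ^ α * M, a, b, ?_, ha, h0, ?_⟩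
  · have : 0 ≤ M := (abs_nonneg _).trans (hM 0)
    positivity
  · intro r hr hrR ρ
    have hM0 : 0 ≤ M := (abs_nonneg _).trans (hM 0)
    by_cases h : ρ ∈ Set.Icc a b
    · have hρ : 0 < ρ := ha.trans_le h.1
      rw [abs_mul]
      gcongr
      · refine (hf.bd _ (mul_pos hr hρ)).trans ?_
        have h1 : r * ρ ≤ |R * b| := by
          refine le_trans ?_ (le_abs_self _)
          have := h.2
          have hR : 0 ≤ R := hr.le.trans hrR
          gcongr
        gcongr
        exact le_abs_self _
      · exact hM ρ
    · rw [h0 ρ h, mul_zero, abs_zero]; positivity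

theorem integrable_kernel (hf : BesselLike c K α f f1) {g : ℝ → ℝ} (hg : Adm g) {r : ℝ} (hr : 0 < r)
    {m : ℝ → ℝ} (hm : Measurable m) (hm1 : ∀ ρ, |m ρ| ≤ 1) :
    Integrable fun ρ => m ρ * (f (r * ρ) * g ρ) := by
  obtain ⟨B, a, b, hB, ha, h0, hbd⟩ := hf.exists_bound hg (R := r)
  have hmeas := hf.meas
  have hgm := hg.1
  have : IntegrableOn (fun ρ => m ρ * (f (r * ρ) * g ρ)) (Set.Icc a b) := by
    refine Integrable.of_bound (by fun_prop) B ?_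
    refine Eventually.of_forall fun ρ => ?_
    rw [Real.norm_eq_abs, abs_mul]
    calc |m ρ| * |f (r * ρ) * g ρ| ≤ 1 * B := by
          gcongr
          · exact hm1 ρ
          · exact hbd r hr le_rfl ρ
      _ = B := one_mul _
  rw [← integrableOn_univ]
  refine this.of_forall_sdiff_eq_zero MeasurableSet.univ fun ρ hρ => ?_
  simp [h0 ρ hρ.2]

theorem integrable_kernel' (hf : BesselLike c K α f f1) {g : ℝ → ℝ} (hg : Adm g) {r : ℝ} (hr : 0 < r) :
    Integrable fun ρ => f (r * ρ) * g ρ := by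
  simpa using hf.integrable_kernel hg hr (m := fun _ => 1) measurable_const (by simp)

theorem measurable_hank (hf : BesselLike c K α f f1) {g : ℝ → ℝ} (hg : Adm g) : Measurable (hank f g) := by
  have hmeas := hf.meas
  have hgm := hg.1
  have : StronglyMeasurable (Function.uncurry fun r ρ => f (r * ρ) * g ρ) := by
    apply Measurable.stronglyMeasurable
    unfold Function.uncurry
    fun_prop
  exact this.integral_prod_right.measurable

theorem lintegral_hank_sq (hf : BesselLike c K α f f1) {g : ℝ → ℝ} (hg : Adm g) :
    ∫⁻ r in Set.Ioi 0, ENNReal.ofReal (hank f g r ^ 2) = ∫⁻ ρ, ENNReal.ofReal (g ρ ^ 2) := by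
  obtain ⟨hm, a, b, M, ha, hM, h0⟩ := hg
  exact hf.iso g hm a b M ha hM h0

theorem integrableOn_hank_sq (hf : BesselLike c K α f f1) {g : ℝ → ℝ} (hg : Adm g) :
    IntegrableOn (fun r => hank f g r ^ 2) (Set.Ioi 0) := by
  refine ⟨((hf.measurable_hank hg).pow_const 2).aestronglyMeasurable, ?_⟩
  rw [hasFiniteIntegral_iff_ofReal (Eventually.of_forall fun r => sq_nonneg _), hf.lintegral_hank_sq hg,
    ← hasFiniteIntegral_iff_ofReal (Eventually.of_forall fun r => sq_nonneg _)]
  exact hg.integrable_sq.2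

theorem integral_hank_sq (hf : BesselLike c K α f f1) {g : ℝ → ℝ} (hg : Adm g) :
    ∫ r in Set.Ioi 0, hank f g r ^ 2 = ∫ ρ, g ρ ^ 2 := by
  rw [integral_eq_lintegral_of_nonneg_ae (Eventually.of_forall fun r => sq_nonneg _)
    ((hf.measurable_hank hg).pow_const 2).aestronglyMeasurable,
    integral_eq_lintegral_of_nonneg_ae (Eventually.of_forall fun r => sq_nonneg _)
    (hg.1.pow_const 2).aestronglyMeasurable, hf.lintegral_hank_sq hg]

theorem hank_add (hf : BesselLike c K α f f1) {g g' : ℝ → ℝ} (hg : Adm g) (hg' : Adm g') {r : ℝ}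
    (hr : 0 < r) : hank f (fun ρ => g ρ + g' ρ) r = hank f g r + hank f g' r := by
  unfold hank
  rw [← integral_add (hf.integrable_kernel' hg hr) (hf.integrable_kernel' hg' hr)]
  congr 1; ext ρ; ring

theorem integrableOn_hank_mul (hf : BesselLike c K α f f1) {g g' : ℝ → ℝ} (hg : Adm g) (hg' : Adm g')
    {m : ℝ → ℝ} (hm : Measurable m) (hm1 : ∀ r, |m r| ≤ 1) :
    IntegrableOn (fun r => m r * (hank f g r * hank f g' r)) (Set.Ioi 0) := by
  have h1 := hf.measurable_hank hg
  have h2 := hf.measurable_hank hg'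
  refine ((hf.integrableOn_hank_sq hg).add (hf.integrableOn_hank_sq hg')).mono'
    (by fun_prop) (Eventually.of_forall fun r => ?_)
  rw [Real.norm_eq_abs, abs_mul, abs_mul]
  have h3 := sq_nonneg (|hank f g r| - |hank f g' r|)
  have h4 := mul_nonneg (abs_nonneg (hank f g r)) (abs_nonneg (hank f g' r))
  calc |m r| * (|hank f g r| * |hank f g' r|) ≤ 1 * (|hank f g r| * |hank f g' r|) := by
        gcongr; exact hm1 r
    _ ≤ hank f g r ^ 2 + hank f g' r ^ 2 := by
        rw [← sq_abs (hank f g r), ← sq_abs (hank f g' r)]; nlinarith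

theorem integral_hank_mul_eq_zero (hf : BesselLike c K α f f1) {g g' : ℝ → ℝ} (hg : Adm g) (hg' : Adm g')
    (h : ∀ ρ, g ρ * g' ρ = 0) : ∫ r in Set.Ioi 0, hank f g r * hank f g' r = 0 := by
  have h1 := hf.integral_hank_sq (hg.add hg')
  have h2 := hf.integral_hank_sq hg
  have h3 := hf.integral_hank_sq hg'
  have i1 := hf.integrableOn_hank_sq hg
  have i2 := hf.integrableOn_hank_sq hg'
  have i3 : IntegrableOn (fun r => hank f g r * hank f g' r) (Set.Ioi 0) := by
    simpa using hf.integrableOn_hank_mul hg hg' (m := fun _ => 1) measurable_const (by simp)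
  have e1 : ∫ r in Set.Ioi 0, hank f (fun ρ => g ρ + g' ρ) r ^ 2 =
      ∫ r in Set.Ioi 0, ((hank f g r ^ 2 + hank f g' r ^ 2) + 2 * (hank f g r * hank f g' r)) := by
    apply setIntegral_congr_fun measurableSet_Ioi
    intro r hr
    simp only []
    rw [hf.hank_add hg hg' hr]; ring
  have e2 : ∫ ρ, (g ρ + g' ρ) ^ 2 = ∫ ρ, (g ρ ^ 2 + g' ρ ^ 2) := by
    congr 1; ext ρ
    linear_combination 2 * h ρ
  have i12 : IntegrableOn (fun r => hank f g r ^ 2 + hank f g' r ^ 2) (Set.Ioi 0) := i1.add i2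
  rw [e1, e2, integral_add i12 (i3.const_mul 2), integral_add i1 i2,
    integral_add hg.integrable_sq hg'.integrable_sq, integral_const_mul] at h1
  linarith

/-- Fubini for the smoothly truncated inner product. -/
theorem integral_ramp_hank (hf : BesselLike c K α f f1) {g g' : ℝ → ℝ} (hg : Adm g) (hg' : Adm g')
    {q q' : ℝ} (hqq : q < q') (hq : 0 < q') :
    ENNReal.ofReal |∫ r in Set.Ioi 0, ramp q q' r * (hank f g r * hank f g' r)| ≤
      ∫⁻ ρ, ∫⁻ ρ', ENNReal.ofReal (|g ρ| * |g' ρ'| *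
        |∫ r in (0:ℝ)..q', ramp q q' r * (f (r * ρ) * f (r * ρ'))|) := by
  have hmeas := hf.meas
  have hgm := hg.1
  have hgm' := hg'.1
  have hrm := (continuous_ramp q q').measurable
  have e1 : ∫ r in Set.Ioi 0, ramp q q' r * (hank f g r * hank f g' r) =
      ∫ r in Set.Ioc 0 q', ramp q q' r * (hank f g r * hank f g' r) := by
    apply setIntegral_eq_of_subset_of_forall_sdiff_eq_zero measurableSet_Ioi Set.Ioc_subset_Ioi_self
    intro r hr
    have : q' ≤ r := by
      by_contra hcon
      exact hr.2 ⟨hr.1, (not_le.mp hcon).le⟩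
    rw [ramp_eq_zero hqq this, zero_mul]
  obtain ⟨B, a, b, hB, ha, h0, hbd⟩ := hf.exists_bound hg (R := q')
  obtain ⟨B', a', b', hB', ha', h0', hbd'⟩ := hf.exists_bound hg' (R := q')
  set F : ℝ → ℝ × ℝ → ℝ := fun r p => ramp q q' r * ((f (r * p.1) * g p.1) * (f (r * p.2) * g' p.2)) with hF
  have hFm : Measurable (Function.uncurry F) := by
    unfold Function.uncurry; simp only [hF]; fun_prop
  have e2 : ∀ r ∈ Set.Ioc 0 q', ramp q q' r * (hank f g r * hank f g' r) = ∫ p, F r p := by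
    intro r hr
    simp only [hF]
    rw [integral_const_mul, Measure.volume_eq_prod, integral_prod_mul (fun ρ => f (r * ρ) * g ρ)
      (fun ρ => f (r * ρ) * g' ρ)]
    rfl
  have hintg : Integrable (Function.uncurry F) ((volume.restrict (Set.Ioc 0 q')).prod volume) := by
    have hsupp : IntegrableOn (Function.uncurry F) (Set.univ ×ˢ (Set.Icc a b ×ˢ Set.Icc a' b'))
        ((volume.restrict (Set.Ioc 0 q')).prod volume) := by
      have : IsFiniteMeasure (((volume.restrict (Set.Ioc 0 q')).prod
          (volume : Measure (ℝ × ℝ))).restrict (Set.univ ×ˢ (Set.Icc a b ×ˢ Set.Icc a' b'))) := by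
        constructor
        rw [Measure.restrict_apply_univ, Measure.prod_prod, Measure.volume_eq_prod, Measure.prod_prod]
        simp only [Measure.restrict_apply_univ, Real.volume_Ioc, Real.volume_Icc]
        exact ENNReal.mul_lt_top ENNReal.ofReal_lt_top (ENNReal.mul_lt_top ENNReal.ofReal_lt_top ENNReal.ofReal_lt_top)
      have hae : ∀ᵐ x ∂((volume.restrict (Set.Ioc 0 q')).prod
          (volume : Measure (ℝ × ℝ))), x.1 ∈ Set.Ioc 0 q' := by
        have : ∀ᵐ r ∂(volume.restrict (Set.Ioc 0 q')), r ∈ Set.Ioc 0 q' := ae_restrict_mem measurableSet_Ioc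
        exact Measure.quasiMeasurePreserving_fst.ae this
      refine Integrable.of_bound hFm.aestronglyMeasurable (B * B') ?_
      refine ae_restrict_of_ae ?_
      filter_upwards [hae] with x hx
      simp only [Function.uncurry, hF, Real.norm_eq_abs]
      rw [abs_mul, abs_of_nonneg (ramp_nonneg _ _ _), abs_mul]
      calc _ ≤ 1 * (B * B') := by
            gcongr
            · exact ramp_le_one _ _ _
            · exact hbd _ hx.1 hx.2 _
            · exact hbd' _ hx.1 hx.2 _
        _ = _ := one_mul _
    rw [← integrableOn_univ]
    refine hsupp.of_forall_sdiff_eq_zero MeasurableSet.univ ?_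
    rintro ⟨r, ρ, ρ'⟩ hx
    simp only [Function.uncurry, hF]
    by_cases h1 : ρ ∈ Set.Icc a b
    · by_cases h2 : ρ' ∈ Set.Icc a' b'
      · exact absurd ⟨Set.mem_univ _, h1, h2⟩ hx.2
      · rw [h0' ρ' h2]; ring
    · rw [h0 ρ h1]; ring
  rw [e1, setIntegral_congr_fun measurableSet_Ioc e2, integral_integral_swap hintg]
  have e3 : ∀ p : ℝ × ℝ, ∫ r in Set.Ioc 0 q', F r p =
      g p.1 * g' p.2 * ∫ r in (0:ℝ)..q', ramp q q' r * (f (r * p.1) * f (r * p.2)) := by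
    intro p
    rw [intervalIntegral.integral_of_le hq.le, ← integral_const_mul]
    congr 1; ext r; simp only [hF]; ring
  simp_rw [e3]
  rw [← Real.norm_eq_abs]
  refine (ofReal_norm _).le.trans ((enorm_integral_le_lintegral_enorm _).trans ?_)
  rw [Measure.volume_eq_prod]
  refine (lintegral_prod_le _).trans (le_of_eq ?_)
  congr 1; ext ρ; congr 1; ext ρ'
  rw [← ofReal_norm, Real.norm_eq_abs, abs_mul, abs_mul]

end BesselLike

/-! ### Estimates on a single box -/

theorem lintegral_div_turn {c r a b : ℝ} (hr : 0 < r) (ha : 0 < a) (hab : a ≤ b) (hc : c < (r * a) ^ 2) :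
    ∫⁻ ρ in Set.Icc a b, ENNReal.ofReal (r * ρ / turn c (r * ρ)) ≤
      ENNReal.ofReal (2 * (b - a) * (r * b / turn c (r * b))) := by
  have hb : 0 < b := ha.trans_le hab
  have hlt : ∀ ρ ∈ Set.Icc a b, c < (r * ρ) ^ 2 := by
    intro ρ hρ
    have := hρ.1
    have : (r * a) ^ 2 ≤ (r * ρ) ^ 2 := by gcongr
    linarith
  have hpos : ∀ ρ ∈ Set.Icc a b, 0 < turn c (r * ρ) := fun ρ hρ =>
    Real.sqrt_pos.mpr (by linarith [hlt ρ hρ])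
  have hcont : ContinuousOn (fun ρ => r * ρ / turn c (r * ρ)) (Set.Icc a b) :=
    ContinuousOn.div (by fun_prop) ((continuous_turn c).comp (by fun_prop)).continuousOn
      fun ρ hρ => (hpos ρ hρ).ne'
  have hFTC : ∫ ρ in a..b, r * ρ / turn c (r * ρ) = turn c (r * b) / r - turn c (r * a) / r := by
    apply intervalIntegral.integral_eq_sub_of_hasDerivAt (f := fun ρ => turn c (r * ρ) / r)
    · intro ρ hρ
      rw [Set.uIcc_of_le hab] at hρ
      have hlin : HasDerivAt (fun ρ : ℝ => r * ρ) r ρ := by simpa using (hasDerivAt_id ρ).const_mul r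
      refine (((hasDerivAt_turn (hlt ρ hρ)).comp ρ hlin).div_const r).congr_deriv ?_
      field_simp
    · exact ContinuousOn.intervalIntegrable_of_Icc hab hcont
  rw [← ofReal_integral_eq_lintegral_ofReal hcont.integrableOn_Icc, integral_Icc_eq_integral_Ioc,
    ← intervalIntegral.integral_of_le hab, hFTC]
  · apply ENNReal.ofReal_le_ofReal
    have h1 := turn_sq (hlt a ⟨le_rfl, hab⟩).le
    have h2 := turn_sq (hlt b ⟨hab, le_rfl⟩).le
    have p1 := hpos a ⟨le_rfl, hab⟩
    have p2 := hpos b ⟨hab, le_rfl⟩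
    rw [← sub_div, div_le_iff₀ hr, show 2 * (b - a) * (r * b / turn c (r * b)) * r =
      2 * (b - a) * r * (r * b) / turn c (r * b) by ring, le_div_iff₀ p2]
    have hm : turn c (r * a) ≤ turn c (r * b) := turn_mono (by positivity) (by gcongr)
    calc (turn c (r * b) - turn c (r * a)) * turn c (r * b)
        ≤ (turn c (r * b) - turn c (r * a)) * (turn c (r * b) + turn c (r * a)) :=
          mul_le_mul_of_nonneg_left (by linarith) (by linarith)
      _ = r ^ 2 * ((b - a) * (b + a)) := by linear_combination h2 - h1
      _ ≤ r ^ 2 * ((b - a) * (2 * b)) := by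
          have : 0 ≤ b - a := by linarith
          gcongr; linarith
      _ = _ := by ring
  · filter_upwards [ae_restrict_mem measurableSet_Icc] with ρ hρ
    have := hpos ρ hρ
    have : 0 < ρ := ha.trans_le hρ.1
    simp only [Pi.zero_apply]; positivity

/-- The turning function at the centre of a box is comparable with its value at the top corner. -/
theorem turn_center_ge {c a b r₁ r₂ x : ℝ} (ha : 0 < a) (hab : a ≤ b) (hr₁ : 0 < r₁) (hrr : r₁ ≤ r₂)
    (hc : c ≤ (r₁ * a) ^ 2) (hx : (a + b) / 2 ≤ x) :
    turn c (r₂ * b) / 4 ≤ turn c ((r₁ + r₂) / 2 * x) := by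
  have hb : 0 < b := ha.trans_le hab
  have hr₂ : 0 < r₂ := hr₁.trans_le hrr
  apply Real.le_sqrt_of_sq_le
  have hcb : c ≤ (r₂ * b) ^ 2 := hc.trans (by gcongr)
  rw [div_pow, turn_sq hcb]
  have h1 : (r₁ + r₂) / 2 * ((a + b) / 2) ≤ (r₁ + r₂) / 2 * x := by gcongr
  have h2 : (3 * (r₁ * a) + r₂ * b) / 4 ≤ (r₁ + r₂) / 2 * ((a + b) / 2) := by
    have e1 : r₁ * a ≤ r₁ * b := by gcongr
    have e2 : r₁ * a ≤ r₂ * a := by gcongr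
    linarith
  have h3 : ((3 * (r₁ * a) + r₂ * b) / 4) ^ 2 ≤ ((r₁ + r₂) / 2 * x) ^ 2 := by
    have : 0 ≤ (3 * (r₁ * a) + r₂ * b) / 4 := by positivity
    exact pow_le_pow_left₀ this (h2.trans h1) 2
  have h4 : (r₁ * a) ^ 2 ≤ (r₁ * a) * (r₂ * b) := by
    rw [pow_two]; gcongr
  nlinarith

namespace BesselLike

variable {c K α : ℝ} {f f1 : ℝ → ℝ}

/-- Hilbert–Schmidt bound on a box. -/
theorem lintegral_box_sq (hf : BesselLike c K α f f1) {κ : ℝ} (hκ : 1 ≤ κ) (hκc : c ≤ κ ^ 3)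
    {a b r₁ r₂ : ℝ} (ha : 0 < a) (hab : a ≤ b) (hr₁ : 0 < r₁) (hrr : r₁ ≤ r₂)
    (hs : κ ≤ turn c (r₁ * a))
    (hle : (r₂ - r₁) * (b - a) * (r₂ * b) ≤ turn c (r₂ * b)) :
    ∫⁻ r in Set.Icc r₁ r₂, ∫⁻ ρ in Set.Icc a b, ENNReal.ofReal (f (r * ρ) ^ 2) ≤
      ENNReal.ofReal (4 * 10 ^ 7) := by
  have hb : 0 < b := ha.trans_le hab
  have hr₂ : 0 < r₂ := hr₁.trans_le hrr
  have hp := mul_pos hr₁ ha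
  calc ∫⁻ r in Set.Icc r₁ r₂, ∫⁻ ρ in Set.Icc a b, ENNReal.ofReal (f (r * ρ) ^ 2)
      ≤ ∫⁻ r in Set.Icc r₁ r₂, ENNReal.ofReal (2 * 10 ^ 7 * (b - a)) *
          ENNReal.ofReal (b * r / turn c (b * r)) := by
        apply setLIntegral_mono' measurableSet_Icc
        intro r hr
        have hr0 : 0 < r := hr₁.trans_le hr.1
        have hra := good_mono hκ hp hs (show r₁ * a ≤ r * a by gcongr; exact hr.1)
        calc ∫⁻ ρ in Set.Icc a b, ENNReal.ofReal (f (r * ρ) ^ 2)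
            ≤ ∫⁻ ρ in Set.Icc a b, ENNReal.ofReal (10 ^ 7) * ENNReal.ofReal (r * ρ / turn c (r * ρ)) := by
              apply setLIntegral_mono' measurableSet_Icc
              intro ρ hρ
              have hg := good_mono hκ hra.1 hra.2.1 (show r * a ≤ r * ρ by gcongr; exact hρ.1)
              rw [← ENNReal.ofReal_mul (by norm_num)]
              exact ENNReal.ofReal_le_ofReal (hf.bounds hκ hκc hg.1 hg.2.1).1
          _ = ENNReal.ofReal (10 ^ 7) * ∫⁻ ρ in Set.Icc a b, ENNReal.ofReal (r * ρ / turn c (r * ρ)) :=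
              lintegral_const_mul' _ _ ENNReal.ofReal_ne_top
          _ ≤ ENNReal.ofReal (10 ^ 7) * ENNReal.ofReal (2 * (b - a) * (r * b / turn c (r * b))) := by
              gcongr; exact lintegral_div_turn hr0 ha hab hra.2.2
          _ = _ := by
              rw [← ENNReal.ofReal_mul (by norm_num),
                ← ENNReal.ofReal_mul (mul_nonneg (by norm_num) (by linarith)), mul_comm r b]
              congr 1; ring
    _ = ENNReal.ofReal (2 * 10 ^ 7 * (b - a)) *
          ∫⁻ r in Set.Icc r₁ r₂, ENNReal.ofReal (b * r / turn c (b * r)) :=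
        lintegral_const_mul' _ _ ENNReal.ofReal_ne_top
    _ ≤ ENNReal.ofReal (2 * 10 ^ 7 * (b - a)) *
          ENNReal.ofReal (2 * (r₂ - r₁) * (b * r₂ / turn c (b * r₂))) := by
        gcongr
        apply lintegral_div_turn hb hr₁ hrr
        have := (good_mono hκ hp hs (show r₁ * a ≤ b * r₁ by rw [mul_comm b]; gcongr)).2.2
        exact this
    _ ≤ ENNReal.ofReal (4 * 10 ^ 7) := by
        rw [← ENNReal.ofReal_mul (mul_nonneg (by norm_num) (by linarith))]
        apply ENNReal.ofReal_le_ofReal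
        have ht := (good_mono hκ hp hs (show r₁ * a ≤ r₂ * b by gcongr)).2.1
        rw [mul_comm b r₂]
        have ht0 : 0 < turn c (r₂ * b) := by linarith
        have : (r₂ - r₁) * (b - a) * (r₂ * b) / turn c (r₂ * b) ≤ 1 := by
          rw [div_le_one ht0]; exact hle
        calc 2 * 10 ^ 7 * (b - a) * (2 * (r₂ - r₁) * (r₂ * b / turn c (r₂ * b)))
            = 4 * 10 ^ 7 * ((r₂ - r₁) * (b - a) * (r₂ * b) / turn c (r₂ * b)) := by ring
          _ ≤ 4 * 10 ^ 7 * 1 := by gcongr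
          _ = _ := mul_one _

/-- The weight `V²` on a box. -/
def boxWeight (c b q r₂ ρ : ℝ) : ℝ := ρ / b * (turn c (r₂ * b) / turn c (q * ρ))

theorem lintegral_boxWeight {κ : ℝ} (hκ : 1 ≤ κ)
    {a b r₁ q r₂ : ℝ} (ha : 0 < a) (hab : a < b) (hr₁ : 0 < r₁) (hq : q = (r₁ + r₂) / 2) (hrr : r₁ < r₂)
    (hs : κ ≤ turn c (r₁ * a)) :
    ∫⁻ ρ in Set.Icc a b, ENNReal.ofReal (boxWeight c b q r₂ ρ) ≤ ENNReal.ofReal (8 * (b - a)) := by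
  have hb : 0 < b := ha.trans hab
  have hr₂ : 0 < r₂ := hr₁.trans hrr
  have hq0 : 0 < q := by linarith
  have hp := mul_pos hr₁ ha
  have hg := good_mono hκ hp hs (show r₁ * a ≤ q * a by gcongr; linarith)
  have ht := (good_mono hκ hp hs (show r₁ * a ≤ r₂ * b by gcongr)).2.1
  have ht0 : 0 < turn c (r₂ * b) := by linarith
  have hcent : turn c (r₂ * b) / 4 ≤ turn c (q * b) := by
    rw [hq]; exact turn_center_ge ha hab.le hr₁ hrr.le (good_mono hκ hp hs le_rfl).2.2.le (by linarith)
  calc ∫⁻ ρ in Set.Icc a b, ENNReal.ofReal (boxWeight c b q r₂ ρ)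
      = ∫⁻ ρ in Set.Icc a b, ENNReal.ofReal (turn c (r₂ * b) / (b * q)) *
          ENNReal.ofReal (q * ρ / turn c (q * ρ)) := by
        congr 1; ext ρ
        rw [← ENNReal.ofReal_mul (by positivity), boxWeight]
        congr 1; field_simp
    _ = ENNReal.ofReal (turn c (r₂ * b) / (b * q)) *
          ∫⁻ ρ in Set.Icc a b, ENNReal.ofReal (q * ρ / turn c (q * ρ)) :=
        lintegral_const_mul' _ _ ENNReal.ofReal_ne_top
    _ ≤ ENNReal.ofReal (turn c (r₂ * b) / (b * q)) *
          ENNReal.ofReal (2 * (b - a) * (q * b / turn c (q * b))) := by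
        gcongr; exact lintegral_div_turn hq0 ha hab.le hg.2.2
    _ ≤ _ := by
        rw [← ENNReal.ofReal_mul (by positivity)]
        apply ENNReal.ofReal_le_ofReal
        have h0 : 0 < turn c (q * b) := by linarith
        have h1 : turn c (r₂ * b) / turn c (q * b) ≤ 4 := by rw [div_le_iff₀ h0]; linarith
        have hba : 0 < b - a := by linarith
        calc turn c (r₂ * b) / (b * q) * (2 * (b - a) * (q * b / turn c (q * b)))
            = 2 * (b - a) * (turn c (r₂ * b) / turn c (q * b)) := by field_simp
          _ ≤ 2 * (b - a) * 4 := by gcongr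
          _ = _ := by ring

theorem boxWeight_le {κ : ℝ} (hκ : 1 ≤ κ)
    {a b r₁ q r₂ ρ : ℝ} (ha : 0 < a) (hab : a < b) (hr₁ : 0 < r₁) (hq : q = (r₁ + r₂) / 2) (hrr : r₁ < r₂)
    (hs : κ ≤ turn c (r₁ * a)) (hρ : (a + b) / 2 ≤ ρ) (hρb : ρ ≤ b) : boxWeight c b q r₂ ρ ≤ 4 := by
  have hb : 0 < b := ha.trans hab
  have hr₂ : 0 < r₂ := hr₁.trans hrr
  have hp := mul_pos hr₁ ha
  have ht := (good_mono hκ hp hs (show r₁ * a ≤ r₂ * b by gcongr)).2.1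
  have hcent : turn c (r₂ * b) / 4 ≤ turn c (q * ρ) := by
    rw [hq]; exact turn_center_ge ha hab.le hr₁ hrr.le (good_mono hκ hp hs le_rfl).2.2.le hρ
  have h0 : 0 < turn c (q * ρ) := by linarith
  have h1 : turn c (r₂ * b) / turn c (q * ρ) ≤ 4 := by rw [div_le_iff₀ h0]; linarith
  have h2 : ρ / b ≤ 1 := by rw [div_le_one hb]; exact hρb
  have h3 : 0 ≤ turn c (r₂ * b) / turn c (q * ρ) := div_nonneg (turn_nonneg _ _) h0.le
  have h4 : 0 ≤ ρ / b := div_nonneg (by linarith) hb.le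
  unfold boxWeight
  nlinarith

theorem lintegral_boxWeight_mul_sq {κ : ℝ} (hκ : 1 ≤ κ)
    {a b r₁ q r₂ : ℝ} (ha : 0 < a) (hab : a < b) (hr₁ : 0 < r₁) (hq : q = (r₁ + r₂) / 2) (hrr : r₁ < r₂)
    (hs : κ ≤ turn c (r₁ * a)) {H : ℝ → ℝ≥0∞} (hH : MonotoneOn H (Set.Ico a b)) :
    ∫⁻ ρ in Set.Ico a b, ENNReal.ofReal (boxWeight c b q r₂ ρ) * H ρ ^ 2 ≤
      20 * ∫⁻ ρ in Set.Ico a b, H ρ ^ 2 := by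
  set m := (a + b) / 2 with hm
  have ham : a < m := by linarith
  have hmb : m < b := by linarith
  have hsplit : Set.Ico a b = Set.Ico a m ∪ Set.Ico m b := (Set.Ico_union_Ico_eq_Ico ham.le hmb.le).symm
  have low : ∫⁻ ρ in Set.Ico a m, ENNReal.ofReal (boxWeight c b q r₂ ρ) * H ρ ^ 2 ≤
      16 * ∫⁻ ρ in Set.Ico m b, H ρ ^ 2 := by
    calc ∫⁻ ρ in Set.Ico a m, ENNReal.ofReal (boxWeight c b q r₂ ρ) * H ρ ^ 2
        ≤ ∫⁻ ρ in Set.Ico a m, ENNReal.ofReal (boxWeight c b q r₂ ρ) * H m ^ 2 := by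
          apply setLIntegral_mono' measurableSet_Ico
          intro ρ hρ
          gcongr
          exact hH ⟨hρ.1, hρ.2.trans hmb⟩ ⟨ham.le, hmb⟩ hρ.2.le
      _ ≤ (∫⁻ ρ in Set.Icc a b, ENNReal.ofReal (boxWeight c b q r₂ ρ)) * H m ^ 2 := by
          rw [lintegral_mul_const]
          · gcongr
            exact fun ρ hρ => ⟨hρ.1, (hρ.2.trans hmb).le⟩
          · have := (continuous_turn c).measurable
            unfold boxWeight; fun_prop
      _ ≤ ENNReal.ofReal (8 * (b - a)) * H m ^ 2 := by
          gcongr; exact lintegral_boxWeight hκ ha hab hr₁ hq hrr hs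
      _ = 16 * ∫⁻ ρ in Set.Ico m b, H m ^ 2 := by
          rw [setLIntegral_const, Real.volume_Ico, mul_comm (H m ^ 2), ← mul_assoc]
          congr 1
          rw [show (16:ℝ≥0∞) = ENNReal.ofReal 16 by norm_num, ← ENNReal.ofReal_mul (by norm_num)]
          congr 1; rw [hm]; ring
      _ ≤ _ := by
          gcongr 16 * ?_
          apply setLIntegral_mono' measurableSet_Ico
          intro ρ hρ
          gcongr
          exact hH ⟨ham.le, hmb⟩ ⟨ham.le.trans hρ.1, hρ.2⟩ hρ.1
  have high : ∫⁻ ρ in Set.Ico m b, ENNReal.ofReal (boxWeight c b q r₂ ρ) * H ρ ^ 2 ≤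
      4 * ∫⁻ ρ in Set.Ico m b, H ρ ^ 2 := by
    rw [← lintegral_const_mul' _ _ (by norm_num)]
    apply setLIntegral_mono' measurableSet_Ico
    intro ρ hρ
    gcongr
    rw [show (4:ℝ≥0∞) = ENNReal.ofReal 4 by norm_num]
    exact ENNReal.ofReal_le_ofReal (boxWeight_le hκ ha hab hr₁ hq hrr hs hρ.1 hρ.2.le)
  calc ∫⁻ ρ in Set.Ico a b, ENNReal.ofReal (boxWeight c b q r₂ ρ) * H ρ ^ 2
      ≤ _ + _ := by rw [hsplit]; exact lintegral_union_le _ _ _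
    _ ≤ 16 * (∫⁻ ρ in Set.Ico m b, H ρ ^ 2) + 4 * ∫⁻ ρ in Set.Ico m b, H ρ ^ 2 := add_le_add low high
    _ = 20 * ∫⁻ ρ in Set.Ico m b, H ρ ^ 2 := by rw [← add_mul]; norm_num
    _ ≤ _ := by
        gcongr 20 * ?_
        exact lintegral_mono_set (Set.Ico_subset_Ico_left ham.le)

end BesselLike

/-- A rectangle `[a, b] × [r₁, r₂]` past the turning point of area at most the wavelength scale. -/
structure IsBox (c κ a b r₁ r₂ : ℝ) : Prop where
  ha : 0 < a
  hab : a ≤ b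
  hr₁ : 0 < r₁
  hrr : r₁ ≤ r₂
  hs : κ ≤ turn c (r₁ * a)
  hle : (r₂ - r₁) * (b - a) * (r₂ * b) ≤ turn c (r₂ * b)

theorem IsBox.strict {c κ a b r₁ r₂ : ℝ} (hB : IsBox c κ a b r₁ r₂) (hκ : 1 ≤ κ)
    (hfull : (r₂ - r₁) * (b - a) * (r₂ * b) = turn c (r₂ * b)) : a < b ∧ r₁ < r₂ := by
  obtain ⟨ha, hab, hr₁, hrr, hs, -⟩ := hB
  have h1 : r₁ * a ≤ r₂ * b := by have := ha.le; have := hr₁.le.trans hrr; gcongr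
  have h2 : κ ≤ turn c (r₂ * b) := hs.trans (turn_mono (by positivity) h1)
  refine ⟨lt_of_le_of_ne hab fun h => ?_, lt_of_le_of_ne hrr fun h => ?_⟩
  · rw [h, sub_self, mul_zero, zero_mul] at hfull; linarith
  · rw [h, sub_self, zero_mul, zero_mul] at hfull; linarith

def tailInt (g : ℝ → ℝ) (a b ρ : ℝ) : ℝ≥0∞ :=
  ∫⁻ r' in Set.Ioi b, ENNReal.ofReal |g r'| * ENNReal.ofReal (tailKer (b - a) (r' - ρ))

theorem tailInt_monotoneOn (g : ℝ → ℝ) {a b : ℝ} (hab : a < b) :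
    MonotoneOn (tailInt g a b) (Set.Ico a b) := by
  intro x hx y hy hxy
  unfold tailInt
  apply setLIntegral_mono' measurableSet_Ioi
  intro r hr
  have hr : b < r := hr
  gcongr
  exact tailKer_anti (by linarith) (by linarith [hy.2]) (by linarith)

theorem ENNReal.mul_le_sq_add_sq (x y : ℝ≥0∞) : x * y ≤ x ^ 2 + y ^ 2 := by
  rcases le_total x y with h | h
  · calc x * y ≤ y * y := by gcongr
      _ = y ^ 2 := (pow_two y).symm
      _ ≤ _ := le_add_self
  · calc x * y ≤ x * x := by gcongr
      _ = x ^ 2 := (pow_two x).symm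
      _ ≤ _ := le_self_add

namespace BesselLike

variable {c K α : ℝ} {f f1 : ℝ → ℝ}

theorem ramp_cross_le (hf : BesselLike c K α f f1) (hK : 0 ≤ K) {κ : ℝ} (hκ : 1 ≤ κ) (hκc : c ≤ κ ^ 3)
    {a b r₁ r₂ β : ℝ} (hB : IsBox c κ a b r₁ r₂)
    (hfull : (r₂ - r₁) * (b - a) * (r₂ * b) = turn c (r₂ * b)) {g : ℝ → ℝ} (hg : Adm g) :
    ENNReal.ofReal |∫ r in Set.Ioi 0, ramp ((r₁ + r₂) / 2) r₂ r *
      (hank f ((Set.Ico a b).indicator g) r * hank f ((Set.Ico b β).indicator g) r)| ≤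
      10 ^ 10 * (∫⁻ ρ in Set.Ico a b, ENNReal.ofReal (g ρ ^ 2)) +
        10 ^ 10 * (20 * ∫⁻ ρ in Set.Ico a b, tailInt g a b ρ ^ 2) := by
  obtain ⟨hab, hrr⟩ := hB.strict hκ hfull
  obtain ⟨ha, -, hr₁, -, hs, -⟩ := hB
  have hr₂ : 0 < r₂ := hr₁.trans hrr
  have hgm := hg.1
  refine (hf.integral_ramp_hank (hg.indicator measurableSet_Ico) (hg.indicator measurableSet_Ico)
    (by linarith) hr₂).trans ?_
  set w := boxWeight c b ((r₁ + r₂) / 2) r₂ with hw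
  have key : ∀ ρ, ∫⁻ ρ', ENNReal.ofReal (|(Set.Ico a b).indicator g ρ| * |(Set.Ico b β).indicator g ρ'| *
        |∫ r in (0:ℝ)..r₂, ramp ((r₁ + r₂) / 2) r₂ r * (f (r * ρ) * f (r * ρ'))|) ≤
      (Set.Ico a b).indicator (fun ρ => 10 ^ 10 * ENNReal.ofReal (g ρ ^ 2) +
        10 ^ 10 * (ENNReal.ofReal (w ρ) * tailInt g a b ρ ^ 2)) ρ := by
    intro ρ
    by_cases hρ : ρ ∈ Set.Ico a b
    swap
    · rw [Set.indicator_of_notMem hρ, Set.indicator_of_notMem hρ]; simp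
    rw [Set.indicator_of_mem hρ, Set.indicator_of_mem hρ]
    have e1 : ∀ᵐ ρ' : ℝ, ENNReal.ofReal (|g ρ| * |(Set.Ico b β).indicator g ρ'| *
        |∫ r in (0:ℝ)..r₂, ramp ((r₁ + r₂) / 2) r₂ r * (f (r * ρ) * f (r * ρ'))|) ≤
        ENNReal.ofReal (|g ρ| * (10 ^ 10 * √(w ρ))) * (Set.Ioi b).indicator (fun ρ' => ENNReal.ofReal |g ρ'| *
          ENNReal.ofReal (tailKer (b - a) (ρ' - ρ))) ρ' := by
      have hne : ∀ᵐ ρ' : ℝ, ρ' ≠ b := by simp [ae_iff, measure_singleton]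
      filter_upwards [hne] with ρ' hρ'
      by_cases h : ρ' ∈ Set.Ico b β
      · have hb' : b < ρ' := lt_of_le_of_ne h.1 (Ne.symm hρ')
        rw [Set.indicator_of_mem h, Set.indicator_of_mem (show ρ' ∈ Set.Ioi b from hb'),
          ← ENNReal.ofReal_mul (abs_nonneg _), ← ENNReal.ofReal_mul (by positivity)]
        apply ENNReal.ofReal_le_ofReal
        have := hf.theta_le hK hκ hκc ha hab hr₁ rfl hrr hs hfull ⟨hρ.1, hρ.2.le⟩ hb'
        calc _ ≤ |g ρ| * |g ρ'| * (10 ^ 10 * √(w ρ) * tailKer (b - a) (ρ' - ρ)) := by gcongr; exact this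
          _ = _ := by ring
      · rw [Set.indicator_of_notMem h]; simp
    refine (lintegral_mono_ae e1).trans ?_
    have hmeas : Measurable fun ρ' => ENNReal.ofReal (tailKer (b - a) (ρ' - ρ)) :=
      ((measurable_tailKer _).comp (by fun_prop)).ennreal_ofReal
    rw [lintegral_const_mul _ (by
      apply Measurable.indicator _ measurableSet_Ioi
      exact (hgm.abs.ennreal_ofReal).mul hmeas), lintegral_indicator measurableSet_Ioi]
    change _ * tailInt g a b ρ ≤ _
    have hw0 : 0 ≤ w ρ := by
      have : 0 ≤ ρ := ha.le.trans hρ.1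
      have hb : 0 < b := ha.trans hab
      exact mul_nonneg (by positivity) (div_nonneg (turn_nonneg _ _) (turn_nonneg _ _))
    calc ENNReal.ofReal (|g ρ| * (10 ^ 10 * √(w ρ))) * tailInt g a b ρ
        = 10 ^ 10 * (ENNReal.ofReal |g ρ| * (ENNReal.ofReal √(w ρ) * tailInt g a b ρ)) := by
          rw [ENNReal.ofReal_mul (abs_nonneg _), ENNReal.ofReal_mul (by positivity),
            ENNReal.ofReal_pow (by norm_num), ENNReal.ofReal_ofNat]
          ring
      _ ≤ 10 ^ 10 * (ENNReal.ofReal |g ρ| ^ 2 + (ENNReal.ofReal √(w ρ) * tailInt g a b ρ) ^ 2) := by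
          gcongr 10 ^ 10 * ?_
          exact ENNReal.mul_le_sq_add_sq _ _
      _ = _ := by
          rw [mul_add, mul_pow, ← ENNReal.ofReal_pow (abs_nonneg _), sq_abs,
            ← ENNReal.ofReal_pow (Real.sqrt_nonneg _), Real.sq_sqrt hw0]
  refine (lintegral_mono key).trans ?_
  rw [lintegral_indicator measurableSet_Ico, lintegral_add_left (by fun_prop),
    lintegral_const_mul _ (by fun_prop), lintegral_const_mul' _ _ (by finiteness)]
  gcongr _ + 10 ^ 10 * ?_
  exact lintegral_boxWeight_mul_sq hκ ha hab hr₁ rfl hrr hs (tailInt_monotoneOn g hab)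

theorem lintegral_box_diff (hf : BesselLike c K α f f1) {κ : ℝ} (hκ : 1 ≤ κ) (hκc : c ≤ κ ^ 3)
    {a b r₁ r₂ : ℝ} (hB : IsBox c κ a b r₁ r₂) {g : ℝ → ℝ} (hg : Measurable g) {m : ℝ → ℝ → ℝ}
    (hm : ∀ r ρ, |m r ρ| ≤ 1) (h0 : ∀ r > 0, r ∉ Set.Ioc r₁ r₂ → ∀ ρ ∈ Set.Ico a b, m r ρ = 0) :
    ∫⁻ r in Set.Ioi 0, ENNReal.ofReal ((∫ ρ, m r ρ * (f (r * ρ) * (Set.Ico a b).indicator g ρ)) ^ 2) ≤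
      4 * 10 ^ 7 * ∫⁻ ρ in Set.Ico a b, ENNReal.ofReal (g ρ ^ 2) := by
  obtain ⟨ha, hab, hr₁, hrr, hs, hle⟩ := hB
  have hmeas := hf.meas
  have key : ∀ r ∈ Set.Ioi (0:ℝ), ENNReal.ofReal ((∫ ρ, m r ρ * (f (r * ρ) * (Set.Ico a b).indicator g ρ)) ^ 2) ≤
      (Set.Icc r₁ r₂).indicator (fun r => ∫⁻ ρ in Set.Icc a b, ENNReal.ofReal (f (r * ρ) ^ 2)) r *
        ∫⁻ ρ in Set.Ico a b, ENNReal.ofReal (g ρ ^ 2) := by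
    intro r hr
    by_cases hrJ : r ∈ Set.Ioc r₁ r₂
    swap
    · have : ∀ ρ, m r ρ * (f (r * ρ) * (Set.Ico a b).indicator g ρ) = 0 := by
        intro ρ
        by_cases h : ρ ∈ Set.Ico a b
        · rw [h0 r hr hrJ ρ h, zero_mul]
        · rw [Set.indicator_of_notMem h]; ring
      simp [this]
    rw [Set.indicator_of_mem (Set.Ioc_subset_Icc_self hrJ)]
    have e1 : ENNReal.ofReal |∫ ρ, m r ρ * (f (r * ρ) * (Set.Ico a b).indicator g ρ)| ≤
        ∫⁻ ρ in Set.Ico a b, ENNReal.ofReal |f (r * ρ)| * ENNReal.ofReal |g ρ| := by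
      rw [← Real.norm_eq_abs, ofReal_norm]
      refine (enorm_integral_le_lintegral_enorm _).trans ?_
      rw [← lintegral_indicator measurableSet_Ico]
      refine lintegral_mono fun ρ => ?_
      by_cases h : ρ ∈ Set.Ico a b
      · simp only [Set.indicator_of_mem h]
        rw [← ofReal_norm, Real.norm_eq_abs, abs_mul, abs_mul, ← ENNReal.ofReal_mul (abs_nonneg _)]
        apply ENNReal.ofReal_le_ofReal
        exact mul_le_of_le_one_left (by positivity) (hm r ρ)
      · simp only [Set.indicator_of_notMem h]; simp
    rw [← sq_abs, ENNReal.ofReal_pow (abs_nonneg _)]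
    calc _ ≤ (∫⁻ ρ in Set.Ico a b, ENNReal.ofReal |f (r * ρ)| * ENNReal.ofReal |g ρ|) ^ 2 := by gcongr
      _ ≤ _ := lintegral_mul_sq_le _ (by fun_prop) (by fun_prop)
      _ ≤ _ := by
          simp only [← ENNReal.ofReal_pow (abs_nonneg _), sq_abs]
          gcongr
          exact Set.Ico_subset_Icc_self
  refine (setLIntegral_mono' measurableSet_Ioi key).trans ?_
  have hm2 : Measurable fun r => ∫⁻ ρ in Set.Icc a b, ENNReal.ofReal (f (r * ρ) ^ 2) := by
    apply Measurable.lintegral_prod_right' (f := fun p : ℝ × ℝ => ENNReal.ofReal (f (p.1 * p.2) ^ 2))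
    fun_prop
  rw [lintegral_mul_const _ (hm2.indicator measurableSet_Icc)]
  gcongr
  calc _ ≤ ∫⁻ r, (Set.Icc r₁ r₂).indicator (fun r => ∫⁻ ρ in Set.Icc a b, ENNReal.ofReal (f (r * ρ) ^ 2)) r :=
        setLIntegral_le_lintegral _ _
    _ ≤ _ := by
        rw [lintegral_indicator measurableSet_Icc]
        refine (hf.lintegral_box_sq hκ hκc ha hab hr₁ hrr hs hle).trans (le_of_eq ?_)
        rw [ENNReal.ofReal_mul (by norm_num), ENNReal.ofReal_pow (by norm_num), ENNReal.ofReal_ofNat,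
          ENNReal.ofReal_ofNat]

theorem sum_hank (hf : BesselLike c K α f f1) {g : ℝ → ℝ} (hg : Adm g) {a : ℕ → ℝ} (ha : Monotone a)
    {r : ℝ} (hr : 0 < r) {m n : ℕ} (hmn : m ≤ n) :
    ∑ l ∈ Finset.Ico m n, hank f ((Set.Ico (a l) (a (l + 1))).indicator g) r =
      hank f ((Set.Ico (a m) (a n)).indicator g) r := by
  induction n, hmn using Nat.le_induction with
  | base => simp [hank]
  | succ n hmn ih =>
    rw [Finset.sum_Ico_succ_top hmn, ih, ← hf.hank_add (hg.indicator measurableSet_Ico)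
      (hg.indicator measurableSet_Ico) hr]
    congr 1; ext ρ
    rw [← Set.Ico_union_Ico_eq_Ico (ha hmn) (ha n.le_succ), Set.indicator_union_of_disjoint]
    rw [Set.disjoint_left]; intro x h1 h2; exact absurd h1.2 (not_lt.mpr h2.1)

theorem sum_sq_expand (F : ℕ → ℝ) (n : ℕ) : (∑ k ∈ Finset.range n, F k) ^ 2 =
    ∑ k ∈ Finset.range n, (F k ^ 2 + 2 * (F k * ∑ l ∈ Finset.Ico (k + 1) n, F l)) := by
  induction n with
  | zero => simp
  | succ n ih =>
    have : ∀ k ∈ Finset.range n, F k ^ 2 + 2 * (F k * ∑ l ∈ Finset.Ico (k + 1) (n + 1), F l) =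
        (F k ^ 2 + 2 * (F k * ∑ l ∈ Finset.Ico (k + 1) n, F l)) + F k * (2 * F n) := by
      intro k hk
      rw [Finset.sum_Ico_succ_top (by have := Finset.mem_range.mp hk; omega)]; ring
    rw [Finset.sum_range_succ, Finset.sum_range_succ, Finset.sum_congr rfl this, Finset.sum_add_distrib,
      ← ih, ← Finset.sum_mul]
    simp; ring

theorem lintegral_sum_hank_sq_le (hf : BesselLike c K α f f1) {g : ℝ → ℝ} (hg : Adm g) {a : ℕ → ℝ}
    (ha : Monotone a) {n : ℕ} {θ : ℕ → ℝ → ℝ} (hθm : ∀ k, Measurable (θ k))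
    (hθ0 : ∀ k r, 0 ≤ θ k r) (hθ1 : ∀ k r, θ k r ≤ 1)
    (hθθ : ∀ k l, k < l → l < n → ∀ r > 0, θ k r * θ l r = θ k r) {Q : ℕ → ℝ≥0∞}
    (hQ : ∀ k < n, ENNReal.ofReal |∫ r in Set.Ioi 0, θ k r *
      (hank f ((Set.Ico (a k) (a (k + 1))).indicator g) r *
        hank f ((Set.Ico (a (k + 1)) (a n)).indicator g) r)| ≤ Q k) :
    ∫⁻ r in Set.Ioi 0, ENNReal.ofReal ((∑ k ∈ Finset.range n,
      θ k r * hank f ((Set.Ico (a k) (a (k + 1))).indicator g) r) ^ 2) ≤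
      ∑ k ∈ Finset.range n, ((∫⁻ ρ in Set.Ico (a k) (a (k + 1)), ENNReal.ofReal (g ρ ^ 2)) + 2 * Q k) := by
  set u : ℕ → ℝ → ℝ := fun k => hank f ((Set.Ico (a k) (a (k + 1))).indicator g) with hu
  set v : ℕ → ℝ → ℝ := fun k => hank f ((Set.Ico (a (k + 1)) (a n)).indicator g) with hv
  have hadm : ∀ x y, Adm ((Set.Ico x y).indicator g) := fun x y => hg.indicator measurableSet_Ico
  have hθa : ∀ k r, |θ k r| ≤ 1 := fun k r => by rw [abs_of_nonneg (hθ0 k r)]; exact hθ1 k r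
  have hexp : ∀ r ∈ Set.Ioi (0:ℝ), (∑ k ∈ Finset.range n, θ k r * u k r) ^ 2 =
      ∑ k ∈ Finset.range n, ((θ k r * u k r) ^ 2 + 2 * (θ k r * (u k r * v k r))) := by
    intro r hr
    rw [sum_sq_expand]
    refine Finset.sum_congr rfl fun k hk => ?_
    have hk := Finset.mem_range.mp hk
    congr 2
    simp only [hv]
    rw [← hf.sum_hank hg ha hr (show k + 1 ≤ n by omega), Finset.mul_sum, Finset.mul_sum, Finset.mul_sum]
    refine Finset.sum_congr rfl fun l hl => ?_
    have hl := Finset.mem_Ico.mp hl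
    have := hθθ k l (by omega) hl.2 r hr
    calc θ k r * u k r * (θ l r * u l r) = (θ k r * θ l r) * (u k r * u l r) := by ring
      _ = _ := by rw [this]
  have i1 : ∀ k, IntegrableOn (fun r => (θ k r * u k r) ^ 2) (Set.Ioi 0) := by
    intro k
    have := hf.integrableOn_hank_mul (hadm (a k) (a (k+1))) (hadm (a k) (a (k+1)))
      (m := fun r => θ k r ^ 2) ((hθm k).pow_const 2)
      (fun r => by rw [abs_pow]; exact pow_le_one₀ (abs_nonneg _) (hθa k r))
    refine this.congr (Eventually.of_forall fun r => ?_)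
    simp only [hu]; ring
  have i2 : ∀ k, IntegrableOn (fun r => 2 * (θ k r * (u k r * v k r))) (Set.Ioi 0) := fun k =>
    (hf.integrableOn_hank_mul (hadm _ _) (hadm _ _) (hθm k) (hθa k)).const_mul 2
  have i3 : ∀ k, IntegrableOn (fun r => (θ k r * u k r) ^ 2 + 2 * (θ k r * (u k r * v k r))) (Set.Ioi 0) :=
    fun k => (i1 k).add (i2 k)
  have i4 : IntegrableOn (fun r => ∑ k ∈ Finset.range n,
      ((θ k r * u k r) ^ 2 + 2 * (θ k r * (u k r * v k r)))) (Set.Ioi 0) :=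
    integrable_finsetSum _ fun k _ => i3 k
  rw [setLIntegral_congr_fun measurableSet_Ioi fun r hr => by
    show ENNReal.ofReal ((∑ k ∈ Finset.range n, θ k r * u k r) ^ 2) = _
    rw [hexp r hr]]
  rw [← ofReal_integral_eq_lintegral_ofReal i4 (by
    filter_upwards [ae_restrict_mem measurableSet_Ioi] with r hr
    rw [← hexp r hr]; exact sq_nonneg _)]
  rw [integral_finsetSum _ fun k _ => i3 k]
  refine (ENNReal.ofReal_le_ofReal (Finset.sum_le_sum fun k _ =>
    (le_abs_self (∫ r in Set.Ioi 0, (θ k r * u k r) ^ 2 + 2 * (θ k r * (u k r * v k r)))))).trans ?_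
  rw [ENNReal.ofReal_sum_of_nonneg fun _ _ => abs_nonneg _]
  refine Finset.sum_le_sum fun k hk => ?_
  have hk := Finset.mem_range.mp hk
  rw [integral_add (i1 k) (i2 k), integral_const_mul]
  refine (ENNReal.ofReal_le_ofReal (abs_add_le _ _)).trans (ENNReal.ofReal_add_le.trans ?_)
  gcongr
  · rw [abs_of_nonneg (integral_nonneg fun r => sq_nonneg _),
      ofReal_integral_eq_lintegral_ofReal (i1 k) (Eventually.of_forall fun r => sq_nonneg _)]
    calc _ ≤ ∫⁻ r in Set.Ioi 0, ENNReal.ofReal (u k r ^ 2) := by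
          refine lintegral_mono fun r => ENNReal.ofReal_le_ofReal ?_
          rw [mul_pow]
          exact mul_le_of_le_one_left (sq_nonneg _) (pow_le_one₀ (hθ0 k r) (hθ1 k r))
      _ = _ := by
          rw [hf.lintegral_hank_sq (hadm _ _), ← lintegral_indicator measurableSet_Ico]
          congr 1; ext ρ
          by_cases h : ρ ∈ Set.Ico (a k) (a (k + 1)) <;> simp [h]
  · rw [abs_mul, ENNReal.ofReal_mul (abs_nonneg _), abs_two, ENNReal.ofReal_ofNat]
    gcongr 2 * ?_
    exact hQ k hk

end BesselLike

namespace BesselLike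

variable {c K α : ℝ} {f f1 : ℝ → ℝ}

theorem sum_sq_of_mul_eq_zero {ι : Type*} (s : Finset ι) (D : ι → ℝ)
    (h : ∀ i ∈ s, ∀ j ∈ s, i ≠ j → D i * D j = 0) : (∑ i ∈ s, D i) ^ 2 = ∑ i ∈ s, D i ^ 2 := by
  rw [pow_two, Finset.sum_mul_sum]
  refine Finset.sum_congr rfl fun i hi => ?_
  rw [Finset.sum_eq_single i (fun j hj hij => h i hi j hj (Ne.symm hij)) (fun hi' => absurd hi hi'), pow_two]

theorem ofReal_add_sq_le (x y : ℝ) : ENNReal.ofReal ((x + y) ^ 2) ≤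
    2 * ENNReal.ofReal (x ^ 2) + 2 * ENNReal.ofReal (y ^ 2) := by
  calc ENNReal.ofReal ((x + y) ^ 2) ≤ ENNReal.ofReal (2 * x ^ 2 + 2 * y ^ 2) := by
        apply ENNReal.ofReal_le_ofReal; nlinarith [sq_nonneg (x - y)]
    _ = _ := by
        rw [ENNReal.ofReal_add (by positivity) (by positivity), ENNReal.ofReal_mul (by norm_num),
          ENNReal.ofReal_mul (by norm_num), ENNReal.ofReal_ofNat]

theorem lintegral_box_family (hf : BesselLike c K α f f1) (hK : 0 ≤ K) {κ : ℝ} (hκ : 1 ≤ κ)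
    (hκc : c ≤ κ ^ 3) {g : ℝ → ℝ} (hg : Adm g) {a : ℕ → ℝ} (ha : Monotone a) {n : ℕ} {r₁ r₂ : ℕ → ℝ}
    (hB : ∀ k < n, IsBox c κ (a k) (a (k + 1)) (r₁ k) (r₂ k))
    (hfull : ∀ k < n, (r₂ k - r₁ k) * (a (k + 1) - a k) * (r₂ k * a (k + 1)) = turn c (r₂ k * a (k + 1)))
    (hdisj : ∀ k < n, ∀ l < n, k ≠ l → Disjoint (Set.Ioc (r₁ k) (r₂ k)) (Set.Ioc (r₁ l) (r₂ l)))
    {θ : ℕ → ℝ → ℝ} (hθ : (∀ k, θ k = ramp ((r₁ k + r₂ k) / 2) (r₂ k)) ∨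
      ∀ k, θ k = fun r => 1 - ramp ((r₁ k + r₂ k) / 2) (r₂ k) r)
    (hθθ : ∀ k l, k < l → l < n → ∀ r > 0, θ k r * θ l r = θ k r)
    {m : ℝ → ℝ → ℝ} (hmm : Measurable (Function.uncurry m)) (hm0 : ∀ r ρ, 0 ≤ m r ρ) (hm1 : ∀ r ρ, m r ρ ≤ 1)
    (hmθ : ∀ k < n, ∀ r > 0, r ∉ Set.Ioc (r₁ k) (r₂ k) → ∀ ρ ∈ Set.Ico (a k) (a (k + 1)), m r ρ = θ k r) :
    ∫⁻ r in Set.Ioi 0, ENNReal.ofReal ((∫ ρ, m r ρ * (f (r * ρ) *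
      (Set.Ico (a 0) (a n)).indicator g ρ)) ^ 2) ≤ 10 ^ 18 * ∫⁻ ρ, ENNReal.ofReal (g ρ ^ 2) := by
  have hgm := hg.1
  have hadm : ∀ x y, Adm ((Set.Ico x y).indicator g) := fun x y => hg.indicator measurableSet_Ico
  have hθm : ∀ k, Measurable (θ k) := by
    intro k
    rcases hθ with h | h
    · rw [h]; exact (continuous_ramp _ _).measurable
    · rw [h]; exact (continuous_ramp _ _).measurable.const_sub _
  have hθ0 : ∀ k r, 0 ≤ θ k r := by
    intro k r
    rcases hθ with h | h
    · rw [h]; exact ramp_nonneg _ _ _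
    · rw [h]; exact sub_nonneg.mpr (ramp_le_one _ _ _)
  have hθ1 : ∀ k r, θ k r ≤ 1 := by
    intro k r
    rcases hθ with h | h
    · rw [h]; exact ramp_le_one _ _ _
    · rw [h]; exact sub_le_self _ (ramp_nonneg _ _ _)
  set N : ℝ≥0∞ := ∫⁻ ρ, ENNReal.ofReal (g ρ ^ 2) with hN
  have hdis : ∀ x y : ℕ, x < y → Disjoint (Set.Ico (a x) (a (x + 1))) (Set.Ico (a y) (a (y + 1))) := by
    intro x y h
    rw [Set.disjoint_left]; intro z h1 h2
    exact absurd h1.2 (not_lt.mpr ((ha (show x + 1 ≤ y by omega)).trans h2.1))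
  have hdis' : ((Finset.range n : Finset ℕ) : Set ℕ).PairwiseDisjoint fun k => Set.Ico (a k) (a (k + 1)) := by
    intro x _ y _ hxy
    rcases lt_or_gt_of_ne hxy with h | h
    · exact hdis x y h
    · exact (hdis y x h).symm
  have hsumN : ∑ k ∈ Finset.range n, ∫⁻ ρ in Set.Ico (a k) (a (k + 1)), ENNReal.ofReal (g ρ ^ 2) ≤ N := by
    rw [← lintegral_biUnion_finset hdis' fun _ _ => measurableSet_Ico]
    exact setLIntegral_le_lintegral _ _
  have hsumT : ∑ k ∈ Finset.range n, ∫⁻ ρ in Set.Ico (a k) (a (k + 1)), tailInt g (a k) (a (k + 1)) ρ ^ 2 ≤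
      1024000 * N := by
    obtain ⟨M, hM⟩ : ∃ M, ∀ ρ, |g ρ| ≤ M := by obtain ⟨-, _, _, M, -, h, -⟩ := hg; exact ⟨M, h⟩
    have := sum_lintegral_tailKer_sq_le (Finset.range n) a (fun k => a (k + 1))
      (fun k hk => ((hB k (Finset.mem_range.mp hk)).strict hκ (hfull k (Finset.mem_range.mp hk))).1) hdis' hgm.abs.ennreal_ofReal
      (fun z => ENNReal.ofReal_le_ofReal (hM z))
    simp only [← ENNReal.ofReal_pow (abs_nonneg _), sq_abs] at this
    exact this
  have hmain := hf.lintegral_sum_hank_sq_le hg ha (n := n) hθm hθ0 hθ1 hθθ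
    (Q := fun k => 10 ^ 10 * (∫⁻ ρ in Set.Ico (a k) (a (k + 1)), ENNReal.ofReal (g ρ ^ 2)) +
        10 ^ 10 * (20 * ∫⁻ ρ in Set.Ico (a k) (a (k + 1)), tailInt g (a k) (a (k + 1)) ρ ^ 2)) (by
      intro k hk
      have hcr := hf.ramp_cross_le hK hκ hκc (β := a n) (hB k hk) (hfull k hk) hg
      rcases hθ with h | h
      · rw [h]; exact hcr
      · refine le_trans (le_of_eq ?_) hcr
        congr 1
        rw [← abs_neg]
        congr 1
        have e0 := hf.integral_hank_mul_eq_zero (hadm (a k) (a (k+1))) (hadm (a (k+1)) (a n)) (by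
          intro ρ
          by_cases h1 : ρ ∈ Set.Ico (a k) (a (k + 1))
          · rw [Set.indicator_of_notMem (s := Set.Ico (a (k+1)) (a n)) (fun h2 => absurd h1.2 (not_lt.mpr h2.1)),
              mul_zero]
          · rw [Set.indicator_of_notMem h1, zero_mul])
        have i1 := hf.integrableOn_hank_mul (hadm (a k) (a (k+1))) (hadm (a (k+1)) (a n))
          (m := ramp ((r₁ k + r₂ k) / 2) (r₂ k)) (continuous_ramp _ _).measurable
          (fun r => by rw [abs_of_nonneg (ramp_nonneg _ _ _)]; exact ramp_le_one _ _ _)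
        have i2 := hf.integrableOn_hank_mul (hadm (a k) (a (k+1))) (hadm (a (k+1)) (a n))
          (m := fun _ => 1) measurable_const (by simp)
        simp only [one_mul] at i2
        rw [h]
        simp only [sub_mul, one_mul]
        rw [integral_sub i2 i1, e0]; ring)
  set F : ℝ → ℝ := fun r => ∑ k ∈ Finset.range n, θ k r * hank f ((Set.Ico (a k) (a (k + 1))).indicator g) r
    with hF
  have hFm : Measurable F := by
    simp only [hF]
    exact Finset.measurable_fun_sum _ fun k _ => (hθm k).mul (hf.measurable_hank (hadm _ _))
  have hF2 : ∫⁻ r in Set.Ioi 0, ENNReal.ofReal (F r ^ 2) ≤ 41 * 10 ^ 16 * N := by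
    refine hmain.trans ?_
    rw [Finset.sum_congr rfl fun k _ => show _ = (1 + 2 * 10 ^ 10) *
        (∫⁻ ρ in Set.Ico (a k) (a (k + 1)), ENNReal.ofReal (g ρ ^ 2)) + 40 * 10 ^ 10 *
        ∫⁻ ρ in Set.Ico (a k) (a (k + 1)), tailInt g (a k) (a (k + 1)) ρ ^ 2 by ring,
      Finset.sum_add_distrib, ← Finset.mul_sum, ← Finset.mul_sum]
    calc _ ≤ (1 + 2 * 10 ^ 10) * N + 40 * 10 ^ 10 * (1024000 * N) := by
          gcongr (1 + 2 * 10 ^ 10) * ?_ + 40 * 10 ^ 10 * ?_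
      _ = (1 + 2 * 10 ^ 10 + 40 * 10 ^ 10 * 1024000) * N := by ring
      _ ≤ (41 * 10 ^ 16) * N := by gcongr ?_ * _; norm_num
  set D : ℕ → ℝ → ℝ := fun k r => ∫ ρ, (m r ρ - θ k r) * (f (r * ρ) *
    (Set.Ico (a k) (a (k + 1))).indicator g ρ) with hD
  have hD2 : ∀ k < n, ∫⁻ r in Set.Ioi 0, ENNReal.ofReal (D k r ^ 2) ≤
      4 * 10 ^ 7 * ∫⁻ ρ in Set.Ico (a k) (a (k + 1)), ENNReal.ofReal (g ρ ^ 2) := by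
    intro k hk
    refine hf.lintegral_box_diff hκ hκc (hB k hk) hgm (m := fun r ρ => m r ρ - θ k r) ?_ ?_
    · intro r ρ
      rw [abs_le]
      constructor <;> linarith [hm0 r ρ, hm1 r ρ, hθ0 k r, hθ1 k r]
    · intro r hr hrJ ρ hρ
      simp only [hmθ k hk r hr hrJ ρ hρ, sub_self]
  have hfm := hf.meas
  have hDm : ∀ k, Measurable (D k) := by
    intro k
    have h1 : Measurable ((Set.Ico (a k) (a (k + 1))).indicator g) := hgm.indicator measurableSet_Ico
    have : StronglyMeasurable (Function.uncurry fun r ρ => (m r ρ - θ k r) * (f (r * ρ) *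
        (Set.Ico (a k) (a (k + 1))).indicator g ρ)) := by
      apply Measurable.stronglyMeasurable
      have h2 := hθm k
      have h3 : Measurable fun p : ℝ × ℝ => m p.1 p.2 := hmm
      unfold Function.uncurry
      fun_prop
    exact this.integral_prod_right.measurable
  have hDz : ∀ k < n, ∀ r > 0, r ∉ Set.Ioc (r₁ k) (r₂ k) → D k r = 0 := by
    intro k hk r hr hrJ
    simp only [hD]
    rw [← integral_zero ℝ ℝ]
    congr 1; ext ρ
    by_cases h : ρ ∈ Set.Ico (a k) (a (k + 1))
    · rw [hmθ k hk r hr hrJ ρ h]; ring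
    · rw [Set.indicator_of_notMem h]; ring
  have hT : ∀ r > 0, ∫ ρ, m r ρ * (f (r * ρ) * (Set.Ico (a 0) (a n)).indicator g ρ) =
      F r + ∑ k ∈ Finset.range n, D k r := by
    intro r hr
    have e1 : ∀ ρ, m r ρ * (f (r * ρ) * (Set.Ico (a 0) (a n)).indicator g ρ) =
        ∑ k ∈ Finset.range n, m r ρ * (f (r * ρ) * (Set.Ico (a k) (a (k + 1))).indicator g ρ) := by
      intro ρ
      have : ∀ N, (Set.Ico (a 0) (a N)).indicator g ρ =
          ∑ k ∈ Finset.range N, (Set.Ico (a k) (a (k + 1))).indicator g ρ := by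
        intro N
        induction N with
        | zero => simp
        | succ N ih =>
          rw [Finset.sum_range_succ, ← ih, ← Set.Ico_union_Ico_eq_Ico (ha (Nat.zero_le N)) (ha N.le_succ),
            Set.indicator_union_of_disjoint]
          rw [Set.disjoint_left]; intro x h1 h2; exact absurd h1.2 (not_lt.mpr h2.1)
      rw [this, Finset.mul_sum, Finset.mul_sum]
    have hintg : ∀ k, Integrable fun ρ => m r ρ * (f (r * ρ) * (Set.Ico (a k) (a (k + 1))).indicator g ρ) :=
      fun k => hf.integrable_kernel (hadm _ _) hr hmm.of_uncurry_left
        (fun ρ => by rw [abs_of_nonneg (hm0 r ρ)]; exact hm1 r ρ)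
    simp_rw [e1]
    rw [integral_finsetSum _ fun k _ => hintg k, hF, ← Finset.sum_add_distrib]
    refine Finset.sum_congr rfl fun k _ => ?_
    simp only [hD, hank]
    simp_rw [sub_mul]
    rw [integral_sub (hintg k) ((hf.integrable_kernel' (hadm _ _) hr).const_mul _), integral_const_mul]
    ring
  have hDsum : ∀ r ∈ Set.Ioi (0:ℝ), ENNReal.ofReal ((∑ k ∈ Finset.range n, D k r) ^ 2) =
      ∑ k ∈ Finset.range n, ENNReal.ofReal (D k r ^ 2) := by
    intro r hr
    rw [sum_sq_of_mul_eq_zero, ENNReal.ofReal_sum_of_nonneg fun _ _ => sq_nonneg _]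
    intro k hk l hl hkl
    have hk := Finset.mem_range.mp hk
    have hl := Finset.mem_range.mp hl
    by_cases h : r ∈ Set.Ioc (r₁ k) (r₂ k)
    · have : r ∉ Set.Ioc (r₁ l) (r₂ l) := Set.disjoint_left.mp (hdisj k hk l hl hkl) h
      rw [hDz l hl r hr this, mul_zero]
    · rw [hDz k hk r hr h, zero_mul]
  calc _ ≤ ∫⁻ r in Set.Ioi 0, (2 * ENNReal.ofReal (F r ^ 2) +
          2 * ∑ k ∈ Finset.range n, ENNReal.ofReal (D k r ^ 2)) := by
        apply setLIntegral_mono' measurableSet_Ioi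
        intro r hr
        rw [hT r hr, ← hDsum r hr]
        exact ofReal_add_sq_le _ _
    _ = 2 * (∫⁻ r in Set.Ioi 0, ENNReal.ofReal (F r ^ 2)) +
          2 * ∑ k ∈ Finset.range n, ∫⁻ r in Set.Ioi 0, ENNReal.ofReal (D k r ^ 2) := by
        rw [lintegral_add_left (by fun_prop), lintegral_const_mul _ (by fun_prop),
          lintegral_const_mul' _ _ (by finiteness), lintegral_finsetSum _ fun k _ => by
            have := hDm k
            fun_prop]
    _ ≤ 2 * (41 * 10 ^ 16 * N) + 2 * (4 * 10 ^ 7 * N) := by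
        gcongr 2 * ?_ + 2 * ?_
        refine (Finset.sum_le_sum fun k hk => hD2 k (Finset.mem_range.mp hk)).trans ?_
        rw [← Finset.mul_sum]
        gcongr (4 * 10 ^ 7) * ?_
    _ = (2 * (41 * 10 ^ 16) + 2 * (4 * 10 ^ 7)) * N := by ring
    _ ≤ _ := by gcongr ?_ * _; norm_num

end BesselLike

/-- Greedy subdivision of `[x, β]` into intervals on which `Φ` vanishes, up to a last one where it is negative. -/
theorem exists_greedy_partition {Φ : ℝ → ℝ → ℝ} {x₀ β δ : ℝ} (hx₀ : x₀ ≤ β) (hδ : 0 < δ)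
    (hcont : ∀ a ∈ Set.Icc x₀ β, ContinuousOn (Φ a) (Set.Icc a β))
    (hneg : ∀ a ∈ Set.Icc x₀ β, Φ a a < 0)
    (hstep : ∀ a b, x₀ ≤ a → a ≤ b → b ≤ β → 0 ≤ Φ a b → δ ≤ b - a) :
    ∃ (n : ℕ) (a : ℕ → ℝ), Monotone a ∧ a 0 = x₀ ∧ (∀ k, a k ∈ Set.Icc x₀ β) ∧
      (∀ k < n, Φ (a k) (a (k + 1)) = 0) ∧ Φ (a n) β < 0 := by
  classical
  have hnext : ∀ a : Set.Icc x₀ β, ∃ b : Set.Icc x₀ β, a.1 ≤ b.1 ∧ (0 ≤ Φ a β → Φ a b = 0) := by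
    rintro ⟨a, ha⟩
    by_cases h : 0 ≤ Φ a β
    · obtain ⟨b, hb, hb0⟩ := intermediate_value_Icc ha.2 (hcont a ha) ⟨(hneg a ha).le, h⟩
      exact ⟨⟨b, ha.1.trans hb.1, hb.2⟩, hb.1, fun _ => hb0⟩
    · exact ⟨⟨a, ha⟩, le_rfl, fun h' => absurd h' h⟩
  choose next hn1 hn2 using hnext
  set s : ℕ → Set.Icc x₀ β := fun k => next^[k] ⟨x₀, le_rfl, hx₀⟩ with hs
  have hsucc : ∀ k, s (k + 1) = next (s k) := fun k => Function.iterate_succ_apply' _ _ _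
  have hmono : Monotone fun k => (s k).1 := monotone_nat_of_le_succ fun k => by
    rw [hsucc]; exact hn1 _
  have hex : ∃ n, Φ (s n) β < 0 := by
    by_contra hcon
    push Not at hcon
    have : ∀ k : ℕ, x₀ + k * δ ≤ s k := by
      intro k
      induction k with
      | zero => simp [hs]
      | succ k ih =>
        have h0 := hn2 _ (hcon k)
        rw [← hsucc] at h0
        have := hstep (s k) (s (k + 1)) (s k).2.1 (hmono k.le_succ) (s (k + 1)).2.2 h0.ge
        push_cast
        linarith
    obtain ⟨k, hk⟩ := exists_nat_gt ((β - x₀) / δ)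
    rw [div_lt_iff₀ hδ] at hk
    linarith [this k, (s k).2.2]
  refine ⟨Nat.find hex, fun k => s k, hmono, rfl, fun k => (s k).2, fun k hk => ?_, Nat.find_spec hex⟩
  have := Nat.find_min hex hk
  have h0 := hn2 _ (not_lt.mp this)
  rwa [← hsucc] at h0

/-- The lower left corner of a box stays beyond the turning point when its other two corners do. -/
theorem corner_ge {c κ P e e' u : ℝ} (hc : -(1 / 4) ≤ c) (hκ : 1 ≤ κ) (hκc : c ≤ κ ^ 3) (hP : 0 < P)
    (hu : u = P + e) (he' : 0 ≤ e') (hee : e' ≤ e) (hX : 10 ^ 4 * κ ^ 2 ≤ P ^ 2 - c)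
    (harea : (e * e') ^ 2 ≤ u ^ 2 - c) : c + κ ^ 2 ≤ (P - e') ^ 2 ∧ e' ≤ P := by
  set y := √(P ^ 2 - c) with hy
  have hX0 : 0 ≤ P ^ 2 - c := le_trans (by positivity) hX
  have hyy : y ^ 2 = P ^ 2 - c := Real.sq_sqrt hX0
  have hyκ : 100 * κ ≤ y := Real.le_sqrt_of_sq_le (by nlinarith)
  have hy100 : 100 ≤ y := by linarith
  have hP2 : 90 * P ^ 2 ≤ y ^ 3 := by
    have h1 : 100 * y ^ 2 ≤ y ^ 3 := by nlinarith [sq_nonneg y]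
    have h2 : (100 * κ) ^ 3 ≤ y ^ 3 := by gcongr
    nlinarith
  have he5 : e' ^ 2 ≤ 5 * y := by
    have h1 : (e * e') ^ 2 ≤ y ^ 2 + e * (2 * P + e) := by rw [hyy]; rw [hu] at harea; nlinarith
    rcases le_total (e * (2 * P + e)) (y ^ 2) with h | h
    · have h2 : e' * e' ≤ e * e' := by gcongr
      have h3 : (e' * e') ^ 2 ≤ (e * e') ^ 2 := by gcongr
      have h4 : (e' ^ 2) ^ 2 ≤ (5 * y) ^ 2 :=
        calc (e' ^ 2) ^ 2 = (e' * e') ^ 2 := by ring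
          _ ≤ 2 * y ^ 2 := by linarith
          _ ≤ (5 * y) ^ 2 := by nlinarith [sq_nonneg y]
      exact le_of_sq_le_sq h4 (by linarith)
    · have he0 : 0 < e := by
        by_contra hcon
        have : e = 0 := le_antisymm (not_lt.mp hcon) (he'.trans hee)
        rw [this] at h; nlinarith
      have h2 : e * e' ^ 2 ≤ 2 * (2 * P + e) := by
        have : e * (e * e' ^ 2) ≤ e * (2 * (2 * P + e)) := by nlinarith
        exact le_of_mul_le_mul_left this he0
      rcases le_total e P with h3 | h3
      · have h4 : e' ^ 2 * y ^ 2 ≤ 18 * P ^ 2 := by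
          have a1 : y ^ 2 ≤ 3 * P * e := by nlinarith
          have a2 : e' ^ 2 * y ^ 2 ≤ e' ^ 2 * (3 * P * e) := by gcongr
          have a3 : 3 * P * (e * e' ^ 2) ≤ 3 * P * (6 * P) :=
            mul_le_mul_of_nonneg_left (by linarith) (by positivity)
          nlinarith
        have h5 : e' ^ 2 * y ^ 2 ≤ 5 * y * y ^ 2 := by nlinarith [pow_pos (show 0 < y by linarith) 3]
        exact le_of_mul_le_mul_right h5 (by positivity)
      · have : e * e' ^ 2 ≤ e * 6 := by nlinarith
        have := le_of_mul_le_mul_left this he0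
        linarith
  have hPe : 4 * (P * e') ≤ y ^ 2 := by
    have h1 : (4 * (P * e')) ^ 2 ≤ (y ^ 2) ^ 2 := by
      have : P ^ 2 * e' ^ 2 ≤ P ^ 2 * (5 * y) := by gcongr
      nlinarith [sq_nonneg (y ^ 2)]
    exact le_of_sq_le_sq h1 (by positivity)
  have hP1 : 1 ≤ P := by
    nlinarith
  refine ⟨by nlinarith [sq_nonneg e'], ?_⟩
  have : 4 * (P * e') ≤ 4 * (P * P) := by nlinarith
  have : P * e' ≤ P * P := by linarith
  exact le_of_mul_le_mul_left this hP

theorem box_corner {c κ a b r₁ r₂ : ℝ} (hc : -(1 / 4) ≤ c) (hκ : 1 ≤ κ) (hκc : c ≤ κ ^ 3)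
    (ha : 0 < a) (hab : a ≤ b) (hr₁ : 0 < r₁) (hrr : r₁ ≤ r₂)
    (h1 : 10 ^ 4 * κ ^ 2 ≤ (r₁ * b) ^ 2 - c) (h2 : 10 ^ 4 * κ ^ 2 ≤ (r₂ * a) ^ 2 - c)
    (hle : (r₂ - r₁) * (b - a) * (r₂ * b) ≤ turn c (r₂ * b)) : κ ≤ turn c (r₁ * a) := by
  have hb : 0 < b := ha.trans_le hab
  have hr₂ : 0 < r₂ := hr₁.trans_le hrr
  have hcb : c ≤ (r₂ * b) ^ 2 := by
    have : (r₁ * b) ^ 2 ≤ (r₂ * b) ^ 2 := by gcongr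
    nlinarith
  have hsq : ((r₂ - r₁) * (b - a) * (r₂ * b)) ^ 2 ≤ (r₂ * b) ^ 2 - c := by
    rw [← turn_sq hcb]
    have : 0 ≤ (r₂ - r₁) * (b - a) * (r₂ * b) :=
      mul_nonneg (mul_nonneg (by linarith) (by linarith)) (by positivity)
    gcongr
  have key : ∃ z, 0 ≤ z ∧ z ≤ r₁ * a ∧ c + κ ^ 2 ≤ z ^ 2 := by
    have hx : 0 ≤ (r₂ - r₁) * b := mul_nonneg (by linarith) hb.le
    have hx' : 0 ≤ r₂ * (b - a) := mul_nonneg hr₂.le (by linarith)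
    rcases le_total (r₂ * (b - a)) ((r₂ - r₁) * b) with h | h
    · obtain ⟨h3, h4⟩ := corner_ge (u := r₂ * b) hc hκ hκc (mul_pos hr₁ hb) (by ring) hx' h h1
        (by convert hsq using 2; ring)
      refine ⟨_, sub_nonneg.mpr h4, ?_, h3⟩
      nlinarith
    · obtain ⟨h3, h4⟩ := corner_ge (u := r₂ * b) hc hκ hκc (mul_pos hr₂ ha) (by ring) hx h h2
        (by convert hsq using 2; ring)
      refine ⟨_, sub_nonneg.mpr h4, ?_, h3⟩
      nlinarith
  obtain ⟨z, hz, hz1, hz2⟩ := key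
  apply Real.le_sqrt_of_sq_le
  have : z ^ 2 ≤ (r₁ * a) ^ 2 := by gcongr
  linarith

namespace BesselLike

variable {c K α : ℝ} {f f1 : ℝ → ℝ}

theorem lintegral_last_box (hf : BesselLike c K α f f1) {κ : ℝ} (hκ : 1 ≤ κ) (hκc : c ≤ κ ^ 3)
    {a b r₁ r₂ : ℝ} (hB : IsBox c κ a b r₁ r₂) {g : ℝ → ℝ} (hg : Adm g) {m : ℝ → ℝ → ℝ}
    (hmm : Measurable (Function.uncurry m)) (hm0 : ∀ r ρ, 0 ≤ m r ρ) (hm1 : ∀ r ρ, m r ρ ≤ 1)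
    {θ : ℝ → ℝ} (hθm : Measurable θ) (hθ0 : ∀ r, 0 ≤ θ r) (hθ1 : ∀ r, θ r ≤ 1)
    (hmθ : ∀ r > 0, r ∉ Set.Ioc r₁ r₂ → ∀ ρ ∈ Set.Ico a b, m r ρ = θ r) :
    ∫⁻ r in Set.Ioi 0, ENNReal.ofReal ((∫ ρ, m r ρ * (f (r * ρ) *
      (Set.Ico a b).indicator g ρ)) ^ 2) ≤ 10 ^ 8 * ∫⁻ ρ, ENNReal.ofReal (g ρ ^ 2) := by
  have hgm := hg.1
  have hadm : Adm ((Set.Ico a b).indicator g) := hg.indicator measurableSet_Ico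
  have hu := hf.measurable_hank hadm
  set N : ℝ≥0∞ := ∫⁻ ρ, ENNReal.ofReal (g ρ ^ 2) with hN
  have hD := hf.lintegral_box_diff hκ hκc hB hgm (m := fun r ρ => m r ρ - θ r)
    (fun r ρ => by rw [abs_le]; constructor <;> linarith [hm0 r ρ, hm1 r ρ, hθ0 r, hθ1 r])
    (fun r hr hrJ ρ hρ => by simp only [hmθ r hr hrJ ρ hρ, sub_self])
  have hF : ∫⁻ r in Set.Ioi 0, ENNReal.ofReal ((θ r * hank f ((Set.Ico a b).indicator g) r) ^ 2) ≤ N := by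
    calc _ ≤ ∫⁻ r in Set.Ioi 0, ENNReal.ofReal (hank f ((Set.Ico a b).indicator g) r ^ 2) := by
          refine lintegral_mono fun r => ENNReal.ofReal_le_ofReal ?_
          rw [mul_pow]
          exact mul_le_of_le_one_left (sq_nonneg _) (pow_le_one₀ (hθ0 r) (hθ1 r))
      _ ≤ _ := by
          rw [hf.lintegral_hank_sq hadm]
          refine lintegral_mono fun ρ => ?_
          by_cases h : ρ ∈ Set.Ico a b <;> simp [h]
  calc _ ≤ ∫⁻ r in Set.Ioi 0, (2 * ENNReal.ofReal ((θ r * hank f ((Set.Ico a b).indicator g) r) ^ 2) +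
          2 * ENNReal.ofReal ((∫ ρ, (m r ρ - θ r) * (f (r * ρ) * (Set.Ico a b).indicator g ρ)) ^ 2)) := by
        apply setLIntegral_mono' measurableSet_Ioi
        intro r hr
        refine le_trans (le_of_eq ?_) (ofReal_add_sq_le _ _)
        congr 2
        simp_rw [sub_mul]
        rw [integral_sub (hf.integrable_kernel hadm hr hmm.of_uncurry_left
          (fun ρ => by rw [abs_of_nonneg (hm0 r ρ)]; exact hm1 r ρ))
          ((hf.integrable_kernel' hadm hr).const_mul _), integral_const_mul]
        unfold hank; ring
    _ ≤ 2 * N + 2 * (4 * 10 ^ 7 * N) := by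
        rw [lintegral_add_left (by fun_prop), lintegral_const_mul _ (by fun_prop),
          lintegral_const_mul' _ _ (by finiteness)]
        gcongr 2 * ?_ + 2 * ?_
        refine hD.trans ?_
        gcongr (4 * 10 ^ 7) * ?_
        exact setLIntegral_le_lintegral _ _
    _ = (2 + 2 * (4 * 10 ^ 7)) * N := by ring
    _ ≤ _ := by gcongr ?_ * _; norm_num

end BesselLike

namespace BesselLike

variable {c K α : ℝ} {f f1 : ℝ → ℝ}

theorem measurable_trunc (hf : BesselLike c K α f f1) {g : ℝ → ℝ} (hg : Measurable g) {m : ℝ → ℝ → ℝ}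
    (hmm : Measurable (Function.uncurry m)) : Measurable fun r => ∫ ρ, m r ρ * (f (r * ρ) * g ρ) := by
  have hmeas := hf.meas
  have h3 : Measurable fun p : ℝ × ℝ => m p.1 p.2 := hmm
  have : StronglyMeasurable (Function.uncurry fun r ρ => m r ρ * (f (r * ρ) * g ρ)) := by
    apply Measurable.stronglyMeasurable
    unfold Function.uncurry
    fun_prop
  exact this.integral_prod_right.measurable

theorem lintegral_trunc_split (hf : BesselLike c K α f f1) {g g' : ℝ → ℝ} (hg : Adm g) (hg' : Adm g')
    {m : ℝ → ℝ → ℝ} (hmm : Measurable (Function.uncurry m)) (hm1 : ∀ r ρ, |m r ρ| ≤ 1) :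
    ∫⁻ r in Set.Ioi 0, ENNReal.ofReal ((∫ ρ, m r ρ * (f (r * ρ) * (g ρ + g' ρ))) ^ 2) ≤
      2 * (∫⁻ r in Set.Ioi 0, ENNReal.ofReal ((∫ ρ, m r ρ * (f (r * ρ) * g ρ)) ^ 2)) +
      2 * ∫⁻ r in Set.Ioi 0, ENNReal.ofReal ((∫ ρ, m r ρ * (f (r * ρ) * g' ρ)) ^ 2) := by
  have h1 := hf.measurable_trunc hg.1 hmm
  rw [← lintegral_const_mul' _ _ (by finiteness), ← lintegral_const_mul' _ _ (by finiteness),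
    ← lintegral_add_left (by fun_prop)]
  apply setLIntegral_mono' measurableSet_Ioi
  intro r hr
  refine le_trans (le_of_eq ?_) (ofReal_add_sq_le _ _)
  rw [← integral_add (hf.integrable_kernel hg hr hmm.of_uncurry_left (hm1 r))
    (hf.integrable_kernel hg' hr hmm.of_uncurry_left (hm1 r))]
  congr 3; ext ρ; ring

theorem indicator_Ico_split {a b e : ℝ} (hab : a ≤ b) (hbe : b ≤ e) (g : ℝ → ℝ) (ρ : ℝ) :
    (Set.Ico a e).indicator g ρ = (Set.Ico a b).indicator g ρ + (Set.Ico b e).indicator g ρ := by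
  rw [← Set.Ico_union_Ico_eq_Ico hab hbe, Set.indicator_union_of_disjoint]
  rw [Set.disjoint_left]; intro x h1 h2; exact absurd h1.2 (not_lt.mpr h2.1)

theorem lintegral_region_inc (hf : BesselLike c K α f f1) (hK : 0 ≤ K) {κ : ℝ} (hκ : 1 ≤ κ)
    (hκc : c ≤ κ ^ 3) {g : ℝ → ℝ} (hg : Adm g) {p : ℝ → ℝ} (hpm : Measurable p) {x₀ β : ℝ} (hx₀ : 0 < x₀)
    (hβ : x₀ ≤ β) (hpc : ContinuousOn p (Set.Icc x₀ β)) (hp0 : 0 < p x₀) (hp : MonotoneOn p (Set.Icc x₀ β))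
    (hs : κ ≤ turn c (x₀ * p x₀)) :
    ∫⁻ r in Set.Ioi 0, ENNReal.ofReal ((∫ ρ, (if r ≤ p ρ then 1 else 0) * (f (r * ρ) *
      (Set.Ico x₀ β).indicator g ρ)) ^ 2) ≤ 3 * 10 ^ 18 * ∫⁻ ρ, ENNReal.ofReal (g ρ ^ 2) := by
  set m : ℝ → ℝ → ℝ := fun r ρ => if r ≤ p ρ then 1 else 0 with hm
  have hmm : Measurable (Function.uncurry m) := by
    unfold Function.uncurry
    exact Measurable.ite (measurableSet_le measurable_fst (hpm.comp measurable_snd)) measurable_const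
      measurable_const
  have hm0 : ∀ r ρ, 0 ≤ m r ρ := fun r ρ => by simp only [hm]; split_ifs <;> norm_num
  have hm1 : ∀ r ρ, m r ρ ≤ 1 := fun r ρ => by simp only [hm]; split_ifs <;> norm_num
  have hm1' : ∀ r ρ, |m r ρ| ≤ 1 := fun r ρ => by rw [abs_of_nonneg (hm0 r ρ)]; exact hm1 r ρ
  have hpos : ∀ x ∈ Set.Icc x₀ β, 0 < p x := fun x hx => hp0.trans_le (hp ⟨le_rfl, hβ⟩ hx hx.1)
  have hβ0 : 0 < β := hx₀.trans_le hβ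
  have hturn : ∀ x ∈ Set.Icc x₀ β, ∀ y ∈ Set.Icc x₀ β, κ ≤ turn c (p x * y) := by
    intro x hx y hy
    refine hs.trans (turn_mono (by positivity) ?_)
    rw [mul_comm]
    exact mul_le_mul (hp ⟨le_rfl, hβ⟩ hx hx.1) hy.1 hx₀.le (hpos x hx).le
  obtain ⟨n, a, hamono, ha0, hamem, hfull, hlast⟩ := exists_greedy_partition
    (Φ := fun a b => (p b - p a) * (b - a) * (p b * b) - turn c (p b * b)) (δ := 1 / (p β * (p β * β))) hβ
    (by have := hpos β ⟨hβ, le_rfl⟩; positivity)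
    (by
      intro a ha
      have h1 : ContinuousOn p (Set.Icc a β) := hpc.mono (Set.Icc_subset_Icc_left ha.1)
      have h2 : ContinuousOn (fun b => turn c (p b * b)) (Set.Icc a β) :=
        (continuous_turn c).comp_continuousOn (h1.mul continuousOn_id)
      fun_prop)
    (by
      intro a ha
      have := hturn a ha a ha
      simp only [sub_self, zero_mul]; linarith)
    (by
      intro a b ha hab hb h
      have hbm : b ∈ Set.Icc x₀ β := ⟨ha.trans hab, hb⟩
      have ham : a ∈ Set.Icc x₀ β := ⟨ha, hab.trans hb⟩
      have hβm : β ∈ Set.Icc x₀ β := ⟨hβ, le_rfl⟩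
      have h1 := hturn b hbm b hbm
      have h2 := hpos a ham
      have h3 := hpos b hbm
      have h4 := hp hbm hβm hb
      have h5 := hpos β hβm
      rw [div_le_iff₀ (by positivity)]
      have h6 : (p b - p a) * (b - a) * (p b * b) ≤ (p β) * (b - a) * (p β * β) := by
        have : 0 ≤ b - a := by linarith
        have : 0 ≤ b := hx₀.le.trans hbm.1
        gcongr
        linarith
      linarith)
  have hboxk : ∀ a b, a ∈ Set.Icc x₀ β → b ∈ Set.Icc x₀ β → a ≤ b →
      (p b - p a) * (b - a) * (p b * b) - turn c (p b * b) ≤ 0 → IsBox c κ a b (p a) (p b) :=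
    fun a b ha hb hab h => ⟨hx₀.trans_le ha.1, hab, hpos a ha, hp ha hb hab, hturn a ha a ha, by linarith⟩
  have hB : ∀ k < n, IsBox c κ (a k) (a (k + 1)) (p (a k)) (p (a (k + 1))) := fun k hk =>
    hboxk _ _ (hamem k) (hamem (k + 1)) (hamono k.le_succ) (hfull k hk).le
  have hstrict : ∀ k < n, p (a k) < p (a (k + 1)) := fun k hk =>
    ((hB k hk).strict hκ (by linarith [hfull k hk])).2
  have hpa : Monotone fun k => p (a k) := fun k l hkl => hp (hamem k) (hamem l) (hamono hkl)
  have h1 := hf.lintegral_box_family hK hκ hκc hg hamono (n := n) (r₁ := fun k => p (a k))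
    (r₂ := fun k => p (a (k + 1))) hB (fun k hk => by linarith [hfull k hk])
    (by
      have : ∀ k l, k < l → Disjoint (Set.Ioc (p (a k)) (p (a (k + 1)))) (Set.Ioc (p (a l)) (p (a (l + 1)))) := by
        intro k l hkl
        rw [Set.disjoint_left]; intro x h1 h2
        have : p (a (k + 1)) ≤ p (a l) := hpa (show k + 1 ≤ l by omega)
        exact absurd h2.1 (not_lt.mpr (h1.2.trans this))
      intro k _ l _ hkl
      rcases lt_or_gt_of_ne hkl with h | h
      · exact this k l h
      · exact (this l k h).symm)
    (θ := fun k => ramp ((p (a k) + p (a (k + 1))) / 2) (p (a (k + 1)))) (Or.inl fun k => rfl)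
    (by
      intro k l hkl hln r hr
      have hk := hstrict k (by omega)
      have hl := hstrict l hln
      have h3 : p (a (k + 1)) ≤ p (a l) := hpa (show k + 1 ≤ l by omega)
      rcases le_total (p (a (k + 1))) r with h | h
      · rw [ramp_eq_zero (by linarith) h, zero_mul]
      · rw [ramp_eq_one (q := (p (a l) + p (a (l + 1))) / 2) (by linarith) (by linarith), mul_one])
    hmm hm0 hm1
    (by
      intro k hk r hr hrJ ρ hρ
      have hs := hstrict k hk
      have hρm : ρ ∈ Set.Icc x₀ β := ⟨(hamem k).1.trans hρ.1, hρ.2.le.trans (hamem (k + 1)).2⟩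
      have e1 := hp (hamem k) hρm hρ.1
      have e2 := hp hρm (hamem (k + 1)) hρ.2.le
      simp only [hm]
      rcases le_or_gt r (p (a k)) with h | h
      · rw [if_pos (by linarith), ramp_eq_one (by linarith) (by linarith)]
      · have h' : p (a (k + 1)) < r := by
          by_contra hcon
          exact hrJ ⟨h, not_lt.mp hcon⟩
        rw [if_neg (by linarith), ramp_eq_zero (by linarith) h'.le])
  have hβm : β ∈ Set.Icc x₀ β := ⟨hβ, le_rfl⟩
  have h2 := hf.lintegral_last_box hκ hκc (hboxk (a n) β (hamem n) hβm (hamem n).2 hlast.le) hg hmm hm0 hm1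
    (θ := fun r => if r ≤ p (a n) then 1 else 0)
    (Measurable.ite measurableSet_Iic measurable_const measurable_const)
    (fun r => by split_ifs <;> norm_num) (fun r => by split_ifs <;> norm_num)
    (by
      intro r hr hrJ ρ hρ
      have hρm : ρ ∈ Set.Icc x₀ β := ⟨(hamem n).1.trans hρ.1, hρ.2.le⟩
      have e1 := hp (hamem n) hρm hρ.1
      have e2 := hp hρm hβm hρ.2.le
      simp only [hm]
      rcases le_or_gt r (p (a n)) with h | h
      · rw [if_pos (by linarith), if_pos h]
      · have h' : p β < r := by
          by_contra hcon
          exact hrJ ⟨h, not_lt.mp hcon⟩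
        rw [if_neg (by linarith), if_neg (by linarith)])
  rw [ha0] at h1
  have h3 := hf.lintegral_trunc_split (hg.indicator (s := Set.Ico x₀ (a n)) measurableSet_Ico)
    (hg.indicator (s := Set.Ico (a n) β) measurableSet_Ico) hmm hm1'
  simp only [← indicator_Ico_split (hamem n).1 (hamem n).2] at h3
  refine h3.trans ?_
  calc _ ≤ 2 * (10 ^ 18 * ∫⁻ ρ, ENNReal.ofReal (g ρ ^ 2)) + 2 * (10 ^ 8 * ∫⁻ ρ, ENNReal.ofReal (g ρ ^ 2)) := by
        gcongr 2 * ?_ + 2 * ?_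
    _ = (2 * 10 ^ 18 + 2 * 10 ^ 8) * ∫⁻ ρ, ENNReal.ofReal (g ρ ^ 2) := by ring
    _ ≤ _ := by gcongr ?_ * _; norm_num

theorem lintegral_region_dec (hf : BesselLike c K α f f1) (hK : 0 ≤ K) {κ : ℝ} (hκ : 1 ≤ κ)
    (hκc : c ≤ κ ^ 3) {g : ℝ → ℝ} (hg : Adm g) {p : ℝ → ℝ} (hpm : Measurable p) {x₀ β : ℝ} (hx₀ : 0 < x₀)
    (hβ : x₀ ≤ β) (hpc : ContinuousOn p (Set.Icc x₀ β)) (hp0 : 0 < p β) (hp : AntitoneOn p (Set.Icc x₀ β))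
    (hs : ∀ x ∈ Set.Icc x₀ β, 10 ^ 4 * κ ^ 2 ≤ (p x * x) ^ 2 - c) :
    ∫⁻ r in Set.Ioi 0, ENNReal.ofReal ((∫ ρ, (if p ρ < r then 1 else 0) * (f (r * ρ) *
      (Set.Ico x₀ β).indicator g ρ)) ^ 2) ≤ 3 * 10 ^ 18 * ∫⁻ ρ, ENNReal.ofReal (g ρ ^ 2) := by
  set m : ℝ → ℝ → ℝ := fun r ρ => if p ρ < r then 1 else 0 with hm
  have hmm : Measurable (Function.uncurry m) := by
    unfold Function.uncurry
    exact Measurable.ite (measurableSet_lt (hpm.comp measurable_snd) measurable_fst) measurable_const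
      measurable_const
  have hm0 : ∀ r ρ, 0 ≤ m r ρ := fun r ρ => by simp only [hm]; split_ifs <;> norm_num
  have hm1 : ∀ r ρ, m r ρ ≤ 1 := fun r ρ => by simp only [hm]; split_ifs <;> norm_num
  have hm1' : ∀ r ρ, |m r ρ| ≤ 1 := fun r ρ => by rw [abs_of_nonneg (hm0 r ρ)]; exact hm1 r ρ
  have hβm : β ∈ Set.Icc x₀ β := ⟨hβ, le_rfl⟩
  have hxm : x₀ ∈ Set.Icc x₀ β := ⟨le_rfl, hβ⟩
  have hpos : ∀ x ∈ Set.Icc x₀ β, 0 < p x := fun x hx => hp0.trans_le (hp hx hβm hx.2)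
  have hβ0 : 0 < β := hx₀.trans_le hβ
  have hturn : ∀ x ∈ Set.Icc x₀ β, ∀ y ∈ Set.Icc x₀ β, x ≤ y → κ ≤ turn c (p x * y) := by
    intro x hx y hy hxy
    have h1 := hpos x hx
    have h2 := hx₀.trans_le hx.1
    refine (Real.le_sqrt_of_sq_le ?_).trans (turn_mono (by positivity) (show p x * x ≤ p x * y by gcongr))
    nlinarith [hs x hx]
  obtain ⟨n, a, hamono, ha0, hamem, hfull, hlast⟩ := exists_greedy_partition
    (Φ := fun a b => (p a - p b) * (b - a) * (p a * b) - turn c (p a * b)) (δ := 1 / (p x₀ * (p x₀ * β))) hβ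
    (by have := hpos x₀ hxm; positivity)
    (by
      intro a ha
      have h1 : ContinuousOn p (Set.Icc a β) := hpc.mono (Set.Icc_subset_Icc_left ha.1)
      have h2 : ContinuousOn (fun b => turn c (p a * b)) (Set.Icc a β) :=
        (continuous_turn c).comp_continuousOn (by fun_prop)
      fun_prop)
    (by
      intro a ha
      have := hturn a ha a ha le_rfl
      simp only [sub_self, zero_mul]; linarith)
    (by
      intro a b ha hab hb h
      have hbm : b ∈ Set.Icc x₀ β := ⟨ha.trans hab, hb⟩
      have ham : a ∈ Set.Icc x₀ β := ⟨ha, hab.trans hb⟩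
      have h1 := hturn a ham b hbm hab
      have h2 := hpos a ham
      have h3 := hpos b hbm
      have h4 := hp hxm ham ha
      have h5 := hpos x₀ hxm
      rw [div_le_iff₀ (by positivity)]
      have h6 : (p a - p b) * (b - a) * (p a * b) ≤ (p x₀) * (b - a) * (p x₀ * β) := by
        have : 0 ≤ b - a := by linarith
        have : 0 ≤ b := hx₀.le.trans hbm.1
        gcongr
        linarith
      linarith)
  have hboxk : ∀ a b, a ∈ Set.Icc x₀ β → b ∈ Set.Icc x₀ β → a ≤ b →
      (p a - p b) * (b - a) * (p a * b) - turn c (p a * b) ≤ 0 → IsBox c κ a b (p b) (p a) :=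
    fun a b ha hb hab h => ⟨hx₀.trans_le ha.1, hab, hpos b hb, hp ha hb hab,
      box_corner hf.hc hκ hκc (hx₀.trans_le ha.1) hab (hpos b hb) (hp ha hb hab) (hs b hb) (hs a ha)
        (by linarith), by linarith⟩
  have hB : ∀ k < n, IsBox c κ (a k) (a (k + 1)) (p (a (k + 1))) (p (a k)) := fun k hk =>
    hboxk _ _ (hamem k) (hamem (k + 1)) (hamono k.le_succ) (hfull k hk).le
  have hstrict : ∀ k < n, p (a (k + 1)) < p (a k) := fun k hk =>
    ((hB k hk).strict hκ (by linarith [hfull k hk])).2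
  have hpa : Antitone fun k => p (a k) := fun k l hkl => hp (hamem k) (hamem l) (hamono hkl)
  have h1 := hf.lintegral_box_family hK hκ hκc hg hamono (n := n) (r₁ := fun k => p (a (k + 1)))
    (r₂ := fun k => p (a k)) hB (fun k hk => by linarith [hfull k hk])
    (by
      have : ∀ k l, k < l → Disjoint (Set.Ioc (p (a (k + 1))) (p (a k))) (Set.Ioc (p (a (l + 1))) (p (a l))) := by
        intro k l hkl
        rw [Set.disjoint_left]; intro x h1 h2
        have : p (a l) ≤ p (a (k + 1)) := hpa (show k + 1 ≤ l by omega)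
        exact absurd h1.1 (not_lt.mpr (h2.2.trans this))
      intro k _ l _ hkl
      rcases lt_or_gt_of_ne hkl with h | h
      · exact this k l h
      · exact (this l k h).symm)
    (θ := fun k r => 1 - ramp ((p (a (k + 1)) + p (a k)) / 2) (p (a k)) r) (Or.inr fun k => rfl)
    (by
      intro k l hkl hln r hr
      have hk := hstrict k (by omega)
      have hl := hstrict l hln
      have h3 : p (a l) ≤ p (a (k + 1)) := hpa (show k + 1 ≤ l by omega)
      rcases le_total r (p (a (k + 1))) with h | h
      · rw [ramp_eq_one (by linarith) (by linarith)]; ring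
      · rw [ramp_eq_zero (q' := p (a l)) (by linarith) (by linarith)]; ring)
    hmm hm0 hm1
    (by
      intro k hk r hr hrJ ρ hρ
      have hs := hstrict k hk
      have hρm : ρ ∈ Set.Icc x₀ β := ⟨(hamem k).1.trans hρ.1, hρ.2.le.trans (hamem (k + 1)).2⟩
      have e1 := hp (hamem k) hρm hρ.1
      have e2 := hp hρm (hamem (k + 1)) hρ.2.le
      simp only [hm]
      rcases le_or_gt r (p (a (k + 1))) with h | h
      · rw [if_neg (by linarith), ramp_eq_one (by linarith) (by linarith), sub_self]
      · have h' : p (a k) < r := by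
          by_contra hcon
          exact hrJ ⟨h, not_lt.mp hcon⟩
        rw [if_pos (by linarith), ramp_eq_zero (by linarith) h'.le, sub_zero])
  have h2 := hf.lintegral_last_box hκ hκc (hboxk (a n) β (hamem n) hβm (hamem n).2 hlast.le) hg hmm hm0 hm1
    (θ := fun r => if p (a n) < r then 1 else 0)
    (Measurable.ite measurableSet_Ioi measurable_const measurable_const)
    (fun r => by split_ifs <;> norm_num) (fun r => by split_ifs <;> norm_num)
    (by
      intro r hr hrJ ρ hρ
      have hρm : ρ ∈ Set.Icc x₀ β := ⟨(hamem n).1.trans hρ.1, hρ.2.le⟩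
      have e1 := hp (hamem n) hρm hρ.1
      have e2 := hp hρm hβm hρ.2.le
      simp only [hm]
      rcases le_or_gt r (p β) with h | h
      · rw [if_neg (by linarith), if_neg (by linarith)]
      · have h' : p (a n) < r := by
          by_contra hcon
          exact hrJ ⟨h, not_lt.mp hcon⟩
        rw [if_pos (by linarith), if_pos (by linarith)])
  rw [ha0] at h1
  have h3 := hf.lintegral_trunc_split (hg.indicator (s := Set.Ico x₀ (a n)) measurableSet_Ico)
    (hg.indicator (s := Set.Ico (a n) β) measurableSet_Ico) hmm hm1'
  simp only [← indicator_Ico_split (hamem n).1 (hamem n).2] at h3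
  refine h3.trans ?_
  calc _ ≤ 2 * (10 ^ 18 * ∫⁻ ρ, ENNReal.ofReal (g ρ ^ 2)) + 2 * (10 ^ 8 * ∫⁻ ρ, ENNReal.ofReal (g ρ ^ 2)) := by
        gcongr 2 * ?_ + 2 * ?_
    _ = (2 * 10 ^ 18 + 2 * 10 ^ 8) * ∫⁻ ρ, ENNReal.ofReal (g ρ ^ 2) := by ring
    _ ≤ _ := by gcongr ?_ * _; norm_num

end BesselLike

theorem lintegral_comp_mul_left {F : ℝ → ℝ≥0∞} (hF : Measurable F) {r : ℝ} (hr : 0 < r) :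
    ∫⁻ ρ, F (r * ρ) = ENNReal.ofReal r⁻¹ * ∫⁻ u, F u := by
  rw [← lintegral_map hF (measurable_const_mul r), Real.map_volume_mul_left hr.ne', lintegral_smul_measure,
    abs_of_pos (inv_pos.mpr hr), smul_eq_mul]

namespace BesselLike

variable {c K α : ℝ} {f f1 : ℝ → ℝ}

theorem lintegral_weight_small (hf : BesselLike c K α f f1) {S x : ℝ}
    (hS : ∫⁻ u in Set.Ioc 0 x, ENNReal.ofReal (|f u| / √u) ≤ ENNReal.ofReal S) {r : ℝ} (hr : 0 < r) :
    ∫⁻ ρ in Set.Ioi 0, (if r * ρ ≤ x then ENNReal.ofReal |f (r * ρ)| else 0) * ENNReal.ofReal (1 / √ρ) ≤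
      ENNReal.ofReal S * ENNReal.ofReal (1 / √r) := by
  have hmeas := hf.meas
  set F : ℝ → ℝ≥0∞ := (Set.Ioc 0 x).indicator fun u => ENNReal.ofReal (|f u| / √u) with hF
  have hFm : Measurable F := by
    apply Measurable.indicator _ measurableSet_Ioc
    fun_prop
  have h1 : ∀ ρ ∈ Set.Ioi (0:ℝ), (if r * ρ ≤ x then ENNReal.ofReal |f (r * ρ)| else 0) * ENNReal.ofReal (1 / √ρ) ≤
      ENNReal.ofReal √r * F (r * ρ) := by
    intro ρ hρ
    have hρ : 0 < ρ := hρ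
    split_ifs with h
    · rw [hF, Set.indicator_of_mem (show r * ρ ∈ Set.Ioc 0 x from ⟨by positivity, h⟩),
        ← ENNReal.ofReal_mul (abs_nonneg _), ← ENNReal.ofReal_mul (Real.sqrt_nonneg _)]
      apply le_of_eq
      congr 1
      rw [Real.sqrt_mul hr.le]
      have := Real.sqrt_pos.mpr hr
      have := Real.sqrt_pos.mpr hρ
      field_simp
    · simp
  refine (setLIntegral_mono' measurableSet_Ioi h1).trans ((setLIntegral_le_lintegral _ _).trans ?_)
  rw [lintegral_const_mul' _ _ (by finiteness), lintegral_comp_mul_left hFm hr, hF,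
    lintegral_indicator measurableSet_Ioc]
  calc _ ≤ ENNReal.ofReal √r * (ENNReal.ofReal r⁻¹ * ENNReal.ofReal S) := by gcongr
    _ = _ := by
      rw [← mul_assoc, mul_comm, ← ENNReal.ofReal_mul (Real.sqrt_nonneg _)]
      congr 2
      have := Real.sqrt_pos.mpr hr
      have h2 := Real.mul_self_sqrt hr.le
      field_simp
      nlinarith

theorem lintegral_schur_small (hf : BesselLike c K α f f1) {S x : ℝ}
    (hS : ∫⁻ u in Set.Ioc 0 x, ENNReal.ofReal (|f u| / √u) ≤ ENNReal.ofReal S) {g : ℝ → ℝ} (hg : Adm g)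
    {m : ℝ → ℝ → ℝ} (hm1 : ∀ r ρ, |m r ρ| ≤ 1) (hm0 : ∀ r > 0, ∀ ρ > 0, x < r * ρ → m r ρ * g ρ = 0) :
    ∫⁻ r in Set.Ioi 0, ENNReal.ofReal ((∫ ρ, m r ρ * (f (r * ρ) * g ρ)) ^ 2) ≤
      ENNReal.ofReal S * ENNReal.ofReal S * ∫⁻ ρ, ENNReal.ofReal (g ρ ^ 2) := by
  have hmeas := hf.meas
  have hgm := hg.1
  have hg0 : ∀ ρ ≤ 0, g ρ = 0 := by
    obtain ⟨-, a, b, M, ha, -, h0⟩ := hg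
    exact fun ρ hρ => h0 ρ fun h => by linarith [h.1]
  have hsch := lintegral_schur (volume.restrict (Set.Ioi (0:ℝ))) (volume.restrict (Set.Ioi (0:ℝ)))
    (k := fun r ρ => if r * ρ ≤ x then ENNReal.ofReal |f (r * ρ)| else 0)
    (w := fun ρ => ENNReal.ofReal (1 / √ρ)) (w' := fun r => ENNReal.ofReal (1 / √r))
    (A := ENNReal.ofReal S) (B := ENNReal.ofReal S) (g := fun ρ => ENNReal.ofReal |g ρ|)
    (by
      unfold Function.uncurry
      exact Measurable.ite (measurableSet_le (by fun_prop) measurable_const) (by fun_prop) measurable_const)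
    (by fun_prop) (by fun_prop)
    (by
      filter_upwards [ae_restrict_mem measurableSet_Ioi] with ρ hρ
      have : 0 < 1 / √ρ := one_div_pos.mpr (Real.sqrt_pos.mpr hρ)
      exact ⟨by simpa using Real.sqrt_pos.mpr hρ, by finiteness⟩)
    (by
      filter_upwards [ae_restrict_mem measurableSet_Ioi] with r hr
      exact hf.lintegral_weight_small hS hr)
    (by
      filter_upwards [ae_restrict_mem measurableSet_Ioi] with r hr
      simp_rw [mul_comm _ r]
      exact hf.lintegral_weight_small hS hr)
    (by fun_prop)
  calc _ ≤ ∫⁻ r in Set.Ioi 0, (∫⁻ ρ in Set.Ioi 0, (if r * ρ ≤ x then ENNReal.ofReal |f (r * ρ)| else 0) *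
          ENNReal.ofReal |g ρ|) ^ 2 := by
        apply setLIntegral_mono' measurableSet_Ioi
        intro r hr
        rw [← sq_abs, ENNReal.ofReal_pow (abs_nonneg _), ← Real.norm_eq_abs, ofReal_norm]
        gcongr
        refine (enorm_integral_le_lintegral_enorm _).trans ?_
        rw [← lintegral_indicator measurableSet_Ioi]
        refine lintegral_mono fun ρ => ?_
        rw [← ofReal_norm, Real.norm_eq_abs]
        by_cases h : ρ ∈ Set.Ioi 0
        · rw [Set.indicator_of_mem h]
          split_ifs with h2
          · rw [← ENNReal.ofReal_mul (abs_nonneg _), abs_mul, abs_mul]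
            apply ENNReal.ofReal_le_ofReal
            exact mul_le_of_le_one_left (by positivity) (hm1 r ρ)
          · rw [show m r ρ * (f (r * ρ) * g ρ) = f (r * ρ) * (m r ρ * g ρ) by ring,
              hm0 r hr ρ h (not_le.mp h2)]
            simp
        · rw [hg0 ρ (not_lt.mp h)]; simp
    _ ≤ _ := hsch
    _ ≤ _ := by
        gcongr ENNReal.ofReal S * ENNReal.ofReal S * ?_
        refine (setLIntegral_le_lintegral _ _).trans (le_of_eq ?_)
        simp only [← ENNReal.ofReal_pow (abs_nonneg _), sq_abs]

def sectorConst (K α : ℝ) : ℝ := 20 * 10 ^ 18 + 20 * (K * 400 ^ α * 40 + 3 * 10 ^ 8) ^ 2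

theorem lintegral_sector (hf : BesselLike c K α f f1) (hK : 0 ≤ K) {g : ℝ → ℝ} (hg : Adm g) {p : ℝ → ℝ}
    (hpm : Measurable p) (hpc : ContinuousOn p (Set.Ioi 0)) (hp0 : ∀ ρ > 0, 0 < p ρ)
    (hp : MonotoneOn p (Set.Ioi 0) ∨ AntitoneOn p (Set.Ioi 0)) :
    ∫⁻ r in Set.Ioi 0, ENNReal.ofReal ((∫ ρ, (if p ρ < r then 1 else 0) * (f (r * ρ) * g ρ)) ^ 2) ≤
      ENNReal.ofReal (sectorConst K α) * ∫⁻ ρ, ENNReal.ofReal (g ρ ^ 2) := by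
  have hgm := hg.1
  obtain ⟨x₀, β, M, hx₀, hM, h0⟩ := id hg.2
  obtain ⟨κ, hκ, hκ3⟩ : ∃ κ : ℝ, 1 ≤ κ ∧ κ ^ 3 = max c 1 := by
    refine ⟨(max c 1) ^ (1 / 3 : ℝ), Real.one_le_rpow (le_max_right _ _) (by norm_num), ?_⟩
    rw [← Real.rpow_natCast, ← Real.rpow_mul (by positivity)]; norm_num
  have hκc : c ≤ κ ^ 3 := hκ3 ▸ le_max_left _ _
  have hu1 : 0 < c + 10 ^ 4 * κ ^ 2 := by nlinarith [hf.hc]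
  set x := √(c + 10 ^ 4 * κ ^ 2) with hx
  have hx0 : 0 < x := Real.sqrt_pos.mpr hu1
  have hxx : x ^ 2 = c + 10 ^ 4 * κ ^ 2 := Real.sq_sqrt hu1.le
  set S := K * 400 ^ α * 40 + 3 * 10 ^ 8 with hS'
  have hSnn : 0 ≤ S := by positivity
  have hS := hf.lintegral_small hK hκ hκ3 hxx.le
  rw [← hS'] at hS
  set N : ℝ≥0∞ := ∫⁻ ρ, ENNReal.ofReal (g ρ ^ 2) with hN
  set b := max β x₀ + 1 with hb
  have hbx : x₀ ≤ b := by linarith [le_max_right β x₀]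
  have hgb : (Set.Ico x₀ b).indicator g = g := by
    ext ρ
    by_cases h : ρ ∈ Set.Ico x₀ b
    · rw [Set.indicator_of_mem h]
    · rw [Set.indicator_of_notMem h, h0 ρ]
      exact fun h' => h ⟨h'.1, by linarith [h'.2, le_max_left β x₀]⟩
  have hNind : ∀ s : Set ℝ, ∫⁻ ρ, ENNReal.ofReal (s.indicator g ρ ^ 2) ≤ N := by
    intro s
    refine lintegral_mono fun ρ => ?_
    by_cases h : ρ ∈ s <;> simp [h]
  have hsub : Set.Icc x₀ b ⊆ Set.Ioi 0 := fun y hy => hx₀.trans_le hy.1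
  have hC : ENNReal.ofReal (sectorConst K α) =
      20 * 10 ^ 18 + 20 * (ENNReal.ofReal S * ENNReal.ofReal S) := by
    unfold sectorConst
    rw [ENNReal.ofReal_add (by positivity) (by positivity), ENNReal.ofReal_mul (by norm_num),
      ENNReal.ofReal_mul (by norm_num), ← pow_two, ENNReal.ofReal_pow hSnn, ENNReal.ofReal_pow (by norm_num)]
    norm_num
  have hmlt : Measurable (Function.uncurry fun (r ρ : ℝ) => if p ρ < r then (1:ℝ) else 0) := by
    unfold Function.uncurry
    exact Measurable.ite (measurableSet_lt (hpm.comp measurable_snd) measurable_fst) measurable_const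
      measurable_const
  have hmle : Measurable (Function.uncurry fun (r ρ : ℝ) => if r ≤ p ρ then (1:ℝ) else 0) := by
    unfold Function.uncurry
    exact Measurable.ite (measurableSet_le measurable_fst (hpm.comp measurable_snd)) measurable_const
      measurable_const
  rcases hp with hp | hp
  · obtain ⟨y, hy, hylow, hyhigh⟩ : ∃ y ∈ Set.Icc x₀ b, (∀ ρ ∈ Set.Ico x₀ y, ρ * p ρ ≤ x) ∧
        (y = b ∨ x ≤ y * p y) := by
      rcases le_or_gt x (x₀ * p x₀) with h | h
      · exact ⟨x₀, ⟨le_rfl, hbx⟩, fun ρ hρ => absurd hρ.2 (not_lt.mpr hρ.1), Or.inr h⟩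
      have hmon : ∀ u ∈ Set.Icc x₀ b, ∀ v ∈ Set.Icc x₀ b, u ≤ v → u * p u ≤ v * p v := by
        intro u hu v hv huv
        exact mul_le_mul huv (hp (hsub hu) (hsub hv) huv) (hp0 u (hsub hu)).le (hx₀.le.trans hv.1)
      rcases le_or_gt (b * p b) x with h' | h'
      · exact ⟨b, ⟨hbx, le_rfl⟩, fun ρ hρ => (hmon ρ ⟨hρ.1, hρ.2.le⟩ b ⟨hbx, le_rfl⟩ hρ.2.le).trans h', Or.inl rfl⟩
      · obtain ⟨y, hy, hy0⟩ := intermediate_value_Icc hbx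
          (continuousOn_id.mul (hpc.mono hsub)) ⟨h.le, h'.le⟩
        have hy0 : y * p y = x := hy0
        exact ⟨y, hy, fun ρ hρ => (hmon ρ ⟨hρ.1, hρ.2.le.trans hy.2⟩ y hy hρ.2.le).trans hy0.le, Or.inr hy0.ge⟩
    have hlow := hf.lintegral_schur_small hS (hg.indicator (s := Set.Ico x₀ y) measurableSet_Ico)
      (m := fun r ρ => if r ≤ p ρ then 1 else 0) (fun r ρ => by split_ifs <;> norm_num)
      (by
        intro r hr ρ hρ hlt
        split_ifs with h
        · rw [Set.indicator_of_notMem, mul_zero]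
          intro hmem
          have := hylow ρ hmem
          have : r * ρ ≤ ρ * p ρ := by rw [mul_comm]; gcongr
          linarith
        · rw [zero_mul])
    have hhigh : ∫⁻ r in Set.Ioi 0, ENNReal.ofReal ((∫ ρ, (if r ≤ p ρ then 1 else 0) * (f (r * ρ) *
        (Set.Ico y b).indicator g ρ)) ^ 2) ≤ 3 * 10 ^ 18 * N := by
      rcases hyhigh with h | h
      · rw [h]; simp
      · have hy0 : 0 < y := hsub hy
        have hsub' : Set.Icc y b ⊆ Set.Ioi 0 := fun z hz => hy0.trans_le hz.1
        refine hf.lintegral_region_inc hK hκ hκc hg hpm hy0 hy.2 (hpc.mono hsub') (hp0 y hy0)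
          (hp.mono hsub') ?_
        refine Real.le_sqrt_of_sq_le ?_
        have : x ^ 2 ≤ (y * p y) ^ 2 := by gcongr
        nlinarith
    have hT := hf.lintegral_trunc_split (hg.indicator (s := Set.Ico x₀ y) measurableSet_Ico)
      (hg.indicator (s := Set.Ico y b) measurableSet_Ico) hmle
      (fun r ρ => by split_ifs <;> norm_num)
    simp only [← indicator_Ico_split hy.1 hy.2, hgb] at hT
    have hmeasT := hf.measurable_trunc hgm hmle
    calc _ ≤ ∫⁻ r in Set.Ioi 0, (2 * ENNReal.ofReal (hank f g r ^ 2) + 2 * ENNReal.ofReal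
            ((-∫ ρ, (if r ≤ p ρ then 1 else 0) * (f (r * ρ) * g ρ)) ^ 2)) := by
          apply setLIntegral_mono' measurableSet_Ioi
          intro r hr
          refine le_trans (le_of_eq ?_) (ofReal_add_sq_le _ _)
          rw [← sub_eq_add_neg, hank, ← integral_sub (hf.integrable_kernel' hg hr)
            (hf.integrable_kernel hg hr (m := fun ρ => if r ≤ p ρ then 1 else 0) hmle.of_uncurry_left
              (fun ρ => by split_ifs <;> norm_num))]
          congr 3; ext ρ
          by_cases h : p ρ < r
          · rw [if_pos h, if_neg (not_le.mpr h)]; ring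
          · rw [if_neg h, if_pos (not_lt.mp h)]; ring
      _ ≤ 2 * N + 2 * (2 * (ENNReal.ofReal S * ENNReal.ofReal S * N) + 2 * (3 * 10 ^ 18 * N)) := by
          have := hf.measurable_hank hg
          rw [lintegral_add_left (by fun_prop), lintegral_const_mul _ (by fun_prop),
            lintegral_const_mul' _ _ (by finiteness), hf.lintegral_hank_sq hg]
          simp only [neg_sq]
          gcongr 2 * N + 2 * ?_
          refine hT.trans ?_
          gcongr 2 * ?_ + 2 * ?_
          refine hlow.trans ?_
          gcongr _ * ?_
          exact hNind _
      _ = (2 + 2 * (2 * (3 * 10 ^ 18)) + 4 * (ENNReal.ofReal S * ENNReal.ofReal S)) * N := by ring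
      _ ≤ _ := by
          rw [hC]
          gcongr ?_ * N
          gcongr <;> norm_num
  · set q : ℝ → ℝ := fun ρ => max (p ρ) (x / ρ) with hq
    have hqm : Measurable q := hpm.max (measurable_const.div measurable_id)
    have hqc : ContinuousOn q (Set.Icc x₀ b) := by
      refine ContinuousOn.sup (hpc.mono hsub) (continuousOn_const.div continuousOn_id fun y hy => ?_)
      exact (hsub hy).ne'
    have hqa : AntitoneOn q (Set.Icc x₀ b) := by
      intro u hu v hv huv
      have h1 := hp (hsub hu) (hsub hv) huv
      have hu0 : 0 < u := hsub hu
      exact max_le_max h1 (by gcongr)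
    have hmq : Measurable (Function.uncurry fun (r ρ : ℝ) => if q ρ < r then (1:ℝ) else 0) := by
      unfold Function.uncurry
      exact Measurable.ite (measurableSet_lt (hqm.comp measurable_snd) measurable_fst) measurable_const
        measurable_const
    have hhigh := hf.lintegral_region_dec hK hκ hκc hg hqm hx₀ hbx hqc
      ((hp0 b (hsub ⟨hbx, le_rfl⟩)).trans_le (le_max_left _ _)) hqa
      (by
        intro y hy
        have hy0 : 0 < y := hsub hy
        have h1 : x ≤ q y * y := by
          calc x = x / y * y := by field_simp
            _ ≤ q y * y := by gcongr; exact le_max_right _ _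
        have : x ^ 2 ≤ (q y * y) ^ 2 := by gcongr
        linarith)
    rw [hgb] at hhigh
    have hlow := hf.lintegral_schur_small hS hg
      (m := fun r ρ => (if p ρ < r then 1 else 0) - if q ρ < r then 1 else 0)
      (fun r ρ => by split_ifs <;> norm_num)
      (by
        intro r hr ρ hρ hlt
        have h1 : x / ρ < r := by rwa [div_lt_iff₀ hρ]
        by_cases h : p ρ < r
        · rw [if_pos h, if_pos (max_lt h h1)]; ring
        · rw [if_neg h, if_neg fun h' => h ((le_max_left _ _).trans_lt h')]; ring)
    have hmeasT := hf.measurable_trunc hgm hmq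
    calc _ ≤ ∫⁻ r in Set.Ioi 0, (2 * ENNReal.ofReal ((∫ ρ, (if q ρ < r then 1 else 0) * (f (r * ρ) * g ρ)) ^ 2) +
            2 * ENNReal.ofReal ((∫ ρ, ((if p ρ < r then 1 else 0) - if q ρ < r then 1 else 0) *
              (f (r * ρ) * g ρ)) ^ 2)) := by
          apply setLIntegral_mono' measurableSet_Ioi
          intro r hr
          refine le_trans (le_of_eq ?_) (ofReal_add_sq_le _ _)
          simp_rw [sub_mul]
          rw [integral_sub
            (hf.integrable_kernel hg hr (m := fun ρ => if p ρ < r then 1 else 0) hmlt.of_uncurry_left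
              (fun ρ => by split_ifs <;> norm_num))
            (hf.integrable_kernel hg hr (m := fun ρ => if q ρ < r then 1 else 0) hmq.of_uncurry_left
              (fun ρ => by split_ifs <;> norm_num))]
          ring_nf
      _ ≤ 2 * (3 * 10 ^ 18 * N) + 2 * (ENNReal.ofReal S * ENNReal.ofReal S * N) := by
          rw [lintegral_add_left (by fun_prop), lintegral_const_mul _ (by fun_prop),
            lintegral_const_mul' _ _ (by finiteness)]
          gcongr 2 * ?_ + 2 * ?_
      _ = (2 * (3 * 10 ^ 18) + 2 * (ENNReal.ofReal S * ENNReal.ofReal S)) * N := by ring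
      _ ≤ _ := by
          rw [hC]
          gcongr ?_ * N
          gcongr ?_ + ?_ * _ <;> norm_num

end BesselLike

abbrev Sph (n : ℕ) := Metric.sphere (0 : Euc (n + 1)) 1

abbrev sphMeas (n : ℕ) : Measure (Sph n) := (volume : Measure (Euc (n + 1))).toSphere

section Polar

variable {n : ℕ}

theorem measurePreserving_polar :
    MeasurePreserving (fun x : Sph n × Set.Ioi (0:ℝ) => x.2.1 • x.1.1)
      ((sphMeas n).prod (Measure.volumeIoiPow n)) (volume : Measure (Euc (n + 1))) := by
  have h := (Measure.measurePreserving_homeomorphUnitSphereProd (volume : Measure (Euc (n + 1)))).symm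
    (homeomorphUnitSphereProd (Euc (n + 1))).toMeasurableEquiv
  have h2 : MeasurePreserving (Subtype.val : ({0}ᶜ : Set (Euc (n + 1))) → Euc (n + 1))
      (Measure.comap Subtype.val volume) (volume.restrict ({0}ᶜ : Set (Euc (n + 1)))) :=
    ⟨measurable_subtype_coe, map_comap_subtype_coe (measurableSet_singleton _).compl _⟩
  rw [restrict_compl_singleton] at h2
  have h3 := h2.comp h
  rw [finrank_euclideanSpace_fin, Nat.add_sub_cancel] at h3
  exact h3

theorem lintegral_volumeIoiPow {F : ℝ → ℝ≥0∞} (hF : Measurable F) :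
    ∫⁻ r, F r.1 ∂(Measure.volumeIoiPow n) = ∫⁻ r in Set.Ioi 0, ENNReal.ofReal (r ^ n) * F r := by
  unfold Measure.volumeIoiPow
  rw [lintegral_withDensity_eq_lintegral_mul _ (by fun_prop) (by fun_prop),
    ← lintegral_subtype_comap measurableSet_Ioi]
  rfl

theorem lintegral_polar {F : Euc (n + 1) → ℝ≥0∞} (hF : Measurable F) :
    ∫⁻ x, F x = ∫⁻ r in Set.Ioi (0:ℝ), ENNReal.ofReal (r ^ n) * ∫⁻ ω, F (r • ω.1) ∂(sphMeas n) := by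
  have hm : Measurable fun r : ℝ => ∫⁻ ω : Sph n, F (r • ω.1) ∂(sphMeas n) := by
    apply Measurable.lintegral_prod_right' (f := fun p : ℝ × Sph n => F (p.1 • p.2.1))
    fun_prop
  rw [← measurePreserving_polar.lintegral_comp hF, lintegral_prod_symm _ (by fun_prop),
    ← lintegral_volumeIoiPow hm]

theorem integral_polar {V : Type*} [NormedAddCommGroup V] [NormedSpace ℝ V] {F : Euc (n + 1) → V}
    (hF : Integrable F) :
    ∫ x, F x = ∫ r in Set.Ioi (0:ℝ), r ^ n • ∫ ω, F (r • ω.1) ∂(sphMeas n) := by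
  have h1 := measurePreserving_polar (n := n)
  have hi : Integrable (fun x : Sph n × Set.Ioi (0:ℝ) => F (x.2.1 • x.1.1))
      ((sphMeas n).prod (Measure.volumeIoiPow n)) := h1.integrable_comp_of_integrable hF
  have h2 : ∫ x, F x = ∫ x : Sph n × Set.Ioi (0:ℝ), F (x.2.1 • x.1.1)
      ∂((sphMeas n).prod (Measure.volumeIoiPow n)) := by
    rw [← h1.map_eq, integral_map h1.measurable.aemeasurable (by rw [h1.map_eq]; exact hF.1)]
  rw [h2, integral_prod_symm _ hi]
  simp only [Measure.volumeIoiPow, ENNReal.ofReal]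
  rw [integral_withDensity_eq_integral_smul (by fun_prop),
    integral_subtype_comap measurableSet_Ioi fun a : ℝ =>
      Real.toNNReal (a ^ n) • ∫ ω : Sph n, F (a • ω.1) ∂(sphMeas n)]
  refine setIntegral_congr_fun measurableSet_Ioi fun x hx => ?_
  simp only [NNReal.smul_def, Real.coe_toNNReal _ (pow_nonneg (le_of_lt hx) _)]

end Polar

section GaussianMoments

variable {n : ℕ}

def gaussRad (N : ℕ) : ℝ := ∫ r in Set.Ioi (0:ℝ), r ^ N * Real.exp (-r ^ 2)

theorem integrableOn_gaussRad (N : ℕ) : IntegrableOn (fun r : ℝ => r ^ N * Real.exp (-r ^ 2)) (Set.Ioi 0) := by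
  have := integrableOn_rpow_mul_exp_neg_mul_sq one_pos (s := N) (by linarith [N.cast_nonneg (α := ℝ)])
  simpa using this

theorem gaussRad_eq (N : ℕ) : gaussRad N = 1 / 2 * Real.Gamma ((N + 1) / 2) := by
  have := integral_rpow_mul_exp_neg_rpow two_pos (q := N) (by linarith [N.cast_nonneg (α := ℝ)])
  simpa [gaussRad] using this

theorem gaussRad_pos (N : ℕ) : 0 < gaussRad N := by
  rw [gaussRad_eq]
  have : 0 < Real.Gamma ((N + 1) / 2) := Real.Gamma_pos_of_pos (by positivity)
  positivity

theorem gaussRad_add_two (N : ℕ) : 2 * gaussRad (N + 2) = (N + 1) * gaussRad N := by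
  rw [gaussRad_eq, gaussRad_eq]
  have : ((N + 2 : ℕ) + 1 : ℝ) / 2 = (N + 1) / 2 + 1 := by push_cast; ring
  rw [this, Real.Gamma_add_one (by positivity)]
  ring

theorem integrable_gauss_moment (a b : Euc (n + 1)) (j k : ℕ) :
    Integrable fun x : Euc (n + 1) => ⟪a, x⟫ ^ j * ⟪b, x⟫ ^ k * Real.exp (-‖x‖ ^ 2) := by
  have h1 : Integrable fun x : Euc (n + 1) => ‖x‖ ^ (j + k) * Real.exp (-‖x‖ ^ 2) := by
    rw [integrable_fun_norm_addHaar volume (f := fun r => r ^ (j + k) * Real.exp (-r ^ 2)),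
      finrank_euclideanSpace_fin, Nat.add_sub_cancel]
    refine (integrableOn_gaussRad (n + (j + k))).congr (Eventually.of_forall fun r => ?_)
    simp only [smul_eq_mul]; ring
  refine (h1.const_mul (‖a‖ ^ j * ‖b‖ ^ k)).mono' (by fun_prop) (Eventually.of_forall fun x => ?_)
  rw [norm_mul, norm_mul, norm_pow, norm_pow, Real.norm_of_nonneg (Real.exp_pos _).le]
  calc _ ≤ (‖a‖ * ‖x‖) ^ j * (‖b‖ * ‖x‖) ^ k * Real.exp (-‖x‖ ^ 2) := by
        gcongr <;> exact norm_inner_le_norm _ _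
    _ = _ := by ring

def gaussMom (a b : Euc (n + 1)) (j k : ℕ) : ℝ :=
  ∫ x : Euc (n + 1), ⟪a, x⟫ ^ j * ⟪b, x⟫ ^ k * Real.exp (-‖x‖ ^ 2)

def sphMom (a b : Euc (n + 1)) (j k : ℕ) : ℝ := ∫ θ : Sph n, ⟪a, θ.1⟫ ^ j * ⟪b, θ.1⟫ ^ k ∂(sphMeas n)

theorem gaussMom_comm (a b : Euc (n + 1)) (j k : ℕ) : gaussMom a b j k = gaussMom b a k j := by
  unfold gaussMom; congr 1; ext x; ring

theorem gaussMom_eq (a b : Euc (n + 1)) (j k : ℕ) :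
    gaussMom a b j k = gaussRad (n + (j + k)) * sphMom a b j k := by
  unfold gaussMom gaussRad sphMom
  rw [integral_polar (integrable_gauss_moment a b j k), ← integral_mul_const]
  refine setIntegral_congr_fun measurableSet_Ioi fun r hr => ?_
  have hr : 0 < r := hr
  simp only [smul_eq_mul, inner_smul_right, norm_smul, mul_pow, norm_eq_of_mem_sphere, mul_one,
    Real.norm_eq_abs, sq_abs]
  rw [← integral_const_mul, ← integral_const_mul]
  congr 1; ext θ; ring

theorem gaussMom_succ (a b : Euc (n + 1)) (j k : ℕ) : 2 * gaussMom a b (j + 1) k =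
    j * ‖a‖ ^ 2 * gaussMom a b (j - 1) k + k * ⟪a, b⟫ * gaussMom a b j (k - 1) := by
  set F : Euc (n + 1) → ℝ := fun x => ⟪a, x⟫ ^ j * ⟪b, x⟫ ^ k with hF
  set G : Euc (n + 1) → ℝ := fun x => Real.exp (-‖x‖ ^ 2) with hG
  have hin : ∀ (v x : Euc (n + 1)), HasFDerivAt (fun x : Euc (n + 1) => ⟪v, x⟫) (innerSL ℝ v) x :=
    fun v x => (innerSL ℝ v).hasFDerivAt
  have hF' : ∀ x, HasFDerivAt F (⟪a, x⟫ ^ j • ((k * ⟪b, x⟫ ^ (k - 1)) • innerSL ℝ b) +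
      ⟪b, x⟫ ^ k • ((j * ⟪a, x⟫ ^ (j - 1)) • innerSL ℝ a)) x := fun x => by
    have := ((hin a x).pow j).mul ((hin b x).pow k)
    simpa using! this
  have hG' : ∀ x, HasFDerivAt G (Real.exp (-‖x‖ ^ 2) • -((2:ℕ) • innerSL ℝ x : Euc (n + 1) →L[ℝ] ℝ)) x := fun x =>
    ((hasStrictFDerivAt_norm_sq x).hasFDerivAt.neg).exp
  have e1 : ∀ x, fderiv ℝ F x a = ‖a‖ ^ 2 * (j * ⟪a, x⟫ ^ (j - 1) * ⟪b, x⟫ ^ k) +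
      ⟪a, b⟫ * (k * ⟪a, x⟫ ^ j * ⟪b, x⟫ ^ (k - 1)) := by
    intro x
    rw [(hF' x).fderiv]
    simp [real_inner_comm a b]
    ring
  have e2 : ∀ x, fderiv ℝ G x a = -2 * ⟪a, x⟫ * Real.exp (-‖x‖ ^ 2) := by
    intro x
    rw [(hG' x).fderiv]
    simp [real_inner_comm a x]
    ring
  have i1 := (integrable_gauss_moment a b (j - 1) k).const_mul (‖a‖ ^ 2 * j)
  have i2 := (integrable_gauss_moment a b j (k - 1)).const_mul (⟪a, b⟫ * k)
  have i3 := (integrable_gauss_moment a b (j + 1) k).const_mul (-2)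
  have h1 : ∀ x, fderiv ℝ F x a * G x = ‖a‖ ^ 2 * j * (⟪a, x⟫ ^ (j - 1) * ⟪b, x⟫ ^ k * Real.exp (-‖x‖ ^ 2)) +
      ⟪a, b⟫ * k * (⟪a, x⟫ ^ j * ⟪b, x⟫ ^ (k - 1) * Real.exp (-‖x‖ ^ 2)) := by
    intro x; rw [e1]; simp only [hG]; ring
  have h2 : ∀ x, F x * fderiv ℝ G x a = -2 * (⟪a, x⟫ ^ (j + 1) * ⟪b, x⟫ ^ k * Real.exp (-‖x‖ ^ 2)) := by
    intro x; rw [e2]; simp only [hF]; ring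
  have key := integral_mul_fderiv_eq_neg_fderiv_mul_of_integrable (μ := volume) (f := F) (g := G) (v := a)
    (by simp_rw [h1]; exact i1.add i2) (by simp_rw [h2]; exact i3)
    (integrable_gauss_moment a b j k) (fun x _ => (hF' x).differentiableAt) (fun x _ => (hG' x).differentiableAt)
  simp_rw [h1, h2] at key
  rw [integral_add i1 i2, integral_const_mul, integral_const_mul, integral_const_mul] at key
  unfold gaussMom
  linarith

theorem sphMom_odd (a b : Euc (n + 1)) {j k : ℕ} (h : Odd (j + k)) : sphMom a b j k = 0 := by
  have h1 : gaussMom a b j k = -gaussMom a b j k := by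
    unfold gaussMom
    conv_lhs => rw [← integral_neg_eq_self]
    rw [← integral_neg]
    congr 1; ext x
    rw [inner_neg_right, inner_neg_right, norm_neg]
    have : (-⟪a, x⟫) ^ j * (-⟪b, x⟫) ^ k = -(⟪a, x⟫ ^ j * ⟪b, x⟫ ^ k) := by
      rw [neg_pow, neg_pow ⟪b, x⟫]
      have : (-1 : ℝ) ^ j * (-1) ^ k = -1 := by rw [← pow_add]; exact h.neg_one_pow
      calc _ = ((-1 : ℝ) ^ j * (-1) ^ k) * (⟪a, x⟫ ^ j * ⟪b, x⟫ ^ k) := by ring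
        _ = _ := by rw [this]; ring
    rw [this]; ring
  have h2 : gaussMom a b j k = 0 := by linarith
  rw [gaussMom_eq] at h2
  exact (mul_eq_zero.mp h2).resolve_left (gaussRad_pos _).ne'

theorem sphMom_swap {a b : Euc (n + 1)} (hab : ‖a‖ = ‖b‖) (j k : ℕ) : sphMom a b j k = sphMom b a j k := by
  have h1 : gaussMom a b j k = gaussMom b a j k := by
    unfold gaussMom
    set R := (ℝ ∙ (a - b))ᗮ.reflection with hR
    have hRa : R a = b := Submodule.reflection_sub hab
    have hRb : R b = a := by rw [← hRa, Submodule.reflection_reflection]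
    have := R.measurePreserving.integral_comp R.toHomeomorph.measurableEmbedding
      (fun x => ⟪a, x⟫ ^ j * ⟪b, x⟫ ^ k * Real.exp (-‖x‖ ^ 2))
    rw [← this]
    congr 1; ext x
    have e1 : ⟪a, R x⟫ = ⟪b, x⟫ := by rw [← hRb, R.inner_map_map]
    have e2 : ⟪b, R x⟫ = ⟪a, x⟫ := by rw [← hRa, R.inner_map_map]
    rw [e1, e2, R.norm_map]
  rw [gaussMom_eq, gaussMom_eq] at h1
  exact mul_left_cancel₀ (gaussRad_pos _).ne' h1

theorem sphMom_rec {a b : Euc (n + 1)} (ha : ‖a‖ = 1) (hb : ‖b‖ = 1) (j k : ℕ) :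
    ((j:ℝ) - k) * (j + k + n - 1) * sphMom a b j k =
      j * (j - 1) * sphMom a b (j - 2) k - k * (k - 1) * sphMom a b j (k - 2) := by
  rcases Nat.lt_or_ge (j + k) 2 with h | h
  · obtain ⟨rfl, rfl⟩ | ⟨rfl, rfl⟩ | ⟨rfl, rfl⟩ : (j = 0 ∧ k = 0) ∨ (j = 1 ∧ k = 0) ∨ (j = 0 ∧ k = 1) := by omega
    · simp
    · rw [sphMom_odd a b (by decide : Odd (1 + 0))]; simp
    · rw [sphMom_odd a b (by decide : Odd (0 + 1))]; simp
  have key : 2 * ((j:ℝ) - k) * gaussMom a b j k =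
      j * (j - 1) * gaussMom a b (j - 2) k - k * (k - 1) * gaussMom a b j (k - 2) := by
    have h1 : 2 * (j:ℝ) * gaussMom a b j k = j * (j - 1) * gaussMom a b (j - 2) k +
        j * k * ⟪a, b⟫ * gaussMom a b (j - 1) (k - 1) := by
      rcases j with _ | j
      · simp
      · have := gaussMom_succ a b j k
        rw [ha] at this
        simp only [Nat.add_sub_cancel, show j + 1 - 2 = j - 1 by omega]
        push_cast
        linear_combination ((j:ℝ) + 1) * this
    have h2 : 2 * (k:ℝ) * gaussMom a b j k = k * (k - 1) * gaussMom a b j (k - 2) +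
        j * k * ⟪a, b⟫ * gaussMom a b (j - 1) (k - 1) := by
      rcases k with _ | k
      · simp
      · have := gaussMom_succ b a k j
        rw [hb, real_inner_comm, gaussMom_comm b a, gaussMom_comm b a, gaussMom_comm b a] at this
        simp only [Nat.add_sub_cancel, show k + 1 - 2 = k - 1 by omega]
        push_cast
        linear_combination ((k:ℝ) + 1) * this
    linear_combination h1 - h2
  have h3 := gaussRad_add_two (n + (j + k - 2))
  rw [show n + (j + k - 2) + 2 = n + (j + k) by omega] at h3
  have hc : ((n + (j + k - 2) : ℕ) : ℝ) + 1 = j + k + n - 1 := by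
    have : ((n + (j + k - 2) : ℕ) : ℝ) = n + (j + k) - 2 := by
      rw [show n + (j + k - 2) = n + (j + k) - 2 by omega, Nat.cast_sub (by omega)]; push_cast; ring
    rw [this]; ring
  rw [hc] at h3
  have e1 : (j:ℝ) * (j - 1) * gaussMom a b (j - 2) k =
      j * (j - 1) * (gaussRad (n + (j + k - 2)) * sphMom a b (j - 2) k) := by
    rcases j with _ | _ | j
    · simp
    · simp
    · rw [gaussMom_eq, show j + 1 + 1 - 2 + k = j + 1 + 1 + k - 2 by omega]
  have e2 : (k:ℝ) * (k - 1) * gaussMom a b j (k - 2) =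
      k * (k - 1) * (gaussRad (n + (j + k - 2)) * sphMom a b j (k - 2)) := by
    rcases k with _ | _ | k
    · simp
    · simp
    · rw [gaussMom_eq, show j + (k + 1 + 1 - 2) = j + (k + 1 + 1) - 2 by omega]
  rw [e1, e2, gaussMom_eq] at key
  apply mul_left_cancel₀ (gaussRad_pos (n + (j + k - 2))).ne'
  linear_combination key - ((j:ℝ) - k) * sphMom a b j k * h3

end GaussianMoments

section Zonal

variable {n : ℕ}

def sphMono {k : ℕ} (s : Fin k → Fin (n + 1)) : C(Sph n, ℝ) :=
  ⟨fun θ => ∏ i, θ.1 (s i), by fun_prop⟩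

abbrev toL : C(Sph n, ℝ) →L[ℝ] Lp ℝ 2 (sphMeas n) := ContinuousMap.toLp 2 (sphMeas n) ℝ

theorem toL_injective : Function.Injective (toL (n := n)) := ContinuousMap.toLp_injective _

theorem inner_toL (a b : C(Sph n, ℝ)) : ⟪toL a, toL b⟫ = ∫ θ, a θ * b θ ∂(sphMeas n) := by
  rw [ContinuousMap.inner_toLp]
  congr 1; ext θ; simp [mul_comm]

theorem integrable_sph {V : Type*} [NormedAddCommGroup V] {y : Sph n → V} (hy : Continuous y) :
    Integrable y (sphMeas n) :=
  hy.integrable_of_hasCompactSupport (HasCompactSupport.of_compactSpace _)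

def zonL (k : ℕ) : Lp ℝ 2 (sphMeas n) →ₗ[ℝ] Lp ℝ 2 (sphMeas n) :=
  ∑ s : Fin k → Fin (n + 1), LinearMap.smulRight (innerₛₗ ℝ (toL (sphMono s))) (toL (sphMono s))

def zon (k : ℕ) : C(Sph n, ℝ) →ₗ[ℝ] C(Sph n, ℝ) :=
  ∑ s : Fin k → Fin (n + 1), LinearMap.smulRight ((innerₛₗ ℝ (toL (sphMono s))).comp toL.toLinearMap) (sphMono s)

theorem toL_zon (k : ℕ) (y : C(Sph n, ℝ)) : toL (zon k y) = zonL k (toL y) := by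
  simp [zon, zonL, LinearMap.sum_apply, map_sum]

theorem zon_apply (k : ℕ) (y : C(Sph n, ℝ)) (ω : Sph n) :
    zon k y ω = ∫ θ, ⟪ω.1, θ.1⟫ ^ k * y θ ∂(sphMeas n) := by
  have h1 : ∀ θ : Sph n, ⟪ω.1, θ.1⟫ ^ k * y θ =
      ∑ s : Fin k → Fin (n + 1), sphMono s ω * (sphMono s θ * y θ) := by
    intro θ
    have : ⟪ω.1, θ.1⟫ = ∑ a, ω.1 a * θ.1 a := by
      rw [PiLp.inner_apply]; simp [mul_comm]
    rw [this, Fintype.sum_pow, Finset.sum_mul]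
    refine Finset.sum_congr rfl fun s _ => ?_
    simp only [sphMono, ContinuousMap.coe_mk, Finset.prod_mul_distrib]; ring
  simp_rw [h1]
  rw [integral_finsetSum _ fun s _ => integrable_sph (by fun_prop)]
  simp only [zon, LinearMap.sum_apply, ContinuousMap.coe_sum, Finset.sum_apply]
  refine Finset.sum_congr rfl fun s _ => ?_
  rw [integral_const_mul, ← inner_toL]
  simp [mul_comm]

theorem zon_zon (j k : ℕ) (y : C(Sph n, ℝ)) (ω : Sph n) :
    zon j (zon k y) ω = ∫ η, sphMom ω.1 η.1 j k * y η ∂(sphMeas n) := by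
  rw [zon_apply]
  simp_rw [zon_apply, ← integral_const_mul]
  rw [integral_integral_swap]
  · congr 1; ext η
    unfold sphMom
    rw [← integral_mul_const]
    congr 1; ext θ
    rw [real_inner_comm θ.1 η.1]; ring
  · refine Continuous.integrable_of_hasCompactSupport ?_ (HasCompactSupport.of_compactSpace _)
    unfold Function.uncurry
    fun_prop

theorem norm_sph (ω : Sph n) : ‖ω.1‖ = 1 := norm_eq_of_mem_sphere ω

theorem zon_comm (j k : ℕ) (y : C(Sph n, ℝ)) : zon j (zon k y) = zon k (zon j y) := by
  ext ω
  rw [zon_zon, zon_zon]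
  congr 1; ext η
  rw [sphMom_swap (by rw [norm_sph, norm_sph])]
  congr 1
  unfold sphMom
  congr 1; ext θ; ring

theorem zon_zon_odd {j k : ℕ} (h : Odd (j + k)) (y : C(Sph n, ℝ)) : zon j (zon k y) = 0 := by
  ext ω
  rw [zon_zon]
  simp [sphMom_odd _ _ h]

theorem continuous_sphMom (ω : Sph n) (j k : ℕ) : Continuous fun η : Sph n => sphMom ω.1 η.1 j k := by
  have : ∀ η : Sph n, sphMom ω.1 η.1 j k =
      zon k ⟨fun θ : Sph n => ⟪ω.1, θ.1⟫ ^ j, by fun_prop⟩ η := by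
    intro η
    rw [zon_apply]
    unfold sphMom
    congr 1; ext θ; simp only [ContinuousMap.coe_mk]; ring
  simp_rw [this]
  exact ContinuousMap.continuous _

theorem zon_rec (j k : ℕ) (y : C(Sph n, ℝ)) :
    (((j:ℝ) - k) * (j + k + n - 1)) • zon j (zon k y) =
      ((j:ℝ) * (j - 1)) • zon (j - 2) (zon k y) - ((k:ℝ) * (k - 1)) • zon j (zon (k - 2) y) := by
  ext ω
  have hi : ∀ j k, Integrable (fun η : Sph n => sphMom ω.1 η.1 j k * y η) (sphMeas n) := fun j k =>
    integrable_sph ((continuous_sphMom ω j k).mul y.continuous)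
  simp only [ContinuousMap.sub_apply, ContinuousMap.smul_apply, smul_eq_mul, zon_zon]
  rw [← integral_const_mul, ← integral_const_mul, ← integral_const_mul,
    ← integral_sub ((hi _ _).const_mul _) ((hi _ _).const_mul _)]
  congr 1; ext η
  linear_combination y η * sphMom_rec (norm_sph ω) (norm_sph η) j k

/-- The span of the monomials of degree at most `N`. -/
def polySpan (n N : ℕ) : Submodule ℝ C(Sph n, ℝ) :=
  Submodule.span ℝ (Set.range fun p : (k : Fin (N + 1)) × (Fin k → Fin (n + 1)) => sphMono p.2)

theorem sphMono_mem {N k : ℕ} (hk : k ≤ N) (s : Fin k → Fin (n + 1)) : sphMono s ∈ polySpan n N :=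
  Submodule.subset_span ⟨⟨⟨k, by omega⟩, s⟩, rfl⟩

theorem zon_mem {N k : ℕ} (hk : k ≤ N) (y : C(Sph n, ℝ)) : zon k y ∈ polySpan n N := by
  simp only [zon, LinearMap.sum_apply, LinearMap.smulRight_apply]
  exact Submodule.sum_mem _ fun s _ => Submodule.smul_mem _ _ (sphMono_mem hk s)

theorem zonL_symm (k : ℕ) : (zonL (n := n) k).IsSymmetric := by
  intro u v
  simp only [zonL, LinearMap.sum_apply, LinearMap.smulRight_apply, innerₛₗ_apply_apply, sum_inner, inner_sum,
    inner_smul_left, inner_smul_right]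
  refine Finset.sum_congr rfl fun s _ => ?_
  simp only [conj_trivial]
  rw [real_inner_comm u]; ring

theorem exists_zonal_basis (n N : ℕ) : ∃ (M : ℕ) (y : Fin M → C(Sph n, ℝ)) (γ : Fin M → ℕ → ℝ),
    (∀ i j, ∫ θ, y i θ * y j θ ∂(sphMeas n) = if i = j then 1 else 0) ∧
    (∀ i, ∀ k ≤ N, zon k (y i) = γ i k • y i) ∧ (∀ i, y i ∈ polySpan n N) ∧
    ∀ q ∈ polySpan n N, ∃ c : Fin M → ℝ, q = ∑ i, c i • y i := by
  classical
  set W : Submodule ℝ (Lp ℝ 2 (sphMeas n)) := (polySpan n N).map toL.toLinearMap with hW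
  have : FiniteDimensional ℝ (polySpan n N) := FiniteDimensional.span_of_finite ℝ (Set.finite_range _)
  have : FiniteDimensional ℝ W := inferInstance
  have hinv : ∀ k : Fin (N + 1), ∀ v ∈ W, zonL k.1 v ∈ W := by
    rintro k v ⟨y, -, rfl⟩
    exact ⟨zon k.1 y, zon_mem (by omega) y, toL_zon _ _⟩
  set T : Fin (N + 1) → W →ₗ[ℝ] W := fun k => (zonL k.1).restrict (hinv k) with hT
  have hsymm : ∀ k, (T k).IsSymmetric := fun k => (zonL_symm k.1).restrict_invariant (hinv k)
  have hcomm : Pairwise (Function.onFun Commute T) := by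
    intro j k _
    refine LinearMap.ext fun ⟨v, hv⟩ => Subtype.ext ?_
    obtain ⟨y, -, rfl⟩ := hv
    change zonL j.1 (zonL k.1 (toL y)) = zonL k.1 (zonL j.1 (toL y))
    rw [← toL_zon, ← toL_zon, ← toL_zon, ← toL_zon, zon_comm]
  set V : (Fin (N + 1) → ℝ) → Submodule ℝ W := fun γ => ⨅ j, Module.End.eigenspace (T j) (γ j) with hV
  have hintg : DirectSum.IsInternal V := LinearMap.IsSymmetric.directSum_isInternal_of_pairwise_commute hsymm hcomm
  have horth : OrthogonalFamily ℝ (fun γ => V γ) fun γ => (V γ).subtypeₗᵢ :=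
    LinearMap.IsSymmetric.orthogonalFamily_iInf_eigenspaces hsymm
  have hintg' : DirectSum.IsInternal fun i : {γ // V γ ≠ ⊥} => V i := DirectSum.isInternal_ne_bot_iff.mpr hintg
  have : Fintype {γ // V γ ≠ ⊥} := hintg.submodule_iSupIndep.fintypeNeBotOfFiniteDimensional
  have horth' : OrthogonalFamily ℝ (fun i : {γ // V γ ≠ ⊥} => V i) fun i => (V i).subtypeₗᵢ :=
    fun i j hij v w => horth (Subtype.val_injective.ne hij) v w
  set b := hintg'.subordinateOrthonormalBasis rfl horth' with hb
  have hsub := fun a => hintg'.subordinateOrthonormalBasis_subordinate rfl a horth'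
  choose y hy1 hy2 using fun i => (b i).2
  refine ⟨_, y, fun i k => if h : k < N + 1 then
    (hintg'.subordinateOrthonormalBasisIndex rfl i horth').1 ⟨k, h⟩ else 0, ?_, ?_, hy1, ?_⟩
  · intro i j
    rw [← inner_toL]
    have := orthonormal_iff_ite.mp b.orthonormal i j
    rw [Submodule.coe_inner, ← hy2 i, ← hy2 j] at this
    exact this
  · intro i k hk
    have hk' : k < N + 1 := by omega
    simp only [hk', dif_pos]
    apply toL_injective
    rw [toL_zon, map_smul]
    have h1 := hsub i
    simp only [hV, Submodule.mem_iInf] at h1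
    have h2 := Module.End.mem_eigenspace_iff.mp (h1 ⟨k, hk'⟩)
    have h3 := congrArg Subtype.val h2
    have h4 : toL (y i) = ((b i : W) : Lp ℝ 2 (sphMeas n)) := hy2 i
    rw [h4]
    exact h3
  · intro q hq
    have hmem : toL q ∈ W := ⟨q, hq, rfl⟩
    have h1 := congrArg W.subtype (b.sum_repr ⟨toL q, hmem⟩)
    rw [map_sum] at h1
    refine ⟨fun i => b.repr ⟨toL q, hmem⟩ i, ?_⟩
    apply toL_injective
    rw [map_sum]
    refine h1.symm.trans ?_
    simp only [map_smul]
    refine Finset.sum_congr rfl fun i _ => ?_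
    congr 1
    exact (hy2 i).symm

end Zonal

/-- A normalized joint eigenfunction of the zonal operators, of degree `m`. -/
structure Zonal (n : ℕ) (y : C(Sph n, ℝ)) (m : ℕ) (lam : ℕ → ℝ) : Prop where
  unit : ∫ θ, y θ * y θ ∂(sphMeas n) = 1
  eig : ∀ k, zon k y = lam k • y
  odd : ∀ k, Odd (m + k) → lam k = 0
  small : ∀ k < m, lam k = 0
  recur : ∀ k : ℕ, ((k:ℝ) - m) * (k + m + n - 1) * lam k = k * (k - 1) * lam (k - 2)

section Zonal

variable {n : ℕ}

theorem exists_zonal {N : ℕ} {y : C(Sph n, ℝ)} {γ : ℕ → ℝ} (hy : y ∈ polySpan n N)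
    (hnorm : ∫ θ, y θ * y θ ∂(sphMeas n) = 1) (heig : ∀ k ≤ N, zon k y = γ k • y) :
    ∃ m lam, Zonal n y m lam := by
  classical
  have hy0 : y ≠ 0 := by rintro rfl; simp at hnorm
  have hex : ∃ m, m ≤ N ∧ γ m ≠ 0 := by
    by_contra hcon
    push Not at hcon
    have h1 : ∀ k ≤ N, ∀ s : Fin k → Fin (n + 1), ⟪toL (sphMono s), toL y⟫ = 0 := by
      intro k hk
      have h2 : ⟪toL y, toL (zon k y)⟫ = 0 := by rw [heig k hk, hcon k hk]; simp
      rw [toL_zon] at h2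
      simp only [zonL, LinearMap.sum_apply, LinearMap.smulRight_apply, innerₛₗ_apply_apply, inner_sum,
        inner_smul_right] at h2
      have h3 : ∀ s : Fin k → Fin (n + 1), ⟪toL (sphMono s), toL y⟫ * ⟪toL y, toL (sphMono s)⟫ =
          ⟪toL (sphMono s), toL y⟫ ^ 2 := fun s => by rw [real_inner_comm, pow_two]
      simp_rw [h3] at h2
      rw [Finset.sum_eq_zero_iff_of_nonneg fun _ _ => sq_nonneg _] at h2
      exact fun s => pow_eq_zero_iff (two_ne_zero) |>.mp (h2 s (Finset.mem_univ _))
    have h2 : ∀ q ∈ polySpan n N, ⟪toL q, toL y⟫ = 0 := by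
      intro q hq
      unfold polySpan at hq
      induction hq using Submodule.span_induction with
      | mem x h => obtain ⟨⟨k, s⟩, rfl⟩ := h; exact h1 k.1 (by omega) s
      | zero => simp
      | add x y _ _ hx hy => rw [map_add, inner_add_left, hx, hy, add_zero]
      | smul a x _ hx => rw [map_smul, inner_smul_left, hx, mul_zero]
    have h3 := h2 y hy
    rw [inner_toL, hnorm] at h3
    exact one_ne_zero h3
  set m := Nat.find hex with hm
  obtain ⟨hmN, hγm⟩ := Nat.find_spec hex
  have hmin : ∀ k < m, γ k = 0 := by
    intro k hk
    by_contra h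
    exact Nat.find_min hex hk ⟨by omega, h⟩
  have hmk : ∀ k, zon m (zon k y) = γ m • zon k y := fun k => by
    rw [zon_comm, heig m hmN, map_smul]
  have hodd : ∀ k, Odd (m + k) → zon k y = 0 := by
    intro k hk
    have := hmk k
    rw [zon_zon_odd hk] at this
    exact (smul_eq_zero.mp this.symm).resolve_left hγm
  have hrec : ∀ k : ℕ, (((k:ℝ) - m) * (k + m + n - 1)) • zon k y = ((k:ℝ) * (k - 1)) • zon (k - 2) y := by
    intro k
    have h1 := zon_rec m k y
    rw [hmk, hmk] at h1
    have h2 : ((m:ℝ) * (m - 1)) • zon (m - 2) (zon k y) = 0 := by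
      rcases Nat.lt_or_ge m 2 with h | h
      · obtain h' | h' : m = 0 ∨ m = 1 := by omega
        · rw [h']; simp
        · rw [h']; simp
      · rw [zon_comm, heig (m - 2) (by omega), hmin (m - 2) (by omega)]; simp
    rw [h2, zero_sub, smul_comm _ (γ m), smul_comm _ (γ m), ← smul_neg] at h1
    have h3 := smul_right_injective _ hγm h1
    rw [← neg_inj, ← h3, ← neg_smul]
    congr 1; ring
  have hall : ∀ k, ∃ l : ℝ, zon k y = l • y := by
    intro k
    induction k using Nat.strong_induction_on with
    | _ k ih =>
      rcases Nat.lt_or_ge N k with h | h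
      swap
      · exact ⟨γ k, heig k h⟩
      by_cases hpar : Odd (m + k)
      · exact ⟨0, by rw [hodd k hpar, zero_smul]⟩
      have hk : m + 2 ≤ k := by
        rw [Nat.not_odd_iff_even] at hpar
        by_contra hcon
        have : k = m + 1 := by omega
        rw [this] at hpar
        obtain ⟨q, hq⟩ := hpar
        omega
      obtain ⟨l, hl⟩ := ih (k - 2) (by omega)
      have hkm : (m:ℝ) + 2 ≤ k := by exact_mod_cast hk
      have hm0 : (0:ℝ) ≤ m := m.cast_nonneg
      have hn0 : (0:ℝ) ≤ n := n.cast_nonneg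
      have hne : ((k:ℝ) - m) * (k + m + n - 1) ≠ 0 :=
        mul_ne_zero (by linarith) (by linarith)
      refine ⟨(((k:ℝ) - m) * (k + m + n - 1))⁻¹ * ((k:ℝ) * (k - 1) * l), ?_⟩
      rw [mul_smul, mul_smul, ← hl, ← hrec, smul_smul, inv_mul_cancel₀ hne, one_smul]
  choose lam hlam using hall
  refine ⟨m, lam, hnorm, hlam, fun k hk => ?_, fun k hk => ?_, fun k => ?_⟩
  · have := hlam k
    rw [hodd k hk] at this
    exact (smul_eq_zero.mp this.symm).resolve_right hy0
  · have := hlam k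
    rw [heig k (by omega), hmin k hk, zero_smul] at this
    exact (smul_eq_zero.mp this.symm).resolve_right hy0
  · have := hrec k
    rw [hlam, hlam, smul_smul, smul_smul] at this
    exact smul_left_injective _ hy0 this

end Zonal

section ExpSeries

/-- The exponential generating function `∑ μ_k u^k / k!`. -/
def egf (μ : ℕ → ℝ) (u : ℝ) : ℝ := ∑' k, μ k * u ^ k / k.factorial

variable {μ : ℕ → ℝ} {B : ℝ}

theorem summable_egf (hμ : ∀ k, |μ k| ≤ B) (u : ℝ) : Summable fun k => μ k * u ^ k / k.factorial := by
  refine Summable.of_norm_bounded ((Real.summable_pow_div_factorial |u|).mul_left B) fun k => ?_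
  rw [norm_div, norm_mul, Real.norm_eq_abs, Real.norm_eq_abs, abs_pow, mul_div_assoc]
  have : ‖(k.factorial : ℝ)‖ = k.factorial := by simp
  rw [this]
  gcongr
  exact hμ k

theorem hasSum_egf (hμ : ∀ k, |μ k| ≤ B) (u : ℝ) : HasSum (fun k => μ k * u ^ k / k.factorial) (egf μ u) :=
  (summable_egf hμ u).hasSum

theorem hasDerivAt_egf (hμ : ∀ k, |μ k| ≤ B) (u : ℝ) :
    HasDerivAt (egf μ) (egf (fun k => μ (k + 1)) u) u := by
  have hB : 0 ≤ B := (abs_nonneg _).trans (hμ 0)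
  set R := |u| + 1 with hR
  have hR0 : 0 < R := by positivity
  set v : ℕ → ℝ := fun k => B * (k * R ^ (k - 1) / k.factorial) with hv
  have hvs : Summable v := by
    apply Summable.mul_left
    rw [← summable_nat_add_iff 1]
    refine (Real.summable_pow_div_factorial R).congr fun k => ?_
    simp only [Nat.add_sub_cancel, Nat.factorial_succ]
    push_cast
    field_simp
  have h := hasDerivAt_tsum_of_isPreconnected (g := fun k u => μ k * u ^ k / k.factorial)
    (g' := fun k u => μ k * (k * u ^ (k - 1)) / k.factorial) (t := Metric.ball 0 R) (y₀ := 0) (y := u)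
    hvs Metric.isOpen_ball (convex_ball _ _).isPreconnected
    (fun k y _ => ((hasDerivAt_pow k y).const_mul _).div_const _)
    (fun k y hy => by
      have hy : |y| ≤ R := by rw [← Real.norm_eq_abs]; exact (mem_ball_zero_iff.mp hy).le
      rw [norm_div, norm_mul, norm_mul, norm_pow, Real.norm_natCast, Real.norm_natCast, Real.norm_eq_abs,
        Real.norm_eq_abs, hv]
      simp only
      rw [mul_div_assoc]
      gcongr
      exact hμ k)
    (Metric.mem_ball_self hR0) (summable_egf hμ 0)
    (by rw [mem_ball_zero_iff, Real.norm_eq_abs]; linarith)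
  refine h.congr_deriv ?_
  have hs : Summable fun k => μ k * (k * u ^ (k - 1)) / (k.factorial : ℝ) := by
    rw [← summable_nat_add_iff 1]
    refine (summable_egf (fun k => hμ (k + 1)) u).congr fun k => ?_
    simp only [Nat.add_sub_cancel, Nat.factorial_succ]
    push_cast
    field_simp
  rw [hs.tsum_eq_zero_add]
  simp only [Nat.cast_zero, zero_mul, mul_zero, zero_div, zero_add, egf]
  congr 1; ext k
  simp only [Nat.add_sub_cancel, Nat.factorial_succ]
  push_cast
  field_simp

theorem HasSum.of_eq {V : Type*} [AddCommMonoid V] [TopologicalSpace V] {f g : ℕ → V} {a : V} (hg : HasSum g a)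
    (h : ∀ k, f k = g k) : HasSum f a := by
  rwa [funext h]

theorem hasSum_mul_shift {ν : ℕ → ℝ} {u s : ℝ} (h : HasSum (fun k => ν (k + 1) * u ^ k / k.factorial) s) :
    HasSum (fun k : ℕ => k * ν k * u ^ k / k.factorial) (u * s) := by
  rw [← hasSum_nat_add_iff' 1]
  simp only [Finset.range_one, Finset.sum_singleton, Nat.cast_zero, zero_mul, zero_div, sub_zero]
  refine (h.mul_left u).of_eq fun k => ?_
  simp only [Nat.factorial_succ]
  push_cast
  field_simp
  ring

theorem egf_ode {m n : ℕ} (hμ : ∀ k, |μ k| ≤ B)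
    (hrec : ∀ k : ℕ, ((k:ℝ) - m) * (k + m + n - 1) * μ k = -(k * (k - 1) * μ (k - 2))) (u : ℝ) :
    u ^ 2 * egf (fun k => μ (k + 2)) u + n * u * egf (fun k => μ (k + 1)) u +
      (u ^ 2 - m * (m + n - 1)) * egf μ u = 0 := by
  have h0 := hasSum_egf hμ u
  have h1 := hasSum_mul_shift (hasSum_egf (fun k => hμ (k + 1)) u)
  have h2' : HasSum (fun k : ℕ => (k:ℝ) * μ (k + 1) * u ^ k / k.factorial) (u * egf (fun k => μ (k + 2)) u) :=
    hasSum_mul_shift (ν := fun k => μ (k + 1)) (hasSum_egf (fun k => hμ (k + 2)) u)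
  have h2 : HasSum (fun k : ℕ => (k:ℝ) * ((k - 1) * μ k) * u ^ k / k.factorial)
      (u * (u * egf (fun k => μ (k + 2)) u)) :=
    hasSum_mul_shift (ν := fun k => ((k:ℝ) - 1) * μ k) (by
      convert h2' using 1; ext k; push_cast; ring)
  have h3' : HasSum (fun k : ℕ => (k:ℝ) * μ (k - 1) * u ^ k / k.factorial) (u * egf μ u) :=
    hasSum_mul_shift (ν := fun k => μ (k - 1)) (by simpa using h0)
  have h3 : HasSum (fun k : ℕ => (k:ℝ) * ((k - 1) * μ (k - 2)) * u ^ k / k.factorial)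
      (u * (u * egf μ u)) :=
    hasSum_mul_shift (ν := fun k => ((k:ℝ) - 1) * μ (k - 2)) (by
      convert h3' using 1; ext k; push_cast; ring_nf)
  have h4 := ((h2.add (h1.mul_left (n:ℝ))).add h3).sub (h0.mul_left ((m:ℝ) * (m + n - 1)))
  have h6 := h4.unique (hasSum_zero.of_eq fun k => by
    linear_combination (u ^ k / k.factorial) * hrec k)
  linear_combination h6

end ExpSeries

section ZonalBessel

variable {n : ℕ}

def zonSeq (m : ℕ) (lam : ℕ → ℝ) (k : ℕ) : ℝ := (-1) ^ m * (-1) ^ ((k + m) / 2) * lam k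

def zonProfile (m : ℕ) (lam : ℕ → ℝ) : ℝ → ℝ := egf (zonSeq m lam)

def zonProfile' (m : ℕ) (lam : ℕ → ℝ) : ℝ → ℝ := egf fun k => zonSeq m lam (k + 1)

abbrev sphArea (n : ℕ) : ℝ := (sphMeas n).real Set.univ

namespace Zonal

variable {y : C(Sph n, ℝ)} {m : ℕ} {lam : ℕ → ℝ}

theorem ne_zero (hy : Zonal n y m lam) : y ≠ 0 := by
  rintro rfl
  have := hy.unit
  simp at this

theorem le_of_mul (hy : Zonal n y m lam) {t : ℝ} (h : ∀ ω, |t * y ω| ≤ ∫ θ, |y θ| ∂(sphMeas n)) :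
    |t| ≤ sphArea n := by
  have h1 : ∫ θ, |y θ| ∂(sphMeas n) ≤ sphArea n * ‖y‖ := by
    calc _ ≤ ∫ θ : Sph n, ‖y‖ ∂(sphMeas n) :=
          integral_mono (integrable_sph (by fun_prop)) (integrable_const _) fun θ => y.norm_coe_le_norm θ
      _ = _ := by rw [integral_const, smul_eq_mul]
  have h2 : ‖t • y‖ ≤ sphArea n * ‖y‖ := by
    rw [ContinuousMap.norm_le _ (by positivity)]
    intro ω
    exact (h ω).trans h1
  rw [norm_smul, Real.norm_eq_abs] at h2
  exact le_of_mul_le_mul_right h2 (norm_pos_iff.mpr hy.ne_zero)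

theorem lam_le (hy : Zonal n y m lam) (k : ℕ) : |lam k| ≤ sphArea n := by
  refine hy.le_of_mul fun ω => ?_
  have := congrArg (fun z : C(Sph n, ℝ) => z ω) (hy.eig k)
  simp only [ContinuousMap.smul_apply, smul_eq_mul] at this
  rw [← this, zon_apply, ← Real.norm_eq_abs]
  refine (norm_integral_le_integral_norm _).trans ?_
  refine integral_mono (integrable_sph (by fun_prop)) (integrable_sph (by fun_prop)) fun θ => ?_
  rw [norm_mul, norm_pow]
  refine mul_le_of_le_one_left (norm_nonneg _) (pow_le_one₀ (norm_nonneg _) ?_)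
  refine (norm_inner_le_norm _ _).trans ?_
  rw [norm_sph, norm_sph, one_mul]

theorem zonSeq_le (hy : Zonal n y m lam) (k : ℕ) : |zonSeq m lam k| ≤ sphArea n := by
  unfold zonSeq
  rw [abs_mul, abs_mul, abs_pow, abs_pow, abs_neg, abs_one, one_pow, one_pow, one_mul, one_mul]
  exact hy.lam_le k

theorem zonSeq_rec (hy : Zonal n y m lam) (k : ℕ) : ((k:ℝ) - m) * (k + m + n - 1) * zonSeq m lam k =
    -(k * (k - 1) * zonSeq m lam (k - 2)) := by
  have := hy.recur k
  unfold zonSeq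
  rcases k with _ | _ | k
  · simp only [Nat.cast_zero, zero_mul] at this ⊢
    linear_combination (-1) ^ m * (-1) ^ ((0 + m) / 2) * this
  · simp only [zero_add, Nat.cast_one, sub_self, zero_mul, mul_zero] at this ⊢
    linear_combination (-1) ^ m * (-1) ^ ((1 + m) / 2) * this
  · rw [show (k + 1 + 1 + m) / 2 = (k + m) / 2 + 1 by omega, pow_succ]
    simp only [show k + 1 + 1 - 2 = k by omega] at this ⊢
    linear_combination -((-1) ^ m * (-1) ^ ((k + m) / 2)) * this

theorem I_pow_mul (hy : Zonal n y m lam) (k : ℕ) :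
    Complex.I ^ k * (lam k : ℂ) = Complex.I ^ m * (zonSeq m lam k : ℂ) := by
  by_cases h : Odd (m + k)
  · unfold zonSeq; rw [hy.odd k h]; simp
  rw [Nat.not_odd_iff_even] at h
  obtain ⟨q, hq⟩ := h
  unfold zonSeq
  rw [show (k + m) / 2 = q by omega]
  push_cast
  have h1 : Complex.I ^ m * Complex.I ^ k = (-1) ^ q := by
    rw [← pow_add, hq, ← two_mul, pow_mul, Complex.I_sq]
  have h2 : Complex.I ^ m * Complex.I ^ m = (-1) ^ m := by
    rw [← pow_add, ← two_mul, pow_mul, Complex.I_sq]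
  have h3 : ((-1 : ℂ)) ^ m * (-1) ^ m = 1 := by rw [← mul_pow]; simp
  rw [← h1]
  linear_combination (-(Complex.I ^ k * (lam k : ℂ)) * (-1) ^ m) * h2 - (Complex.I ^ k * (lam k : ℂ)) * h3

theorem integral_exp (hy : Zonal n y m lam) (u : ℝ) (ω : Sph n) :
    ∫ θ, Complex.exp (Complex.I * ((u * ⟪ω.1, θ.1⟫ : ℝ) : ℂ)) * (y θ : ℂ) ∂(sphMeas n) =
      Complex.I ^ m * (zonProfile m lam u : ℂ) * (y ω : ℂ) := by
  set F : ℕ → Sph n → ℂ := fun k θ => (Complex.I * ((u * ⟪ω.1, θ.1⟫ : ℝ) : ℂ)) ^ k / k.factorial * (y θ : ℂ) with hF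
  have hFc : ∀ k, Continuous (F k) := fun k => by simp only [hF]; fun_prop
  have hFb : ∀ k θ, ‖F k θ‖ ≤ |u| ^ k / k.factorial * ‖y‖ := by
    intro k θ
    simp only [hF]
    rw [norm_mul, norm_div, norm_pow, norm_mul, Complex.norm_I, one_mul, Complex.norm_real, Complex.norm_real,
      Complex.norm_natCast, norm_mul]
    have h1 : ‖⟪ω.1, θ.1⟫‖ ≤ 1 := by
      refine (norm_inner_le_norm _ _).trans ?_
      rw [norm_sph, norm_sph, one_mul]
    have h2 : ‖u‖ * ‖⟪ω.1, θ.1⟫‖ ≤ |u| := by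
      rw [Real.norm_eq_abs]; exact mul_le_of_le_one_right (abs_nonneg _) h1
    gcongr
    exact y.norm_coe_le_norm θ
  have hsum : HasSum (fun k => ∫ θ, F k θ ∂(sphMeas n))
      (∫ θ, Complex.exp (Complex.I * ((u * ⟪ω.1, θ.1⟫ : ℝ) : ℂ)) * (y θ : ℂ) ∂(sphMeas n)) := by
    refine hasSum_integral_of_dominated_convergence (fun k _ => |u| ^ k / k.factorial * ‖y‖)
      (fun k => (hFc k).aestronglyMeasurable) (fun k => Eventually.of_forall (hFb k))
      (Eventually.of_forall fun θ => (Real.summable_pow_div_factorial _).mul_right _) (integrable_const _)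
      (Eventually.of_forall fun θ => ?_)
    have := NormedSpace.expSeries_div_hasSum_exp (𝔸 := ℂ) (Complex.I * ((u * ⟪ω.1, θ.1⟫ : ℝ) : ℂ))
    rw [← Complex.exp_eq_exp_ℂ] at this
    exact this.mul_right _
  have hterm : ∀ k, ∫ θ, F k θ ∂(sphMeas n) =
      Complex.I ^ m * (((zonSeq m lam k * u ^ k / k.factorial : ℝ) : ℂ)) * (y ω : ℂ) := by
    intro k
    have h1 : ∀ θ, F k θ = (Complex.I ^ k * (u:ℂ) ^ k / k.factorial) * ((⟪ω.1, θ.1⟫ ^ k * y θ : ℝ) : ℂ) := by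
      intro θ; simp only [hF]; push_cast; ring
    simp_rw [h1]
    have h2 := congrArg (fun z : C(Sph n, ℝ) => z ω) (hy.eig k)
    simp only [ContinuousMap.smul_apply, smul_eq_mul] at h2
    rw [integral_const_mul, integral_complex_ofReal, ← zon_apply, h2]
    push_cast
    linear_combination (u:ℂ) ^ k / k.factorial * (y ω : ℂ) * hy.I_pow_mul k
  have hsum2 : HasSum (fun k => Complex.I ^ m * (((zonSeq m lam k * u ^ k / k.factorial : ℝ) : ℂ)) * (y ω : ℂ))
      (Complex.I ^ m * (zonProfile m lam u : ℂ) * (y ω : ℂ)) :=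
    ((Complex.hasSum_ofReal.mpr (hasSum_egf hy.zonSeq_le u)).mul_left _).mul_right _
  exact (hsum.of_eq fun k => (hterm k).symm).unique hsum2

theorem profile_le (hy : Zonal n y m lam) (u : ℝ) : |zonProfile m lam u| ≤ sphArea n := by
  refine hy.le_of_mul fun ω => ?_
  have h := congrArg norm (hy.integral_exp u ω)
  rw [norm_mul, norm_mul, norm_pow, Complex.norm_I, one_pow, one_mul, Complex.norm_real, Complex.norm_real,
    ← norm_mul, Real.norm_eq_abs] at h
  rw [← h]
  refine (norm_integral_le_integral_norm _).trans (le_of_eq ?_)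
  congr 1; ext θ
  rw [norm_mul, mul_comm Complex.I, Complex.norm_exp_ofReal_mul_I, one_mul, Complex.norm_real, Real.norm_eq_abs]

theorem hasDerivAt_profile (hy : Zonal n y m lam) (u : ℝ) :
    HasDerivAt (zonProfile m lam) (zonProfile' m lam u) u := hasDerivAt_egf hy.zonSeq_le u

theorem hasDerivAt_profile' (hy : Zonal n y m lam) (u : ℝ) :
    HasDerivAt (zonProfile' m lam) (egf (fun k => zonSeq m lam (k + 2)) u) u :=
  hasDerivAt_egf (fun k => hy.zonSeq_le (k + 1)) u

theorem continuous_profile (hy : Zonal n y m lam) : Continuous (zonProfile m lam) :=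
  continuous_iff_continuousAt.mpr fun u => (hy.hasDerivAt_profile u).continuousAt

theorem continuous_profile' (hy : Zonal n y m lam) : Continuous (zonProfile' m lam) :=
  continuous_iff_continuousAt.mpr fun u => (hy.hasDerivAt_profile' u).continuousAt

end Zonal

theorem egf_zero (μ : ℕ → ℝ) : egf μ 0 = μ 0 := by
  unfold egf
  rw [tsum_eq_single 0 (fun k hk => by simp [hk])]
  simp

/-- `(2π)^{-(n+1)/2}` -/
def fourConst (n : ℕ) : ℝ := (√((2 * Real.pi) ^ (n + 1)))⁻¹

theorem fourConst_pos (n : ℕ) : 0 < fourConst n := by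
  unfold fourConst; have := Real.pi_pos; positivity

def zonBessel (n m : ℕ) (lam : ℕ → ℝ) (u : ℝ) : ℝ := fourConst n * (u ^ (n / 2 : ℝ) * zonProfile m lam u)

def zonBessel' (n m : ℕ) (lam : ℕ → ℝ) (u : ℝ) : ℝ :=
  fourConst n * ((n / 2 : ℝ) * u ^ (n / 2 - 1 : ℝ) * zonProfile m lam u + u ^ (n / 2 : ℝ) * zonProfile' m lam u)

def zonParam (n m : ℕ) : ℝ := m * (m + n - 1) + n / 2 * (n / 2 - 1)

namespace Zonal

variable {y : C(Sph n, ℝ)} {m : ℕ} {lam : ℕ → ℝ}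

theorem param_ge (n m : ℕ) : -(1 / 4) ≤ zonParam n m := by
  unfold zonParam
  have h1 : (0:ℝ) ≤ m * (m + n - 1) := by
    rcases m with _ | m
    · simp
    · push_cast
      have : (0:ℝ) ≤ m := m.cast_nonneg
      have : (0:ℝ) ≤ n := n.cast_nonneg
      apply mul_nonneg <;> linarith
  nlinarith [sq_nonneg ((n:ℝ) / 2 - 1 / 2)]

theorem bessel_d1 (hy : Zonal n y m lam) {u : ℝ} (hu : 0 < u) :
    HasDerivAt (zonBessel n m lam) (zonBessel' n m lam u) u :=
  (((Real.hasDerivAt_rpow_const (Or.inl hu.ne')).mul (hy.hasDerivAt_profile u)).const_mul _)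

theorem bessel_d2 (hy : Zonal n y m lam) {u : ℝ} (hu : 0 < u) :
    HasDerivAt (zonBessel' n m lam) (-((u ^ 2 - zonParam n m) / u ^ 2 * zonBessel n m lam u)) u := by
  have h1 : HasDerivAt (fun u : ℝ => u ^ (n / 2 : ℝ)) ((n / 2 : ℝ) * u ^ (n / 2 - 1 : ℝ)) u :=
    Real.hasDerivAt_rpow_const (Or.inl hu.ne')
  have h2 : HasDerivAt (fun u : ℝ => u ^ (n / 2 - 1 : ℝ)) ((n / 2 - 1 : ℝ) * u ^ (n / 2 - 1 - 1 : ℝ)) u :=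
    Real.hasDerivAt_rpow_const (Or.inl hu.ne')
  have h3 := ((((h2.const_mul (n / 2 : ℝ)).mul (hy.hasDerivAt_profile u)).add
    (h1.mul (hy.hasDerivAt_profile' u))).const_mul (fourConst n))
  refine h3.congr_deriv ?_
  have hode := egf_ode hy.zonSeq_le hy.zonSeq_rec u
  have e1 : u ^ (n / 2 - 1 - 1 : ℝ) = u ^ (n / 2 : ℝ) / u ^ 2 := by
    rw [show (n / 2 - 1 - 1 : ℝ) = n / 2 - 2 by ring, Real.rpow_sub hu, Real.rpow_two]
  have e2 : u ^ (n / 2 - 1 : ℝ) = u ^ (n / 2 : ℝ) / u := by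
    rw [Real.rpow_sub hu, Real.rpow_one]
  rw [e1, e2]
  unfold zonBessel zonParam
  change _ * egf _ u + _ * zonProfile' m lam u + _ * zonProfile m lam u = 0 at hode
  generalize zonProfile m lam u = A0 at *
  generalize zonProfile' m lam u = A1 at *
  generalize egf (fun k => zonSeq m lam (k + 2)) u = A2 at *
  generalize u ^ (n / 2 : ℝ) = w at *
  field_simp
  linear_combination 4 * fourConst n * w * hode

theorem bessel_continuousAt_zero (hy : Zonal n y m lam) : ContinuousAt (zonBessel n m lam) 0 := by
  have h1 : ContinuousAt (fun u : ℝ => u ^ (n / 2 : ℝ)) 0 :=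
    Real.continuousAt_rpow_const _ _ (Or.inr (by positivity))
  exact continuousAt_const.mul (h1.mul hy.continuous_profile.continuousAt)

theorem bessel_zero (hy : Zonal n y m lam) (hc : 0 < zonParam n m) :
    Tendsto (zonBessel n m lam) (𝓝[>] 0) (𝓝 0) := by
  have h := hy.bessel_continuousAt_zero.tendsto
  have h0 : zonBessel n m lam 0 = 0 := by
    unfold zonBessel
    rcases Nat.eq_zero_or_pos n with hn | hn
    · have hm : 0 < m := by
        rcases Nat.eq_zero_or_pos m with hm | hm
        · subst hn hm; simp [zonParam] at hc
        · exact hm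
      have : zonProfile m lam 0 = 0 := by
        unfold zonProfile
        rw [egf_zero, zonSeq, hy.small 0 hm, mul_zero]
      rw [this]; ring
    · rw [Real.zero_rpow (by positivity)]; ring
  rw [h0] at h
  exact h.mono_left nhdsWithin_le_nhds

theorem bessel_wr (hy : Zonal n y m lam) {ρ ρ' : ℝ} (hρ : 0 < ρ) (hρ' : 0 < ρ') :
    Tendsto (fun r => ρ * zonBessel' n m lam (r * ρ) * zonBessel n m lam (r * ρ') -
      ρ' * zonBessel n m lam (r * ρ) * zonBessel' n m lam (r * ρ')) (𝓝[>] 0) (𝓝 0) := by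
  set W : ℝ → ℝ := fun r => fourConst n ^ 2 * ((r * ρ) ^ (n / 2 : ℝ) * (r * ρ') ^ (n / 2 : ℝ)) *
    (ρ * zonProfile' m lam (r * ρ) * zonProfile m lam (r * ρ') -
      ρ' * zonProfile m lam (r * ρ) * zonProfile' m lam (r * ρ')) with hW
  have hc := hy.continuous_profile
  have hc' := hy.continuous_profile'
  have hWc : ContinuousAt W 0 := by
    have h1 : ∀ ρ : ℝ, ContinuousAt (fun r : ℝ => (r * ρ) ^ (n / 2 : ℝ)) 0 := fun ρ => by
      have : ContinuousAt (fun r : ℝ => r * ρ) 0 := by fun_prop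
      exact this.rpow_const (Or.inr (by positivity))
    have h2 := h1 ρ
    have h3 := h1 ρ'
    have h4 : Continuous fun r : ℝ => ρ * zonProfile' m lam (r * ρ) * zonProfile m lam (r * ρ') -
      ρ' * zonProfile m lam (r * ρ) * zonProfile' m lam (r * ρ') := by fun_prop
    exact (continuousAt_const.mul (h2.mul h3)).mul h4.continuousAt
  have hW0 : W 0 = 0 := by
    simp only [hW, zero_mul]
    have : zonProfile' m lam 0 * zonProfile m lam 0 = 0 := by
      unfold zonProfile zonProfile'
      rw [egf_zero, egf_zero]
      unfold zonSeq
      rcases Nat.even_or_odd m with h | h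
      · rw [hy.odd 1 (h.add_odd (by decide))]; ring
      · rw [hy.odd 0 (by simpa using h)]; ring
    linear_combination (fourConst n ^ 2 * ((0:ℝ) ^ (n / 2 : ℝ) * 0 ^ (n / 2 : ℝ)) * (ρ - ρ')) * this
  have h := hWc.tendsto
  rw [hW0] at h
  refine (h.mono_left nhdsWithin_le_nhds).congr' ?_
  filter_upwards [self_mem_nhdsWithin] with r hr
  have hr : 0 < r := hr
  have e : ∀ {ρ : ℝ}, 0 < ρ → (r * ρ) ^ (n / 2 - 1 : ℝ) = (r * ρ) ^ (n / 2 : ℝ) / (r * ρ) := fun hρ => by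
    rw [Real.rpow_sub (by positivity), Real.rpow_one]
  simp only [hW, zonBessel, zonBessel', e hρ, e hρ']
  field_simp
  ring

theorem bessel_bd (hy : Zonal n y m lam) {u : ℝ} (hu : 0 < u) :
    |zonBessel n m lam u| ≤ fourConst n * sphArea n * u ^ (n / 2 : ℝ) := by
  unfold zonBessel
  have hw : 0 < u ^ (n / 2 : ℝ) := Real.rpow_pos_of_pos hu _
  have hC := fourConst_pos n
  rw [abs_mul, abs_mul, abs_of_pos hC, abs_of_pos hw]
  have := hy.profile_le u
  calc _ ≤ fourConst n * (u ^ (n / 2 : ℝ) * sphArea n) := by gcongr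
    _ = _ := by ring

theorem measurable_bessel (hy : Zonal n y m lam) : Measurable (zonBessel n m lam) := by
  have := hy.continuous_profile.measurable
  unfold zonBessel
  fun_prop

end Zonal

end ZonalBessel

section Plancherel

open FourierTransform SchwartzMap

variable {d : ℕ}

theorem fourier_toLp_ae_eq {G : Euc d → ℂ} (h1 : Integrable G) (h2 : MemLp G 2 volume) :
    (𝓕 (h2.toLp G) : Lp ℂ 2 (volume : Measure (Euc d))) =ᵐ[volume] 𝓕 G := by
  have hcont : Continuous (𝓕 G) :=
    VectorFourier.fourierIntegral_continuous Real.continuous_fourierChar continuous_inner h1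
  refine ae_eq_of_integral_contDiff_smul_eq ((Lp.memLp _).locallyIntegrable one_le_two)
    hcont.locallyIntegrable fun φ hφ hφc => ?_
  have hg₁ : HasCompactSupport (Complex.ofRealCLM ∘ φ) := hφc.comp_left rfl
  have hg₂ : ContDiff ℝ (⊤ : ℕ∞) (Complex.ofRealCLM ∘ φ) := by fun_prop
  set ψ := hg₁.toSchwartzMap hg₂ with hψ
  have e1 := congrArg (fun T => T ψ) (Lp.fourier_toTemperedDistribution_eq (h2.toLp G))
  simp only [TemperedDistribution.fourier_apply, Lp.toTemperedDistribution_apply] at e1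
  have e2 : ∫ x, φ x • (𝓕 (h2.toLp G) : Lp ℂ 2 (volume : Measure (Euc d))) x =
      ∫ x, ψ x • (𝓕 (h2.toLp G) : Lp ℂ 2 (volume : Measure (Euc d))) x := by
    congr 1
  have e3 : ∫ x, (𝓕 ψ) x • (h2.toLp G) x = ∫ x, (𝓕 ψ) x • G x := by
    refine integral_congr_ae ?_
    filter_upwards [h2.coeFn_toLp] with x hx
    rw [hx]
  have e4 : ∫ x, (𝓕 ψ) x • G x = ∫ x, ψ x • 𝓕 G x := by
    have := VectorFourier.integral_fourierIntegral_smul_eq_flip (L := innerₗ (Euc d)) (f := ψ) (g := G)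
      (μ := volume) (ν := volume) Real.continuous_fourierChar continuous_inner ψ.integrable h1
    rw [flip_innerₗ] at this
    exact this
  rw [e2, ← e1, e3, e4]
  congr 1

theorem lintegral_enorm_sq_eq_eLpNorm {X : Type*} [MeasurableSpace X] {μ : Measure X} (F : X → ℂ) :
    ∫⁻ x, ‖F x‖ₑ ^ 2 ∂μ = eLpNorm F 2 μ ^ 2 := by
  rw [eLpNorm_eq_lintegral_rpow_enorm_toReal (by norm_num) (by norm_num)]
  simp only [ENNReal.toReal_ofNat, ENNReal.rpow_ofNat, one_div]
  rw [← ENNReal.rpow_natCast, ← ENNReal.rpow_mul]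
  norm_num

theorem lintegral_fourier_sq {G : Euc d → ℂ} (h1 : Integrable G) (h2 : MemLp G 2 volume) :
    ∫⁻ x, ‖∫ ξ, Complex.exp (Complex.I * ((⟪x, ξ⟫ : ℝ) : ℂ)) * G ξ‖ₑ ^ 2 =
      ENNReal.ofReal ((2 * Real.pi) ^ d) * ∫⁻ ξ, ‖G ξ‖ₑ ^ 2 := by
  have hpi := Real.pi_pos
  have hcont : Continuous (𝓕 G) :=
    VectorFourier.fourierIntegral_continuous Real.continuous_fourierChar continuous_inner h1
  set c : ℝ := -(2 * Real.pi)⁻¹ with hc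
  have hc0 : c ≠ 0 := by rw [hc]; exact neg_ne_zero.mpr (by positivity)
  have e1 : ∀ x, ∫ ξ, Complex.exp (Complex.I * ((⟪x, ξ⟫ : ℝ) : ℂ)) * G ξ = 𝓕 G (c • x) := by
    intro x
    rw [Real.fourier_eq']
    congr 1; ext ξ
    rw [smul_eq_mul, inner_smul_right, mul_comm Complex.I, real_inner_comm]
    congr 4
    rw [hc]; field_simp
  simp_rw [e1]
  have hm : Measurable fun x => ‖𝓕 G x‖ₑ ^ 2 := by fun_prop
  rw [← lintegral_map hm (measurable_const_smul c), Measure.map_addHaar_smul _ hc0, lintegral_smul_measure,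
    finrank_euclideanSpace_fin, smul_eq_mul]
  congr 1
  · congr 1
    rw [hc, neg_pow, abs_inv, abs_mul, abs_pow, abs_neg, abs_one, one_pow, one_mul, abs_of_pos (by positivity),
      inv_pow, inv_inv]
  · rw [lintegral_enorm_sq_eq_eLpNorm, lintegral_enorm_sq_eq_eLpNorm,
      ← eLpNorm_congr_ae (fourier_toLp_ae_eq h1 h2), ← eLpNorm_congr_ae h2.coeFn_toLp,
      ← Lp.enorm_def, ← Lp.enorm_def, ← ofReal_norm, ← ofReal_norm, Lp.norm_fourier_eq]

end Plancherel

section Radial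

variable {n : ℕ} {ι : Type*} [Fintype ι]

/-- The oscillatory integral `∫ e^{ix·ξ} m(|x|,|ξ|) g(ξ) dξ`. -/
def radOp {d : ℕ} (m : ℝ → ℝ → ℝ) (g : Euc d → ℂ) (x : Euc d) : ℂ :=
  ∫ ξ, Complex.exp (Complex.I * ((⟪x, ξ⟫ : ℝ) : ℂ)) * ((m ‖x‖ ‖ξ‖ : ℂ) * g ξ)

theorem measurable_radOp {d : ℕ} {m : ℝ → ℝ → ℝ} (hm : Measurable (Function.uncurry m)) {g : Euc d → ℂ}
    (hg : Measurable g) : Measurable (radOp m g) := by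
  have h1 : Measurable fun p : Euc d × Euc d => m ‖p.1‖ ‖p.2‖ :=
    hm.comp (by fun_prop : Measurable fun p : Euc d × Euc d => (‖p.1‖, ‖p.2‖))
  have : StronglyMeasurable (Function.uncurry fun x ξ : Euc d =>
      Complex.exp (Complex.I * ((⟪x, ξ⟫ : ℝ) : ℂ)) * ((m ‖x‖ ‖ξ‖ : ℂ) * g ξ)) := by
    apply Measurable.stronglyMeasurable
    unfold Function.uncurry
    fun_prop
  exact this.integral_prod_right.measurable

theorem integrable_radOp {d : ℕ} {m : ℝ → ℝ → ℝ} (hm : Measurable (Function.uncurry m))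
    (hm1 : ∀ r ρ, |m r ρ| ≤ 1) {g : Euc d → ℂ} (hg : Integrable g) (x : Euc d) :
    Integrable fun ξ => Complex.exp (Complex.I * ((⟪x, ξ⟫ : ℝ) : ℂ)) * ((m ‖x‖ ‖ξ‖ : ℂ) * g ξ) := by
  have h1 : Measurable fun ξ : Euc d => m ‖x‖ ‖ξ‖ := hm.of_uncurry_left.comp measurable_norm
  have hgm := hg.aestronglyMeasurable
  refine hg.norm.mono' ?_ (Eventually.of_forall fun ξ => ?_)
  · exact AEStronglyMeasurable.mul (by fun_prop)
      (AEStronglyMeasurable.mul (Complex.measurable_ofReal.comp h1).aestronglyMeasurable hgm)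
  · rw [norm_mul, mul_comm Complex.I, Complex.norm_exp_ofReal_mul_I, one_mul, norm_mul, Complex.norm_real]
    exact mul_le_of_le_one_left (norm_nonneg _) (hm1 _ _)

theorem lintegral_sph_sum {y : ι → C(Sph n, ℝ)} [DecidableEq ι]
    (hy : ∀ i j, ∫ θ, y i θ * y j θ ∂(sphMeas n) = if i = j then 1 else 0) (z : ι → ℂ) :
    ∫⁻ θ, ‖∑ i, z i * (y i θ : ℂ)‖ₑ ^ 2 ∂(sphMeas n) = ENNReal.ofReal (∑ i, ‖z i‖ ^ 2) := by
  have hre : ∀ w : ι → ℝ, ∫ θ, (∑ i, w i * y i θ) ^ 2 ∂(sphMeas n) = ∑ i, w i ^ 2 := by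
    intro w
    have : ∀ θ, (∑ i, w i * y i θ) ^ 2 = ∑ i, ∑ j, w i * w j * (y i θ * y j θ) := by
      intro θ
      rw [pow_two, Finset.sum_mul_sum]
      refine Finset.sum_congr rfl fun i _ => Finset.sum_congr rfl fun j _ => ?_
      ring
    simp_rw [this]
    rw [integral_finsetSum _ fun i _ => integrable_sph (by fun_prop)]
    refine Finset.sum_congr rfl fun i _ => ?_
    rw [integral_finsetSum _ fun j _ => integrable_sph (by fun_prop)]
    simp_rw [integral_const_mul, hy]
    simp [pow_two]
  have hpt : ∀ θ, ‖∑ i, z i * (y i θ : ℂ)‖ₑ ^ 2 = ENNReal.ofReal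
      ((∑ i, (z i).re * y i θ) ^ 2 + (∑ i, (z i).im * y i θ) ^ 2) := by
    intro θ
    rw [← ofReal_norm, ← ENNReal.ofReal_pow (norm_nonneg _), ← Complex.normSq_eq_norm_sq, Complex.normSq_apply,
      Complex.re_sum, Complex.im_sum]
    simp only [Complex.mul_re, Complex.mul_im, Complex.ofReal_re, Complex.ofReal_im, mul_zero, sub_zero,
      zero_add, pow_two]
  simp_rw [hpt]
  rw [← ofReal_integral_eq_lintegral_ofReal (integrable_sph (by fun_prop))
    (Eventually.of_forall fun θ => by positivity),
    integral_add (integrable_sph (by fun_prop)) (integrable_sph (by fun_prop)), hre, hre,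
    ← Finset.sum_add_distrib]
  congr 1
  refine Finset.sum_congr rfl fun i _ => ?_
  rw [← Complex.normSq_eq_norm_sq, Complex.normSq_apply]; ring

theorem lintegral_enorm_sq_radial {y : ι → C(Sph n, ℝ)} [DecidableEq ι]
    (hy : ∀ i j, ∫ θ, y i θ * y j θ ∂(sphMeas n) = if i = j then 1 else 0)
    {F : Euc (n + 1) → ℂ} (hF : Measurable F) {z : ι → ℝ → ℂ}
    (hz : ∀ r > 0, ∀ ω : Sph n, F (r • ω.1) = ∑ i, (r ^ (-(n / 2) : ℝ) : ℝ) * z i r * (y i ω : ℂ)) :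
    ∫⁻ x, ‖F x‖ₑ ^ 2 = ∫⁻ r in Set.Ioi 0, ENNReal.ofReal (∑ i, ‖z i r‖ ^ 2) := by
  rw [lintegral_polar (by fun_prop)]
  refine setLIntegral_congr_fun measurableSet_Ioi fun r hr => ?_
  have hr : 0 < r := hr
  simp_rw [hz r hr]
  rw [lintegral_sph_sum hy, ← ENNReal.ofReal_mul (by positivity)]
  congr 1
  rw [Finset.mul_sum]
  refine Finset.sum_congr rfl fun i _ => ?_
  rw [norm_mul, mul_pow, Complex.norm_real, Real.norm_of_nonneg (by positivity), ← mul_assoc]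
  have : r ^ n * (r ^ (-(n / 2) : ℝ)) ^ 2 = 1 := by
    rw [← Real.rpow_natCast (r ^ (-(n / 2) : ℝ)), ← Real.rpow_mul hr.le, ← Real.rpow_natCast r n,
      ← Real.rpow_add hr]
    have : (n:ℝ) + -(n / 2) * ((2:ℕ):ℝ) = 0 := by push_cast; ring
    rw [this, Real.rpow_zero]
  rw [this, one_mul]

theorem radOp_radial {y : ι → C(Sph n, ℝ)} {deg : ι → ℕ} {lam : ι → ℕ → ℝ}
    (hy : ∀ i, Zonal n (y i) (deg i) (lam i)) {m : ℝ → ℝ → ℝ} (hm : Measurable (Function.uncurry m))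
    (hm1 : ∀ r ρ, |m r ρ| ≤ 1) {G : Euc (n + 1) → ℂ} (hG : Integrable G) {h : ι → ℝ → ℝ}
    (hGh : ∀ r > 0, ∀ ω : Sph n, G (r • ω.1) = ∑ i, (r ^ (-(n / 2) : ℝ) : ℝ) * (h i r : ℂ) * (y i ω : ℂ))
    (h0 : ∀ i, ∀ ρ ≤ 0, h i ρ = 0) {r : ℝ} (hr : 0 < r) (ω : Sph n)
    (hintg : ∀ i, Integrable fun ρ => m r ρ * (zonBessel n (deg i) (lam i) (r * ρ) * h i ρ)) :
    radOp m G (r • ω.1) = ∑ i, (r ^ (-(n / 2) : ℝ) : ℝ) * (Complex.I ^ deg i * ((fourConst n)⁻¹ *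
      ∫ ρ, m r ρ * (zonBessel n (deg i) (lam i) (r * ρ) * h i ρ) : ℝ)) * (y i ω : ℂ) := by
  have hnorm : ‖r • ω.1‖ = r := by rw [norm_smul, norm_sph, mul_one, Real.norm_of_nonneg hr.le]
  unfold radOp
  rw [integral_polar (integrable_radOp hm hm1 hG _), hnorm]
  have key : ∀ ρ ∈ Set.Ioi (0:ℝ), ρ ^ n • ∫ θ : Sph n, Complex.exp (Complex.I * ((⟪r • ω.1, ρ • θ.1⟫ : ℝ) : ℂ)) *
        ((m r ‖ρ • θ.1‖ : ℂ) * G (ρ • θ.1)) ∂(sphMeas n) =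
      ∑ i, ((r ^ (-(n / 2) : ℝ) * (fourConst n)⁻¹ : ℝ) * Complex.I ^ deg i * (y i ω : ℂ)) *
        ((m r ρ * (zonBessel n (deg i) (lam i) (r * ρ) * h i ρ) : ℝ) : ℂ) := by
    intro ρ hρ
    have hρ : 0 < ρ := hρ
    have e1 : ∀ θ : Sph n, Complex.exp (Complex.I * ((⟪r • ω.1, ρ • θ.1⟫ : ℝ) : ℂ)) *
        ((m r ‖ρ • θ.1‖ : ℂ) * G (ρ • θ.1)) = ∑ i, ((m r ρ * ρ ^ (-(n / 2) : ℝ) * h i ρ : ℝ) : ℂ) *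
          (Complex.exp (Complex.I * ((r * ρ * ⟪ω.1, θ.1⟫ : ℝ) : ℂ)) * (y i θ : ℂ)) := by
      intro θ
      rw [hGh ρ hρ, inner_smul_left, inner_smul_right, norm_smul, norm_sph, mul_one, Real.norm_of_nonneg hρ.le,
        Finset.mul_sum, Finset.mul_sum]
      refine Finset.sum_congr rfl fun i _ => ?_
      simp only [conj_trivial]
      rw [← mul_assoc r ρ]
      push_cast; ring
    simp_rw [e1]
    rw [integral_finsetSum _ fun i _ => integrable_sph (by fun_prop), Finset.smul_sum]
    refine Finset.sum_congr rfl fun i _ => ?_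
    rw [integral_const_mul, (hy i).integral_exp, zonBessel, Complex.real_smul]
    have e2 : ρ ^ n * ρ ^ (-(n / 2) : ℝ) = ρ ^ (n / 2 : ℝ) := by
      rw [← Real.rpow_natCast, ← Real.rpow_add hρ]; congr 1; ring
    have e3 : (r * ρ) ^ (n / 2 : ℝ) * r ^ (-(n / 2) : ℝ) = ρ ^ (n / 2 : ℝ) := by
      rw [Real.mul_rpow hr.le hρ.le, mul_comm, ← mul_assoc, ← Real.rpow_add hr]; simp
    have e4 : (fourConst n)⁻¹ * fourConst n = 1 := inv_mul_cancel₀ (fourConst_pos n).ne'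
    have e5 : ρ ^ n * (m r ρ * ρ ^ (-(n / 2) : ℝ) * h i ρ) * zonProfile (deg i) (lam i) (r * ρ) =
        (r ^ (-(n / 2) : ℝ) * (fourConst n)⁻¹) * (m r ρ * (fourConst n * ((r * ρ) ^ (n / 2 : ℝ) *
          zonProfile (deg i) (lam i) (r * ρ)) * h i ρ)) := by
      linear_combination (m r ρ * h i ρ * zonProfile (deg i) (lam i) (r * ρ)) * (e2 - e3 -
        ((r * ρ) ^ (n / 2 : ℝ) * r ^ (-(n / 2) : ℝ)) * e4)
    have e6 := congrArg (fun t : ℝ => (t : ℂ)) e5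
    push_cast at e6 ⊢
    linear_combination (Complex.I ^ deg i * (y i ω : ℂ)) * e6
  rw [setIntegral_congr_fun measurableSet_Ioi key, integral_finsetSum]
  · refine Finset.sum_congr rfl fun i _ => ?_
    rw [integral_const_mul, integral_complex_ofReal, setIntegral_eq_integral_of_forall_compl_eq_zero]
    · push_cast; ring
    · intro ρ hρ
      rw [h0 i ρ (not_lt.mp hρ)]; ring
  · intro i _
    exact ((hintg i).integrableOn.ofReal).const_mul _

end Radial

section Zonal

variable {n : ℕ} {ι : Type*} [Fintype ι]

theorem Zonal.integrable_kernel {y : C(Sph n, ℝ)} {deg : ℕ} {lam : ℕ → ℝ} (hy : Zonal n y deg lam)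
    {h : ℝ → ℝ} (hh : Adm h) {r : ℝ} (hr : 0 < r) {m : ℝ → ℝ} (hm : Measurable m) (hm1 : ∀ ρ, |m ρ| ≤ 1) :
    Integrable fun ρ => m ρ * (zonBessel n deg lam (r * ρ) * h ρ) := by
  obtain ⟨hhm, a, b, M, ha, hM, h0⟩ := hh
  have hb := hy.measurable_bessel
  have hfin : Integrable (Set.indicator (Set.Icc a b)
      fun _ : ℝ => 1 * (fourConst n * sphArea n * (r * b) ^ (n / 2 : ℝ) * M)) :=
    (integrable_indicator_iff measurableSet_Icc).mpr (integrableOn_const (by simp))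
  refine hfin.mono' (by fun_prop) (Eventually.of_forall fun ρ => ?_)
  by_cases hρ : ρ ∈ Set.Icc a b
  · have hρ0 : 0 < ρ := ha.trans_le hρ.1
    rw [Set.indicator_of_mem hρ, Real.norm_eq_abs, abs_mul, abs_mul]
    have h1 := hy.bessel_bd (mul_pos hr hρ0)
    have hK : 0 ≤ fourConst n * sphArea n := by
      have h2 := (abs_nonneg _).trans h1
      exact nonneg_of_mul_nonneg_left h2 (by positivity)
    have h3 : (r * ρ) ^ (n / 2 : ℝ) ≤ (r * b) ^ (n / 2 : ℝ) := by
      have := hρ.2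
      gcongr
    have h4 : |zonBessel n deg lam (r * ρ)| ≤ fourConst n * sphArea n * (r * b) ^ (n / 2 : ℝ) :=
      h1.trans (mul_le_mul_of_nonneg_left h3 hK)
    exact mul_le_mul (hm1 ρ) (mul_le_mul h4 (hM ρ) (abs_nonneg _) ((abs_nonneg _).trans h4)) (by positivity)
      zero_le_one
  · rw [Set.indicator_of_notMem hρ, h0 ρ hρ]; simp

theorem Adm.eq_zero_of_nonpos {h : ℝ → ℝ} (hh : Adm h) {ρ : ℝ} (hρ : ρ ≤ 0) : h ρ = 0 := by
  obtain ⟨-, a, b, M, ha, -, h0⟩ := hh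
  exact h0 ρ fun hmem => (ha.trans_le hmem.1).not_ge hρ

theorem lintegral_sq_of_radial {y : ι → C(Sph n, ℝ)} [DecidableEq ι]
    (hortho : ∀ i j, ∫ θ, y i θ * y j θ ∂(sphMeas n) = if i = j then 1 else 0)
    {G : Euc (n + 1) → ℂ} (hGm : Measurable G) {h : ι → ℝ → ℝ} (hh : ∀ i, Adm (h i))
    (hGh : ∀ r > 0, ∀ ω : Sph n, G (r • ω.1) = ∑ i, (r ^ (-(n / 2) : ℝ) : ℝ) * (h i r : ℂ) * (y i ω : ℂ)) :
    ∫⁻ x, ‖G x‖ₑ ^ 2 = ∑ i, ∫⁻ ρ, ENNReal.ofReal (h i ρ ^ 2) := by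
  have hmeas : ∀ i, Measurable (h i) := fun i => (hh i).1
  rw [lintegral_enorm_sq_radial hortho hGm (z := fun i r => (h i r : ℂ)) hGh]
  simp_rw [Complex.norm_real, Real.norm_eq_abs, sq_abs]
  simp_rw [ENNReal.ofReal_sum_of_nonneg (fun i _ => sq_nonneg (h i _))]
  rw [lintegral_finsetSum _ fun i _ => by fun_prop]
  refine Finset.sum_congr rfl fun i _ => ?_
  rw [← lintegral_indicator measurableSet_Ioi]
  refine lintegral_congr fun ρ => ?_
  by_cases hρ : ρ ∈ Set.Ioi 0
  · rw [Set.indicator_of_mem hρ]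
  · rw [Set.indicator_of_notMem hρ, (hh i).eq_zero_of_nonpos (not_lt.mp (by simpa using hρ))]; simp

theorem lintegral_radOp_of_radial {y : ι → C(Sph n, ℝ)} [DecidableEq ι] {deg : ι → ℕ} {lam : ι → ℕ → ℝ}
    (hy : ∀ i, Zonal n (y i) (deg i) (lam i))
    (hortho : ∀ i j, ∫ θ, y i θ * y j θ ∂(sphMeas n) = if i = j then 1 else 0)
    {m : ℝ → ℝ → ℝ} (hm : Measurable (Function.uncurry m))
    (hm1 : ∀ r ρ, |m r ρ| ≤ 1) {G : Euc (n + 1) → ℂ} (hG : Integrable G) (hGm : Measurable G) {h : ι → ℝ → ℝ}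
    (hh : ∀ i, Adm (h i))
    (hGh : ∀ r > 0, ∀ ω : Sph n, G (r • ω.1) = ∑ i, (r ^ (-(n / 2) : ℝ) : ℝ) * (h i r : ℂ) * (y i ω : ℂ)) :
    ∫⁻ x, ‖radOp m G x‖ₑ ^ 2 = ENNReal.ofReal ((2 * Real.pi) ^ (n + 1)) * ∑ i, ∫⁻ r in Set.Ioi 0,
      ENNReal.ofReal ((∫ ρ, m r ρ * (zonBessel n (deg i) (lam i) (r * ρ) * h i ρ)) ^ 2) := by
  have hmeas : ∀ i, Measurable (h i) := fun i => (hh i).1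
  have hbm := fun i => (hy i).measurable_bessel
  have hpi := Real.pi_pos
  have hmr : ∀ r, Measurable (m r) := fun r => hm.of_uncurry_left
  have hIm : ∀ i, Measurable fun r => ∫ ρ, m r ρ * (zonBessel n (deg i) (lam i) (r * ρ) * h i ρ) := by
    intro i
    have : StronglyMeasurable (Function.uncurry fun r ρ : ℝ =>
        m r ρ * (zonBessel n (deg i) (lam i) (r * ρ) * h i ρ)) := by
      apply Measurable.stronglyMeasurable
      refine hm.mul (Measurable.mul ((hbm i).comp ?_) ((hmeas i).comp measurable_snd))
      fun_prop
    exact this.integral_prod_right.measurable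
  rw [lintegral_enorm_sq_radial hortho (measurable_radOp hm hGm) (fun r hr ω =>
    radOp_radial hy hm hm1 hG hGh (fun i ρ hρ => (hh i).eq_zero_of_nonpos hρ) hr ω
      fun i => (hy i).integrable_kernel (hh i) hr (hmr r) (hm1 r))]
  have hc : ((fourConst n)⁻¹) ^ 2 = (2 * Real.pi) ^ (n + 1) := by
    rw [fourConst, inv_inv, Real.sq_sqrt (by positivity)]
  simp_rw [norm_mul, norm_pow, Complex.norm_I, one_pow, one_mul, Complex.norm_real, Real.norm_eq_abs, sq_abs,
    mul_pow, hc, ← Finset.mul_sum]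
  simp_rw [ENNReal.ofReal_mul (show 0 ≤ (2 * Real.pi) ^ (n + 1) by positivity)]
  rw [lintegral_const_mul _ (by fun_prop)]
  congr 1
  · rw [mul_pow]
  refine (lintegral_congr fun r => ENNReal.ofReal_sum_of_nonneg fun i _ => sq_nonneg _).trans ?_
  rw [lintegral_finsetSum _ fun i _ => by fun_prop]

theorem integrable_memLp_of_bounded_support {d : ℕ} {G : Euc d → ℂ} (hG : Measurable G) {b B : ℝ}
    (hB : ∀ x, ‖G x‖ ≤ B) (h0 : ∀ x, b < ‖x‖ → G x = 0) : Integrable G ∧ MemLp G 2 volume := by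
  have hs : Function.support G ⊆ Metric.closedBall 0 b := by
    intro x hx
    rw [mem_closedBall_zero_iff]
    by_contra h
    exact hx (h0 x (not_le.mp h))
  have h1 : Integrable G :=
    (integrableOn_iff_integrable_of_support_subset hs).mp
      (Measure.integrableOn_of_bounded (M := B) (measure_closedBall_lt_top).ne hG.aestronglyMeasurable
        (Eventually.of_forall hB))
  refine ⟨h1, (memLp_two_iff_integrable_sq_norm hG.aestronglyMeasurable).mpr ?_⟩
  refine (h1.norm.const_mul B).mono' (by fun_prop) (Eventually.of_forall fun x => ?_)
  rw [Real.norm_of_nonneg (by positivity), pow_two]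
  exact mul_le_mul_of_nonneg_right (hB x) (norm_nonneg _)

/-- The function `|ξ|^{-n/2} h(|ξ|) y(ξ/|ξ|)`. -/
theorem exists_radial_extension (y : C(Sph n, ℝ)) {h : ℝ → ℝ} (hh : Adm h) :
    ∃ G : Euc (n + 1) → ℂ, Measurable G ∧ Integrable G ∧ MemLp G 2 volume ∧
      ∀ r > 0, ∀ ω : Sph n, G (r • ω.1) = (r ^ (-(n / 2) : ℝ) : ℝ) * (h r : ℂ) * (y ω : ℂ) := by
  obtain ⟨Y, hY⟩ := ContinuousMap.exists_restrict_eq (Metric.isClosed_sphere (x := (0 : Euc (n + 1))) (ε := 1)) y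
  have hYy : ∀ ω : Sph n, Y ω.1 = y ω := fun ω => by rw [← hY]; rfl
  obtain ⟨hhm, a, b, M, ha, hM, h0⟩ := id hh
  set G : Euc (n + 1) → ℂ := fun ξ => (‖ξ‖ ^ (-(n / 2) : ℝ) : ℝ) * (h ‖ξ‖ : ℂ) * (Y (‖ξ‖⁻¹ • ξ) : ℂ) with hG
  have hGm : Measurable G := by
    have : Measurable Y := Y.continuous.measurable
    have h2 : Measurable fun ξ : Euc (n + 1) => Y (‖ξ‖⁻¹ • ξ) := this.comp (by fun_prop)
    fun_prop
  have hM0 : 0 ≤ M := (abs_nonneg _).trans (hM 0)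
  have hb := integrable_memLp_of_bounded_support (b := b) (B := a ^ (-(n / 2) : ℝ) * M * ‖y‖) hGm ?_ ?_
  · refine ⟨G, hGm, hb.1, hb.2, fun r hr ω => ?_⟩
    have : ‖r • ω.1‖ = r := by rw [norm_smul, norm_sph, mul_one, Real.norm_of_nonneg hr.le]
    rw [hG]
    simp only [this, smul_smul, inv_mul_cancel₀ hr.ne', one_smul, hYy]
  · intro ξ
    by_cases hξ : ‖ξ‖ ∈ Set.Icc a b
    · have hξ0 : 0 < ‖ξ‖ := ha.trans_le hξ.1
      have hs : ‖ξ‖⁻¹ • ξ ∈ Metric.sphere (0 : Euc (n + 1)) 1 := by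
        rw [mem_sphere_zero_iff_norm, norm_smul, norm_inv, norm_norm, inv_mul_cancel₀ hξ0.ne']
      have hY1 : |Y (‖ξ‖⁻¹ • ξ)| ≤ ‖y‖ := by
        rw [show Y (‖ξ‖⁻¹ • ξ) = y ⟨_, hs⟩ from hYy ⟨_, hs⟩]
        exact y.norm_coe_le_norm _
      rw [hG]
      simp only [norm_mul, Complex.norm_real, Real.norm_eq_abs]
      rw [abs_of_nonneg (by positivity : 0 ≤ ‖ξ‖ ^ (-(n / 2) : ℝ))]
      have h5 : ‖ξ‖ ^ (-(n / 2) : ℝ) ≤ a ^ (-(n / 2) : ℝ) :=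
        Real.rpow_le_rpow_of_nonpos ha hξ.1 (by have : (0:ℝ) ≤ n := n.cast_nonneg; linarith)
      have := hM ‖ξ‖
      gcongr
    · rw [hG]
      simp only [h0 _ hξ]
      simp only [Complex.ofReal_zero, mul_zero, zero_mul, norm_zero]
      positivity
  · intro ξ hξ
    rw [hG]
    simp only [h0 _ (fun hc : ‖ξ‖ ∈ Set.Icc a b => hξ.not_ge hc.2)]
    simp

theorem Zonal.bessel_iso {y : C(Sph n, ℝ)} {deg : ℕ} {lam : ℕ → ℝ} (hy : Zonal n y deg lam)
    {h : ℝ → ℝ} (hh : Adm h) :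
    ∫⁻ r in Set.Ioi 0, ENNReal.ofReal ((∫ ρ, zonBessel n deg lam (r * ρ) * h ρ) ^ 2) =
      ∫⁻ ρ, ENNReal.ofReal (h ρ ^ 2) := by
  obtain ⟨G, hGm, h1, h2, hGh⟩ := exists_radial_extension y hh
  have hpi := Real.pi_pos
  have hort : ∀ i j : Unit, ∫ θ, y θ * y θ ∂(sphMeas n) = if i = j then 1 else 0 := by
    intro i j; simpa using hy.unit
  have e1 := lintegral_sq_of_radial (ι := Unit) (y := fun _ => y) hort hGm (h := fun _ => h) (fun _ => hh)
    (fun r hr ω => by simpa using hGh r hr ω)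
  have e2 := lintegral_radOp_of_radial (ι := Unit) (y := fun _ => y) (deg := fun _ => deg) (lam := fun _ => lam)
    (fun _ => hy) hort (m := fun _ _ => 1) (measurable_const) (by simp) h1 hGm (h := fun _ => h) (fun _ => hh)
    (fun r hr ω => by simpa using hGh r hr ω)
  have e3 := lintegral_fourier_sq h1 h2
  simp only [Finset.univ_unique, Finset.sum_singleton, one_mul] at e1 e2
  unfold radOp at e2
  simp only [Complex.ofReal_one, one_mul] at e2
  rw [e2, e1] at e3
  exact (ENNReal.mul_right_inj (by simp; positivity) ENNReal.ofReal_ne_top).mp e3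

theorem Zonal.besselLike {y : C(Sph n, ℝ)} {m : ℕ} {lam : ℕ → ℝ} (hy : Zonal n y m lam) :
    BesselLike (zonParam n m) (fourConst n * sphArea n) (n / 2) (zonBessel n m lam) (zonBessel' n m lam) where
  hc := Zonal.param_ge n m
  hα := by positivity
  meas := hy.measurable_bessel
  d1 := fun u hu => hy.bessel_d1 hu
  d2 := fun u hu => hy.bessel_d2 hu
  bd := fun u hu => hy.bessel_bd hu
  zero := hy.bessel_zero
  wr := fun ρ hρ ρ' hρ' => hy.bessel_wr hρ hρ'
  iso := fun g hg a b M ha hM h0 => hy.bessel_iso ⟨hg, a, b, M, ha, hM, h0⟩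

end Zonal

section Annulus

variable {n : ℕ}

def annulus (d : ℕ) (a b : ℝ) : Set (Euc d) := {ξ | a ≤ ‖ξ‖ ∧ ‖ξ‖ ≤ b}

theorem isClosed_annulus (d : ℕ) (a b : ℝ) : IsClosed (annulus d a b) :=
  (isClosed_le continuous_const continuous_norm).inter (isClosed_le continuous_norm continuous_const)

theorem isCompact_annulus (d : ℕ) (a b : ℝ) : IsCompact (annulus d a b) :=
  (isCompact_closedBall (0 : Euc d) b).of_isClosed_subset (isClosed_annulus d a b) fun _ hξ =>
    mem_closedBall_zero_iff.mpr hξ.2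

instance (d : ℕ) (a b : ℝ) : CompactSpace (annulus d a b) := isCompact_iff_compactSpace.mp (isCompact_annulus d a b)

def coordFn (d : ℕ) (a b : ℝ) (j : Fin d) : C(annulus d a b, ℝ) := ⟨fun ξ => ξ.1 j, by fun_prop⟩

def polyAlg (d : ℕ) (a b : ℝ) : Subalgebra ℝ C(annulus d a b, ℝ) :=
  Algebra.adjoin ℝ (Set.range (coordFn d a b))

theorem polyAlg_separatesPoints (d : ℕ) (a b : ℝ) : (polyAlg d a b).SeparatesPoints := by
  intro ξ η hne
  have : ∃ j, ξ.1 j ≠ η.1 j := by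
    by_contra h
    push Not at h
    exact hne (Subtype.ext (by ext j; exact h j))
  obtain ⟨j, hj⟩ := this
  exact ⟨_, ⟨coordFn d a b j, Algebra.subset_adjoin ⟨j, rfl⟩, rfl⟩, hj⟩

theorem sphMono_polar_list {a b : ℝ} (l : List C(annulus (n + 1) a b, ℝ))
    (hl : ∀ q ∈ l, q ∈ Set.range (coordFn (n + 1) a b)) :
    ∃ s : Fin l.length → Fin (n + 1), ∀ (r : ℝ) (ω : Sph n) (h : r • ω.1 ∈ annulus (n + 1) a b),
      l.prod ⟨r • ω.1, h⟩ = r ^ l.length * sphMono s ω := by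
  have : ∀ i : Fin l.length, ∃ j, coordFn (n + 1) a b j = l.get i := fun i => hl _ (List.get_mem l i)
  choose s hs using this
  refine ⟨s, fun r ω h => ?_⟩
  have e : l.prod = ∏ i, l.get i := by
    conv_lhs => rw [← List.ofFn_get l]
    rw [List.prod_ofFn]
  rw [e, ContinuousMap.prod_apply]
  simp_rw [← hs]
  have : ∀ i, coordFn (n + 1) a b (s i) ⟨r • ω.1, h⟩ = r * ω.1 (s i) := fun i => rfl
  simp_rw [this, Finset.prod_mul_distrib, Finset.prod_const, Finset.card_univ, Fintype.card_fin]
  rfl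

theorem polyAlg_polar {a b : ℝ} {q : C(annulus (n + 1) a b, ℝ)} (hq : q ∈ polyAlg (n + 1) a b) :
    ∃ N, ∀ N' ≥ N, ∃ Q : Fin (N' + 1) → C(Sph n, ℝ), (∀ k, Q k ∈ polySpan n N') ∧
      ∀ (r : ℝ) (ω : Sph n) (h : r • ω.1 ∈ annulus (n + 1) a b), q ⟨r • ω.1, h⟩ =
        ∑ k : Fin (N' + 1), r ^ (k : ℕ) * Q k ω := by
  rw [polyAlg, ← Subalgebra.mem_toSubmodule, Algebra.adjoin_eq_span] at hq
  induction hq using Submodule.span_induction with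
  | mem q hmem =>
    obtain ⟨l, hl, rfl⟩ := Submonoid.exists_list_of_mem_closure hmem
    obtain ⟨s, hs⟩ := sphMono_polar_list l hl
    refine ⟨l.length, fun N' hN => ⟨fun k => if (k : ℕ) = l.length then sphMono s else 0, fun k => ?_,
      fun r ω h => ?_⟩⟩
    · dsimp only
      split_ifs
      · exact sphMono_mem hN s
      · exact Submodule.zero_mem _
    · rw [hs, Finset.sum_eq_single (⟨l.length, by omega⟩ : Fin (N' + 1))]
      · simp
      · intro k _ hk
        have : (k : ℕ) ≠ l.length := fun h => hk (Fin.ext h)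
        simp [this]
      · simp
  | zero => exact ⟨0, fun N' _ => ⟨0, fun k => Submodule.zero_mem _, by simp⟩⟩
  | add q₁ q₂ _ _ h₁ h₂ =>
    obtain ⟨N₁, h₁⟩ := h₁
    obtain ⟨N₂, h₂⟩ := h₂
    refine ⟨max N₁ N₂, fun N' hN => ?_⟩
    obtain ⟨Q₁, hQ₁, e₁⟩ := h₁ N' ((le_max_left _ _).trans hN)
    obtain ⟨Q₂, hQ₂, e₂⟩ := h₂ N' ((le_max_right _ _).trans hN)
    refine ⟨fun k => Q₁ k + Q₂ k, fun k => Submodule.add_mem _ (hQ₁ k) (hQ₂ k), fun r ω h => ?_⟩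
    rw [ContinuousMap.add_apply, e₁, e₂, ← Finset.sum_add_distrib]
    simp [mul_add]
  | smul c q _ h =>
    obtain ⟨N, h⟩ := h
    refine ⟨N, fun N' hN => ?_⟩
    obtain ⟨Q, hQ, e⟩ := h N' hN
    refine ⟨fun k => c • Q k, fun k => Submodule.smul_mem _ _ (hQ k), fun r ω h => ?_⟩
    rw [ContinuousMap.smul_apply, e, smul_eq_mul, Finset.mul_sum]
    refine Finset.sum_congr rfl fun k _ => ?_
    rw [ContinuousMap.smul_apply, smul_eq_mul]; ring

/-- Extension by zero of a function on an annulus. -/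
def extZero {d : ℕ} {a b : ℝ} (q : C(annulus d a b, ℝ)) : Euc d → ℝ := Function.extend Subtype.val q 0

theorem extZero_of_mem {d : ℕ} {a b : ℝ} (q : C(annulus d a b, ℝ)) {ξ : Euc d} (h : ξ ∈ annulus d a b) :
    extZero q ξ = q ⟨ξ, h⟩ := Subtype.val_injective.extend_apply q 0 (⟨ξ, h⟩ : annulus d a b)

theorem extZero_of_notMem {d : ℕ} {a b : ℝ} (q : C(annulus d a b, ℝ)) {ξ : Euc d} (h : ξ ∉ annulus d a b) :
    extZero q ξ = 0 := Function.extend_apply' _ _ _ (by rintro ⟨⟨η, hη⟩, rfl⟩; exact h hη)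

theorem measurable_extZero {d : ℕ} {a b : ℝ} (q : C(annulus d a b, ℝ)) : Measurable (extZero q) :=
  (MeasurableEmbedding.subtype_coe (isClosed_annulus d a b).measurableSet).measurable_extend q.continuous.measurable
    measurable_const

theorem integrable_extZero {d : ℕ} {a b : ℝ} (q : C(annulus d a b, ℝ)) :
    Integrable (fun ξ => (extZero q ξ : ℂ)) ∧ MemLp (fun ξ => (extZero q ξ : ℂ)) 2 volume := by
  have := measurable_extZero q
  refine integrable_memLp_of_bounded_support (b := b) (B := ‖q‖) (by fun_prop) (fun ξ => ?_) fun ξ hξ => ?_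
  · rw [Complex.norm_real]
    by_cases h : ξ ∈ annulus d a b
    · rw [extZero_of_mem q h]; exact q.norm_coe_le_norm _
    · rw [extZero_of_notMem q h, norm_zero]; exact norm_nonneg _
  · rw [extZero_of_notMem q fun h => hξ.not_ge h.2, Complex.ofReal_zero]

theorem extZero_radial {a b : ℝ} (ha : 0 < a) {q : C(annulus (n + 1) a b, ℝ)} (hq : q ∈ polyAlg (n + 1) a b) :
    ∃ (M : ℕ) (y : Fin M → C(Sph n, ℝ)) (deg : Fin M → ℕ) (lam : Fin M → ℕ → ℝ) (h : Fin M → ℝ → ℝ),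
      (∀ i, Zonal n (y i) (deg i) (lam i)) ∧
      (∀ i j, ∫ θ, y i θ * y j θ ∂(sphMeas n) = if i = j then 1 else 0) ∧ (∀ i, Adm (h i)) ∧
      ∀ r > 0, ∀ ω : Sph n, (extZero q (r • ω.1) : ℂ) =
        ∑ i, (r ^ (-(n / 2) : ℝ) : ℝ) * (h i r : ℂ) * (y i ω : ℂ) := by
  obtain ⟨N, hN⟩ := polyAlg_polar hq
  obtain ⟨Q, hQ, e⟩ := hN N le_rfl
  obtain ⟨M, y, γ, hort, heig, hmem, hspan⟩ := exists_zonal_basis n N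
  have hz : ∀ i, ∃ m lam, Zonal n (y i) m lam := fun i =>
    exists_zonal (hmem i) (by simpa using hort i i) (heig i)
  choose deg lam hzon using hz
  have hc : ∀ k, ∃ c : Fin M → ℝ, Q k = ∑ i, c i • y i := fun k => hspan _ (hQ k)
  choose c hc using hc
  set H : Fin M → ℝ → ℝ := fun i r => r ^ (n / 2 : ℝ) * ∑ k : Fin (N + 1), r ^ (k : ℕ) * c k i with hH
  have hHm : ∀ i, Measurable (H i) := fun i => by fun_prop
  refine ⟨M, y, deg, lam, fun i => (Set.Icc a b).indicator (H i), hzon, hort, fun i => ?_, fun r hr ω => ?_⟩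
  · have hcont : ContinuousOn (H i) (Set.Icc a b) := by
      refine ContinuousOn.mul (fun r hr => ?_) (by fun_prop)
      exact (Real.continuousAt_rpow_const r _ (Or.inl (ha.trans_le hr.1).ne')).continuousWithinAt
    obtain ⟨B, hB⟩ := isCompact_Icc.exists_bound_of_continuousOn hcont
    refine ⟨(hHm i).indicator measurableSet_Icc, a, b, |B|, ha, fun ρ => ?_, fun ρ hρ =>
      Set.indicator_of_notMem hρ _⟩
    dsimp only
    by_cases hρ : ρ ∈ Set.Icc a b
    · rw [Set.indicator_of_mem hρ]; exact (hB ρ hρ).trans (le_abs_self _)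
    · rw [Set.indicator_of_notMem hρ, abs_zero]; exact abs_nonneg _
  · have hnorm : ‖r • ω.1‖ = r := by rw [norm_smul, norm_sph, mul_one, Real.norm_of_nonneg hr.le]
    by_cases hmem : r • ω.1 ∈ annulus (n + 1) a b
    · have hr' : r ∈ Set.Icc a b := by
        have := hmem; rw [annulus, Set.mem_ofPred_eq, hnorm] at this; exact this
      have hrr : r ^ (-(n / 2) : ℝ) * r ^ (n / 2 : ℝ) = 1 := by
        rw [← Real.rpow_add hr]; simp
      have : extZero q (r • ω.1) = ∑ i, r ^ (-(n / 2) : ℝ) * H i r * y i ω := by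
        rw [extZero_of_mem q hmem, e]
        simp_rw [hc, ContinuousMap.sum_apply, ContinuousMap.smul_apply, smul_eq_mul, Finset.mul_sum]
        rw [Finset.sum_comm]
        refine Finset.sum_congr rfl fun i _ => ?_
        rw [hH]; dsimp only
        rw [← mul_assoc, hrr, one_mul, Finset.sum_mul]
        refine Finset.sum_congr rfl fun k _ => ?_
        ring
      rw [this]
      simp_rw [Set.indicator_of_mem hr']
      push_cast; rfl
    · have hr' : r ∉ Set.Icc a b := by
        have := hmem; rw [annulus, Set.mem_ofPred_eq, hnorm] at this; exact this
      rw [extZero_of_notMem q hmem]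
      simp_rw [Set.indicator_of_notMem hr']
      simp

/-- The cutoff `1_{p(ρ) < r}`. -/
def cutoff (p : ℝ → ℝ) (r ρ : ℝ) : ℝ := if p ρ < r then 1 else 0

theorem measurable_cutoff {p : ℝ → ℝ} (hp : Measurable p) : Measurable (Function.uncurry (cutoff p)) := by
  unfold Function.uncurry cutoff
  exact Measurable.ite (measurableSet_lt (hp.comp measurable_snd) measurable_fst) measurable_const measurable_const

theorem abs_cutoff_le (p : ℝ → ℝ) (r ρ : ℝ) : |cutoff p r ρ| ≤ 1 := by
  unfold cutoff; split_ifs <;> simp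

def radConst (n : ℕ) : ℝ := (2 * Real.pi) ^ (n + 1) * BesselLike.sectorConst (fourConst n * sphArea n) (n / 2)

/-- The hypotheses on the radius of the cutoff. -/
structure CutoffRadius (p : ℝ → ℝ) : Prop where
  meas : Measurable p
  cont : ContinuousOn p (Set.Ioi 0)
  pos : ∀ ρ > 0, 0 < p ρ
  mono : MonotoneOn p (Set.Ioi 0) ∨ AntitoneOn p (Set.Ioi 0)

theorem lintegral_radOp_extZero {p : ℝ → ℝ} (hp : CutoffRadius p) {a b : ℝ} (ha : 0 < a)
    {q : C(annulus (n + 1) a b, ℝ)} (hq : q ∈ polyAlg (n + 1) a b) :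
    ∫⁻ x, ‖radOp (cutoff p) (fun ξ => (extZero q ξ : ℂ)) x‖ₑ ^ 2 ≤
      ENNReal.ofReal (radConst n) * ∫⁻ ξ, ‖(extZero q ξ : ℂ)‖ₑ ^ 2 := by
  obtain ⟨M, y, deg, lam, h, hzon, hort, hh, hG⟩ := extZero_radial ha hq
  have hm := measurable_extZero q
  have hpi := Real.pi_pos
  have hK : 0 ≤ fourConst n * sphArea n := by
    refine mul_nonneg (fourConst_pos n).le ?_
    unfold sphArea; positivity
  rw [lintegral_sq_of_radial (G := fun ξ => (extZero q ξ : ℂ)) hort (by fun_prop) hh hG, lintegral_radOp_of_radial hzon hort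
    (measurable_cutoff hp.meas) (abs_cutoff_le p) (integrable_extZero q).1 (by fun_prop) hh hG, radConst,
    ENNReal.ofReal_mul (by positivity), mul_assoc, Finset.mul_sum Finset.univ _ (ENNReal.ofReal (BesselLike.sectorConst _ _))]
  gcongr
  exact (hzon _).besselLike.lintegral_sector hK (hh _) hp.meas hp.cont hp.pos hp.mono

end Annulus

section Density

variable {n : ℕ}

theorem enorm_radOp_sub_le {d : ℕ} {m : ℝ → ℝ → ℝ} (hm : Measurable (Function.uncurry m))
    (hm1 : ∀ r ρ, |m r ρ| ≤ 1) {g₁ g₂ : Euc d → ℂ} (h₁ : Integrable g₁) (h₂ : Integrable g₂) (x : Euc d) :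
    ‖radOp m g₁ x - radOp m g₂ x‖ₑ ≤ eLpNorm (g₁ - g₂) 1 volume := by
  unfold radOp
  rw [← integral_sub (integrable_radOp hm hm1 h₁ x) (integrable_radOp hm hm1 h₂ x), eLpNorm_one_eq_lintegral_enorm]
  refine (enorm_integral_le_lintegral_enorm _).trans (lintegral_mono fun ξ => ?_)
  rw [← mul_sub, ← mul_sub, ← ofReal_norm, ← ofReal_norm]
  apply ENNReal.ofReal_le_ofReal
  rw [norm_mul, mul_comm Complex.I, Complex.norm_exp_ofReal_mul_I, one_mul, norm_mul, Complex.norm_real]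
  exact mul_le_of_le_one_left (norm_nonneg _) (hm1 _ _)

theorem eLpNorm_le_of_tendsto {d : ℕ} {F : ℕ → Euc d → ℂ} {G : Euc d → ℂ} (hF : ∀ j, Measurable (F j))
    (hlim : ∀ x, Tendsto (fun j => F j x) atTop (𝓝 (G x))) {u : ℕ → ℝ≥0∞} {D : ℝ≥0∞}
    (hu : ∀ j, eLpNorm (F j) 2 volume ≤ u j) (hD : Tendsto u atTop (𝓝 D)) : eLpNorm G 2 volume ≤ D := by
  refine (Lp.eLpNorm_lim_le_liminf_eLpNorm (fun j => (hF j).aestronglyMeasurable) G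
    (Eventually.of_forall hlim)).trans ?_
  rw [← hD.liminf_eq]
  exact liminf_le_liminf (Eventually.of_forall hu)

theorem eLpNorm_radOp_extZero {p : ℝ → ℝ} (hp : CutoffRadius p) {a b : ℝ} (ha : 0 < a)
    {q : C(annulus (n + 1) a b, ℝ)} (hq : q ∈ polyAlg (n + 1) a b) :
    eLpNorm (radOp (cutoff p) fun ξ => (extZero q ξ : ℂ)) 2 volume ≤
      ENNReal.ofReal (√(radConst n)) * eLpNorm (fun ξ => (extZero q ξ : ℂ)) 2 volume := by
  have h := lintegral_radOp_extZero hp ha hq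
  have h0 : 0 ≤ radConst n := by
    have := Real.pi_pos
    unfold radConst BesselLike.sectorConst; positivity
  rw [lintegral_enorm_sq_eq_eLpNorm, lintegral_enorm_sq_eq_eLpNorm (fun ξ => (extZero q ξ : ℂ)),
    ← Real.sq_sqrt h0, ENNReal.ofReal_pow (Real.sqrt_nonneg _), ← mul_pow] at h
  exact (ENNReal.pow_le_pow_left_iff two_ne_zero).mp h

theorem exists_polyAlg_near {d : ℕ} {a b : ℝ} {g : Euc d → ℝ} (hg : MemLp g 2 volume)
    (h0 : ∀ ξ ∉ annulus d a b, g ξ = 0) {ε : ℝ≥0∞} (hε : ε ≠ 0) :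
    ∃ q ∈ polyAlg d a b, eLpNorm (fun ξ => g ξ - extZero q ξ) 2 volume ≤ ε := by
  set K := annulus d a b with hK
  have hKm : MeasurableSet K := (isClosed_annulus d a b).measurableSet
  have hKfin : volume K ≠ ∞ := (isCompact_annulus d a b).measure_lt_top.ne
  have : IsFiniteMeasure (volume.restrict K) := ⟨by simpa using hKfin.lt_top⟩
  have hε2 : ε / 2 ≠ 0 := by simp [hε]
  obtain ⟨φ, hφ, -⟩ := (hg.restrict K).exists_boundedContinuous_eLpNorm_sub_le (by simp) hε2
  obtain ⟨δ, hδ0, hδ⟩ : ∃ δ : ℝ, 0 < δ ∧ ENNReal.ofReal δ * (volume K) ^ (1 / 2 : ℝ) ≤ ε / 2 := by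
    obtain ⟨δ, hδ0, hδ⟩ := ENNReal.exists_nnreal_pos_mul_lt (a := (volume K) ^ (1 / 2 : ℝ)) (by simp [hKfin]) hε2
    exact ⟨δ, hδ0, by rw [ENNReal.ofReal_coe_nnreal]; exact hδ.le⟩
  obtain ⟨q, hq⟩ := ContinuousMap.exists_mem_subalgebra_near_continuousMap_of_separatesPoints (polyAlg d a b)
    (polyAlg_separatesPoints d a b) (φ.toContinuousMap.restrict K) δ hδ0
  refine ⟨q, q.2, ?_⟩
  have hsupp : (fun ξ => g ξ - extZero q.1 ξ) = K.indicator fun ξ => g ξ - extZero q.1 ξ := by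
    ext ξ
    by_cases h : ξ ∈ K
    · rw [Set.indicator_of_mem h]
    · rw [Set.indicator_of_notMem h, h0 ξ h, extZero_of_notMem _ h, sub_zero]
  rw [hsupp, eLpNorm_indicator_eq_eLpNorm_restrict hKm]
  have hsplit : (fun ξ => g ξ - extZero q.1 ξ) = (g - φ) + fun ξ => φ ξ - extZero q.1 ξ := by
    ext ξ; simp
  have hqm := measurable_extZero q.1
  have hφm : Measurable φ := φ.continuous.measurable
  rw [hsplit]
  refine (eLpNorm_add_le ((hg.restrict K).aestronglyMeasurable.sub hφm.aestronglyMeasurable)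
    (by fun_prop) one_le_two).trans ?_
  rw [← ENNReal.add_halves ε]
  gcongr
  refine le_trans ?_ hδ
  have hb : ∀ᵐ ξ ∂(volume.restrict K), ‖φ ξ - extZero q.1 ξ‖ ≤ δ := by
    filter_upwards [ae_restrict_mem hKm] with ξ hξ
    rw [extZero_of_mem _ hξ, norm_sub_rev]
    exact ((q.1 - φ.toContinuousMap.restrict K).norm_coe_le_norm ⟨ξ, hξ⟩).trans hq.le
  refine (eLpNorm_le_of_ae_bound hb).trans ?_
  rw [mul_comm]
  simp

theorem eLpNorm_radOp_annulus {p : ℝ → ℝ} (hp : CutoffRadius p) {a b : ℝ} (ha : 0 < a)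
    {g : Euc (n + 1) → ℝ} (hg : MemLp g 2 volume) (h0 : ∀ ξ ∉ annulus (n + 1) a b, g ξ = 0) :
    eLpNorm (radOp (cutoff p) fun ξ => (g ξ : ℂ)) 2 volume ≤
      ENNReal.ofReal (√(radConst n)) * eLpNorm g 2 volume := by
  set K := annulus (n + 1) a b with hK
  have hKm : MeasurableSet K := (isClosed_annulus (n + 1) a b).measurableSet
  have hKfin : volume K ≠ ∞ := (isCompact_annulus (n + 1) a b).measure_lt_top.ne
  have hex : ∀ j : ℕ, ∃ q ∈ polyAlg (n + 1) a b,
      eLpNorm (fun ξ => g ξ - extZero q ξ) 2 volume ≤ ENNReal.ofReal (1 / (j + 1)) :=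
    fun j => exists_polyAlg_near hg h0 (by simp; positivity)
  choose q hq hqg using hex
  have hqm := fun j => measurable_extZero (q j)
  have : IsFiniteMeasure (volume.restrict K) := ⟨by simpa using hKfin.lt_top⟩
  have hgI : Integrable fun ξ => (g ξ : ℂ) := by
    have : IntegrableOn g K := (hg.restrict K).integrable one_le_two
    refine Integrable.ofReal ((integrableOn_iff_integrable_of_support_subset fun ξ hξ => ?_).mp this)
    by_contra h
    exact hξ (h0 ξ h)
  have hlim0 : Tendsto (fun j : ℕ => ENNReal.ofReal (1 / ((j:ℝ) + 1))) atTop (𝓝 0) := by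
    rw [← ENNReal.ofReal_zero]
    exact (ENNReal.continuous_ofReal.tendsto 0).comp tendsto_one_div_add_atTop_nhds_zero_nat
  refine eLpNorm_le_of_tendsto (F := fun j => radOp (cutoff p) fun ξ => (extZero (q j) ξ : ℂ))
    (u := fun j => ENNReal.ofReal (√(radConst n)) * (eLpNorm g 2 volume + ENNReal.ofReal (1 / (j + 1))))
    (fun j => measurable_radOp (measurable_cutoff hp.meas) (by fun_prop)) (fun x => ?_) (fun j => ?_) ?_
  · rw [tendsto_iff_edist_tendsto_0]
    have hlim1 : Tendsto (fun j : ℕ => ENNReal.ofReal (1 / ((j:ℝ) + 1)) * (volume K) ^ (1 / 2 : ℝ)) atTop (𝓝 0) := by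
      have := ENNReal.Tendsto.mul_const hlim0 (b := (volume K) ^ (1 / 2 : ℝ)) (Or.inr (by simp [hKfin]))
      simpa using this
    refine tendsto_of_tendsto_of_tendsto_of_le_of_le tendsto_const_nhds hlim1 (fun _ => bot_le) fun j => ?_
    dsimp only
    rw [edist_comm, edist_eq_enorm_sub]
    refine (enorm_radOp_sub_le (measurable_cutoff hp.meas) (abs_cutoff_le p) hgI
      (integrable_extZero (q j)).1 x).trans ?_
    have e1 : eLpNorm ((fun ξ => (g ξ : ℂ)) - fun ξ => (extZero (q j) ξ : ℂ)) 1 volume =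
        eLpNorm (fun ξ => g ξ - extZero (q j) ξ) 1 volume := by
      refine eLpNorm_congr_norm_ae (Eventually.of_forall fun ξ => ?_)
      rw [Pi.sub_apply, ← Complex.ofReal_sub, Complex.norm_real]
    have hsupp : (fun ξ => g ξ - extZero (q j) ξ) = K.indicator fun ξ => g ξ - extZero (q j) ξ := by
      ext ξ
      by_cases h : ξ ∈ K
      · rw [Set.indicator_of_mem h]
      · rw [Set.indicator_of_notMem h, h0 ξ h, extZero_of_notMem _ h, sub_zero]
    have h2 := hqg j
    rw [hsupp, eLpNorm_indicator_eq_eLpNorm_restrict hKm] at h2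
    rw [e1, hsupp, eLpNorm_indicator_eq_eLpNorm_restrict hKm]
    refine (eLpNorm_le_eLpNorm_mul_rpow_measure_univ (p := 1) (q := 2) one_le_two
      ((hg.restrict K).aestronglyMeasurable.sub (hqm j).aestronglyMeasurable)).trans ?_
    rw [Measure.restrict_apply_univ]
    have : 1 / (1:ℝ≥0∞).toReal - 1 / (2:ℝ≥0∞).toReal = 1 / 2 := by norm_num
    rw [this]
    gcongr
    exact h2
  · refine (eLpNorm_radOp_extZero hp ha (hq j)).trans ?_
    gcongr
    have e1 : eLpNorm (fun ξ => (extZero (q j) ξ : ℂ)) 2 volume = eLpNorm (extZero (q j)) 2 volume :=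
      eLpNorm_congr_norm_ae (Eventually.of_forall fun ξ => by rw [Complex.norm_real])
    have e2 : extZero (q j) = g - fun ξ => g ξ - extZero (q j) ξ := by ext ξ; simp
    rw [e1, e2]
    refine (eLpNorm_sub_le hg.aestronglyMeasurable (hg.aestronglyMeasurable.sub (hqm j).aestronglyMeasurable)
      one_le_two).trans ?_
    gcongr
    exact hqg j
  · have := ENNReal.Tendsto.const_mul (a := ENNReal.ofReal (√(radConst n)))
      (tendsto_const_nhds (x := eLpNorm g 2 volume).add hlim0) (Or.inr ENNReal.ofReal_ne_top)
    simpa using this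

theorem eLpNorm_radOp_real {p : ℝ → ℝ} (hp : CutoffRadius p) {g : Euc (n + 1) → ℝ} (hg1 : Integrable g)
    (hg : MemLp g 2 volume) (hgm : Measurable g) :
    eLpNorm (radOp (cutoff p) fun ξ => (g ξ : ℂ)) 2 volume ≤
      ENNReal.ofReal (√(radConst n)) * eLpNorm g 2 volume := by
  set K : ℕ → Set (Euc (n + 1)) := fun j => annulus (n + 1) (1 / (j + 1)) (j + 1) with hK
  have hKm : ∀ j, MeasurableSet (K j) := fun j => (isClosed_annulus _ _ _).measurableSet
  refine eLpNorm_le_of_tendsto (F := fun j => radOp (cutoff p) fun ξ => (((K j).indicator g ξ : ℝ) : ℂ))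
    (u := fun _ => ENNReal.ofReal (√(radConst n)) * eLpNorm g 2 volume)
    (fun j => measurable_radOp (measurable_cutoff hp.meas)
      (Complex.measurable_ofReal.comp (hgm.indicator (hKm j)))) (fun x => ?_) (fun j => ?_) tendsto_const_nhds
  · unfold radOp
    refine tendsto_integral_of_dominated_convergence (fun ξ => ‖g ξ‖)
      (fun j => (integrable_radOp (measurable_cutoff hp.meas) (abs_cutoff_le p)
        ((hg1.indicator (hKm j)).ofReal) x).aestronglyMeasurable) hg1.norm (fun j => Eventually.of_forall fun ξ => ?_) ?_
    · rw [norm_mul, mul_comm Complex.I, Complex.norm_exp_ofReal_mul_I, one_mul, norm_mul, Complex.norm_real,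
        Complex.norm_real]
      exact (mul_le_of_le_one_left (norm_nonneg _) (abs_cutoff_le _ _ _)).trans (norm_indicator_le_norm_self _ _)
    · have hne : ∀ᵐ ξ : Euc (n + 1), ξ ≠ 0 := by
        simp [ae_iff]
      filter_upwards [hne] with ξ hξ
      have hξ0 : 0 < ‖ξ‖ := norm_pos_iff.mpr hξ
      apply tendsto_const_nhds.congr'
      obtain ⟨j₀, hj₀⟩ := exists_nat_gt (max ‖ξ‖ ‖ξ‖⁻¹)
      filter_upwards [eventually_ge_atTop j₀] with j hj
      have hj' : (j₀ : ℝ) ≤ j := by exact_mod_cast hj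
      have hmem : ξ ∈ K j := by
        refine ⟨?_, ?_⟩
        · rw [one_div]
          refine inv_le_of_inv_le₀ hξ0 ?_
          have := le_max_right ‖ξ‖ ‖ξ‖⁻¹
          linarith
        · have := le_max_left ‖ξ‖ ‖ξ‖⁻¹
          linarith
      rw [Set.indicator_of_mem hmem]
  · refine (eLpNorm_radOp_annulus hp (a := 1 / (j + 1)) (b := j + 1) (by positivity) (hg.indicator (hKm j))
      fun ξ hξ => Set.indicator_of_notMem hξ _).trans ?_
    gcongr
    exact eLpNorm_indicator_le _

theorem radOp_add {d : ℕ} {m : ℝ → ℝ → ℝ} (hm : Measurable (Function.uncurry m))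
    (hm1 : ∀ r ρ, |m r ρ| ≤ 1) {g₁ g₂ : Euc d → ℂ} (h₁ : Integrable g₁) (h₂ : Integrable g₂) (x : Euc d) :
    radOp m (fun ξ => g₁ ξ + g₂ ξ) x = radOp m g₁ x + radOp m g₂ x := by
  unfold radOp
  rw [← integral_add (integrable_radOp hm hm1 h₁ x) (integrable_radOp hm hm1 h₂ x)]
  congr 1; ext ξ; ring

theorem radOp_const_mul {d : ℕ} (m : ℝ → ℝ → ℝ) (c : ℂ) (g : Euc d → ℂ) (x : Euc d) :
    radOp m (fun ξ => c * g ξ) x = c * radOp m g x := by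
  unfold radOp
  rw [← integral_const_mul]
  congr 1; ext ξ; ring

theorem eLpNorm_radOp_le {p : ℝ → ℝ} (hp : CutoffRadius p) {g : Euc (n + 1) → ℂ} (hg1 : Integrable g)
    (hg : MemLp g 2 volume) (hgm : Measurable g) :
    eLpNorm (radOp (cutoff p) g) 2 volume ≤ ENNReal.ofReal (2 * √(radConst n)) * eLpNorm g 2 volume := by
  have hc := measurable_cutoff hp.meas
  have hrem : Measurable fun ξ => (g ξ).re := by fun_prop
  have himm : Measurable fun ξ => (g ξ).im := by fun_prop
  have hre1 : Integrable fun ξ => (g ξ).re := hg1.re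
  have him1 : Integrable fun ξ => (g ξ).im := hg1.im
  have hre2 : Integrable fun ξ => ((g ξ).re : ℂ) := hre1.ofReal
  have him2 : Integrable fun ξ => Complex.I * ((g ξ).im : ℂ) := him1.ofReal.const_mul _
  have hre := eLpNorm_radOp_real hp hre1 hg.re hrem
  have him := eLpNorm_radOp_real hp him1 hg.im himm
  have e : radOp (cutoff p) g = (radOp (cutoff p) fun ξ => ((g ξ).re : ℂ)) +
      Complex.I • radOp (cutoff p) fun ξ => ((g ξ).im : ℂ) := by
    ext x
    rw [Pi.add_apply, Pi.smul_apply, smul_eq_mul, ← radOp_const_mul,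
      ← radOp_add hc (abs_cutoff_le p) hre2 him2]
    congr 1; ext ξ
    rw [mul_comm Complex.I, Complex.re_add_im]
  rw [e]
  refine (eLpNorm_add_le (measurable_radOp hc (by fun_prop)).aestronglyMeasurable
    ((measurable_radOp hc (by fun_prop)).const_smul _).aestronglyMeasurable one_le_two).trans ?_
  rw [eLpNorm_const_smul, ← ofReal_norm, Complex.norm_I, ENNReal.ofReal_one, one_mul]
  have h1 : eLpNorm (fun ξ => (g ξ).re) 2 volume ≤ eLpNorm g 2 volume :=
    eLpNorm_mono fun ξ => Complex.abs_re_le_norm _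
  have h2 : eLpNorm (fun ξ => (g ξ).im) 2 volume ≤ eLpNorm g 2 volume :=
    eLpNorm_mono fun ξ => Complex.abs_im_le_norm _
  rw [ENNReal.ofReal_mul zero_le_two, ENNReal.ofReal_ofNat, mul_assoc, two_mul]
  gcongr
  · exact hre.trans (by gcongr)
  · exact him.trans (by gcongr)

end Density

section Superposition

open FourierTransform SchwartzMap

variable {d : ℕ}

theorem lintegral_weighted_sq_le {X : Type*} [MeasurableSpace X] {μ : Measure X} {w F : X → ℝ≥0∞}
    (hw : Measurable w) (hF : Measurable F) :
    (∫⁻ x, w x * F x ∂μ) ^ 2 ≤ (∫⁻ x, w x ∂μ) * ∫⁻ x, w x * F x ^ 2 ∂μ := by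
  have h := lintegral_mul_sq_le μ (f := fun x => w x ^ (1 / 2 : ℝ)) (g := fun x => w x ^ (1 / 2 : ℝ) * F x)
    (by fun_prop) (by fun_prop)
  have e1 : ∀ x, w x ^ (1 / 2 : ℝ) * (w x ^ (1 / 2 : ℝ) * F x) = w x * F x := fun x => by
    rw [← mul_assoc, ← ENNReal.rpow_add_of_nonneg _ _ (by norm_num) (by norm_num)]; norm_num
  have e2 : ∀ x, (w x ^ (1 / 2 : ℝ)) ^ 2 = w x := fun x => by
    rw [← ENNReal.rpow_natCast, ← ENNReal.rpow_mul]; norm_num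
  simpa only [e1, e2, mul_pow] using h

theorem eLpNorm_superposition {w : Euc d → ℂ} (hw : Measurable w) {F : Euc d → Euc d → ℂ}
    (hF : Measurable (Function.uncurry F)) {D : ℝ≥0∞} (hD : ∀ η, eLpNorm (F η) 2 volume ≤ D) {G : Euc d → ℂ}
    (hG : ∀ x, ‖G x‖ₑ ≤ ∫⁻ η, ‖w η‖ₑ * ‖F η x‖ₑ) :
    eLpNorm G 2 volume ≤ (∫⁻ η, ‖w η‖ₑ) * D := by
  rw [← ENNReal.pow_le_pow_left_iff two_ne_zero, ← lintegral_enorm_sq_eq_eLpNorm]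
  have hFx : ∀ x, Measurable fun η => ‖F η x‖ₑ := fun x => hF.of_uncurry_right.enorm
  have hFη : ∀ η, Measurable fun x => ‖F η x‖ₑ := fun η => hF.of_uncurry_left.enorm
  have hprod : Measurable (Function.uncurry fun (x η : Euc d) => ‖w η‖ₑ * ‖F η x‖ₑ ^ 2) := by
    have : Measurable fun z : Euc d × Euc d => F z.2 z.1 := hF.comp measurable_swap
    unfold Function.uncurry
    fun_prop
  calc ∫⁻ x, ‖G x‖ₑ ^ 2 ≤ ∫⁻ x, (∫⁻ η, ‖w η‖ₑ) * ∫⁻ η, ‖w η‖ₑ * ‖F η x‖ₑ ^ 2 :=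
        lintegral_mono fun x => (pow_le_pow_left' (hG x) 2).trans (lintegral_weighted_sq_le hw.enorm (hFx x))
    _ = (∫⁻ η, ‖w η‖ₑ) * ∫⁻ η, ‖w η‖ₑ * ∫⁻ x, ‖F η x‖ₑ ^ 2 := by
        rw [lintegral_const_mul _ (Measurable.lintegral_prod_right hprod), lintegral_lintegral_swap hprod.aemeasurable]
        congr 1
        refine lintegral_congr fun η => ?_
        rw [lintegral_const_mul _ ((hFη η).pow_const 2)]
    _ ≤ (∫⁻ η, ‖w η‖ₑ) * ∫⁻ η, ‖w η‖ₑ * D ^ 2 := by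
        gcongr with η
        rw [lintegral_enorm_sq_eq_eLpNorm]
        exact pow_le_pow_left' (hD η) 2
    _ = ((∫⁻ η, ‖w η‖ₑ) * D) ^ 2 := by
        rw [lintegral_mul_const _ hw.enorm]; ring

/-- Modulation of `g` by the phase `2π⟨η, v(ξ)⟩`. -/
def modulate (v : Euc d → Euc d) (g : Euc d → ℂ) (η ξ : Euc d) : ℂ :=
  Complex.exp (((2 * Real.pi * ⟪η, v ξ⟫ : ℝ) : ℂ) * Complex.I) * g ξ

theorem norm_modulate (v : Euc d → Euc d) (g : Euc d → ℂ) (η ξ : Euc d) : ‖modulate v g η ξ‖ = ‖g ξ‖ := by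
  rw [modulate, norm_mul, Complex.norm_exp_ofReal_mul_I, one_mul]

theorem measurable_modulate {v : Euc d → Euc d} (hv : Measurable v) {g : Euc d → ℂ} (hg : Measurable g)
    (η : Euc d) : Measurable (modulate v g η) := by
  unfold modulate
  fun_prop

theorem integrable_modulate {v : Euc d → Euc d} (hv : Measurable v) {g : Euc d → ℂ} (hgm : Measurable g)
    (hg : Integrable g) (η : Euc d) : Integrable (modulate v g η) :=
  hg.mono (measurable_modulate hv hgm η).aestronglyMeasurable
    (Eventually.of_forall fun ξ => (norm_modulate v g η ξ).le)

/-- A symbol `χ(σx + v(ξ))` is a superposition of modulations. -/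
theorem integral_symbol_eq (χ : SchwartzMap (Euc d) ℂ) {v : Euc d → Euc d} (hv : Measurable v) (σ : ℝ)
    {m : ℝ → ℝ → ℝ} (hm : Measurable (Function.uncurry m)) (hm1 : ∀ r ρ, |m r ρ| ≤ 1)
    {g : Euc d → ℂ} (hgm : Measurable g) (hg : Integrable g) (x : Euc d) :
    ∫ ξ, Complex.exp (Complex.I * ((⟪x, ξ⟫ : ℝ) : ℂ)) * (χ (σ • x + v ξ) * (m ‖x‖ ‖ξ‖ : ℂ)) * g ξ =
      ∫ η, (𝓕 χ) η * (Complex.exp (((2 * Real.pi * ⟪η, σ • x⟫ : ℝ) : ℂ) * Complex.I) *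
        radOp m (modulate v g η) x) := by
  set J : Euc d → Euc d → ℂ := fun ξ η => (𝓕 χ) η * (Complex.exp (((2 * Real.pi * ⟪η, σ • x⟫ : ℝ) : ℂ) * Complex.I) *
    (Complex.exp (Complex.I * ((⟪x, ξ⟫ : ℝ) : ℂ)) * ((m ‖x‖ ‖ξ‖ : ℂ) * modulate v g η ξ))) with hJ
  have hw : Integrable (𝓕 χ : SchwartzMap (Euc d) ℂ) := SchwartzMap.integrable _
  have hwm : Measurable fun η => (𝓕 χ : SchwartzMap (Euc d) ℂ) η := (SchwartzMap.continuous _).measurable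
  have hJi : Integrable (Function.uncurry J) (volume.prod volume) := by
    have h1 : Measurable fun z : Euc d × Euc d => m ‖x‖ ‖z.1‖ :=
      hm.of_uncurry_left.comp (measurable_norm.comp measurable_fst)
    have h2 : Measurable fun z : Euc d × Euc d => modulate v g z.2 z.1 := by
      unfold modulate; fun_prop
    refine (hg.mul_prod hw).mono ?_ (Eventually.of_forall fun z => ?_)
    · apply Measurable.aestronglyMeasurable
      unfold Function.uncurry
      rw [hJ]
      fun_prop
    · simp only [Function.uncurry, hJ, norm_mul, Complex.norm_exp_ofReal_mul_I, norm_modulate, Complex.norm_real]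
      rw [mul_comm Complex.I, Complex.norm_exp_ofReal_mul_I, one_mul, one_mul, mul_comm]
      gcongr
      exact mul_le_of_le_one_left (norm_nonneg _) (hm1 _ _)
  have e1 : ∀ η, (𝓕 χ) η * (Complex.exp (((2 * Real.pi * ⟪η, σ • x⟫ : ℝ) : ℂ) * Complex.I) *
        radOp m (modulate v g η) x) = ∫ ξ, J ξ η := by
    intro η
    rw [hJ, radOp]
    rw [← integral_const_mul, ← integral_const_mul]
  simp_rw [e1]
  rw [← integral_integral_swap hJi]
  refine integral_congr_ae (Eventually.of_forall fun ξ => ?_)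
  have hinv : χ (σ • x + v ξ) = ∫ η, Complex.exp (((2 * Real.pi * ⟪η, σ • x + v ξ⟫ : ℝ) : ℂ) * Complex.I) *
      (𝓕 χ) η := by
    have : 𝓕⁻ (𝓕 χ) = χ := FourierTransform.fourierInv_fourier_eq χ
    conv_lhs => rw [← this]
    rw [SchwartzMap.fourierInv_coe, Real.fourierInv_eq']
    rfl
  dsimp only
  rw [hinv, ← integral_mul_const, ← integral_const_mul, ← integral_mul_const]
  refine integral_congr_ae (Eventually.of_forall fun η => ?_)
  simp only [hJ, modulate]
  rw [inner_add_right, mul_add, Complex.ofReal_add, add_mul, Complex.exp_add]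
  ring

theorem measurable_radOp_modulate {v : Euc d → Euc d} (hv : Measurable v) {m : ℝ → ℝ → ℝ}
    (hm : Measurable (Function.uncurry m)) {g : Euc d → ℂ} (hgm : Measurable g) :
    Measurable (Function.uncurry fun η x => radOp m (modulate v g η) x) := by
  have h1 : Measurable fun p : (Euc d × Euc d) × Euc d => m ‖p.1.2‖ ‖p.2‖ :=
    hm.comp (by fun_prop : Measurable fun p : (Euc d × Euc d) × Euc d => (‖p.1.2‖, ‖p.2‖))
  have h2 : Measurable fun p : (Euc d × Euc d) × Euc d => modulate v g p.1.1 p.2 := by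
    unfold modulate; fun_prop
  have : StronglyMeasurable (Function.uncurry fun (z : Euc d × Euc d) ξ =>
      Complex.exp (Complex.I * ((⟪z.2, ξ⟫ : ℝ) : ℂ)) * ((m ‖z.2‖ ‖ξ‖ : ℂ) * modulate v g z.1 ξ)) := by
    apply Measurable.stronglyMeasurable
    unfold Function.uncurry
    fun_prop
  have h3 := (this.integral_prod_right (ν := volume)).measurable
  unfold radOp
  exact h3

theorem FT_eq_fourier (f : SchwartzMap (Euc d) ℂ) (ξ : Euc d) :
    FT f ξ = (𝓕 f) ((2 * Real.pi)⁻¹ • ξ) := by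
  have hpi := Real.pi_pos
  rw [SchwartzMap.fourier_coe, Real.fourier_eq', FT]
  congr 1; ext x
  rw [smul_eq_mul, inner_smul_right]
  congr 2
  have : -2 * Real.pi * ((2 * Real.pi)⁻¹ * ⟪x, ξ⟫) = -⟪x, ξ⟫ := by field_simp
  rw [this]; push_cast; ring

theorem continuous_FT (f : SchwartzMap (Euc d) ℂ) : Continuous (FT f) := by
  have : FT f = fun ξ => (𝓕 f) ((2 * Real.pi)⁻¹ • ξ) := funext (FT_eq_fourier f)
  rw [this]
  exact (SchwartzMap.continuous _).comp (by fun_prop)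

theorem integrable_FT (f : SchwartzMap (Euc d) ℂ) : Integrable (FT f) := by
  have : FT f = fun ξ => (𝓕 f) ((2 * Real.pi)⁻¹ • ξ) := funext (FT_eq_fourier f)
  rw [this]
  exact (SchwartzMap.integrable (𝓕 f : SchwartzMap (Euc d) ℂ)).comp_smul (inv_ne_zero (by have := Real.pi_pos; positivity))

theorem eLpNorm_FT (f : SchwartzMap (Euc d) ℂ) :
    eLpNorm (FT f) 2 volume = ENNReal.ofReal (√((2 * Real.pi) ^ d)) * eLpNorm f 2 volume := by
  have hpi := Real.pi_pos
  have h := lintegral_fourier_sq (G := f) f.integrable (f.memLp 2)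
  rw [← lintegral_neg_eq_self] at h
  have e : ∀ ξ, ∫ x, Complex.exp (Complex.I * ((⟪-ξ, x⟫ : ℝ) : ℂ)) * f x = FT f ξ := by
    intro ξ
    rw [FT]
    congr 1; ext x
    rw [inner_neg_left, real_inner_comm]
    push_cast
    rw [mul_neg]
  simp_rw [e] at h
  rw [lintegral_enorm_sq_eq_eLpNorm, lintegral_enorm_sq_eq_eLpNorm, ← Real.sq_sqrt (show 0 ≤ (2 * Real.pi) ^ d by positivity),
    ENNReal.ofReal_pow (Real.sqrt_nonneg _), ← mul_pow] at h
  exact le_antisymm ((ENNReal.pow_le_pow_left_iff two_ne_zero).mp h.le)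
    ((ENNReal.pow_le_pow_left_iff two_ne_zero).mp h.ge)

end Superposition

section Main

open FourierTransform

variable {n : ℕ}

theorem eLpNorm_OpS_cutoff_le (χ : SchwartzMap (Euc (n + 1)) ℂ) {v : Euc (n + 1) → Euc (n + 1)} (hv : Measurable v)
    (σ : ℝ) {p : ℝ → ℝ} (hp : CutoffRadius p) (f : SchwartzMap (Euc (n + 1)) ℂ) :
    eLpNorm (OpS (fun x ξ => χ (σ • x + v ξ) * (cutoff p ‖x‖ ‖ξ‖ : ℂ)) f) 2 volume ≤
      ENNReal.ofReal (((2 * Real.pi) ^ (n + 1))⁻¹ * ((∫ η, ‖(𝓕 χ) η‖) *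
        (2 * √(radConst n) * √((2 * Real.pi) ^ (n + 1))))) * eLpNorm f 2 volume := by
  have hpi := Real.pi_pos
  have hg1 := integrable_FT f
  have hgm := (continuous_FT f).measurable
  have hw : Integrable (𝓕 χ : SchwartzMap (Euc (n + 1)) ℂ) := SchwartzMap.integrable _
  have hwm : Measurable fun η => (𝓕 χ : SchwartzMap (Euc (n + 1)) ℂ) η := (SchwartzMap.continuous _).measurable
  have hg2 : MemLp (FT f) 2 volume := by
    refine ⟨hgm.aestronglyMeasurable, ?_⟩
    rw [eLpNorm_FT]
    exact ENNReal.mul_lt_top ENNReal.ofReal_lt_top (f.memLp 2 volume).eLpNorm_lt_top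
  have hc := measurable_cutoff hp.meas
  have hmain : eLpNorm (fun x => ∫ ξ, Complex.exp (Complex.I * ((⟪x, ξ⟫ : ℝ) : ℂ)) *
      (χ (σ • x + v ξ) * (cutoff p ‖x‖ ‖ξ‖ : ℂ)) * FT f ξ) 2 volume ≤
      (∫⁻ η, ‖(𝓕 χ) η‖ₑ) * (ENNReal.ofReal (2 * √(radConst n)) * eLpNorm (FT f) 2 volume) := by
    refine eLpNorm_superposition hwm (measurable_radOp_modulate hv hc hgm) (fun η => ?_) (fun x => ?_)
    · have hmm : Measurable (modulate v (FT f) η) := measurable_modulate hv hgm η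
      have hn : eLpNorm (modulate v (FT f) η) 2 volume = eLpNorm (FT f) 2 volume :=
        eLpNorm_congr_norm_ae (Eventually.of_forall fun ξ => norm_modulate _ _ _ _)
      rw [← hn]
      exact eLpNorm_radOp_le hp (integrable_modulate hv hgm hg1 η) ⟨hmm.aestronglyMeasurable, hn ▸ hg2.2⟩ hmm
    · rw [integral_symbol_eq χ hv σ hc (abs_cutoff_le p) hgm hg1]
      refine (enorm_integral_le_lintegral_enorm _).trans (lintegral_mono fun η => ?_)
      rw [enorm_mul, enorm_mul, ← ofReal_norm (Complex.exp _), Complex.norm_exp_ofReal_mul_I, ENNReal.ofReal_one,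
        one_mul]
  have hsc : OpS (fun x ξ => χ (σ • x + v ξ) * (cutoff p ‖x‖ ‖ξ‖ : ℂ)) f =
      (((2 * Real.pi) ^ (n + 1) : ℝ) : ℂ)⁻¹ • fun x => ∫ ξ, Complex.exp (Complex.I * ((⟪x, ξ⟫ : ℝ) : ℂ)) *
      (χ (σ • x + v ξ) * (cutoff p ‖x‖ ‖ξ‖ : ℂ)) * FT f ξ := by
    ext x; rfl
  rw [hsc, eLpNorm_const_smul, ← ofReal_norm, norm_inv, Complex.norm_real, Real.norm_of_nonneg (by positivity),
    ENNReal.ofReal_mul (by positivity), mul_assoc]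
  refine mul_le_mul_right (hmain.trans_eq ?_) _
  rw [eLpNorm_FT, ENNReal.ofReal_mul (integral_nonneg fun _ => norm_nonneg _),
    ENNReal.ofReal_mul (by positivity : 0 ≤ 2 * √(radConst n)), ofReal_integral_norm_eq_lintegral_enorm hw]
  ring

theorem norm_Pgrad {d : ℕ} {P : ℝ → ℝ} (hP : ∀ ρ > 0, 0 < deriv P ρ) {ξ : Euc d} (hξ : ξ ≠ 0) :
    ‖Pgrad P ξ‖ = deriv P ‖ξ‖ := by
  have h := norm_pos_iff.mpr hξ
  rw [Pgrad, norm_smul, Real.norm_of_nonneg (div_nonneg (hP _ h).le h.le), div_mul_cancel₀ _ h.ne']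

theorem measurable_Pgrad {d : ℕ} (P : ℝ → ℝ) : Measurable (Pgrad P : Euc d → Euc d) := by
  unfold Pgrad
  have : Measurable (deriv P) := measurable_deriv P
  fun_prop

theorem HypH.cutoffRadius {p₀ p₁ P₀ P₁ : ℝ} {P : ℝ → ℝ} (hP : HypH p₀ p₁ P₀ P₁ P) {t : ℝ} (ht : t ≠ 0) :
    CutoffRadius fun ρ => |t| * deriv P ρ where
  meas := (measurable_deriv P).const_mul _
  cont := (hP.1.continuousOn_deriv_of_isOpen isOpen_Ioi (by simp)).const_mul _
  pos := fun ρ hρ => mul_pos (abs_pos.mpr ht) (hP.2.1 ρ hρ)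
  mono := hP.2.2.1.imp (fun h _ hx _ hy hxy => mul_le_mul_of_nonneg_left (h hx hy hxy) (abs_nonneg t))
    fun h _ hx _ hy hxy => mul_le_mul_of_nonneg_left (h hx hy hxy) (abs_nonneg t)

end Main

/-- Corollary 2.4 (i): with `P₀ = P₁ = 0`, the operator with symbol
`χ((x+tP'(ξ))/(|t|μ)) 1_{|x| > |t||P'(ξ)|}` is bounded on `L²` uniformly in `t ≠ 0`
and in the scale parameter `μ > 0`. -/
theorem statement11
    (d : ℕ) (hd : 1 ≤ d) (p₀ p₁ : ℝ) (hp₀ : p₀ ≠ 0) (hp₁ : p₁ ≠ 0)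
    (χ : Euc d → ℂ) (hχsm : ContDiff ℝ (⊤ : ℕ∞) χ) (hχc : HasCompactSupport χ)
    (P : ℝ → ℝ) (hP : HypH p₀ p₁ 0 0 P) :
    ∃ C : ℝ, 0 < C ∧ ∀ t : ℝ, t ≠ 0 → ∀ μ : ℝ, 0 < μ → ∀ f : SchwartzMap (Euc d) ℂ,
      eLpNorm
        (OpS (fun x ξ =>
          χ ((|t| * μ)⁻¹ • (x + t • Pgrad P ξ)) *
            (if |t| * ‖Pgrad P ξ‖ < ‖x‖ then (1:ℂ) else 0)) ⇑f) 2
        (volume : Measure (Euc d))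
      ≤ ENNReal.ofReal C * eLpNorm (⇑f) 2 (volume : Measure (Euc d)) := by
  obtain ⟨n, rfl⟩ : ∃ n, d = n + 1 := ⟨d - 1, by omega⟩
  set ψ := hχc.toSchwartzMap hχsm with hψ
  set A : ℝ := ((2 * Real.pi) ^ (n + 1))⁻¹ * ((∫ η, ‖(FourierTransform.fourier ψ) η‖) *
    (2 * √(radConst n) * √((2 * Real.pi) ^ (n + 1)))) with hA
  have hA0 : 0 ≤ A := by
    have := Real.pi_pos
    positivity
  refine ⟨A + 1, by positivity, fun t ht μ hμ f => ?_⟩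
  have hv : Measurable fun ξ : Euc (n + 1) => ((|t| * μ)⁻¹ * t) • Pgrad P ξ :=
    (measurable_Pgrad P).const_smul ((|t| * μ)⁻¹ * t)
  have h := eLpNorm_OpS_cutoff_le ψ hv (|t| * μ)⁻¹ (hP.cutoffRadius ht) f
  refine (le_of_eq ?_).trans (h.trans (mul_le_mul_left (ENNReal.ofReal_le_ofReal (le_add_of_nonneg_right zero_le_one)) _))
  congr 1
  ext x
  unfold OpS
  congr 1
  refine integral_congr_ae ?_
  have hne : ∀ᵐ ξ : Euc (n + 1), ξ ≠ 0 := by simp [ae_iff]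
  filter_upwards [hne] with ξ hξ
  have e1 : ψ ((|t| * μ)⁻¹ • x + ((|t| * μ)⁻¹ * t) • Pgrad P ξ) = χ ((|t| * μ)⁻¹ • (x + t • Pgrad P ξ)) := by
    rw [smul_add, smul_smul]; rfl
  have e2 : ((cutoff (fun ρ => |t| * deriv P ρ) ‖x‖ ‖ξ‖ : ℝ) : ℂ) =
      if |t| * ‖Pgrad P ξ‖ < ‖x‖ then 1 else 0 := by
    rw [norm_Pgrad hP.2.1 hξ, cutoff]
    split_ifs <;> simp
  rw [e1, e2]
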